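/- For every natural number K ≥ 1 there are infinitely many natural numbers n such that φ(p_n − 1) < φ(p_{n+1} − 1) < ⋯ < φ(p_{n+K−1} − 1), i.e., Euler's totient function evaluated at the shifted primes p − 1 is strictly increasing along some run of K consecutive primes, for infinitely many starting indices n. -/

import Mathlib

set_option linter.all false
section
open ArithmeticFunction Finset
open scoped ArithmeticFunction.Moebius

namespace TotRun

lemma dbl {M : Type*} [AddCommMonoid M] (N : ℕ) (F : ℕ → ℕ → M) :
    ∑ n ∈ Ioc 0 N, ∑ d ∈ n.divisors, F d (n / d) =
      ∑ d ∈ Ioc 0 N, ∑ k ∈ Ioc 0 (N / d), F d k := by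
  rw [Finset.sum_sigma', Finset.sum_sigma']
  refine Finset.sum_bij' (fun x _ => ⟨x.2, x.1 / x.2⟩) (fun x _ => ⟨x.1 * x.2, x.1⟩) ?_ ?_ ?_ ?_ ?_
  · rintro ⟨n, d⟩ h
    simp only [mem_sigma, mem_Ioc, Nat.mem_divisors] at h ⊢
    obtain ⟨⟨h1, h2⟩, h3, h4⟩ := h
    have hd := Nat.pos_of_dvd_of_pos h3 h1
    have := Nat.le_of_dvd h1 h3
    exact ⟨⟨hd, by omega⟩, Nat.div_pos this hd, Nat.div_le_div_right h2⟩
  · rintro ⟨d, k⟩ h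
    simp only [mem_sigma, mem_Ioc, Nat.mem_divisors] at h ⊢
    obtain ⟨⟨h1, h2⟩, h3, h4⟩ := h
    have := (Nat.le_div_iff_mul_le h1).1 h4
    refine ⟨⟨Nat.mul_pos h1 h3, by linarith [mul_comm k d]⟩, Dvd.intro _ rfl, ?_⟩
    exact (Nat.mul_pos h1 h3).ne'
  · rintro ⟨n, d⟩ h
    simp only [mem_sigma, mem_Ioc, Nat.mem_divisors] at h ⊢
    simp [Nat.mul_div_cancel' h.2.1]
  · rintro ⟨d, k⟩ h
    simp only [mem_sigma, mem_Ioc, Nat.mem_divisors] at h ⊢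
    simp [Nat.mul_div_cancel_left _ h.1.1]
  · rintro ⟨n, d⟩ h
    rfl

/-- sum over multiples -/
lemma sum_mult {M : Type*} [AddCommMonoid M] (N d : ℕ) (hd : 0 < d) (F : ℕ → M) :
    ∑ n ∈ (Ioc 0 N).filter (fun n => d ∣ n), F n = ∑ j ∈ Ioc 0 (N / d), F (d * j) := by
  symm
  refine Finset.sum_bij (fun j _ => d * j) ?_ ?_ ?_ ?_
  · intro j hj
    simp only [mem_Ioc, mem_filter] at hj ⊢
    have := (Nat.le_div_iff_mul_le hd).1 hj.2
    exact ⟨⟨Nat.mul_pos hd hj.1, by linarith [mul_comm j d]⟩, Dvd.intro _ rfl⟩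
  · intro a _ b _ h
    exact Nat.eq_of_mul_eq_mul_left hd h
  · intro n hn
    simp only [mem_Ioc, mem_filter] at hn
    obtain ⟨⟨h1, h2⟩, j, rfl⟩ := hn
    refine ⟨j, ?_, rfl⟩
    simp only [mem_Ioc]
    exact ⟨Nat.pos_of_mul_pos_left h1, (Nat.le_div_iff_mul_le hd).2 (by linarith [mul_comm j d])⟩
  · intros; rfl

lemma log_fact_bounds (N : ℕ) (hN : 1 ≤ N) :
    (N : ℝ) * Real.log N - N ≤ ∑ n ∈ Ioc 0 N, Real.log n ∧
      ∑ n ∈ Ioc 0 N, Real.log n ≤ N * Real.log N := by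
  constructor
  · induction N, hN using Nat.le_induction with
    | base => simp
    | succ n hn ih =>
      rw [Finset.sum_Ioc_succ_top (by omega)]
      have hn' : (0 : ℝ) < n := by exact_mod_cast hn
      have h1 : Real.log ((n + 1 : ℕ) : ℝ) - Real.log n ≤ 1 / n := by
        rw [← Real.log_div (by positivity) (by positivity)]
        have := Real.log_le_sub_one_of_pos (x := ((n + 1 : ℕ) : ℝ) / n) (by positivity)
        refine this.trans (le_of_eq ?_)
        push_cast
        field_simp
        ring
      have h2 : (n : ℝ) * (Real.log ((n + 1 : ℕ) : ℝ) - Real.log n) ≤ 1 := by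
        calc _ ≤ (n : ℝ) * (1 / n) := by gcongr
          _ = 1 := by field_simp
      push_cast at *
      nlinarith
  · calc ∑ n ∈ Ioc 0 N, Real.log n ≤ ∑ n ∈ Ioc 0 N, Real.log N := by
          refine Finset.sum_le_sum fun n hn => ?_
          simp only [mem_Ioc] at hn
          exact Real.log_le_log (by exact_mod_cast hn.1) (by exact_mod_cast hn.2)
      _ = N * Real.log N := by simp

lemma sum_log_eq (N : ℕ) :
    ∑ n ∈ Ioc 0 N, Real.log n = ∑ d ∈ Ioc 0 N, Λ d * ((N / d : ℕ) : ℝ) := by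
  have := dbl N (fun d _ => Λ d)
  simp only [vonMangoldt_sum] at this
  rw [this]
  refine Finset.sum_congr rfl fun d _ => ?_
  simp [mul_comm]

lemma mertens (N : ℕ) (hN : 1 ≤ N) :
    |∑ n ∈ Ioc 0 N, Λ n / n - Real.log N| ≤ 6 := by
  have h1 := log_fact_bounds N hN
  rw [sum_log_eq] at h1
  have hN' : (0 : ℝ) < N := by exact_mod_cast hN
  have hpsi : ∑ d ∈ Ioc 0 N, Λ d ≤ 6 * N := by
    have := Chebyshev.psi_le_const_mul_self (x := N) (by positivity)
    simp only [Chebyshev.psi, Nat.floor_natCast] at this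
    have h4 : Real.log 4 ≤ 2 := by
      have : Real.log 4 = 2 * Real.log 2 := by
        rw [show (4 : ℝ) = 2 ^ 2 by norm_num, Real.log_pow]; norm_num
      have := Real.log_two_lt_d9
      linarith
    nlinarith
  have up : ∑ d ∈ Ioc 0 N, Λ d * ((N / d : ℕ) : ℝ) ≤ N * ∑ n ∈ Ioc 0 N, Λ n / n := by
    rw [mul_sum]
    refine Finset.sum_le_sum fun d hd => ?_
    have : ((N / d : ℕ) : ℝ) ≤ N / d := Nat.cast_div_le
    calc Λ d * ((N / d : ℕ) : ℝ) ≤ Λ d * (N / d) := by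
          gcongr
      _ = _ := by ring
  have lo : N * ∑ n ∈ Ioc 0 N, Λ n / n - ∑ d ∈ Ioc 0 N, Λ d ≤
      ∑ d ∈ Ioc 0 N, Λ d * ((N / d : ℕ) : ℝ) := by
    rw [mul_sum, ← Finset.sum_sub_distrib]
    refine Finset.sum_le_sum fun d hd => ?_
    have hd0 : 0 < d := (mem_Ioc.1 hd).1
    have : (N / d : ℝ) ≤ ((N / d : ℕ) : ℝ) + 1 := by
      rw [div_le_iff₀ (by exact_mod_cast hd0)]
      have := Nat.lt_div_mul_add (a := N) hd0
      have h2 : N ≤ (N / d + 1) * d := by nlinarith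
      exact_mod_cast h2
    have := mul_le_mul_of_nonneg_left this (vonMangoldt_nonneg (n := d))
    calc _ = Λ d * (N / d) - Λ d := by ring
      _ ≤ _ := by linarith
  rw [abs_le]
  constructor
  · have : N * Real.log N - N ≤ N * ∑ n ∈ Ioc 0 N, Λ n / n := by linarith
    have : (N : ℝ) * (Real.log N - 1) ≤ N * ∑ n ∈ Ioc 0 N, Λ n / n := by linarith
    have := le_of_mul_le_mul_left this hN'
    linarith
  · have : (N : ℝ) * ∑ n ∈ Ioc 0 N, Λ n / n ≤ N * (Real.log N + 6) := by linarith
    have := le_of_mul_le_mul_left this hN'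
    linarith

/-- Partial summation. -/
lemma psum (f : ℕ → ℝ) (M N : ℕ) (hM : 1 ≤ M) (hMN : M ≤ N) :
    ∑ k ∈ Ioc M N, f k / k = (∑ k ∈ Ioc 0 N, f k) / N - (∑ k ∈ Ioc 0 M, f k) / M +
      ∑ n ∈ Ico M N, (∑ k ∈ Ioc 0 n, f k) * (1 / n - 1 / (n + 1)) := by
  induction N, hMN using Nat.le_induction with
  | base => simp
  | succ n hn ih =>
    rw [Finset.sum_Ioc_succ_top (by omega), ih, Finset.sum_Ico_succ_top (by omega),
      Finset.sum_Ioc_succ_top (by omega : 0 ≤ n)]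
    have : (n : ℝ) ≠ 0 := by
      have : 0 < n := by omega
      positivity
    have : (n : ℝ) + 1 ≠ 0 := by positivity
    push_cast
    field_simp
    ring

lemma pp_exists : ∃ C : ℝ, 0 < C ∧ ∀ V N : ℕ, 1 ≤ V →
    ∑ n ∈ Ioc V N, (if n.Prime then 0 else Λ n) / n ≤ C / Real.sqrt V := by
  obtain ⟨C0, hC0⟩ := Chebyshev.psi_sub_theta_le_mul_sqrt
  set C := max C0 1 with hC
  have hS : ∀ n : ℕ, ∑ k ∈ Ioc 0 n, (if k.Prime then 0 else Λ k) ≤ C * Real.sqrt n := by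
    intro n
    have h1 := hC0 n
    rw [Chebyshev.psi_sub_theta_eq_sum_not_prime] at h1
    simp only [Nat.floor_natCast, Finset.sum_filter] at h1
    calc _ = ∑ a ∈ Ioc 0 n, (if ¬ Nat.Prime a then Λ a else 0) := by
          refine Finset.sum_congr rfl fun a _ => ?_
          by_cases h : a.Prime <;> simp [h]
      _ ≤ C0 * Real.sqrt n := h1
      _ ≤ _ := by gcongr; exact le_max_left _ _
  have hC1 : 0 < C := lt_of_lt_of_le one_pos (le_max_right _ _)
  refine ⟨3 * C, by positivity, fun V N hV => ?_⟩
  by_cases hVN : V ≤ N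
  swap
  · rw [Finset.Ioc_eq_empty (by omega)]
    simp; positivity
  have key : ∀ n ∈ Ico V N, (∑ k ∈ Ioc 0 n, (if k.Prime then 0 else Λ k)) * (1 / n - 1 / (n + 1))
      ≤ 2 * C * (1 / Real.sqrt n - 1 / Real.sqrt ((n + 1 : ℕ) : ℝ)) := by
    intro n hn
    have hn0 : 0 < n := by have := (mem_Ico.1 hn).1; omega
    have hn' : (0 : ℝ) < n := by exact_mod_cast hn0
    have hd : (1 / (n : ℝ) - 1 / (n + 1)) = 1 / (n * (n + 1)) := by field_simp; ring
    have ha : 0 < Real.sqrt n := Real.sqrt_pos.2 hn'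
    have hb : 0 < Real.sqrt ((n + 1 : ℕ) : ℝ) := Real.sqrt_pos.2 (by positivity)
    have ha2 : Real.sqrt n ^ 2 = n := Real.sq_sqrt hn'.le
    have hb2 : Real.sqrt ((n + 1 : ℕ) : ℝ) ^ 2 = n + 1 := by
      rw [Real.sq_sqrt (by positivity)]; push_cast; ring
    set a := Real.sqrt n
    set b := Real.sqrt ((n + 1 : ℕ) : ℝ)
    have hab : a ≤ b := Real.sqrt_le_sqrt (by push_cast; linarith)
    calc _ ≤ C * a * (1 / n - 1 / (n + 1)) := by
          refine mul_le_mul_of_nonneg_right (hS n) ?_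
          rw [hd]; positivity
      _ = C * a / (a ^ 2 * b ^ 2) := by rw [hd, ha2, hb2]; ring
      _ ≤ 2 * C * ((b ^ 2 - a ^ 2) / (a * b * (a + b))) := by
          rw [hb2, ha2, show (n : ℝ) + 1 - n = 1 by ring]
          rw [← mul_div_assoc, mul_one, div_le_div_iff₀ (by positivity) (by positivity)]
          rw [← ha2, ← mul_one (2 * C)]
          have : 0 < C * a ^ 2 * b := by positivity
          have h3 : (C * a ^ 2 * b) * (a + b) ≤ (C * a ^ 2 * b) * (2 * b) := by gcongr; linarith
          have hb2' : b ^ 2 = a ^ 2 + 1 := by rw [hb2, ha2]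
          nlinarith
      _ = _ := by
          congr 1
          rw [div_sub_div _ _ ha.ne' hb.ne', div_eq_div_iff (by positivity) (by positivity)]
          ring
  rw [psum _ V N hV hVN]
  have htel : ∑ n ∈ Ico V N, 2 * C * (1 / Real.sqrt n - 1 / Real.sqrt ((n + 1 : ℕ) : ℝ)) =
      2 * C * (1 / Real.sqrt V - 1 / Real.sqrt N) := by
    rw [← mul_sum]
    congr 1
    have := Finset.sum_Ico_sub (fun n : ℕ => - (1 / Real.sqrt n)) hVN
    rw [show (1 / Real.sqrt V - 1 / Real.sqrt N) = -(1 / Real.sqrt N) - -(1 / Real.sqrt V) by ring,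
      ← this]
    exact Finset.sum_congr rfl fun n _ => by ring
  have h1 := Finset.sum_le_sum key
  rw [htel] at h1
  have hN0 : (0 : ℝ) < N := by exact_mod_cast (by omega : 0 < N)
  have h2 : (∑ k ∈ Ioc 0 N, (if k.Prime then 0 else Λ k)) / N ≤ C * (1 / Real.sqrt N) := by
    rw [div_le_iff₀ hN0]
    refine (hS N).trans (le_of_eq ?_)
    have : Real.sqrt N ≠ 0 := (Real.sqrt_pos.2 hN0).ne'
    have h3 : (N : ℝ) = Real.sqrt N * Real.sqrt N := (Real.mul_self_sqrt hN0.le).symm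
    rw [mul_assoc]
    congr 1
    rw [h3]
    field_simp
    rw [Real.sqrt_sq (Real.sqrt_nonneg _)]
  have h3 : 0 ≤ (∑ k ∈ Ioc 0 V, (if k.Prime then 0 else Λ k)) / V := by
    refine div_nonneg (Finset.sum_nonneg fun k _ => ?_) (by positivity)
    split_ifs
    · exact le_rfl
    · exact vonMangoldt_nonneg
  have h4 : 1 / Real.sqrt N ≤ 1 / Real.sqrt V := by
    have : 0 < Real.sqrt V := Real.sqrt_pos.2 (by exact_mod_cast hV)
    gcongr
  have h5 : 0 ≤ 1 / Real.sqrt N := by positivity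
  rw [show 3 * C / Real.sqrt V = C * (1 / Real.sqrt V) + 2 * C * (1 / Real.sqrt V) by ring]
  nlinarith

lemma mertens_prime : ∃ C : ℝ, 0 < C ∧ ∀ N : ℕ, 1 ≤ N →
    |∑ n ∈ Ioc 0 N, (if n.Prime then Real.log n else 0) / n - Real.log N| ≤ C := by
  obtain ⟨C, hC, h⟩ := pp_exists
  refine ⟨C + 6, by positivity, fun N hN => ?_⟩
  have h1 := h 1 N le_rfl
  have h2 := mertens N hN
  have hsplit : ∑ n ∈ Ioc 0 N, Λ n / n = ∑ n ∈ Ioc 0 N, (if n.Prime then Real.log n else 0) / n +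
      ∑ n ∈ Ioc 0 N, (if n.Prime then 0 else Λ n) / n := by
    rw [← Finset.sum_add_distrib]
    refine Finset.sum_congr rfl fun n _ => ?_
    by_cases hp : n.Prime
    · simp [hp, vonMangoldt_apply_prime hp]
    · simp [hp]
  have h3 : ∑ n ∈ Ioc 0 N, (if n.Prime then 0 else Λ n) / n =
      ∑ n ∈ Ioc 1 N, (if n.Prime then 0 else Λ n) / n := by
    rw [← Finset.sum_Ioc_consecutive _ (Nat.zero_le 1) hN]
    simp
  have h4 : 0 ≤ ∑ n ∈ Ioc 1 N, (if n.Prime then 0 else Λ n) / (n : ℝ) := by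
    refine Finset.sum_nonneg fun k _ => div_nonneg ?_ (by positivity)
    split_ifs
    · exact le_rfl
    · exact vonMangoldt_nonneg
  simp only [Nat.cast_one, Real.sqrt_one, div_one] at h1
  rw [h3] at hsplit
  rw [abs_le] at *
  constructor <;> linarith [h2.1, h2.2]

/-- Abel summation bound. -/
lemma abel_bound (c : ℕ → ℂ) (v : ℕ → ℝ) (B : ℝ)
    (hc : ∀ n, ‖∑ k ∈ Ioc 0 n, c k‖ ≤ B) (J N : ℕ) (hJN : J ≤ N) :
    ‖∑ n ∈ Ioc J N, c n * v n‖ ≤ 2 * B * (|v (N + 1)| + ∑ n ∈ Ioc J N, |v n - v (n + 1)|) := by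
  have hB : 0 ≤ B := (norm_nonneg _).trans (hc 0)
  have hd : ∀ n, J ≤ n → ‖∑ k ∈ Ioc J n, c k‖ ≤ 2 * B := by
    intro n hn
    have : ∑ k ∈ Ioc J n, c k = ∑ k ∈ Ioc 0 n, c k - ∑ k ∈ Ioc 0 J, c k := by
      rw [← Finset.sum_Ioc_consecutive _ (Nat.zero_le J) hn]; ring
    rw [this]
    have := norm_sub_le (∑ k ∈ Ioc 0 n, c k) (∑ k ∈ Ioc 0 J, c k)
    linarith [hc n, hc J]
  have key : ∑ n ∈ Ioc J N, c n * v n = (∑ k ∈ Ioc J N, c k) * v (N + 1) +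
      ∑ n ∈ Ioc J N, (∑ k ∈ Ioc J n, c k) * ((v n - v (n + 1) : ℝ) : ℂ) := by
    induction N, hJN using Nat.le_induction with
    | base => simp
    | succ n hn ih =>
      rw [Finset.sum_Ioc_succ_top (by omega), ih, Finset.sum_Ioc_succ_top (by omega),
        Finset.sum_Ioc_succ_top (by omega : J ≤ n) (fun n => (∑ k ∈ Ioc J n, c k) * _),
        Finset.sum_Ioc_succ_top (by omega : J ≤ n)]
      push_cast
      ring
  rw [key, mul_add]
  refine (norm_add_le _ _).trans (add_le_add ?_ ?_)
  · rw [norm_mul, Complex.norm_real]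
    exact mul_le_mul_of_nonneg_right (hd N hJN) (norm_nonneg _)
  · rw [mul_sum]
    refine (norm_sum_le _ _).trans (Finset.sum_le_sum fun n hn => ?_)
    rw [norm_mul, Complex.norm_real]
    exact mul_le_mul_of_nonneg_right (hd n (mem_Ioc.1 hn).1.le) (norm_nonneg _)

lemma tel_inv (J N : ℕ) (hJN : J ≤ N) :
    ∑ n ∈ Ioc J N, (1 / (n : ℝ) - 1 / (n + 1)) = 1 / (J + 1) - 1 / (N + 1) := by
  induction N, hJN using Nat.le_induction with
  | base => simp
  | succ n hn ih =>
    rw [Finset.sum_Ioc_succ_top (by omega), ih]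
    push_cast
    ring

lemma abel_u (c : ℕ → ℂ) (u : ℕ → ℝ) (B M : ℝ) (hM : 0 ≤ M)
    (hc : ∀ n, ‖∑ k ∈ Ioc 0 n, c k‖ ≤ B) (J N : ℕ)
    (hu : ∀ n, J < n → |u n| ≤ M) (hu' : ∀ n, J < n → |u n - u (n + 1)| ≤ M / n) :
    ‖∑ n ∈ Ioc J N, c n * ((u n / n : ℝ) : ℂ)‖ ≤ 6 * B * M / (J + 1) := by
  have hB : 0 ≤ B := (norm_nonneg _).trans (hc 0)
  by_cases hJN : J ≤ N
  swap
  · rw [Finset.Ioc_eq_empty (by omega)]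
    simp; positivity
  refine (abel_bound c (fun n => u n / n) B hc J N hJN).trans ?_
  have h1 : |u (N + 1) / ((N + 1 : ℕ) : ℝ)| ≤ M / (J + 1) := by
    rw [abs_div, abs_of_nonneg (by positivity : (0 : ℝ) ≤ ((N + 1 : ℕ) : ℝ))]
    have := hu (N + 1) (by omega)
    push_cast
    gcongr
  have h2 : ∑ n ∈ Ioc J N, |u n / n - u (n + 1) / ((n + 1 : ℕ) : ℝ)| ≤
      ∑ n ∈ Ioc J N, 2 * M * (1 / (n : ℝ) - 1 / (n + 1)) := by
    refine Finset.sum_le_sum fun n hn => ?_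
    have hn1 := (mem_Ioc.1 hn).1
    have hn' : (0 : ℝ) < n := by exact_mod_cast (by omega : 0 < n)
    have : u n / n - u (n + 1) / ((n + 1 : ℕ) : ℝ) =
        u n * (1 / (n : ℝ) - 1 / (n + 1)) + (u n - u (n + 1)) * (1 / (n + 1)) := by
      push_cast; ring
    rw [this]
    have hpos : 0 ≤ (1 / (n : ℝ) - 1 / (n + 1)) := by
      have : 1 / ((n : ℝ) + 1) ≤ 1 / n := by gcongr; linarith
      linarith
    refine (abs_add_le _ _).trans ?_
    rw [abs_mul, abs_mul, abs_of_nonneg hpos, abs_of_nonneg (by positivity : (0 : ℝ) ≤ 1 / (n + 1))]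
    have e : M / n * (1 / (n + 1)) = M * (1 / (n : ℝ) - 1 / (n + 1)) := by field_simp; ring
    have a1 := mul_le_mul_of_nonneg_right (hu n hn1) hpos
    have a2 := mul_le_mul_of_nonneg_right (hu' n hn1) (by positivity : (0 : ℝ) ≤ 1 / (n + 1))
    linarith
  rw [← mul_sum, tel_inv J N hJN] at h2
  have h3 : (0 : ℝ) ≤ 1 / (N + 1) := by positivity
  have h4 : |u (N + 1) / ((N + 1 : ℕ) : ℝ)| + ∑ n ∈ Ioc J N, |u n / n - u (n + 1) / ((n + 1 : ℕ) : ℝ)|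
      ≤ 3 * M / (J + 1) := by
    have : 2 * M * (1 / ((J : ℝ) + 1) - 1 / (N + 1)) ≤ 2 * M / (J + 1) := by
      have : 0 ≤ 2 * M * (1 / ((N : ℝ) + 1)) := by positivity
      rw [mul_sub, mul_one_div]; linarith
    have : M / ((J : ℝ) + 1) + 2 * M / (J + 1) = 3 * M / (J + 1) := by ring
    linarith
  calc _ ≤ 2 * B * (3 * M / (J + 1)) := by gcongr
    _ = _ := by ring

lemma harm_le (N : ℕ) : ∑ n ∈ Ioc 0 N, 1 / (n : ℝ) ≤ 1 + Real.log N := by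
  have := harmonic_le_one_add_log N
  rw [harmonic_eq_sum_Icc] at this
  push_cast at this
  simpa [← Finset.Icc_succ_left_eq_Ioc, one_div] using this

lemma harm_ge (N : ℕ) : Real.log (N + 1) ≤ ∑ n ∈ Ioc 0 N, 1 / (n : ℝ) := by
  have := log_add_one_le_harmonic N
  rw [harmonic_eq_sum_Icc] at this
  push_cast at this
  simpa [← Finset.Icc_succ_left_eq_Ioc, one_div] using this

end TotRun
end

section
open ArithmeticFunction Finset
open scoped ArithmeticFunction.Moebius ArithmeticFunction.zeta

namespace TotRun

/-- coprimality indicator -/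
def cop (r : ℕ) : ArithmeticFunction ℤ := ⟨fun n => if n = 0 then 0 else if n.Coprime r then 1 else 0, by simp⟩

lemma cop_mult (r : ℕ) : (cop r).IsMultiplicative := by
  rw [IsMultiplicative.iff_ne_zero]
  refine ⟨by simp [cop], ?_⟩
  intro m n hm hn _
  simp only [cop, coe_mk, hm, hn, mul_eq_zero, or_self, if_false, Nat.coprime_mul_iff_left]
  by_cases h1 : m.Coprime r
  · by_cases h2 : n.Coprime r
    · rw [if_pos ⟨h1, h2⟩, if_pos h1, if_pos h2, one_mul]
    · rw [if_neg (fun h => h2 h.2), if_neg h2, mul_zero]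
  · rw [if_neg (fun h => h1 h.1), if_neg h1, zero_mul]

lemma er_eq (r n : ℕ) (hr : r ≠ 0) (hn : n ≠ 0) :
    ∑ d ∈ n.divisors, (if d.Coprime r then μ d else 0) =
      if n.primeFactors ⊆ r.primeFactors then 1 else 0 := by
  have hm : ((pmul μ (cop r)) * ζ : ArithmeticFunction ℤ).IsMultiplicative :=
    (isMultiplicative_moebius.pmul (cop_mult r)).mul isMultiplicative_zeta.natCast
  have h1 : ∀ n, n ≠ 0 → ∑ d ∈ n.divisors, (if d.Coprime r then μ d else 0) =
      ((pmul μ (cop r)) * ζ : ArithmeticFunction ℤ) n := by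
    intro n hn
    rw [coe_mul_zeta_apply]
    refine Finset.sum_congr rfl fun d hd => ?_
    have : d ≠ 0 := (Nat.pos_of_mem_divisors hd).ne'
    rw [pmul_apply]
    simp only [cop, coe_mk, if_neg this]
    by_cases h : d.Coprime r
    · rw [if_pos h, if_pos h, mul_one]
    · rw [if_neg h, if_neg h, mul_zero]
  rw [h1 n hn, hm.multiplicative_factorization _ hn, Finsupp.prod, Nat.support_factorization]
  have h2 : ∀ p ∈ n.primeFactors, ((pmul μ (cop r)) * ζ : ArithmeticFunction ℤ)
      (p ^ n.factorization p) = if p ∈ r.primeFactors then 1 else 0 := by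
    intro p hp
    have hpp := Nat.prime_of_mem_primeFactors hp
    have hf : n.factorization p ≠ 0 := by
      rw [← Nat.support_factorization] at hp
      exact Finsupp.mem_support_iff.1 hp
    obtain ⟨k, hk⟩ := Nat.exists_eq_succ_of_ne_zero hf
    rw [← h1 _ (pow_ne_zero _ hpp.ne_zero), Nat.sum_divisors_prime_pow hpp, hk,
      Finset.sum_range_succ', Finset.sum_range_succ']
    rw [Finset.sum_eq_zero (s := range k)]
    · simp only [zero_add, pow_one, pow_zero, Nat.coprime_one_left_eq_true, if_true,
        moebius_apply_one, moebius_apply_prime hpp, Nat.mem_primeFactors, hpp, hr, ne_eq,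
        not_false_eq_true, and_true, true_and, hpp.coprime_iff_not_dvd]
      by_cases h : p ∣ r <;> simp [h]
    · intro i _
      rw [moebius_apply_prime_pow hpp (by omega)]
      simp
  rw [Finset.prod_congr rfl h2]
  by_cases h : n.primeFactors ⊆ r.primeFactors
  · rw [if_pos h]
    exact Finset.prod_eq_one fun p hp => by simp [h hp]
  · rw [if_neg h]
    obtain ⟨p, hp, hp'⟩ := Finset.not_subset.1 h
    exact Finset.prod_eq_zero hp (by simp only [hp', if_false])

/-- the inverse hom -/
noncomputable def invHom : ℕ →* ℝ where
  toFun n := ((n : ℝ))⁻¹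
  map_one' := by simp
  map_mul' := by intro a b; push_cast; rw [mul_inv]

lemma totient_ratio (r : ℕ) (hr : r ≠ 0) :
    ∏ p ∈ r.primeFactors, (1 - (p : ℝ)⁻¹)⁻¹ = r / Nat.totient r := by
  have h : (Nat.totient r : ℝ) = r * ∏ p ∈ r.primeFactors, (1 - (p : ℝ)⁻¹) := by
    have := Nat.totient_eq_mul_prod_factors r
    have h2 := congrArg (fun x : ℚ => (x : ℝ)) this
    push_cast at h2
    exact h2
  rw [h, Finset.prod_inv_distrib]
  have : (r : ℝ) ≠ 0 := by exact_mod_cast hr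
  field_simp

lemma factored_sum (s : Finset ℕ) (hs : ∀ p ∈ s, p.Prime) (T : Finset ℕ)
    (hT : ∀ n ∈ T, n ≠ 0 ∧ n.primeFactors ⊆ s) :
    ∑ n ∈ T, 1 / (n : ℝ) ≤ ∏ p ∈ s, (1 - (p : ℝ)⁻¹)⁻¹ := by
  have h := (EulerProduct.summable_and_hasSum_factoredNumbers_prod_filter_prime_geometric
    (f := invHom) (fun {p} hp => by
      simp only [invHom, MonoidHom.coe_mk, OneHom.coe_mk, norm_inv, Real.norm_natCast]
      exact inv_lt_one_of_one_lt₀ (by exact_mod_cast hp.one_lt)) s).2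
  have hf : s.filter Nat.Prime = s := Finset.filter_true_of_mem hs
  rw [hf] at h
  have hTm : ∀ n ∈ T, n ∈ Nat.factoredNumbers s := fun n hn =>
    Nat.mem_factoredNumbers_of_primeFactors_subset (hT n hn).1 (hT n hn).2
  have h2 := sum_le_hasSum (T.attach.image (fun n => (⟨n.1, hTm n.1 n.2⟩ : Nat.factoredNumbers s)))
    (fun n _ => by simp [invHom]) h
  rw [Finset.sum_image] at h2
  · have : ∑ x ∈ T.attach, invHom x.1 = ∑ n ∈ T, 1 / (n : ℝ) := by
      rw [Finset.sum_attach T (fun n => invHom n)]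
      simp [invHom]
    simp only at h2
    rw [this] at h2
    exact h2
  · intro a _ b _ hab
    simp only [Subtype.mk.injEq] at hab
    exact Subtype.ext hab

lemma I_bound (r Y : ℕ) (hr : r ≠ 0) :
    |∑ m ∈ Ioc 0 Y, (if m.Coprime r then (μ m : ℝ) else 0) / m * ∑ k ∈ Ioc 0 (Y / m), 1 / (k : ℝ)|
      ≤ r / Nat.totient r := by
  have h1 : ∑ m ∈ Ioc 0 Y, (if m.Coprime r then (μ m : ℝ) else 0) / m *
      ∑ k ∈ Ioc 0 (Y / m), 1 / (k : ℝ) =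
      ∑ n ∈ Ioc 0 Y, (if n.primeFactors ⊆ r.primeFactors then 1 / (n : ℝ) else 0) := by
    have := dbl Y (fun d k => (if d.Coprime r then (μ d : ℝ) else 0) / d * (1 / (k : ℝ)))
    simp only [mul_sum]
    rw [← this]
    refine Finset.sum_congr rfl fun n hn => ?_
    have hn0 : n ≠ 0 := by have := (mem_Ioc.1 hn).1; omega
    have h2 := er_eq r n hr hn0
    have h3 : ∀ d ∈ n.divisors, (if d.Coprime r then (μ d : ℝ) else 0) / d *
        (1 / ((n / d : ℕ) : ℝ)) = ((if d.Coprime r then μ d else 0 : ℤ) : ℝ) * (1 / n) := by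
      intro d hd
      have hd0 : d ≠ 0 := (Nat.pos_of_mem_divisors hd).ne'
      have hd1 := (Nat.mem_divisors.1 hd).1
      rw [Nat.cast_div hd1 (by exact_mod_cast hd0)]
      have : (d : ℝ) ≠ 0 := by exact_mod_cast hd0
      have : (n : ℝ) ≠ 0 := by exact_mod_cast hn0
      push_cast
      field_simp
    rw [Finset.sum_congr rfl h3, ← Finset.sum_mul, ← Int.cast_sum, h2]
    split_ifs <;> simp
  rw [h1, abs_of_nonneg (Finset.sum_nonneg fun n _ => by split_ifs <;> positivity),
    ← Finset.sum_filter, ← totient_ratio r hr]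
  refine factored_sum _ (fun p hp => Nat.prime_of_mem_primeFactors hp) _ fun n hn => ?_
  simp only [mem_filter, mem_Ioc] at hn
  exact ⟨by omega, hn.2⟩

lemma g_bound (r Y : ℕ) (hr : r ≠ 0) :
    |∑ m ∈ Ioc 0 Y, (if m.Coprime r then (μ m : ℝ) else 0) / m| ≤ 2 := by
  rcases Nat.eq_zero_or_pos Y with rfl | hY
  · simp
  have hY' : (0 : ℝ) < Y := by exact_mod_cast hY
  have h1 : ∑ m ∈ Ioc 0 Y, (if m.Coprime r then (μ m : ℝ) else 0) * ((Y / m : ℕ) : ℝ) =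
      ∑ n ∈ Ioc 0 Y, (if n.primeFactors ⊆ r.primeFactors then (1 : ℝ) else 0) := by
    have := dbl Y (fun d k => (if d.Coprime r then (μ d : ℝ) else 0))
    have e : ∀ m, (if m.Coprime r then (μ m : ℝ) else 0) * ((Y / m : ℕ) : ℝ) =
       ∑ k ∈ Ioc 0 (Y / m), (if m.Coprime r then (μ m : ℝ) else 0) := by
      intro m; simp [mul_comm]
    simp only [e]
    rw [← this]
    refine Finset.sum_congr rfl fun n hn => ?_
    have hn0 : n ≠ 0 := by have := (mem_Ioc.1 hn).1; omega
    have h2 := er_eq r n hr hn0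
    have h3 := congrArg (fun x : ℤ => (x : ℝ)) h2
    push_cast at h3
    exact h3
  have h2 : |∑ m ∈ Ioc 0 Y, (if m.Coprime r then (μ m : ℝ) else 0) * ((Y / m : ℕ) : ℝ)| ≤ Y := by
    rw [h1, abs_of_nonneg (Finset.sum_nonneg fun n _ => by split_ifs <;> positivity)]
    calc _ ≤ ∑ n ∈ Ioc 0 Y, (1 : ℝ) := Finset.sum_le_sum fun n _ => by split_ifs <;> norm_num
      _ = Y := by simp
  have hmu : ∀ m, |(if m.Coprime r then (μ m : ℝ) else 0)| ≤ 1 := by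
    intro m
    split_ifs
    · exact_mod_cast abs_moebius_le_one
    · simp
  have h3 : |Y * (∑ m ∈ Ioc 0 Y, (if m.Coprime r then (μ m : ℝ) else 0) / m) -
      ∑ m ∈ Ioc 0 Y, (if m.Coprime r then (μ m : ℝ) else 0) * ((Y / m : ℕ) : ℝ)| ≤ Y := by
    rw [mul_sum, ← Finset.sum_sub_distrib]
    refine (Finset.abs_sum_le_sum_abs _ _).trans ?_
    calc _ ≤ ∑ n ∈ Ioc 0 Y, (1 : ℝ) := Finset.sum_le_sum fun m hm => ?_
      _ = Y := by simp
    have hm0 : 0 < m := (mem_Ioc.1 hm).1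
    have e : Y * ((if m.Coprime r then (μ m : ℝ) else 0) / m) -
        (if m.Coprime r then (μ m : ℝ) else 0) * ((Y / m : ℕ) : ℝ) =
        (if m.Coprime r then (μ m : ℝ) else 0) * ((Y : ℝ) / m - ((Y / m : ℕ) : ℝ)) := by ring
    rw [e, abs_mul]
    have a1 : ((Y / m : ℕ) : ℝ) ≤ Y / m := Nat.cast_div_le
    have a2 : (Y / m : ℝ) ≤ ((Y / m : ℕ) : ℝ) + 1 := by
      rw [div_le_iff₀ (by exact_mod_cast hm0)]
      have := Nat.lt_div_mul_add (a := Y) hm0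
      have h2 : Y ≤ (Y / m + 1) * m := by nlinarith
      exact_mod_cast h2
    have a3 : |(Y : ℝ) / m - ((Y / m : ℕ) : ℝ)| ≤ 1 := by rw [abs_le]; constructor <;> linarith
    exact mul_le_one₀ (hmu m) (abs_nonneg _) a3
  have h4 : |Y * (∑ m ∈ Ioc 0 Y, (if m.Coprime r then (μ m : ℝ) else 0) / m)| ≤ Y * 2 := by
    rw [abs_le] at *
    constructor <;> linarith [h2.1, h2.2, h3.1, h3.2]
  rw [abs_mul, abs_of_pos hY'] at h4
  exact le_of_mul_le_mul_left h4 hY'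

lemma harm_gamma (n : ℕ) (hn : 1 ≤ n) (u : ℝ) (h1 : n ≤ u) (h2 : u ≤ n + 1) :
    |∑ k ∈ Ioc 0 n, 1 / (k : ℝ) - Real.log u - Real.eulerMascheroniConstant| ≤ 2 / u := by
  have hn' : (0 : ℝ) < n := by exact_mod_cast hn
  have a := Real.eulerMascheroniSeq_lt_eulerMascheroniConstant n
  have b := Real.eulerMascheroniConstant_lt_eulerMascheroniSeq' n
  rw [Real.eulerMascheroniSeq] at a
  rw [Real.eulerMascheroniSeq', if_neg (by omega)] at b
  rw [harmonic_eq_sum_Icc] at a b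
  push_cast at a b
  have e : ∑ k ∈ Ioc 0 n, 1 / (k : ℝ) = ∑ i ∈ Icc 1 n, (i : ℝ)⁻¹ := by
    simp [← Finset.Icc_succ_left_eq_Ioc, one_div]
  rw [e]
  have c1 : Real.log n ≤ Real.log u := Real.log_le_log hn' h1
  have c2 : Real.log u ≤ Real.log (n + 1) := Real.log_le_log (by linarith) h2
  have c3 : Real.log (n + 1) - Real.log n ≤ 1 / n := by
    rw [← Real.log_div (by positivity) (by positivity)]
    have := Real.log_le_sub_one_of_pos (x := ((n : ℝ) + 1) / n) (by positivity)
    refine this.trans (le_of_eq ?_)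
    field_simp
    ring
  have c4 : 1 / (n : ℝ) ≤ 2 / u := by
    rw [div_le_div_iff₀ hn' (by linarith)]
    have : (1 : ℝ) ≤ n := by exact_mod_cast hn
    linarith
  rw [abs_le]
  constructor <;> linarith

lemma G_bound (r Y : ℕ) (hr : r ≠ 0) (y : ℝ) (hy : Y ≤ y) (hy' : y < Y + 1) (hY : 1 ≤ Y) :
    |∑ m ∈ Ioc 0 Y, (if m.Coprime r then (μ m : ℝ) else 0) / m * Real.log (y / m)|
      ≤ 5 * (r / Nat.totient r) := by
  have hmu : ∀ m, |(if m.Coprime r then (μ m : ℝ) else 0)| ≤ 1 := by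
    intro m
    split_ifs
    · exact_mod_cast abs_moebius_le_one
    · simp
  set c : ℕ → ℝ := fun m => (if m.Coprime r then (μ m : ℝ) else 0) with hc
  have hy0 : 0 < y := lt_of_lt_of_le (by exact_mod_cast hY) hy
  have hI := I_bound r Y hr
  have hg := g_bound r Y hr
  have hE : |∑ m ∈ Ioc 0 Y, c m / m * (∑ k ∈ Ioc 0 (Y / m), 1 / (k : ℝ) - Real.log (y / m) -
      Real.eulerMascheroniConstant)| ≤ 2 := by
    refine (Finset.abs_sum_le_sum_abs _ _).trans ?_
    calc _ ≤ ∑ n ∈ Ioc 0 Y, (2 / y : ℝ) := Finset.sum_le_sum fun m hm => ?_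
      _ = Y / y * 2 := by simp; ring
      _ ≤ 2 := by
        have : Y / y ≤ 1 := by rw [div_le_one hy0]; exact hy
        linarith
    have hm0 : 0 < m := (mem_Ioc.1 hm).1
    have hm0' : (0 : ℝ) < m := by exact_mod_cast hm0
    have hd : 1 ≤ Y / m := Nat.div_pos (mem_Ioc.1 hm).2 hm0
    have a1 : ((Y / m : ℕ) : ℝ) ≤ y / m := Nat.cast_div_le.trans (by gcongr)
    have a2 : y / m ≤ ((Y / m : ℕ) : ℝ) + 1 := by
      rw [div_le_iff₀ hm0']
      have := Nat.lt_div_mul_add (a := Y) hm0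
      have h2 : Y + 1 ≤ (Y / m + 1) * m := by nlinarith
      have h3 : (Y : ℝ) + 1 ≤ (((Y / m : ℕ) : ℝ) + 1) * m := by exact_mod_cast h2
      linarith
    have := harm_gamma (Y / m) hd (y / m) a1 a2
    rw [abs_mul, abs_div, abs_of_pos hm0']
    calc _ ≤ 1 / m * (2 / (y / m)) := by
          gcongr
          exact hmu m
      _ = 2 / y := by field_simp
  have key : ∑ m ∈ Ioc 0 Y, c m / m * Real.log (y / m) =
      ∑ m ∈ Ioc 0 Y, c m / m * ∑ k ∈ Ioc 0 (Y / m), 1 / (k : ℝ) -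
      (∑ m ∈ Ioc 0 Y, c m / m) * Real.eulerMascheroniConstant -
      ∑ m ∈ Ioc 0 Y, c m / m * (∑ k ∈ Ioc 0 (Y / m), 1 / (k : ℝ) - Real.log (y / m) -
      Real.eulerMascheroniConstant) := by
    rw [Finset.sum_mul, ← Finset.sum_sub_distrib, ← Finset.sum_sub_distrib]
    exact Finset.sum_congr rfl fun m _ => by ring
  rw [key]
  have hγ : |Real.eulerMascheroniConstant| ≤ 1 := by
    have := Real.one_half_lt_eulerMascheroniConstant
    have := Real.eulerMascheroniConstant_lt_two_thirds
    rw [abs_le]; constructor <;> linarith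
  have hgg : |(∑ m ∈ Ioc 0 Y, c m / m) * Real.eulerMascheroniConstant| ≤ 2 := by
    rw [abs_mul]
    have := mul_le_mul hg hγ (abs_nonneg _) (by norm_num)
    linarith
  have hr1 : (1 : ℝ) ≤ r / Nat.totient r := by
    have : 0 < Nat.totient r := Nat.totient_pos.2 (by omega)
    rw [le_div_iff₀ (by exact_mod_cast this), one_mul]
    exact_mod_cast Nat.totient_le r
  have h1 := abs_sub (∑ m ∈ Ioc 0 Y, c m / m * ∑ k ∈ Ioc 0 (Y / m), 1 / (k : ℝ) -
      (∑ m ∈ Ioc 0 Y, c m / m) * Real.eulerMascheroniConstant) (∑ m ∈ Ioc 0 Y, c m / m * (∑ k ∈ Ioc 0 (Y / m), 1 / (k : ℝ) - Real.log (y / m) -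
      Real.eulerMascheroniConstant))
  have h2 := abs_sub (∑ m ∈ Ioc 0 Y, c m / m * ∑ k ∈ Ioc 0 (Y / m), 1 / (k : ℝ)) ((∑ m ∈ Ioc 0 Y, c m / m) * Real.eulerMascheroniConstant)
  linarith

end TotRun
end

section
open ArithmeticFunction Finset
open scoped ArithmeticFunction.Moebius ArithmeticFunction.zeta

namespace TotRun

lemma sqfree_sum (P S : Finset ℕ) (f : ℕ → ℝ) (hf : ∀ p ∈ P, 0 ≤ f p)
    (hS : ∀ d ∈ S, Squarefree d ∧ d.primeFactors ⊆ P) :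
    ∑ d ∈ S, ∏ p ∈ d.primeFactors, f p ≤ ∏ p ∈ P, (1 + f p) := by
  rw [Finset.prod_one_add]
  have hinj : Set.InjOn (fun d : ℕ => d.primeFactors) S := by
    intro a ha b hb h
    rw [← Nat.prod_primeFactors_of_squarefree (hS a ha).1,
      ← Nat.prod_primeFactors_of_squarefree (hS b hb).1]
    simp only at h
    rw [h]
  rw [← Finset.sum_image (f := fun s => ∏ p ∈ s, f p) hinj]
  refine Finset.sum_le_sum_of_subset_of_nonneg ?_ ?_
  · intro s hs
    obtain ⟨d, hd, rfl⟩ := Finset.mem_image.1 hs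
    exact Finset.mem_powerset.2 (hS d hd).2
  · intro s hs _
    exact Finset.prod_nonneg fun p hp => hf p (Finset.mem_powerset.1 hs hp)

lemma totient_sqfree (r : ℕ) (h : Squarefree r) :
    (Nat.totient r : ℝ) = ∏ p ∈ r.primeFactors, ((p : ℝ) - 1) := by
  have h0 : r ≠ 0 := h.ne_zero
  have := totient_ratio r h0
  have ht : (0:ℝ) < Nat.totient r := by exact_mod_cast Nat.totient_pos.2 (Nat.pos_of_ne_zero h0)
  have h1 : (r : ℝ) = ∏ p ∈ r.primeFactors, (p : ℝ) := by
    conv_lhs => rw [← Nat.prod_primeFactors_of_squarefree h]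
    push_cast; rfl
  have h2 : ∏ p ∈ r.primeFactors, ((p : ℝ) - 1) = r * (∏ p ∈ r.primeFactors, (1 - (p : ℝ)⁻¹)⁻¹)⁻¹ := by
    rw [h1, ← Finset.prod_inv_distrib, ← Finset.prod_mul_distrib]
    refine Finset.prod_congr rfl fun p hp => ?_
    have : (p : ℝ) ≠ 0 := by exact_mod_cast (Nat.prime_of_mem_primeFactors hp).ne_zero
    rw [inv_inv]; field_simp
  have hr : (r : ℝ) ≠ 0 := by exact_mod_cast h0
  rw [h2, this]
  field_simp

lemma primeFactors_prod_primes (s : Finset ℕ) (hs : ∀ p ∈ s, p.Prime) :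
    (∏ p ∈ s, p).primeFactors = s := Nat.primeFactors_prod hs

lemma sum_div_sqfree (r : ℕ) (hr : Squarefree r) (f : ℕ → ℝ) :
    ∑ d ∈ r.divisors, ∏ p ∈ d.primeFactors, f p = ∏ p ∈ r.primeFactors, (1 + f p) := by
  rw [Finset.prod_one_add]
  refine Finset.sum_nbij' (fun d => d.primeFactors) (fun s => ∏ p ∈ s, p) ?_ ?_ ?_ ?_ ?_
  · intro d hd
    exact Finset.mem_powerset.2 (Nat.primeFactors_mono (Nat.dvd_of_mem_divisors hd) hr.ne_zero)
  · intro s hs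
    rw [Nat.mem_divisors]
    refine ⟨?_, hr.ne_zero⟩
    conv_rhs => rw [← Nat.prod_primeFactors_of_squarefree hr]
    exact Finset.prod_dvd_prod_of_subset _ _ _ (Finset.mem_powerset.1 hs)
  · intro d hd
    exact Nat.prod_primeFactors_of_squarefree (hr.squarefree_of_dvd (Nat.dvd_of_mem_divisors hd))
  · intro s hs
    exact primeFactors_prod_primes s fun p hp =>
      Nat.prime_of_mem_primeFactors (Finset.mem_powerset.1 hs hp)
  · intro d hd; rfl

lemma sum_inv_pp1 (N : ℕ) : ∑ p ∈ (Ioc 1 N), 1 / ((p : ℝ) * (p - 1)) ≤ 1 := by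
  have : ∀ N : ℕ, 1 ≤ N → ∑ p ∈ (Ioc 1 N), 1 / ((p : ℝ) * (p - 1)) = 1 - 1 / N := by
    intro N hN
    induction N, hN using Nat.le_induction with
    | base => simp
    | succ n hn ih =>
      rw [Finset.sum_Ioc_succ_top (by omega), ih]
      have : (n : ℝ) ≠ 0 := by exact_mod_cast (by omega : n ≠ 0)
      have : (n : ℝ) + 1 ≠ 0 := by positivity
      push_cast
      rw [add_sub_cancel_right]
      field_simp
      ring
  rcases Nat.eq_zero_or_pos N with rfl | h
  · simp
  · rw [this N h]
    have : (0:ℝ) ≤ 1 / N := by positivity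
    linarith

lemma sum_inv_totient (R : ℕ) :
    ∑ r ∈ (Ioc 0 R).filter Squarefree, 1 / (Nat.totient r : ℝ) ≤ 3 * (1 + Real.log R) := by
  rcases Nat.eq_zero_or_pos R with rfl | hR
  · simp
  have hL : 0 ≤ Real.log R := Real.log_nonneg (by exact_mod_cast hR)
  have h1 : ∀ r ∈ (Ioc 0 R).filter Squarefree, 1 / (Nat.totient r : ℝ) =
      1 / r * ∑ d ∈ r.divisors, 1 / (Nat.totient d : ℝ) := by
    intro r hr
    have hsq := (Finset.mem_filter.1 hr).2
    have e : ∑ d ∈ r.divisors, 1 / (Nat.totient d : ℝ) =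
        ∏ p ∈ r.primeFactors, (1 + 1 / ((p : ℝ) - 1)) := by
      rw [← sum_div_sqfree r hsq]
      refine Finset.sum_congr rfl fun d hd => ?_
      rw [totient_sqfree d (hsq.squarefree_of_dvd (Nat.dvd_of_mem_divisors hd)), Finset.prod_div_distrib]
      simp
    rw [e, totient_sqfree r hsq]
    have h1 : (r : ℝ) = ∏ p ∈ r.primeFactors, (p : ℝ) := by
      conv_lhs => rw [← Nat.prod_primeFactors_of_squarefree hsq]
      push_cast; rfl
    rw [h1, one_div, one_div, ← Finset.prod_inv_distrib, ← Finset.prod_inv_distrib, ← Finset.prod_mul_distrib]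
    refine Finset.prod_congr rfl fun p hp => ?_
    have h2 : (1 : ℝ) < p := by exact_mod_cast (Nat.prime_of_mem_primeFactors hp).one_lt
    have : (p : ℝ) - 1 ≠ 0 := by linarith
    have : (p : ℝ) ≠ 0 := by linarith
    field_simp
    ring
  rw [Finset.sum_congr rfl h1]
  -- swap
  have h2 : ∑ r ∈ (Ioc 0 R).filter Squarefree, 1 / (r : ℝ) * ∑ d ∈ r.divisors, 1 / (Nat.totient d : ℝ)
      ≤ ∑ r ∈ Ioc 0 R, ∑ d ∈ r.divisors, (if Squarefree d then 1 / ((d : ℝ) * Nat.totient d) else 0) * (1 / ((r / d : ℕ) : ℝ)) := by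
    rw [Finset.sum_filter]
    refine Finset.sum_le_sum fun r hr => ?_
    split_ifs with hsq
    · rw [Finset.mul_sum]
      refine Finset.sum_le_sum fun d hd => le_of_eq ?_
      have hd' := Nat.dvd_of_mem_divisors hd
      rw [if_pos (hsq.squarefree_of_dvd hd')]
      have hd0 : (d : ℝ) ≠ 0 := by exact_mod_cast (Nat.pos_of_mem_divisors hd).ne'
      rw [Nat.cast_div hd' hd0]
      have : (r : ℝ) ≠ 0 := by exact_mod_cast hsq.ne_zero
      field_simp
    · exact Finset.sum_nonneg fun d _ => by split_ifs <;> positivity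
  refine h2.trans ?_
  rw [dbl R (fun d k => (if Squarefree d then 1 / ((d : ℝ) * Nat.totient d) else 0) * (1 / (k : ℝ)))]
  have h3 : ∀ d ∈ Ioc 0 R, ∑ k ∈ Ioc 0 (R / d), (if Squarefree d then 1 / ((d : ℝ) * Nat.totient d) else 0) * (1 / (k : ℝ)) ≤ (if Squarefree d then 1 / ((d : ℝ) * Nat.totient d) else 0) * (1 + Real.log R) := by
    intro d hd
    rw [← Finset.mul_sum]
    refine mul_le_mul_of_nonneg_left ?_ (by split_ifs <;> positivity)
    refine le_trans ?_ (harm_le R)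
    refine Finset.sum_le_sum_of_subset_of_nonneg (Finset.Ioc_subset_Ioc le_rfl (Nat.div_le_self _ _)) ?_
    intros; positivity
  refine (Finset.sum_le_sum h3).trans ?_
  rw [← Finset.sum_mul]
  refine mul_le_mul_of_nonneg_right ?_ (by positivity)
  rw [← Finset.sum_filter]
  have h4 : ∑ d ∈ (Ioc 0 R).filter Squarefree, 1 / ((d : ℝ) * Nat.totient d) =
      ∑ d ∈ (Ioc 0 R).filter Squarefree, ∏ p ∈ d.primeFactors, 1 / ((p : ℝ) * (p - 1)) := by
    refine Finset.sum_congr rfl fun d hd => ?_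
    have hsq := (Finset.mem_filter.1 hd).2
    rw [totient_sqfree d hsq]
    conv_lhs => rw [← Nat.prod_primeFactors_of_squarefree hsq]
    rw [primeFactors_prod_primes _ (fun p hp => Nat.prime_of_mem_primeFactors hp)]
    push_cast
    rw [← Finset.prod_mul_distrib, Finset.prod_div_distrib]
    simp
  rw [h4]
  have hpos : ∀ p ∈ Ioc 1 R, (0:ℝ) ≤ 1 / ((p : ℝ) * (p - 1)) := by
    intro p hp
    have : (1:ℝ) < p := by exact_mod_cast (Finset.mem_Ioc.1 hp).1
    have : (0:ℝ) ≤ p - 1 := by linarith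
    positivity
  refine (sqfree_sum (Ioc 1 R) _ _ hpos ?_).trans ?_
  · intro d hd
    rw [Finset.mem_filter, Finset.mem_Ioc] at hd
    refine ⟨hd.2, fun p hp => Finset.mem_Ioc.2 ⟨(Nat.prime_of_mem_primeFactors hp).one_lt, ?_⟩⟩
    exact (Nat.le_of_mem_primeFactors hp).trans hd.1.2
  · calc ∏ p ∈ Ioc 1 R, (1 + 1 / ((p : ℝ) * (p - 1))) ≤ ∏ p ∈ Ioc 1 R, Real.exp (1 / ((p : ℝ) * (p - 1))) := by
          refine Finset.prod_le_prod (fun p hp => ?_) (fun p hp => ?_)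
          · have := hpos p hp; linarith
          · have := Real.add_one_le_exp (1 / ((p : ℝ) * (p - 1))); linarith
      _ = Real.exp (∑ p ∈ Ioc 1 R, 1 / ((p : ℝ) * (p - 1))) := by rw [Real.exp_sum]
      _ ≤ Real.exp 1 := Real.exp_le_exp.2 (sum_inv_pp1 R)
      _ ≤ 3 := by have := Real.exp_one_lt_d9; linarith

/-- Selberg-type weights -/
noncomputable def lam (R d : ℕ) : ℝ := (μ d : ℝ) * Real.log (R / d)

noncomputable def LR (R n : ℕ) : ℝ := ∑ d ∈ Ioc 0 R, if d ∣ n then lam R d else 0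

lemma moebius_mul_real (r j : ℕ) :
    (μ (r * j) : ℝ) = (μ r : ℝ) * (if j.Coprime r then (μ j : ℝ) else 0) := by
  by_cases h : j.Coprime r
  · rw [if_pos h, isMultiplicative_moebius.map_mul_of_coprime h.symm]; push_cast; rfl
  · rw [if_neg h, mul_zero]
    have : ¬ Squarefree (r * j) := fun hs => h (Nat.coprime_of_squarefree_mul hs).symm
    rw [moebius_eq_zero_of_not_squarefree this]; simp

lemma lam_inner (R r : ℕ) (hr : r ∈ Ioc 0 R) :
    |∑ d ∈ (Ioc 0 R).filter (r ∣ ·), lam R d / d| ≤ if Squarefree r then 5 / (Nat.totient r : ℝ) else 0 := by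
  rw [Finset.mem_Ioc] at hr
  rw [sum_mult R r hr.1]
  have hr0 : (0:ℝ) < r := by exact_mod_cast hr.1
  have e : ∑ j ∈ Ioc 0 (R / r), lam R (r * j) / ((r * j : ℕ) : ℝ) =
      (μ r : ℝ) / r * ∑ m ∈ Ioc 0 (R / r), (if m.Coprime r then (μ m : ℝ) else 0) / m * Real.log (((R : ℝ) / r) / m) := by
    rw [Finset.mul_sum]
    refine Finset.sum_congr rfl fun m hm => ?_
    have hm0 : (m : ℝ) ≠ 0 := by exact_mod_cast (Finset.mem_Ioc.1 hm).1.ne'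
    rw [lam, moebius_mul_real]
    push_cast
    rw [div_div]
    field_simp
  rw [e, abs_mul]
  have hb := G_bound r (R / r) hr.1.ne' ((R : ℝ) / r) Nat.cast_div_le (by
    rw [div_lt_iff₀ hr0]
    have := Nat.lt_div_mul_add (a := R) hr.1
    have h2 : R < (R / r + 1) * r := by rw [add_mul, one_mul]; exact this
    exact_mod_cast h2) (Nat.div_pos hr.2 hr.1)
  split_ifs with hsq
  · have ht : (0:ℝ) < Nat.totient r := by exact_mod_cast Nat.totient_pos.2 hr.1
    have : |(μ r : ℝ) / r| = 1 / r := by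
      rw [abs_div, abs_of_pos hr0]
      have := (abs_moebius_eq_one_of_squarefree hsq)
      have h2 : |(μ r : ℝ)| = 1 := by exact_mod_cast this
      rw [h2]
    rw [this]
    calc _ ≤ 1 / (r : ℝ) * (5 * (r / Nat.totient r)) := by gcongr
      _ = _ := by field_simp
  · rw [moebius_eq_zero_of_not_squarefree hsq]; simp

lemma E_eq (R : ℕ) : ∑ d ∈ Ioc 0 R, ∑ e ∈ Ioc 0 R, lam R d * lam R e / (Nat.lcm d e) =
    ∑ r ∈ Ioc 0 R, (Nat.totient r : ℝ) * (∑ d ∈ (Ioc 0 R).filter (r ∣ ·), lam R d / d) ^ 2 := by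
  have h1 : ∀ d ∈ Ioc 0 R, ∀ e ∈ Ioc 0 R, lam R d * lam R e / (Nat.lcm d e : ℝ) =
      ∑ r ∈ Ioc 0 R, (Nat.totient r : ℝ) * ((if r ∣ d then lam R d / d else 0) * (if r ∣ e then lam R e / e else 0)) := by
    intro d hd e he
    rw [Finset.mem_Ioc] at hd he
    have hd0 : (d : ℝ) ≠ 0 := by exact_mod_cast hd.1.ne'
    have he0 : (e : ℝ) ≠ 0 := by exact_mod_cast he.1.ne'
    have hg : (Nat.gcd d e : ℝ) = ∑ r ∈ Ioc 0 R, if r ∣ d ∧ r ∣ e then (Nat.totient r : ℝ) else 0 := by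
      have := Nat.sum_totient (Nat.gcd d e)
      rw [← Finset.sum_filter]
      rw [← Nat.cast_sum]
      congr 1
      conv_lhs => rw [← this]
      refine Finset.sum_congr ?_ fun _ _ => rfl
      ext r
      rw [Nat.mem_divisors, Finset.mem_filter, Finset.mem_Ioc, Nat.dvd_gcd_iff]
      refine ⟨fun h => ⟨⟨Nat.pos_of_dvd_of_pos h.1.1 hd.1, (Nat.le_of_dvd hd.1 h.1.1).trans hd.2⟩, h.1⟩, fun h => ⟨h.2, ?_⟩⟩
      exact (Nat.gcd_pos_of_pos_left _ hd.1).ne'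
    have hl : (Nat.gcd d e : ℝ) * Nat.lcm d e = d * e := by exact_mod_cast Nat.gcd_mul_lcm d e
    have hl0 : (Nat.lcm d e : ℝ) ≠ 0 := by exact_mod_cast (Nat.lcm_pos hd.1 he.1).ne'
    have : lam R d * lam R e / (Nat.lcm d e : ℝ) = (Nat.gcd d e : ℝ) * (lam R d / d * (lam R e / e)) := by
      field_simp
      linear_combination (-(lam R d * lam R e)) * hl
    rw [this, hg, Finset.sum_mul]
    refine Finset.sum_congr rfl fun r _ => ?_
    by_cases a : r ∣ d <;> by_cases b : r ∣ e <;> simp [a, b]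
  calc _ = ∑ d ∈ Ioc 0 R, ∑ e ∈ Ioc 0 R, ∑ r ∈ Ioc 0 R, (Nat.totient r : ℝ) * ((if r ∣ d then lam R d / d else 0) * (if r ∣ e then lam R e / e else 0)) :=
        Finset.sum_congr rfl fun d hd => Finset.sum_congr rfl fun e he => h1 d hd e he
    _ = ∑ r ∈ Ioc 0 R, ∑ d ∈ Ioc 0 R, ∑ e ∈ Ioc 0 R, (Nat.totient r : ℝ) * ((if r ∣ d then lam R d / d else 0) * (if r ∣ e then lam R e / e else 0)) := by
        rw [Finset.sum_comm (s := Ioc 0 R) (t := Ioc 0 R) (f := fun r d => ∑ e ∈ Ioc 0 R, (Nat.totient r : ℝ) * ((if r ∣ d then lam R d / d else 0) * (if r ∣ e then lam R e / e else 0)))]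
        exact Finset.sum_congr rfl fun d _ => Finset.sum_comm
    _ = _ := by
        refine Finset.sum_congr rfl fun r _ => ?_
        rw [Finset.sum_filter, sq, Finset.sum_mul_sum, Finset.mul_sum]
        refine Finset.sum_congr rfl fun d _ => ?_
        rw [Finset.mul_sum]

lemma E_bound (R : ℕ) : ∑ d ∈ Ioc 0 R, ∑ e ∈ Ioc 0 R, lam R d * lam R e / (Nat.lcm d e) ≤ 75 * (1 + Real.log R) := by
  rw [E_eq]
  calc _ ≤ ∑ r ∈ Ioc 0 R, (if Squarefree r then 25 * (1 / (Nat.totient r : ℝ)) else 0) := by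
        refine Finset.sum_le_sum fun r hr => ?_
        have h := lam_inner R r hr
        have h2 := sq_le_sq' (by linarith [neg_abs_le (∑ d ∈ (Ioc 0 R).filter (r ∣ ·), lam R d / d), h]) ((le_abs_self _).trans h)
        refine (mul_le_mul_of_nonneg_left h2 (by positivity)).trans (le_of_eq ?_)
        have ht : (Nat.totient r : ℝ) ≠ 0 := by exact_mod_cast (Nat.totient_pos.2 (Finset.mem_Ioc.1 hr).1).ne'
        split_ifs
        · field_simp; norm_num
        · simp
    _ ≤ _ := by
        rw [← Finset.sum_filter, ← Finset.mul_sum]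
        have := sum_inv_totient R
        linarith

lemma abs_lam_le (R d : ℕ) (hd : d ∈ Ioc 0 R) : |lam R d| ≤ Real.log R := by
  rw [Finset.mem_Ioc] at hd
  have hd0 : (1:ℝ) ≤ d := by exact_mod_cast hd.1
  have hR : (d:ℝ) ≤ R := by exact_mod_cast hd.2
  rw [lam, abs_mul]
  have h1 : |(μ d : ℝ)| ≤ 1 := by exact_mod_cast abs_moebius_le_one
  have h2 : |Real.log (R / d)| ≤ Real.log R := by
    rw [abs_of_nonneg (Real.log_nonneg (by rw [le_div_iff₀ (by linarith)]; linarith))]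
    exact Real.log_le_log (by apply div_pos <;> linarith) (div_le_self (by linarith) hd0)
  calc _ ≤ 1 * Real.log R := by gcongr
    _ = _ := one_mul _

lemma LR_sq_sum (R N : ℕ) (hR : 1 ≤ R) :
    ∑ n ∈ Ioc 0 N, LR R n ^ 2 ≤ 75 * (1 + Real.log R) * N + (R : ℝ) ^ 4 := by
  have e : ∑ n ∈ Ioc 0 N, LR R n ^ 2 = ∑ d ∈ Ioc 0 R, ∑ e ∈ Ioc 0 R, lam R d * lam R e * ((N / Nat.lcm d e : ℕ) : ℝ) := by
    calc _ = ∑ n ∈ Ioc 0 N, ∑ d ∈ Ioc 0 R, ∑ e ∈ Ioc 0 R, (if Nat.lcm d e ∣ n then lam R d * lam R e else 0) := by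
          refine Finset.sum_congr rfl fun n _ => ?_
          rw [sq, LR, Finset.sum_mul_sum]
          refine Finset.sum_congr rfl fun d _ => Finset.sum_congr rfl fun e _ => ?_
          by_cases a : d ∣ n <;> by_cases b : e ∣ n <;> simp [a, b, Nat.lcm_dvd_iff]
      _ = _ := by
          rw [Finset.sum_comm]
          refine Finset.sum_congr rfl fun d _ => ?_
          rw [Finset.sum_comm]
          refine Finset.sum_congr rfl fun e _ => ?_
          rw [← Finset.sum_filter, Finset.sum_const, Nat.Ioc_filter_dvd_card_eq_div, nsmul_eq_mul, mul_comm]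
  have hL : 0 ≤ Real.log R := Real.log_nonneg (by exact_mod_cast hR)
  have hE := E_bound R
  have hLR : Real.log R ≤ R := (Real.log_le_sub_one_of_pos (by exact_mod_cast hR)).trans (by linarith)
  have hN : (0:ℝ) ≤ N := by positivity
  have h2 : ∑ d ∈ Ioc 0 R, ∑ e ∈ Ioc 0 R, lam R d * lam R e * ((N / Nat.lcm d e : ℕ) : ℝ) ≤
      ∑ d ∈ Ioc 0 R, ∑ e ∈ Ioc 0 R, (N * (lam R d * lam R e / (Nat.lcm d e)) + (R : ℝ) * R) := by
    refine Finset.sum_le_sum fun d hd => Finset.sum_le_sum fun e he => ?_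
    have h1 := abs_lam_le R d hd
    have h2 := abs_lam_le R e he
    have hl0 : (0:ℝ) < Nat.lcm d e := by exact_mod_cast Nat.lcm_pos (Finset.mem_Ioc.1 hd).1 (Finset.mem_Ioc.1 he).1
    have a1 : ((N / Nat.lcm d e : ℕ) : ℝ) ≤ N / Nat.lcm d e := Nat.cast_div_le
    have a2 : (N : ℝ) / Nat.lcm d e ≤ ((N / Nat.lcm d e : ℕ) : ℝ) + 1 := by
      rw [div_le_iff₀ hl0]
      have := Nat.lt_div_mul_add (a := N) (b := Nat.lcm d e) (by exact_mod_cast hl0)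
      have h2 : N ≤ (N / Nat.lcm d e + 1) * Nat.lcm d e := by rw [add_mul, one_mul]; exact this.le
      exact_mod_cast h2
    have h3 : |lam R d * lam R e * (((N / Nat.lcm d e : ℕ) : ℝ) - N / Nat.lcm d e)| ≤ (R : ℝ) * R * 1 := by
      rw [abs_mul, abs_mul]
      refine mul_le_mul (mul_le_mul (h1.trans hLR) (h2.trans hLR) (abs_nonneg _) (by positivity)) ?_ (abs_nonneg _) (by positivity)
      rw [abs_le]; constructor <;> linarith
    have h4 := le_abs_self (lam R d * lam R e * (((N / Nat.lcm d e : ℕ) : ℝ) - N / Nat.lcm d e))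
    have h5 : lam R d * lam R e * (((N / Nat.lcm d e : ℕ) : ℝ)) = lam R d * lam R e * (((N / Nat.lcm d e : ℕ) : ℝ) - N / Nat.lcm d e) + N * (lam R d * lam R e / (Nat.lcm d e)) := by ring
    linarith
  rw [e]
  refine h2.trans ?_
  simp_rw [Finset.sum_add_distrib, ← Finset.mul_sum]
  rw [Finset.sum_const, Finset.sum_const, Nat.card_Ioc, nsmul_eq_mul, nsmul_eq_mul]
  have := mul_le_mul_of_nonneg_left hE hN
  push_cast [Nat.sub_zero]
  nlinarith

lemma tel_ge (M N : ℕ) (hM : 1 ≤ M) (hMN : M ≤ N) :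
    ∑ n ∈ Ico M N, (n : ℝ) * (1 / n - 1 / (n + 1)) ≤ 1 + Real.log N := by
  calc _ ≤ ∑ n ∈ Ioc 0 N, 1 / (n : ℝ) := by
        calc _ ≤ ∑ n ∈ Ico M N, 1 / (n : ℝ) := by
              refine Finset.sum_le_sum fun n hn => ?_
              have : (1:ℝ) ≤ n := by exact_mod_cast hM.trans (Finset.mem_Ico.1 hn).1
              rw [show (n : ℝ) * (1 / n - 1 / (n + 1)) = 1 / (n + 1) by field_simp; ring]
              exact one_div_le_one_div_of_le (by linarith) (by linarith)
          _ ≤ _ := by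
              refine Finset.sum_le_sum_of_subset_of_nonneg ?_ (by intros; positivity)
              intro n hn
              rw [Finset.mem_Ico] at hn
              rw [Finset.mem_Ioc]; omega
    _ ≤ _ := harm_le N

lemma LR_tail (R N : ℕ) (hR : 3 ≤ R) :
    ∑ n ∈ Ioc (R ^ 4) N, LR R n ^ 2 / n ≤ 151 * (1 + Real.log R) * (2 + Real.log N) := by
  have hL : 0 ≤ Real.log R := Real.log_nonneg (by exact_mod_cast (by omega : 1 ≤ R))
  have hLN : 0 ≤ Real.log N := Real.log_natCast_nonneg N
  rcases lt_or_ge N (R ^ 4) with h | h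
  · rw [Finset.Ioc_eq_empty (by omega)]; simp; positivity
  have h4 : 1 ≤ R ^ 4 := Nat.one_le_pow _ _ (by omega)
  rw [psum (fun n => LR R n ^ 2) _ _ h4 h]
  have hS : ∀ n, R ^ 4 ≤ n → ∑ k ∈ Ioc 0 n, LR R k ^ 2 ≤ 76 * (1 + Real.log R) * n := by
    intro n hn
    have := LR_sq_sum R n (by omega)
    have h2 : ((R : ℝ)) ^ 4 ≤ n := by exact_mod_cast hn
    nlinarith
  have hN0 : (0:ℝ) < N := by exact_mod_cast (by omega : 0 < N)
  have a1 : (∑ k ∈ Ioc 0 N, LR R k ^ 2) / N ≤ 76 * (1 + Real.log R) := by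
    rw [div_le_iff₀ hN0]; exact hS N h
  have a2 : 0 ≤ (∑ k ∈ Ioc 0 (R ^ 4), LR R k ^ 2) / ((R ^ 4 : ℕ) : ℝ) := by positivity
  have a3 : ∑ n ∈ Ico (R ^ 4) N, (∑ k ∈ Ioc 0 n, LR R k ^ 2) * (1 / (n : ℝ) - 1 / (n + 1)) ≤
      76 * (1 + Real.log R) * (1 + Real.log N) := by
    calc _ ≤ ∑ n ∈ Ico (R ^ 4) N, 76 * (1 + Real.log R) * ((n : ℝ) * (1 / n - 1 / (n + 1))) := by
          refine Finset.sum_le_sum fun n hn => ?_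
          rw [← mul_assoc]
          have h1 := (Finset.mem_Ico.1 hn).1
          have hn0 : (0:ℝ) < n := by exact_mod_cast (by omega : 0 < n)
          refine mul_le_mul_of_nonneg_right (hS n h1) ?_
          rw [sub_nonneg]
          exact one_div_le_one_div_of_le hn0 (by linarith)
      _ ≤ _ := by
          rw [← Finset.mul_sum]
          exact mul_le_mul_of_nonneg_left (tel_ge _ _ h4 h) (by positivity)
  nlinarith

lemma LR_mul_prime (R n l : ℕ) (hl : l.Prime) (h : R < l) : LR R (l * n) = LR R n := by
  unfold LR
  refine Finset.sum_congr rfl fun d hd => ?_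
  rw [Finset.mem_Ioc] at hd
  have : Nat.Coprime d l := by
    rw [Nat.coprime_comm, hl.coprime_iff_not_dvd]
    intro h2
    have := Nat.le_of_dvd hd.1 h2
    omega
  simp only [Nat.Coprime.dvd_mul_left this]

lemma log_mertens_block : ∃ R0 : ℕ, 3 ≤ R0 ∧ ∀ R : ℕ, R0 ≤ R →
    Real.log R ≤ ∑ n ∈ Ioc (R ^ 4) (R ^ 8), (if n.Prime then Real.log n else 0) / (n : ℝ) := by
  obtain ⟨C, hC, h⟩ := mertens_prime
  refine ⟨max 3 (⌈Real.exp C⌉₊), le_max_left _ _, fun R hR => ?_⟩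
  have hR3 : 3 ≤ R := (le_max_left _ _).trans hR
  have hR2 : Real.exp C ≤ R := (Nat.le_ceil _).trans (by exact_mod_cast (le_max_right _ _).trans hR)
  have hCL : C ≤ Real.log R := by
    rw [Real.le_log_iff_exp_le (by exact_mod_cast (by omega : 0 < R))]; exact hR2
  have h1 := h (R ^ 4) (Nat.one_le_pow _ _ (by omega))
  have h2 := h (R ^ 8) (Nat.one_le_pow _ _ (by omega))
  have hs := Finset.sum_Ioc_consecutive (fun n : ℕ => (if n.Prime then Real.log n else 0) / (n : ℝ))
    (Nat.zero_le (R ^ 4)) (Nat.pow_le_pow_right (by omega) (by norm_num) : R ^ 4 ≤ R ^ 8)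
  push_cast at h1 h2
  rw [Real.log_pow] at h1 h2
  rw [abs_le] at h1 h2
  push_cast at h1 h2
  linarith [h1.1, h1.2, h2.1, h2.2]

lemma sum_log_prime_dvd (m : ℕ) (hm : m ≠ 0) :
    ∑ l ∈ m.divisors, (if l.Prime then Real.log l else 0) ≤ Real.log m := by
  rw [← vonMangoldt_sum]
  refine Finset.sum_le_sum fun l _ => ?_
  split_ifs with h
  · rw [vonMangoldt_apply_prime h]
  · exact vonMangoldt_nonneg

lemma LR_small : ∃ C : ℝ, 0 < C ∧ ∃ R0 : ℕ, 3 ≤ R0 ∧ ∀ R : ℕ, R0 ≤ R →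
    ∑ n ∈ Ioc 0 (R ^ 4), LR R n ^ 2 / n ≤ C * Real.log R ^ 2 := by
  obtain ⟨R0, hR0, hb⟩ := log_mertens_block
  refine ⟨151 * 2 * 14 * 12, by norm_num, R0, hR0, fun R hR => ?_⟩
  have hR3 : 3 ≤ R := hR0.trans hR
  have hL1 : 1 ≤ Real.log R := by
    rw [Real.le_log_iff_exp_le (by exact_mod_cast (by omega : 0 < R))]
    have := Real.exp_one_lt_d9
    have : (3:ℝ) ≤ R := by exact_mod_cast hR3
    linarith
  have hB := hb R hR
  set H : ℕ → ℕ → ℝ := fun d k => if R ^ 4 < d ∧ d ≤ R ^ 8 then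
    (if d.Prime then Real.log d else 0) * (LR R (d * k) ^ 2 / ((d * k : ℕ) : ℝ)) else 0 with hH
  have hlg : ∀ d : ℕ, 0 ≤ (if d.Prime then Real.log d else 0) := by
    intro d; split_ifs
    · exact Real.log_natCast_nonneg d
    · exact le_rfl
  have hH0 : ∀ d k, 0 ≤ H d k := by
    intro d k
    simp only [hH]
    have := hlg d
    split_ifs
    · positivity
    · positivity
    · exact le_rfl
  have h1 : (∑ n ∈ Ioc (R ^ 4) (R ^ 8), (if n.Prime then Real.log n else 0) / (n : ℝ)) *
      ∑ n ∈ Ioc 0 (R ^ 4), LR R n ^ 2 / n ≤ ∑ d ∈ Ioc 0 (R ^ 12), ∑ k ∈ Ioc 0 (R ^ 12 / d), H d k := by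
    rw [Finset.sum_mul_sum]
    calc _ ≤ ∑ d ∈ Ioc (R ^ 4) (R ^ 8), ∑ k ∈ Ioc 0 (R ^ 12 / d), H d k := by
          refine Finset.sum_le_sum fun d hd => ?_
          have hd' := Finset.mem_Ioc.1 hd
          have hsub : Ioc 0 (R ^ 4) ⊆ Ioc 0 (R ^ 12 / d) := by
            refine Finset.Ioc_subset_Ioc le_rfl ?_
            rw [Nat.le_div_iff_mul_le (by omega)]
            calc R ^ 4 * d ≤ R ^ 4 * R ^ 8 := Nat.mul_le_mul_left _ hd'.2
              _ = R ^ 12 := by ring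
          refine le_trans (le_of_eq ?_) (Finset.sum_le_sum_of_subset_of_nonneg hsub fun k _ _ => hH0 d k)
          refine Finset.sum_congr rfl fun n hn => ?_
          simp only [hH, if_pos hd']
          split_ifs with hp
          · rw [LR_mul_prime R n d hp]
            · have : (d : ℝ) ≠ 0 := by exact_mod_cast hp.ne_zero
              have : (n : ℝ) ≠ 0 := by exact_mod_cast (Finset.mem_Ioc.1 hn).1.ne'
              push_cast
              field_simp
            · exact lt_of_le_of_lt (Nat.le_self_pow (by norm_num) R) hd'.1
          · simp
      _ ≤ _ := by
          refine Finset.sum_le_sum_of_subset_of_nonneg ?_ fun d _ _ => Finset.sum_nonneg fun k _ => hH0 d k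
          refine Finset.Ioc_subset_Ioc (Nat.zero_le _) (Nat.pow_le_pow_right (by omega) (by norm_num))
  rw [← dbl] at h1
  have h2 : ∑ n ∈ Ioc 0 (R ^ 12), ∑ d ∈ n.divisors, H d (n / d) ≤
      ∑ n ∈ Ioc (R ^ 4) (R ^ 12), (12 * Real.log R) * (LR R n ^ 2 / n) := by
    have hsub : Ioc (R ^ 4) (R ^ 12) ⊆ Ioc 0 (R ^ 12) := Finset.Ioc_subset_Ioc (Nat.zero_le _) le_rfl
    rw [← Finset.sum_subset hsub]
    · refine Finset.sum_le_sum fun n hn => ?_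
      have hn' := Finset.mem_Ioc.1 hn
      have hn0 : n ≠ 0 := by omega
      calc _ ≤ ∑ d ∈ n.divisors, (if d.Prime then Real.log d else 0) * (LR R n ^ 2 / (n : ℝ)) := by
            refine Finset.sum_le_sum fun d hd => ?_
            have hm : d * (n / d) = n := Nat.mul_div_cancel' (Nat.dvd_of_mem_divisors hd)
            simp only [hH, hm]
            have := hlg d
            by_cases hc : R ^ 4 < d ∧ d ≤ R ^ 8
            · rw [if_pos hc]
            · rw [if_neg hc]; exact mul_nonneg this (by positivity)
        _ ≤ _ := by
            rw [← Finset.sum_mul]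
            refine mul_le_mul_of_nonneg_right ((sum_log_prime_dvd n hn0).trans ?_) (by positivity)
            rw [← Nat.cast_ofNat, ← Real.log_pow]
            exact Real.log_le_log (by exact_mod_cast (by omega : 0 < n)) (by exact_mod_cast hn'.2)
    · intro n hn hn2
      refine Finset.sum_eq_zero fun d hd => ?_
      simp only [hH]
      rw [if_neg]
      rintro ⟨h, -⟩
      have := Nat.divisor_le hd
      rw [Finset.mem_Ioc] at hn hn2
      omega
  rw [← Finset.mul_sum] at h2
  have h3 := LR_tail R (R ^ 12) hR3
  push_cast at h3
  rw [Real.log_pow] at h3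
  push_cast at h3
  have hS0 : 0 ≤ ∑ n ∈ Ioc 0 (R ^ 4), LR R n ^ 2 / (n : ℝ) := Finset.sum_nonneg fun _ _ => by positivity
  set S := ∑ n ∈ Ioc 0 (R ^ 4), LR R n ^ 2 / (n : ℝ)
  set L := Real.log R
  have h4 : L * S ≤ 12 * L * (151 * (1 + L) * (2 + 12 * L)) := by
    calc L * S ≤ _ := mul_le_mul_of_nonneg_right hB hS0
      _ ≤ _ := h1.trans (h2.trans (mul_le_mul_of_nonneg_left h3 (by positivity)))
  have h5 : S ≤ 12 * (151 * (1 + L) * (2 + 12 * L)) := by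
    refine le_of_mul_le_mul_left (a := L) ?_ (by linarith)
    linarith
  have h6 : (1 + L) * (2 + 12 * L) ≤ 2 * L * (14 * L) := by
    apply mul_le_mul <;> nlinarith
  nlinarith

/-- mean square of the Selberg weights -/
lemma LR_all : ∃ C : ℝ, 0 < C ∧ ∃ R0 : ℕ, 3 ≤ R0 ∧ ∀ R N : ℕ, R0 ≤ R → R ≤ N →
    ∑ n ∈ Ioc 0 N, LR R n ^ 2 / n ≤ C * Real.log R * Real.log N := by
  obtain ⟨C, hC, R0, hR0, h⟩ := LR_small
  refine ⟨C + 151 * 6, by positivity, R0, hR0, fun R N hR hN => ?_⟩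
  have hR3 : 3 ≤ R := hR0.trans hR
  have hL1 : 1 ≤ Real.log R := by
    rw [Real.le_log_iff_exp_le (by exact_mod_cast (by omega : 0 < R))]
    have := Real.exp_one_lt_d9
    have : (3:ℝ) ≤ R := by exact_mod_cast hR3
    linarith
  have hLN : Real.log R ≤ Real.log N := Real.log_le_log (by exact_mod_cast (by omega : 0 < R)) (by exact_mod_cast hN)
  have h1 := h R hR
  have h2 := LR_tail R N hR3
  have h3 : ∑ n ∈ Ioc 0 N, LR R n ^ 2 / (n:ℝ) ≤ ∑ n ∈ Ioc 0 (R ^ 4), LR R n ^ 2 / (n:ℝ) + ∑ n ∈ Ioc (R ^ 4) N, LR R n ^ 2 / (n:ℝ) := by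
    rw [← Finset.sum_union (Finset.disjoint_left.2 fun x hx hy => by
      rw [Finset.mem_Ioc] at hx hy; omega)]
    refine Finset.sum_le_sum_of_subset_of_nonneg ?_ fun _ _ _ => by positivity
    intro x hx
    rw [Finset.mem_union, Finset.mem_Ioc, Finset.mem_Ioc]
    rw [Finset.mem_Ioc] at hx
    omega
  set L := Real.log R
  set M := Real.log N
  have a1 : (1 + L) * (2 + M) ≤ (2 * L) * (3 * M) := by
    apply mul_le_mul <;> linarith
  have a2 : C * L ^ 2 ≤ C * L * M := by
    rw [sq, ← mul_assoc]; exact mul_le_mul_of_nonneg_left hLN (by positivity)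
  nlinarith

end TotRun
end

section
open ArithmeticFunction Finset
open scoped ArithmeticFunction.Moebius ArithmeticFunction.zeta ComplexConjugate

namespace TotRun

lemma tail_mult (c : ℕ → ℂ) (hmul : ∀ m n, c (m * n) = c m * c n) (hnorm : ∀ n, ‖c n‖ ≤ 1)
    (B M : ℝ) (hM : 0 ≤ M) (hc : ∀ n, ‖∑ k ∈ Ioc 0 n, c k‖ ≤ B) (D U N : ℕ) (hD : 1 ≤ D) (hU : 1 ≤ U)
    (v : ℕ → ℝ) (h1 : ∀ n, U / D < n → |v (D * n)| ≤ M)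
    (h2 : ∀ n, U / D < n → |v (D * n) - v (D * (n + 1))| ≤ M / n) :
    ‖∑ m ∈ (Ioc U N).filter (D ∣ ·), c m * ((v m / m : ℝ) : ℂ)‖ ≤ 6 * B * M / U := by
  have hB : 0 ≤ B := (norm_nonneg _).trans (hc 0)
  have hD0 : (0:ℝ) < D := by exact_mod_cast hD
  have hU0 : (0:ℝ) < U := by exact_mod_cast hU
  have e : ∑ m ∈ (Ioc U N).filter (D ∣ ·), c m * ((v m / m : ℝ) : ℂ) =
      (c D * ((1 / D : ℝ) : ℂ)) * ∑ j ∈ Ioc (U / D) (N / D), c j * ((v (D * j) / j : ℝ) : ℂ) := by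
    have h3 : (Ioc U N).filter (D ∣ ·) = ((Ioc 0 N).filter (D ∣ ·)).filter (U < ·) := by
      ext x; simp only [Finset.mem_filter, Finset.mem_Ioc]
      constructor
      · rintro ⟨⟨a, b⟩, c⟩; exact ⟨⟨⟨by omega, b⟩, c⟩, a⟩
      · rintro ⟨⟨⟨a, b⟩, c⟩, d⟩; exact ⟨⟨d, b⟩, c⟩
    have h4 : Ioc (U / D) (N / D) = (Ioc 0 (N / D)).filter (fun j => U < D * j) := by
      ext x; simp only [Finset.mem_filter, Finset.mem_Ioc]
      rw [Nat.div_lt_iff_lt_mul (by omega), mul_comm x D]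
      constructor
      · rintro ⟨a, b⟩
        refine ⟨⟨?_, b⟩, a⟩
        rcases Nat.eq_zero_or_pos x with rfl | h
        · simp at a
        · exact h
      · rintro ⟨⟨_, b⟩, a⟩; exact ⟨a, b⟩
    rw [h3, h4, Finset.sum_filter, sum_mult N D hD, Finset.sum_filter, Finset.mul_sum]
    refine Finset.sum_congr rfl fun j hj => ?_
    split_ifs
    · have hj0 : (j : ℂ) ≠ 0 := by exact_mod_cast (Finset.mem_Ioc.1 hj).1.ne'
      have hD1 : (D : ℂ) ≠ 0 := by exact_mod_cast (by omega : D ≠ 0)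
      rw [hmul]; push_cast
      field_simp
    · simp
  rw [e, norm_mul, norm_mul]
  have h5 := abel_u c (fun n => v (D * n)) B M hM hc (U / D) (N / D) h1 h2
  have h6 : ‖((1 / D : ℝ) : ℂ)‖ = 1 / D := by
    rw [Complex.norm_real, Real.norm_of_nonneg (by positivity)]
  rw [h6]
  calc _ ≤ 1 * (1 / (D:ℝ)) * (6 * B * M / ((U / D : ℕ) + 1)) := by
        gcongr
        exact hnorm D
    _ ≤ _ := by
        have : (U : ℝ) ≤ D * ((U / D : ℕ) + 1) := by
          have := Nat.lt_mul_div_succ U (by omega : 0 < D)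
          exact_mod_cast this.le
        rw [one_mul, div_mul_div_comm, one_mul]
        exact div_le_div_of_nonneg_left (by positivity) hU0 this

/-- A family of almost orthogonal completely multiplicative functions -/
structure Fam (R : ℕ) {ι : Type} [Fintype ι] (χ : ι → ℕ → ℂ) : Prop where
  mul : ∀ i m n, χ i (m * n) = χ i m * χ i n
  norm : ∀ i n, ‖χ i n‖ ≤ 1
  ps : ∀ i N, ‖∑ n ∈ Ioc 0 N, χ i n‖ ≤ (R : ℝ) ^ 10
  ps2 : ∀ i j, i ≠ j → ∀ N, ‖∑ n ∈ Ioc 0 N, χ i n * conj (χ j n)‖ ≤ (R : ℝ) ^ 10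
  card : (Fintype.card ι : ℝ) ≤ (R : ℝ) ^ 10

lemma LR_sq (R n : ℕ) : LR R n ^ 2 = ∑ d ∈ Ioc 0 R, ∑ e ∈ Ioc 0 R, (if Nat.lcm d e ∣ n then lam R d * lam R e else 0) := by
  rw [sq, LR, Finset.sum_mul_sum]
  refine Finset.sum_congr rfl fun d _ => Finset.sum_congr rfl fun e _ => ?_
  by_cases a : d ∣ n <;> by_cases b : e ∣ n <;> simp [a, b, Nat.lcm_dvd_iff]

lemma off_diag (R U N : ℕ) (hU : 1 ≤ U) (hR : 3 ≤ R) (c : ℕ → ℂ) (hmul : ∀ m n, c (m * n) = c m * c n)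
    (hnorm : ∀ n, ‖c n‖ ≤ 1) (B : ℝ) (hc : ∀ n, ‖∑ k ∈ Ioc 0 n, c k‖ ≤ B) :
    ‖∑ m ∈ Ioc U N, c m * ((LR R m ^ 2 / m : ℝ) : ℂ)‖ ≤ Real.log R ^ 2 * (R ^ 2 * (6 * B / U)) := by
  have e : ∑ m ∈ Ioc U N, c m * ((LR R m ^ 2 / m : ℝ) : ℂ) =
      ∑ d ∈ Ioc 0 R, ∑ e ∈ Ioc 0 R, ((lam R d * lam R e : ℝ) : ℂ) *
        ∑ m ∈ (Ioc U N).filter (Nat.lcm d e ∣ ·), c m * (((fun _ => (1:ℝ)) m / m : ℝ) : ℂ) := by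
    simp_rw [LR_sq, Finset.sum_filter, Finset.mul_sum]
    rw [Finset.sum_congr rfl fun d _ => Finset.sum_comm, Finset.sum_comm]
    refine Finset.sum_congr rfl fun m _ => ?_
    rw [Finset.sum_div]; push_cast; rw [Finset.mul_sum]
    refine Finset.sum_congr rfl fun d _ => ?_
    rw [Finset.sum_div]; push_cast; rw [Finset.mul_sum]
    refine Finset.sum_congr rfl fun e _ => ?_
    split_ifs <;> simp
    ring
  rw [e]
  have hB : 0 ≤ B := (norm_nonneg _).trans (hc 0)
  refine (norm_sum_le _ _).trans ?_
  refine (Finset.sum_le_sum fun d hd => norm_sum_le _ _).trans ?_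
  calc _ ≤ ∑ d ∈ Ioc 0 R, ∑ e ∈ Ioc 0 R, (Real.log R ^ 2 * (6 * B * 1 / U)) := by
        refine Finset.sum_le_sum fun d hd => Finset.sum_le_sum fun e he => ?_
        rw [norm_mul]
        have h1 := abs_lam_le R d hd
        have h2 := abs_lam_le R e he
        refine mul_le_mul ?_ ?_ (norm_nonneg _) (by positivity)
        · rw [Complex.norm_real, Real.norm_eq_abs, abs_mul, sq]
          exact mul_le_mul h1 h2 (abs_nonneg _) ((abs_nonneg _).trans h1)
        · refine tail_mult c hmul hnorm B 1 zero_le_one hc _ U N ?_ hU _ ?_ ?_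
          · exact Nat.lcm_pos (Finset.mem_Ioc.1 hd).1 (Finset.mem_Ioc.1 he).1
          · intros; simp
          · intros; simp
    _ = _ := by
        rw [Finset.sum_const, Finset.sum_const, Nat.card_Ioc]
        simp only [nsmul_eq_mul, Nat.sub_zero]
        ring

/-- duality -/
lemma duality {ι : Type} [Fintype ι] (S : Finset ℕ) (s : ℕ → ℝ) (t : ℕ → ℂ) (χ : ι → ℕ → ℂ) (Δ : ℝ) (hΔ : 0 ≤ Δ)
    (h : ∀ b : ι → ℂ, ∑ m ∈ S, s m ^ 2 * ‖∑ i, b i * χ i m‖ ^ 2 ≤ Δ * ∑ i, ‖b i‖ ^ 2) :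
    ∑ i, ‖∑ m ∈ S, (s m : ℂ) * t m * χ i m‖ ^ 2 ≤ Δ * ∑ m ∈ S, ‖t m‖ ^ 2 := by
  set T : ι → ℂ := fun i => ∑ m ∈ S, (s m : ℂ) * t m * χ i m with hT
  set X := ∑ i, ‖T i‖ ^ 2 with hX
  have hX0 : 0 ≤ X := Finset.sum_nonneg fun _ _ => by positivity
  have e : (X : ℂ) = ∑ m ∈ S, t m * ((s m : ℂ) * ∑ i, conj (T i) * χ i m) := by
    rw [hX]; push_cast
    have : ∀ i, ((‖T i‖ : ℂ)) ^ 2 = ∑ m ∈ S, conj (T i) * ((s m : ℂ) * t m * χ i m) := by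
      intro i
      rw [← Finset.mul_sum, ← Complex.conj_mul']
    rw [Finset.sum_congr rfl fun i _ => this i, Finset.sum_comm]
    refine Finset.sum_congr rfl fun m _ => ?_
    rw [Finset.mul_sum, Finset.mul_sum]
    exact Finset.sum_congr rfl fun i _ => by ring
  have h1 : X ≤ ∑ m ∈ S, ‖t m‖ * (|s m| * ‖∑ i, conj (T i) * χ i m‖) := by
    calc X = ‖(X : ℂ)‖ := by rw [Complex.norm_real, Real.norm_of_nonneg hX0]
      _ ≤ _ := by
        rw [e]
        refine (norm_sum_le _ _).trans (le_of_eq ?_)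
        refine Finset.sum_congr rfl fun m _ => ?_
        rw [norm_mul, norm_mul, Complex.norm_real, Real.norm_eq_abs]
  have h2 : X ^ 2 ≤ (∑ m ∈ S, ‖t m‖ ^ 2) * (Δ * X) := by
    calc X ^ 2 ≤ (∑ m ∈ S, ‖t m‖ * (|s m| * ‖∑ i, conj (T i) * χ i m‖)) ^ 2 := by gcongr
      _ ≤ (∑ m ∈ S, ‖t m‖ ^ 2) * ∑ m ∈ S, (|s m| * ‖∑ i, conj (T i) * χ i m‖) ^ 2 :=
          Finset.sum_mul_sq_le_sq_mul_sq _ _ _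
      _ ≤ _ := by
          refine mul_le_mul_of_nonneg_left ?_ (Finset.sum_nonneg fun _ _ => by positivity)
          have := h (fun i => conj (T i))
          simp only [RCLike.norm_conj] at this
          refine le_trans (le_of_eq ?_) this
          refine Finset.sum_congr rfl fun m _ => ?_
          rw [mul_pow, sq_abs]
  rcases hX0.eq_or_lt with h0 | h0
  · rw [← h0]
    exact mul_nonneg hΔ (Finset.sum_nonneg fun _ _ => by positivity)
  · refine le_of_mul_le_mul_left (a := X) ?_ h0
    nlinarith

lemma log_ge_one (R : ℕ) (hR3 : 3 ≤ R) : 1 ≤ Real.log R := by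
  rw [Real.le_log_iff_exp_le (by exact_mod_cast (by omega : 0 < R))]
  have := Real.exp_one_lt_d9
  have : (3:ℝ) ≤ R := by exact_mod_cast hR3
  linarith

/-- the sieve weight in the large sieve -/
noncomputable def sw (R m : ℕ) : ℝ := LR R m / Real.log R / Real.sqrt m

lemma sw_sq (R m : ℕ) : sw R m ^ 2 = LR R m ^ 2 / m / Real.log R ^ 2 := by
  rw [sw, div_pow, div_pow, Real.sq_sqrt (by positivity)]; ring

lemma large_sieve : ∃ C : ℝ, 0 < C ∧ ∃ R0 : ℕ, 3 ≤ R0 ∧ ∀ R : ℕ, R0 ≤ R → ∀ (ι : Type) [Fintype ι]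
    (χ : ι → ℕ → ℂ), Fam R χ → ∀ N : ℕ, N ≤ R ^ 1000 → ∀ t : ℕ → ℂ,
    ∑ i, ‖∑ m ∈ Ioc (R ^ 22) N, (sw R m : ℂ) * t m * χ i m‖ ^ 2 ≤
      C * ∑ m ∈ Ioc (R ^ 22) N, ‖t m‖ ^ 2 := by
  obtain ⟨C, hC, R0, hR0, h⟩ := LR_all
  refine ⟨1000 * C + 6, by positivity, R0, hR0, fun R hR ι _ χ hχ N hN t => ?_⟩
  classical
  have hR3 : 3 ≤ R := hR0.trans hR
  have hL1 := log_ge_one R hR3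
  have hRpos : (0:ℝ) < R := by exact_mod_cast (by omega : 0 < R)
  set L := Real.log R with hL
  refine duality _ _ _ _ _ (by positivity) fun b => ?_
  set S := Ioc (R ^ 22) N
  have hdiag : ∑ m ∈ S, sw R m ^ 2 ≤ 1000 * C := by
    calc _ ≤ ∑ m ∈ Ioc 0 (R ^ 1000), sw R m ^ 2 := by
          refine Finset.sum_le_sum_of_subset_of_nonneg (Finset.Ioc_subset_Ioc (Nat.zero_le _) hN) ?_
          intros; positivity
      _ = (∑ m ∈ Ioc 0 (R ^ 1000), LR R m ^ 2 / m) / L ^ 2 := by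
          rw [Finset.sum_div]; exact Finset.sum_congr rfl fun m _ => sw_sq R m
      _ ≤ (C * L * (1000 * L)) / L ^ 2 := by
          have := h R (R ^ 1000) hR (Nat.le_self_pow (by norm_num) R)
          push_cast at this
          rw [Real.log_pow] at this
          push_cast at this
          gcongr
      _ = _ := by field_simp
  have e : ∀ i j, ‖∑ m ∈ S, χ i m * conj (χ j m) * ((sw R m ^ 2 : ℝ) : ℂ)‖ ≤
      (if i = j then 1000 * C else 0) + 6 / (R : ℝ) ^ 10 := by
    intro i j
    split_ifs with hij
    · refine le_trans ?_ (le_add_of_nonneg_right (by positivity))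
      refine le_trans ?_ hdiag
      refine (norm_sum_le _ _).trans (Finset.sum_le_sum fun m _ => ?_)
      rw [norm_mul, norm_mul, RCLike.norm_conj, Complex.norm_real, Real.norm_of_nonneg (sq_nonneg _)]
      have h1 := hχ.norm i m
      have h2 := hχ.norm j m
      have : ‖χ i m‖ * ‖χ j m‖ ≤ 1 := mul_le_one₀ h1 (norm_nonneg _) h2
      calc _ ≤ 1 * sw R m ^ 2 := by gcongr
        _ = _ := one_mul _
    · rw [zero_add]
      have h1 := off_diag R (R ^ 22) N (Nat.one_le_pow _ _ (by omega)) hR3 (fun m => χ i m * conj (χ j m))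
        (by intro m n; simp only [hχ.mul, map_mul]; ring)
        (by intro n; rw [norm_mul, RCLike.norm_conj]; exact mul_le_one₀ (hχ.norm i n) (norm_nonneg _) (hχ.norm j n))
        _ (hχ.ps2 i j hij)
      have e2 : ∑ m ∈ S, χ i m * conj (χ j m) * ((sw R m ^ 2 : ℝ) : ℂ) =
          (∑ m ∈ S, χ i m * conj (χ j m) * ((LR R m ^ 2 / m : ℝ) : ℂ)) * ((1 / L ^ 2 : ℝ) : ℂ) := by
        rw [Finset.sum_mul]
        refine Finset.sum_congr rfl fun m _ => ?_
        rw [sw_sq, mul_assoc _ _ (((1 / L ^ 2 : ℝ)) : ℂ), ← Complex.ofReal_mul]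
        congr 2; rw [← hL]; ring
      rw [e2, norm_mul, Complex.norm_real, Real.norm_of_nonneg (by positivity)]
      calc _ ≤ L ^ 2 * ((R:ℝ) ^ 2 * (6 * (R:ℝ) ^ 10 / ((R ^ 22 : ℕ) : ℝ))) * (1 / L ^ 2) := by gcongr
        _ = _ := by push_cast; field_simp
  have e3 : ((∑ m ∈ S, sw R m ^ 2 * ‖∑ i, b i * χ i m‖ ^ 2 : ℝ) : ℂ) =
      ∑ i, ∑ j, b i * conj (b j) * ∑ m ∈ S, χ i m * conj (χ j m) * ((sw R m ^ 2 : ℝ) : ℂ) := by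
    simp_rw [Finset.mul_sum]
    rw [Finset.sum_congr rfl fun d _ => Finset.sum_comm, Finset.sum_comm]
    push_cast
    refine Finset.sum_congr rfl fun m _ => ?_
    rw [← Complex.mul_conj', map_sum, Finset.sum_mul_sum, Finset.mul_sum]
    refine Finset.sum_congr rfl fun i _ => ?_
    rw [Finset.mul_sum]
    refine Finset.sum_congr rfl fun j _ => ?_
    rw [map_mul]; ring
  have hpos : 0 ≤ ∑ m ∈ S, sw R m ^ 2 * ‖∑ i, b i * χ i m‖ ^ 2 := Finset.sum_nonneg fun _ _ => by positivity
  calc _ = ‖((∑ m ∈ S, sw R m ^ 2 * ‖∑ i, b i * χ i m‖ ^ 2 : ℝ) : ℂ)‖ := by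
        rw [Complex.norm_real, Real.norm_of_nonneg hpos]
    _ ≤ ∑ i, ∑ j, ‖b i‖ * ‖b j‖ * ((if i = j then 1000 * C else 0) + 6 / (R : ℝ) ^ 10) := by
        rw [e3]
        refine (norm_sum_le _ _).trans (Finset.sum_le_sum fun i _ => ?_)
        refine (norm_sum_le _ _).trans (Finset.sum_le_sum fun j _ => ?_)
        rw [norm_mul, norm_mul, RCLike.norm_conj]
        exact mul_le_mul_of_nonneg_left (e i j) (by positivity)
    _ = 1000 * C * ∑ i, ‖b i‖ ^ 2 + 6 / (R : ℝ) ^ 10 * (∑ i, ‖b i‖) ^ 2 := by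
        have : ∀ i, ∑ j, ‖b i‖ * ‖b j‖ * ((if i = j then 1000 * C else 0) + 6 / (R : ℝ) ^ 10) =
            1000 * C * ‖b i‖ ^ 2 + 6 / (R : ℝ) ^ 10 * (‖b i‖ * ∑ j, ‖b j‖) := by
          intro i
          simp_rw [mul_add, Finset.sum_add_distrib, mul_ite, mul_zero]
          rw [Finset.sum_ite_eq Finset.univ i, if_pos (Finset.mem_univ _), ← Finset.sum_mul, ← Finset.mul_sum]
          ring
        rw [Finset.sum_congr rfl fun i _ => this i, Finset.sum_add_distrib, ← Finset.mul_sum, ← Finset.mul_sum,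
          ← Finset.sum_mul]
        ring
    _ ≤ 1000 * C * ∑ i, ‖b i‖ ^ 2 + 6 / (R : ℝ) ^ 10 * ((R : ℝ) ^ 10 * ∑ i, ‖b i‖ ^ 2) := by
        have h1 : (∑ i, ‖b i‖) ^ 2 ≤ (Fintype.card ι : ℝ) * ∑ i, ‖b i‖ ^ 2 := by
          have := sq_sum_le_card_mul_sum_sq (s := (Finset.univ : Finset ι)) (f := fun i => ‖b i‖)
          simpa using this
        have h2 : 0 ≤ ∑ i, ‖b i‖ ^ 2 := Finset.sum_nonneg fun _ _ => by positivity
        have h3 := hχ.card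
        gcongr
        exact h1.trans (mul_le_mul_of_nonneg_right h3 h2)
    _ = _ := by
        field_simp

end TotRun
end

section
open ArithmeticFunction Finset
open scoped ArithmeticFunction.Moebius ArithmeticFunction.zeta ComplexConjugate

namespace TotRun

noncomputable def lpf (T : ℝ) (n : ℕ) : ℝ := max 0 (T - Real.log n)

/-- the hat function -/
noncomputable def hat (R n : ℕ) : ℝ :=
  lpf (600 * Real.log R) n - 2 * lpf (400 * Real.log R) n + lpf (200 * Real.log R) n

lemma lpf_lip (T : ℝ) (a b : ℕ) : |lpf T a - lpf T b| ≤ |Real.log a - Real.log b| := by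
  unfold lpf
  rw [max_comm 0, max_comm 0]
  refine (abs_max_sub_max_le_abs _ _ _).trans (le_of_eq ?_)
  rw [← abs_neg]; congr 1; ring

lemma hat_lip (R a b : ℕ) : |hat R a - hat R b| ≤ 4 * |Real.log a - Real.log b| := by
  have h1 := abs_le.1 (lpf_lip (600 * Real.log R) a b)
  have h2 := abs_le.1 (lpf_lip (400 * Real.log R) a b)
  have h3 := abs_le.1 (lpf_lip (200 * Real.log R) a b)
  unfold hat
  rw [abs_le]
  constructor <;> linarith [h1.1, h1.2, h2.1, h2.2, h3.1, h3.2]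

lemma hat_nonneg (R n : ℕ) : 0 ≤ hat R n := by
  unfold hat lpf
  rcases le_total 0 (400 * Real.log R - Real.log n) with h | h
  · rw [max_eq_right h]
    have h1 := le_max_right 0 (600 * Real.log R - Real.log n)
    have h2 := le_max_right 0 (200 * Real.log R - Real.log n)
    linarith
  · rw [max_eq_left h]
    have h1 := le_max_left 0 (600 * Real.log R - Real.log n)
    have h2 := le_max_left 0 (200 * Real.log R - Real.log n)
    linarith

lemma hat_le (R n : ℕ) : hat R n ≤ 200 * Real.log R := by
  unfold hat lpf
  have hL : 0 ≤ Real.log R := Real.log_natCast_nonneg R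
  rcases le_total 0 (400 * Real.log R - Real.log n) with h | h
  · rw [max_eq_right h, max_eq_right (by linarith : 0 ≤ 600 * Real.log R - Real.log n)]
    rcases le_total 0 (200 * Real.log R - Real.log n) with h1 | h1
    · rw [max_eq_right h1]; linarith
    · rw [max_eq_left h1]; linarith
  · rw [max_eq_left h, max_eq_left (by linarith : 200 * Real.log R - Real.log n ≤ 0)]
    rcases le_total 0 (600 * Real.log R - Real.log n) with h1 | h1
    · rw [max_eq_right h1]; linarith
    · rw [max_eq_left h1]; linarith

lemma hat_abs (R n : ℕ) : |hat R n| ≤ 200 * Real.log R := by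
  rw [abs_of_nonneg (hat_nonneg R n)]; exact hat_le R n

lemma log_natpow (R a : ℕ) : Real.log ((R ^ a : ℕ) : ℝ) = a * Real.log R := by
  push_cast; rw [Real.log_pow]

lemma hat_lo (R n : ℕ) (h : n ≤ R ^ 200) : hat R n = 0 := by
  have hL : 0 ≤ Real.log R := Real.log_natCast_nonneg R
  have : Real.log n ≤ 200 * Real.log R := by
    rcases Nat.eq_zero_or_pos n with rfl | hn
    · simp; exact hL
    · have := Real.log_le_log (by exact_mod_cast hn) (by exact_mod_cast h : (n:ℝ) ≤ ((R ^ 200 : ℕ) : ℝ))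
      rw [log_natpow] at this
      exact_mod_cast this
  unfold hat lpf
  rw [max_eq_right (by linarith), max_eq_right (by linarith), max_eq_right (by linarith)]
  ring

lemma hat_hi (R n : ℕ) (hR : 1 ≤ R) (h : R ^ 600 ≤ n) : hat R n = 0 := by
  have hL : 0 ≤ Real.log R := Real.log_natCast_nonneg R
  have : 600 * Real.log R ≤ Real.log n := by
    have := Real.log_le_log (by exact_mod_cast Nat.pow_pos (by omega)) (by exact_mod_cast h : ((R ^ 600 : ℕ) : ℝ) ≤ n)
    rw [log_natpow] at this
    exact_mod_cast this
  unfold hat lpf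
  rw [max_eq_left (by linarith), max_eq_left (by linarith), max_eq_left (by linarith)]
  ring

/-! separation of variables -/

lemma lpf_int (T : ℝ) (m k : ℕ) (hm : 1 ≤ m) (hk : 1 ≤ k) (hT : 0 ≤ T) :
    IntervalIntegrable (fun t : ℝ => (if Real.log m ≤ t then (1:ℂ) else 0) * (if Real.log k ≤ T - t then 1 else 0)) MeasureTheory.volume 0 T ∧
    ∫ t in (0:ℝ)..T, (if Real.log m ≤ t then (1:ℂ) else 0) * (if Real.log k ≤ T - t then 1 else 0) = (lpf T (m * k) : ℂ) := by
  have e : (fun t : ℝ => (if Real.log m ≤ t then (1:ℂ) else 0) * (if Real.log k ≤ T - t then 1 else 0)) =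
      Set.indicator (Set.Icc (Real.log m) (T - Real.log k)) (fun _ => (1:ℂ)) := by
    ext t
    rw [Set.indicator_apply]
    by_cases h1 : Real.log m ≤ t <;> by_cases h2 : Real.log k ≤ T - t
    · rw [if_pos h1, if_pos h2, if_pos ⟨h1, by linarith⟩]; simp
    · rw [if_pos h1, if_neg h2, if_neg (fun h => h2 (by linarith [h.2]))]; simp
    · rw [if_neg h1, zero_mul, if_neg (fun h : t ∈ Set.Icc _ _ => h1 h.1)]
    · rw [if_neg h1, zero_mul, if_neg (fun h : t ∈ Set.Icc _ _ => h1 h.1)]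
  have hm0 : 0 ≤ Real.log m := Real.log_natCast_nonneg m
  have hk0 : 0 ≤ Real.log k := Real.log_natCast_nonneg k
  have hmk : Real.log ((m * k : ℕ) : ℝ) = Real.log m + Real.log k := by
    push_cast
    rw [Real.log_mul (by exact_mod_cast (by omega : m ≠ 0)) (by exact_mod_cast (by omega : k ≠ 0))]
  rw [e]
  constructor
  · rw [intervalIntegrable_iff_integrableOn_Icc_of_le hT]
    exact (MeasureTheory.integrableOn_const (by simp) (by simp)).indicator measurableSet_Icc
  · rw [intervalIntegral.integral_of_le hT, ← MeasureTheory.integral_Icc_eq_integral_Ioc,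
      MeasureTheory.setIntegral_indicator measurableSet_Icc]
    have : Set.Icc 0 T ∩ Set.Icc (Real.log m) (T - Real.log k) = Set.Icc (Real.log m) (T - Real.log k) := by
      rw [Set.inter_eq_right]
      exact Set.Icc_subset_Icc hm0 (by linarith)
    rw [this, MeasureTheory.setIntegral_const]
    simp only [MeasureTheory.measureReal_def, Real.volume_Icc, ENNReal.toReal_ofReal', Complex.real_smul, mul_one]
    rw [lpf, hmk, max_comm]
    congr 2; ring

lemma sep {ι : Type} [Fintype ι] (S1 S2 : Finset ℕ) (h1 : ∀ m ∈ S1, 1 ≤ m) (h2 : ∀ k ∈ S2, 1 ≤ k)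
    (A K : ι → ℕ → ℂ) (T x y : ℝ) (hT : 0 ≤ T) (hx : 0 ≤ x) (hy : 0 ≤ y)
    (hA : ∀ t, ∑ i, ‖∑ m ∈ S1 with Real.log (m : ℕ) ≤ t, A i m‖ ^ 2 ≤ x ^ 2)
    (hK : ∀ t, ∑ i, ‖∑ k ∈ S2 with Real.log (k : ℕ) ≤ t, K i k‖ ^ 2 ≤ y ^ 2) :
    ∑ i, ‖∑ m ∈ S1, ∑ k ∈ S2, A i m * K i k * (lpf T (m * k) : ℂ)‖ ≤ T * (x * y) := by
  set f : ι → ℝ → ℂ := fun i t => (∑ m ∈ S1 with Real.log (m : ℕ) ≤ t, A i m) * (∑ k ∈ S2 with Real.log (k : ℕ) ≤ T - t, K i k) with hf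
  have ef : ∀ i, f i = fun t => ∑ m ∈ S1, ∑ k ∈ S2, A i m * K i k * ((if Real.log m ≤ t then (1:ℂ) else 0) * (if Real.log k ≤ T - t then 1 else 0)) := by
    intro i
    ext t
    simp only [hf]
    rw [Finset.sum_filter, Finset.sum_filter, Finset.sum_mul_sum]
    refine Finset.sum_congr rfl fun m _ => Finset.sum_congr rfl fun k _ => ?_
    split_ifs <;> simp
  have hintg : ∀ i, IntervalIntegrable (f i) MeasureTheory.volume 0 T := by
    intro i
    rw [ef i]
    have : (fun t => ∑ m ∈ S1, ∑ k ∈ S2, A i m * K i k * ((if Real.log m ≤ t then (1:ℂ) else 0) * (if Real.log k ≤ T - t then 1 else 0))) =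
      ∑ m ∈ S1, ∑ k ∈ S2, fun t => A i m * K i k * ((if Real.log m ≤ t then (1:ℂ) else 0) * (if Real.log k ≤ T - t then 1 else 0)) := by
      ext t; simp [Finset.sum_apply]
    rw [this]
    exact IntervalIntegrable.sum _ fun m hm => IntervalIntegrable.sum _ fun k hk =>
      (lpf_int T m k (h1 m hm) (h2 k hk) hT).1.const_mul _
  have hval : ∀ i, ∑ m ∈ S1, ∑ k ∈ S2, A i m * K i k * (lpf T (m * k) : ℂ) = ∫ t in (0:ℝ)..T, f i t := by
    intro i
    rw [ef i, intervalIntegral.integral_finset_sum]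
    · refine Finset.sum_congr rfl fun m hm => ?_
      rw [intervalIntegral.integral_finset_sum]
      · refine Finset.sum_congr rfl fun k hk => ?_
        rw [intervalIntegral.integral_const_mul, (lpf_int T m k (h1 m hm) (h2 k hk) hT).2]
      · intro k hk
        exact (lpf_int T m k (h1 m hm) (h2 k hk) hT).1.const_mul _
    · intro m hm
      have : (fun t => ∑ k ∈ S2, A i m * K i k * ((if Real.log m ≤ t then (1:ℂ) else 0) * (if Real.log k ≤ T - t then 1 else 0))) =
        ∑ k ∈ S2, fun t => A i m * K i k * ((if Real.log m ≤ t then (1:ℂ) else 0) * (if Real.log k ≤ T - t then 1 else 0)) := by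
        ext t; simp [Finset.sum_apply]
      rw [this]
      exact IntervalIntegrable.sum _ fun k hk => (lpf_int T m k (h1 m hm) (h2 k hk) hT).1.const_mul _
  calc _ ≤ ∑ i, ∫ t in (0:ℝ)..T, ‖f i t‖ := by
        refine Finset.sum_le_sum fun i _ => ?_
        rw [hval i]
        exact intervalIntegral.norm_integral_le_integral_norm hT
    _ = ∫ t in (0:ℝ)..T, ∑ i, ‖f i t‖ := by
        rw [intervalIntegral.integral_finset_sum]
        exact fun i _ => (hintg i).norm
    _ ≤ ∫ t in (0:ℝ)..T, x * y := by
        refine intervalIntegral.integral_mono_on hT ?_ (by simp) ?_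
        · have : (fun t => ∑ i, ‖f i t‖) = ∑ i, fun t => ‖f i t‖ := by ext t; simp [Finset.sum_apply]
          rw [this]
          exact IntervalIntegrable.sum _ fun i _ => (hintg i).norm
        · intro t _
          simp only [hf, norm_mul]
          refine (Real.sum_mul_le_sqrt_mul_sqrt _ _ _).trans ?_
          refine mul_le_mul ?_ ?_ (Real.sqrt_nonneg _) hx
          · rw [Real.sqrt_le_iff]; exact ⟨hx, hA t⟩
          · rw [Real.sqrt_le_iff]; exact ⟨hy, hK (T - t)⟩
    _ = _ := by rw [intervalIntegral.integral_const, smul_eq_mul, sub_zero]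

lemma filter_log (U N : ℕ) (t : ℝ) :
    (Ioc U N).filter (fun m : ℕ => Real.log m ≤ t) = Ioc U (min N ⌊Real.exp t⌋₊) := by
  ext m
  simp only [Finset.mem_filter, Finset.mem_Ioc, le_min_iff]
  constructor
  · rintro ⟨⟨a, b⟩, c⟩
    refine ⟨a, b, Nat.le_floor ?_⟩
    rwa [← Real.log_le_iff_le_exp (by exact_mod_cast (by omega : 0 < m))]
  · rintro ⟨a, b, c⟩
    refine ⟨⟨a, b⟩, ?_⟩
    rw [Real.log_le_iff_le_exp (by exact_mod_cast (by omega : 0 < m))]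
    exact (Nat.le_floor_iff (Real.exp_pos _).le).1 c

end TotRun
end

section
open ArithmeticFunction Finset
open scoped ArithmeticFunction.Moebius ArithmeticFunction.zeta ComplexConjugate

namespace TotRun

lemma LR_prime_or_one (R k : ℕ) (hR : 1 ≤ R) (hk : k = 1 ∨ (k.Prime ∧ R < k)) : LR R k = Real.log R := by
  unfold LR
  rw [Finset.sum_eq_single 1]
  · simp [lam]
  · intro d hd hd1
    rw [if_neg]
    intro hdk
    rw [Finset.mem_Ioc] at hd
    rcases hk with rfl | ⟨hk, hRk⟩
    · exact hd1 (Nat.dvd_one.1 hdk)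
    · rcases (Nat.dvd_prime hk).1 hdk with h | h
      · exact hd1 h
      · omega
  · intro h; exact absurd (Finset.mem_Ioc.2 ⟨one_pos, hR⟩) h

lemma LR_eq_vonMangoldt (R m : ℕ) (h1 : 1 < m) (h2 : m ≤ R) : LR R m = Λ m := by
  have e : LR R m = ∑ d ∈ m.divisors, lam R d := by
    unfold LR
    rw [← Finset.sum_filter]
    refine Finset.sum_congr ?_ fun _ _ => rfl
    ext d
    rw [Finset.mem_filter, Finset.mem_Ioc, Nat.mem_divisors]
    constructor
    · rintro ⟨a, b⟩; exact ⟨b, by omega⟩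
    · rintro ⟨a, b⟩
      exact ⟨⟨Nat.pos_of_dvd_of_pos a (by omega), (Nat.le_of_dvd (by omega) a).trans h2⟩, a⟩
  rw [e]
  have e2 : ∀ d ∈ m.divisors, lam R d = Real.log R * ((μ d : ℤ) : ℝ) - (μ d : ℝ) * Real.log d := by
    intro d hd
    have hd0 : (d : ℝ) ≠ 0 := by exact_mod_cast (Nat.pos_of_mem_divisors hd).ne'
    have hR0 : (R : ℝ) ≠ 0 := by exact_mod_cast (by omega : R ≠ 0)
    rw [lam, Real.log_div hR0 hd0]; ring
  rw [Finset.sum_congr rfl e2, Finset.sum_sub_distrib, ← Finset.mul_sum]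
  have h3 := sum_moebius_mul_log_eq (n := m)
  have h4 : ∑ d ∈ m.divisors, ((μ d : ℤ) : ℝ) = 0 := by
    have h5 : ∑ d ∈ m.divisors, (μ d : ℤ) = 0 := by
      rw [← coe_mul_zeta_apply, moebius_mul_coe_zeta, one_apply, if_neg (by omega)]
    exact_mod_cast h5
  simp only [log_apply] at h3
  rw [h4, h3]; ring

noncomputable def psi (R m : ℕ) : ℝ := (LR (R ^ 44) m - LR (R ^ 22) m) / (22 * Real.log R)
noncomputable def amp (R m : ℕ) : ℝ := psi R m * (LR R m / Real.log R)

lemma amp_one (R : ℕ) (hR : 3 ≤ R) : amp R 1 = 1 := by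
  have hL := log_ge_one R hR
  unfold amp psi
  rw [LR_prime_or_one R 1 (by omega) (Or.inl rfl), LR_prime_or_one (R ^ 44) 1 (Nat.one_le_pow _ _ (by omega)) (Or.inl rfl),
    LR_prime_or_one (R ^ 22) 1 (Nat.one_le_pow _ _ (by omega)) (Or.inl rfl), log_natpow, log_natpow]
  push_cast
  field_simp
  ring

lemma amp_zero (R m : ℕ) (hR : 3 ≤ R) (h1 : 1 < m) (h2 : m ≤ R ^ 22) : amp R m = 0 := by
  unfold amp psi
  rw [LR_eq_vonMangoldt _ m h1 h2, LR_eq_vonMangoldt _ m h1 (h2.trans (Nat.pow_le_pow_right (by omega) (by norm_num)))]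
  simp

noncomputable def pc (R d : ℕ) : ℝ := (lam (R ^ 44) d - (if d ≤ R ^ 22 then lam (R ^ 22) d else 0)) / (22 * Real.log R)
noncomputable def ec (R e : ℕ) : ℝ := lam R e / Real.log R

lemma amp_expand (R m : ℕ) (hR : 3 ≤ R) : amp R m = ∑ d ∈ Ioc 0 (R ^ 44), ∑ e ∈ Ioc 0 R,
    (if Nat.lcm d e ∣ m then pc R d * ec R e else 0) := by
  have h1 : psi R m = ∑ d ∈ Ioc 0 (R ^ 44), if d ∣ m then pc R d else 0 := by
    have : LR (R ^ 22) m = ∑ d ∈ Ioc 0 (R ^ 44), if d ∣ m then (if d ≤ R ^ 22 then lam (R ^ 22) d else 0) else 0 := by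
      unfold LR
      have hsub : Ioc 0 (R ^ 22) ⊆ Ioc 0 (R ^ 44) :=
        Finset.Ioc_subset_Ioc le_rfl (Nat.pow_le_pow_right (by omega) (by norm_num))
      rw [← Finset.sum_subset hsub]
      · refine Finset.sum_congr rfl fun d hd => ?_
        rw [if_pos (Finset.mem_Ioc.1 hd).2]
      · intro d hd hd2
        rw [Finset.mem_Ioc] at hd hd2
        rw [if_neg (by omega : ¬ d ≤ R ^ 22)]; simp
    unfold psi
    rw [this, LR, ← Finset.sum_sub_distrib, Finset.sum_div]
    refine Finset.sum_congr rfl fun d _ => ?_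
    by_cases h : d ∣ m
    · simp only [if_pos h, pc]
    · simp only [if_neg h]; simp
  unfold amp
  rw [h1, LR, Finset.sum_div, Finset.sum_mul_sum]
  refine Finset.sum_congr rfl fun d _ => Finset.sum_congr rfl fun e _ => ?_
  by_cases a : d ∣ m <;> by_cases b : e ∣ m <;> simp [a, b, Nat.lcm_dvd_iff, ec]

lemma pcec_le (R d e : ℕ) (hR : 3 ≤ R) (hd : d ∈ Ioc 0 (R ^ 44)) (he : e ∈ Ioc 0 R) :
    |pc R d * ec R e| ≤ 3 := by
  have hL := log_ge_one R hR
  have h1 : |pc R d| ≤ 3 := by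
    unfold pc
    rw [abs_div, abs_of_pos (by positivity : 0 < 22 * Real.log R), div_le_iff₀ (by positivity)]
    have a := abs_lam_le _ d hd
    rw [log_natpow] at a
    have b : |(if d ≤ R ^ 22 then lam (R ^ 22) d else 0)| ≤ 22 * Real.log R := by
      split_ifs with h
      · have := abs_lam_le (R ^ 22) d (Finset.mem_Ioc.2 ⟨(Finset.mem_Ioc.1 hd).1, h⟩)
        rw [log_natpow] at this; exact_mod_cast this
      · simp; positivity
    have c := abs_sub (lam (R ^ 44) d) (if d ≤ R ^ 22 then lam (R ^ 22) d else 0)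
    push_cast at a
    linarith
  have h2 : |ec R e| ≤ 1 := by
    unfold ec
    rw [abs_div, abs_of_pos (by positivity : 0 < Real.log R), div_le_iff₀ (by positivity), one_mul]
    exact abs_lam_le R e he
  rw [abs_mul]
  calc _ ≤ 3 * 1 := mul_le_mul h1 h2 (abs_nonneg _) (by norm_num)
    _ = 3 := by norm_num

/-- mean square of psi -/
lemma psi_sq : ∃ C : ℝ, 0 < C ∧ ∃ R0 : ℕ, 3 ≤ R0 ∧ ∀ R N : ℕ, R0 ≤ R → N ≤ R ^ 1000 →
    ∑ m ∈ Ioc 0 N, psi R m ^ 2 / m ≤ C := by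
  obtain ⟨C, hC, R0, hR0, h⟩ := LR_all
  refine ⟨C * 300, by positivity, R0, hR0, fun R N hR hN => ?_⟩
  have hR3 : 3 ≤ R := hR0.trans hR
  have hL := log_ge_one R hR3
  have h1 := h (R ^ 44) (R ^ 1000) (hR.trans (Nat.le_self_pow (by norm_num) R)) (Nat.pow_le_pow_right (by omega) (by norm_num))
  have h2 := h (R ^ 22) (R ^ 1000) (hR.trans (Nat.le_self_pow (by norm_num) R)) (Nat.pow_le_pow_right (by omega) (by norm_num))
  rw [log_natpow, log_natpow] at h1 h2
  push_cast at h1 h2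
  calc _ ≤ ∑ m ∈ Ioc 0 (R ^ 1000), psi R m ^ 2 / m :=
        Finset.sum_le_sum_of_subset_of_nonneg (Finset.Ioc_subset_Ioc le_rfl hN) (by intros; positivity)
    _ ≤ ∑ m ∈ Ioc 0 (R ^ 1000), (2 * (LR (R ^ 44) m ^ 2 / m) + 2 * (LR (R ^ 22) m ^ 2 / m)) / (22 * Real.log R) ^ 2 := by
        refine Finset.sum_le_sum fun m _ => ?_
        unfold psi
        rw [div_pow, div_right_comm]
        gcongr
        rw [mul_div_assoc', mul_div_assoc', ← add_div]
        gcongr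
        nlinarith [sq_nonneg (LR (R ^ 44) m + LR (R ^ 22) m)]
    _ ≤ (2 * (C * (44 * Real.log R) * (1000 * Real.log R)) + 2 * (C * (22 * Real.log R) * (1000 * Real.log R))) / (22 * Real.log R) ^ 2 := by
        rw [← Finset.sum_div, Finset.sum_add_distrib, ← Finset.mul_sum, ← Finset.mul_sum]
        gcongr
    _ ≤ _ := by
        rw [div_le_iff₀ (by positivity)]
        have : 0 < C * Real.log R ^ 2 := by positivity
        nlinarith

lemma Bmom : ∃ C : ℝ, 0 < C ∧ ∃ R0 : ℕ, 3 ≤ R0 ∧ ∀ R : ℕ, R0 ≤ R → ∀ (ι : Type) [Fintype ι]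
    (χ : ι → ℕ → ℂ), Fam R χ → ∀ N : ℕ, N ≤ R ^ 1000 →
    ∑ i, ‖∑ m ∈ Ioc (R ^ 22) N, ((amp R m / m : ℝ) : ℂ) * χ i m‖ ^ 2 ≤ C := by
  obtain ⟨C1, hC1, R1, hR1, h1⟩ := large_sieve
  obtain ⟨C2, hC2, R2, hR2, h2⟩ := psi_sq
  refine ⟨C1 * C2, by positivity, max R1 R2, hR1.trans (le_max_left _ _), fun R hR ι _ χ hχ N hN => ?_⟩
  have a := h1 R ((le_max_left _ _).trans hR) ι χ hχ N hN (fun m => ((psi R m / Real.sqrt m : ℝ) : ℂ))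
  have b := h2 R N ((le_max_right _ _).trans hR) hN
  have e : ∀ i, ∑ m ∈ Ioc (R ^ 22) N, ((amp R m / m : ℝ) : ℂ) * χ i m =
      ∑ m ∈ Ioc (R ^ 22) N, (sw R m : ℂ) * ((psi R m / Real.sqrt m : ℝ) : ℂ) * χ i m := by
    intro i
    refine Finset.sum_congr rfl fun m _ => ?_
    rw [← Complex.ofReal_mul]
    congr 2
    rw [sw, amp, div_mul_div_comm, Real.mul_self_sqrt (by positivity)]
    ring
  simp_rw [e]
  refine a.trans (mul_le_mul_of_nonneg_left ?_ hC1.le)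
  calc _ = ∑ m ∈ Ioc (R ^ 22) N, psi R m ^ 2 / m := by
        refine Finset.sum_congr rfl fun m _ => ?_
        rw [Complex.norm_real, Real.norm_eq_abs, sq_abs, div_pow, Real.sq_sqrt (by positivity)]
    _ ≤ ∑ m ∈ Ioc 0 N, psi R m ^ 2 / m :=
        Finset.sum_le_sum_of_subset_of_nonneg (Finset.Ioc_subset_Ioc (Nat.zero_le _) le_rfl) (by intros; positivity)
    _ ≤ _ := b

lemma Pmom : ∃ C : ℝ, 0 < C ∧ ∃ R0 : ℕ, 3 ≤ R0 ∧ ∀ R : ℕ, R0 ≤ R → ∀ (ι : Type) [Fintype ι]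
    (χ : ι → ℕ → ℂ), Fam R χ → ∀ N : ℕ, N ≤ R ^ 1000 →
    ∑ i, ‖∑ m ∈ Ioc (R ^ 22) N, ((Λ m / m : ℝ) : ℂ) * χ i m‖ ^ 2 ≤ C * Real.log R ^ 2 := by
  obtain ⟨C1, hC1, R1, hR1, h1⟩ := large_sieve
  obtain ⟨C2, hC2, h2⟩ := mertens_prime
  obtain ⟨C3, hC3, h3⟩ := pp_exists
  refine ⟨2 * (C1 * (1000 * (1000 + C2))) + 2 * C3 ^ 2, by positivity, R1, hR1, fun R hR ι _ χ hχ N hN => ?_⟩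
  have hR3 : 3 ≤ R := hR1.trans hR
  have hL := log_ge_one R hR3
  have hRpos : (1:ℝ) ≤ R := by exact_mod_cast (by omega : 1 ≤ R)
  set S := Ioc (R ^ 22) N
  set L := Real.log R with hLdef
  have a := h1 R hR ι χ hχ N hN (fun m => (((if m.Prime then Real.log m else 0) / Real.sqrt m : ℝ) : ℂ))
  have hlogN : ∀ m ∈ Ioc 0 N, Real.log m ≤ 1000 * L := by
    intro m hm
    have := Real.log_le_log (by exact_mod_cast (Finset.mem_Ioc.1 hm).1) (by exact_mod_cast (Finset.mem_Ioc.1 hm).2.trans hN : (m:ℝ) ≤ ((R ^ 1000 : ℕ) : ℝ))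
    rw [log_natpow] at this
    exact_mod_cast this
  have hsq : ∑ m ∈ S, ‖(((if m.Prime then Real.log m else 0) / Real.sqrt m : ℝ) : ℂ)‖ ^ 2 ≤ 1000 * (1000 + C2) * L ^ 2 := by
    calc _ ≤ ∑ m ∈ S, 1000 * L * ((if m.Prime then Real.log m else 0) / (m : ℝ)) := by
          refine Finset.sum_le_sum fun m hm => ?_
          rw [Complex.norm_real, Real.norm_eq_abs, sq_abs, div_pow, Real.sq_sqrt (by positivity), ← mul_div_assoc]
          gcongr
          split_ifs
          · rw [sq]
            have := hlogN m (Finset.mem_Ioc.2 ⟨by have := (Finset.mem_Ioc.1 hm).1; omega, (Finset.mem_Ioc.1 hm).2⟩)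
            exact mul_le_mul_of_nonneg_right this (Real.log_natCast_nonneg m)
          · simp
      _ ≤ 1000 * L * ∑ m ∈ Ioc 0 (R ^ 1000), ((if m.Prime then Real.log m else 0) / (m : ℝ)) := by
          rw [← Finset.mul_sum]
          refine mul_le_mul_of_nonneg_left ?_ (by positivity)
          refine Finset.sum_le_sum_of_subset_of_nonneg (Finset.Ioc_subset_Ioc (Nat.zero_le _) hN) ?_
          intro m _ _
          have := Real.log_natCast_nonneg m
          split_ifs <;> positivity
      _ ≤ 1000 * L * (1000 * L + C2) := by
          have := (abs_le.1 (h2 (R ^ 1000) (Nat.one_le_pow _ _ (by omega)))).2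
          rw [log_natpow] at this
          push_cast at this
          refine mul_le_mul_of_nonneg_left (by linarith) (by positivity)
      _ ≤ _ := by
          have : 0 ≤ C2 * (L * (L - 1)) := mul_nonneg hC2.le (mul_nonneg (by linarith) (by linarith))
          nlinarith
  have e : ∀ i, ∑ m ∈ S, ((Λ m / m : ℝ) : ℂ) * χ i m =
      ∑ m ∈ S, (sw R m : ℂ) * (((if m.Prime then Real.log m else 0) / Real.sqrt m : ℝ) : ℂ) * χ i m +
      ∑ m ∈ S, (((if m.Prime then 0 else Λ m) / m : ℝ) : ℂ) * χ i m := by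
    intro i
    rw [← Finset.sum_add_distrib]
    refine Finset.sum_congr rfl fun m hm => ?_
    rw [← add_mul, ← Complex.ofReal_mul, ← Complex.ofReal_add]
    congr 2
    split_ifs with hp
    · have hRm : R < m := lt_of_le_of_lt (Nat.le_self_pow (by norm_num) R) (Finset.mem_Ioc.1 hm).1
      rw [sw, LR_prime_or_one R m (by omega) (Or.inr ⟨hp, hRm⟩), ← hLdef, div_self (by linarith),
        vonMangoldt_apply_prime hp, div_mul_div_comm, Real.mul_self_sqrt (by positivity)]
      ring
    · simp
  have hpp : ∀ i, ‖∑ m ∈ S, (((if m.Prime then 0 else Λ m) / m : ℝ) : ℂ) * χ i m‖ ≤ C3 / R ^ 11 := by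
    intro i
    have := h3 (R ^ 22) N (Nat.one_le_pow _ _ (by omega))
    rw [show ((R ^ 22 : ℕ) : ℝ) = ((R : ℝ) ^ 11) ^ 2 by push_cast; ring, Real.sqrt_sq (by positivity)] at this
    refine le_trans ?_ this
    refine (norm_sum_le _ _).trans (Finset.sum_le_sum fun m _ => ?_)
    rw [norm_mul, Complex.norm_real, Real.norm_of_nonneg]
    · refine mul_le_of_le_one_right ?_ (hχ.norm i m)
      split_ifs
      · simp
      · exact div_nonneg vonMangoldt_nonneg (by positivity)
    · split_ifs
      · simp
      · exact div_nonneg vonMangoldt_nonneg (by positivity)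
  calc _ ≤ ∑ i, (2 * ‖∑ m ∈ S, (sw R m : ℂ) * (((if m.Prime then Real.log m else 0) / Real.sqrt m : ℝ) : ℂ) * χ i m‖ ^ 2 + 2 * (C3 / R ^ 11) ^ 2) := by
        refine Finset.sum_le_sum fun i _ => ?_
        rw [e i]
        set X := ∑ m ∈ S, (sw R m : ℂ) * (((if m.Prime then Real.log m else 0) / Real.sqrt m : ℝ) : ℂ) * χ i m
        set Y := ∑ m ∈ S, (((if m.Prime then 0 else Λ m) / m : ℝ) : ℂ) * χ i m
        have h1 := norm_add_le X Y
        have h2 : ‖Y‖ ^ 2 ≤ (C3 / R ^ 11) ^ 2 := by gcongr; exact hpp i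
        have h3 : ‖X + Y‖ ^ 2 ≤ (‖X‖ + ‖Y‖) ^ 2 := by gcongr
        nlinarith [sq_nonneg (‖X‖ - ‖Y‖)]
    _ ≤ 2 * (C1 * (1000 * (1000 + C2) * L ^ 2)) + (R : ℝ) ^ 10 * (2 * (C3 / R ^ 11) ^ 2) := by
        rw [Finset.sum_add_distrib, ← Finset.mul_sum, Finset.sum_const, nsmul_eq_mul, Finset.card_univ]
        have := hχ.card
        have a2 := a.trans (mul_le_mul_of_nonneg_left hsq hC1.le)
        gcongr
    _ ≤ _ := by
        have h5 : (R : ℝ) ^ 10 * (2 * (C3 / R ^ 11) ^ 2) ≤ 2 * C3 ^ 2 * L ^ 2 := by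
          have : (R : ℝ) ^ 10 * (2 * (C3 / R ^ 11) ^ 2) = 2 * C3 ^ 2 * (1 / R ^ 12) := by field_simp
          rw [this]
          refine mul_le_mul_of_nonneg_left ?_ (by positivity)
          have h6 : 1 / (R:ℝ) ^ 12 ≤ 1 := by
            rw [div_le_one (by positivity)]; exact one_le_pow₀ hRpos
          nlinarith
        nlinarith

end TotRun
end

section
set_option exponentiation.threshold 2000
open ArithmeticFunction Finset
open scoped ArithmeticFunction.Moebius ArithmeticFunction.zeta ComplexConjugate

namespace TotRun

lemma log_step (a n : ℕ) (ha : 1 ≤ a) (hn : 1 ≤ n) :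
    |Real.log ((a * n : ℕ) : ℝ) - Real.log ((a * (n + 1) : ℕ) : ℝ)| ≤ 1 / n := by
  have ha0 : (0:ℝ) < a := by exact_mod_cast ha
  have hn0 : (0:ℝ) < n := by exact_mod_cast hn
  push_cast
  rw [Real.log_mul ha0.ne' hn0.ne', Real.log_mul ha0.ne' (by positivity), abs_sub_comm,
    show Real.log a + Real.log ((n:ℝ) + 1) - (Real.log a + Real.log n) = Real.log ((n:ℝ)+1) - Real.log n by ring,
    ← Real.log_div (by positivity) hn0.ne', abs_of_nonneg (Real.log_nonneg (by rw [le_div_iff₀ hn0]; linarith))]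
  have := Real.log_le_sub_one_of_pos (by positivity : 0 < ((n:ℝ) + 1) / n)
  refine this.trans (le_of_eq ?_)
  field_simp; ring

lemma hat_step (R a n : ℕ) (ha : 1 ≤ a) (hn : 1 ≤ n) : |hat R (a * n) - hat R (a * (n + 1))| ≤ 4 / n := by
  have := hat_lip R (a * n) (a * (n + 1))
  have h2 := log_step a n ha hn
  refine this.trans ?_
  rw [show (4:ℝ) / n = 4 * (1 / n) by ring]
  linarith

lemma conv_div (n D : ℕ) (hn : 1 ≤ n) (hD : D ∣ n) :
    ∑ m ∈ n.divisors, (if D ∣ m then Λ (n / m) else 0) = Real.log ((n / D : ℕ) : ℝ) := by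
  rw [← vonMangoldt_sum, ← Finset.sum_filter]
  have hD0 : 0 < D := Nat.pos_of_dvd_of_pos hD hn
  obtain ⟨q, rfl⟩ := hD
  have hq : 0 < q := Nat.pos_of_mul_pos_left hn
  rw [Nat.mul_div_cancel_left _ hD0]
  refine Finset.sum_nbij' (fun m => D * q / m) (fun k => D * q / k) ?_ ?_ ?_ ?_ ?_
  · intro m hm
    rw [Finset.mem_filter, Nat.mem_divisors] at hm
    obtain ⟨⟨hm1, _⟩, ⟨m', rfl⟩⟩ := hm
    rw [Nat.mul_div_mul_left _ _ hD0, Nat.mem_divisors]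
    exact ⟨Nat.div_dvd_of_dvd (Nat.dvd_of_mul_dvd_mul_left hD0 hm1), hq.ne'⟩
  · intro k hk
    rw [Nat.mem_divisors] at hk
    rw [Finset.mem_filter, Nat.mem_divisors]
    refine ⟨⟨Nat.div_dvd_of_dvd (hk.1.mul_left D), by positivity⟩, ?_⟩
    rw [Nat.mul_div_assoc _ hk.1]
    exact Dvd.intro _ rfl
  · intro m hm
    rw [Finset.mem_filter, Nat.mem_divisors] at hm
    exact Nat.div_div_self hm.1.1 hm.1.2
  · intro k hk
    rw [Nat.mem_divisors] at hk
    exact Nat.div_div_self (hk.1.mul_left D) (by positivity)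
  · intro m _; rfl

noncomputable def FF (R : ℕ) (c : ℕ → ℂ) (m k : ℕ) : ℂ :=
  ((amp R m * Λ k * (hat R (m * k) / ((m * k : ℕ) : ℝ)) : ℝ) : ℂ) * c (m * k)

lemma conv_amp (R n : ℕ) (hR : 3 ≤ R) (hn : 1 ≤ n) : ∑ m ∈ n.divisors, amp R m * Λ (n / m) =
    ∑ d ∈ Ioc 0 (R ^ 44), ∑ e ∈ Ioc 0 R, if Nat.lcm d e ∣ n then pc R d * ec R e * Real.log ((n / Nat.lcm d e : ℕ) : ℝ) else 0 := by
  simp_rw [amp_expand R _ hR, Finset.sum_mul]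
  rw [Finset.sum_comm]
  refine Finset.sum_congr rfl fun d _ => ?_
  rw [Finset.sum_comm]
  refine Finset.sum_congr rfl fun e _ => ?_
  split_ifs with h
  · rw [← conv_div n _ hn h, Finset.mul_sum]
    refine Finset.sum_congr rfl fun m _ => ?_
    split_ifs <;> simp
  · refine Finset.sum_eq_zero fun m hm => ?_
    rw [if_neg (fun h2 => h (h2.trans (Nat.dvd_of_mem_divisors hm))), zero_mul]

lemma T_eq (R : ℕ) (hR : 3 ≤ R) (c : ℕ → ℂ) :
    ∑ m ∈ Ioc 0 (R ^ 600), ∑ k ∈ Ioc 0 (R ^ 600), FF R c m k =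
    ∑ d ∈ Ioc 0 (R ^ 44), ∑ e ∈ Ioc 0 R, ((pc R d * ec R e : ℝ) : ℂ) *
      ∑ n ∈ (Ioc (R ^ 200) (R ^ 600)).filter (Nat.lcm d e ∣ ·),
        c n * (((fun n : ℕ => hat R n * Real.log ((n / Nat.lcm d e : ℕ) : ℝ)) n / n : ℝ) : ℂ) := by
  set N := R ^ 600 with hN
  have h1 : ∑ m ∈ Ioc 0 N, ∑ k ∈ Ioc 0 N, FF R c m k = ∑ m ∈ Ioc 0 N, ∑ k ∈ Ioc 0 (N / m), FF R c m k := by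
    refine Finset.sum_congr rfl fun m hm => ?_
    symm
    refine Finset.sum_subset (Finset.Ioc_subset_Ioc le_rfl (Nat.div_le_self _ _)) ?_
    intro k hk hk2
    have : N < k * m := by
      rw [Finset.mem_Ioc] at hk hk2
      rw [← Nat.div_lt_iff_lt_mul (Finset.mem_Ioc.1 hm).1]
      omega
    unfold FF
    rw [hat_hi R (m * k) (by omega) (by rw [← hN, mul_comm]; exact this.le)]
    simp
  rw [h1, ← dbl]
  have h2 : ∀ n ∈ Ioc 0 N, ∑ m ∈ n.divisors, FF R c m (n / m) =
      ∑ d ∈ Ioc 0 (R ^ 44), ∑ e ∈ Ioc 0 R, if Nat.lcm d e ∣ n then ((pc R d * ec R e : ℝ) : ℂ) *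
        (c n * ((hat R n * Real.log ((n / Nat.lcm d e : ℕ) : ℝ) / n : ℝ) : ℂ)) else 0 := by
    intro n hn
    have e : ∀ m ∈ n.divisors, FF R c m (n / m) = ((amp R m * Λ (n / m) : ℝ) : ℂ) * (((hat R n / n : ℝ) : ℂ) * c n) := by
      intro m hm
      unfold FF
      rw [Nat.mul_div_cancel' (Nat.dvd_of_mem_divisors hm)]
      push_cast; ring
    rw [Finset.sum_congr rfl e, ← Finset.sum_mul, ← Complex.ofReal_sum, conv_amp R n hR (Finset.mem_Ioc.1 hn).1]
    push_cast
    rw [Finset.sum_mul]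
    refine Finset.sum_congr rfl fun d _ => ?_
    rw [Finset.sum_mul]
    refine Finset.sum_congr rfl fun e _ => ?_
    split_ifs
    · push_cast; ring
    · simp
  rw [Finset.sum_congr rfl h2, Finset.sum_comm]
  refine Finset.sum_congr rfl fun d _ => ?_
  rw [Finset.sum_comm]
  refine Finset.sum_congr rfl fun e _ => ?_
  rw [← Finset.sum_filter, Finset.mul_sum]
  symm
  refine Finset.sum_subset ?_ ?_
  · exact Finset.filter_subset_filter _ (Finset.Ioc_subset_Ioc (Nat.zero_le _) le_rfl)
  · intro n hn hn2
    have : n ≤ R ^ 200 := by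
      simp only [Finset.mem_filter, Finset.mem_Ioc, not_and] at hn hn2
      by_contra h
      exact hn2 ⟨by omega, hn.1.2⟩ hn.2
    simp [hat_lo R n this]

lemma double_bound (R : ℕ) (hR : 3 ≤ R) (X : ℕ → ℕ → ℂ) (M : ℝ) (hM : 0 ≤ M)
    (h : ∀ d e, d ∈ Ioc 0 (R ^ 44) → e ∈ Ioc 0 R → ‖X d e‖ ≤ M) :
    ‖∑ d ∈ Ioc 0 (R ^ 44), ∑ e ∈ Ioc 0 R, ((pc R d * ec R e : ℝ) : ℂ) * X d e‖ ≤ (R : ℝ) ^ 45 * (3 * M) := by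
  calc _ ≤ ∑ d ∈ Ioc 0 (R ^ 44), ∑ e ∈ Ioc 0 R, 3 * M := by
        refine (norm_sum_le _ _).trans (Finset.sum_le_sum fun d hd => ?_)
        refine (norm_sum_le _ _).trans (Finset.sum_le_sum fun e he => ?_)
        rw [norm_mul, Complex.norm_real, Real.norm_eq_abs]
        exact mul_le_mul (pcec_le R d e hR hd he) (h d e hd he) (norm_nonneg _) (by norm_num)
    _ = _ := by
        rw [Finset.sum_const, Finset.sum_const, Nat.card_Ioc, Nat.card_Ioc]
        simp only [nsmul_eq_mul, Nat.sub_zero]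
        push_cast; ring

lemma T_bd (R : ℕ) (hR : 3 ≤ R) (c : ℕ → ℂ) (hmul : ∀ m n, c (m * n) = c m * c n) (hnorm : ∀ n, ‖c n‖ ≤ 1)
    (hc : ∀ n, ‖∑ k ∈ Ioc 0 n, c k‖ ≤ (R : ℝ) ^ 10) :
    ‖∑ m ∈ Ioc 0 (R ^ 600), ∑ k ∈ Ioc 0 (R ^ 600), FF R c m k‖ ≤
      (R : ℝ) ^ 45 * (3 * (6 * (R : ℝ) ^ 10 * (1000000 * Real.log R ^ 2) / ((R ^ 200 : ℕ) : ℝ))) := by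
  have hL := log_ge_one R hR
  rw [T_eq R hR c]
  refine double_bound R hR _ _ (by positivity) fun d e hd he => ?_
  set D := Nat.lcm d e
  have hD : 1 ≤ D := Nat.lcm_pos (Finset.mem_Ioc.1 hd).1 (Finset.mem_Ioc.1 he).1
  set L := Real.log R with hLdef
  have hlog : ∀ n : ℕ, 1 ≤ n → D * n < R ^ 600 → Real.log n ≤ 600 * L := by
    intro n hn h
    have h2 : n ≤ R ^ 600 := (Nat.le_mul_of_pos_left n hD).trans h.le
    have := Real.log_le_log (by exact_mod_cast hn) (by exact_mod_cast h2 : (n:ℝ) ≤ ((R ^ 600 : ℕ) : ℝ))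
    rw [log_natpow] at this
    exact_mod_cast this
  refine tail_mult c hmul hnorm _ _ (by positivity) hc D _ _ hD (Nat.one_le_pow _ _ (by omega)) _ ?_ ?_
  · intro n hn
    have hn1 : 1 ≤ n := Nat.one_le_of_lt hn
    simp only [Nat.mul_div_cancel_left n hD]
    rw [abs_mul]
    by_cases h : D * n < R ^ 600
    · have h1 := hat_abs R (D * n)
      have h2 := hlog n hn1 h
      rw [abs_of_nonneg (Real.log_natCast_nonneg n)]
      calc _ ≤ (200 * L) * (600 * L) := mul_le_mul h1 h2 (Real.log_natCast_nonneg n) (by positivity)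
        _ ≤ _ := by nlinarith
    · rw [hat_hi R _ (by omega) (by omega)]; simp; positivity
  · intro n hn
    have hn1 : 1 ≤ n := Nat.one_le_of_lt hn
    simp only [Nat.mul_div_cancel_left _ hD]
    by_cases h : D * n < R ^ 600
    · have h1 := hat_abs R (D * (n + 1))
      have h2 := hlog n hn1 h
      have h3 := hat_step R D n hD hn1
      have h4 := log_step 1 n le_rfl hn1
      rw [one_mul, one_mul] at h4
      have hn0 : (0:ℝ) < n := by exact_mod_cast hn1
      have e : hat R (D * n) * Real.log n - hat R (D * (n + 1)) * Real.log ((n + 1 : ℕ) : ℝ) =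
        (hat R (D * n) - hat R (D * (n + 1))) * Real.log n + hat R (D * (n + 1)) * (Real.log n - Real.log ((n + 1 : ℕ) : ℝ)) := by ring
      rw [e]
      refine (abs_add_le _ _).trans ?_
      rw [abs_mul, abs_mul, abs_of_nonneg (Real.log_natCast_nonneg n)]
      calc _ ≤ 4 / (n:ℝ) * (600 * L) + (200 * L) * (1 / n) := by
            refine add_le_add (mul_le_mul h3 h2 (Real.log_natCast_nonneg n) (by positivity))
              (mul_le_mul h1 h4 (abs_nonneg _) (by positivity))
        _ = (2600 * L) / n := by ring
        _ ≤ _ := by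
            apply div_le_div_of_nonneg_right _ hn0.le
            nlinarith
    · rw [hat_hi R _ (by omega) (by omega), hat_hi R _ (by omega) (by nlinarith)]
      simp; positivity

lemma TV_bd (R : ℕ) (hR : 3 ≤ R) (c : ℕ → ℂ) (hmul : ∀ m n, c (m * n) = c m * c n) (hnorm : ∀ n, ‖c n‖ ≤ 1)
    (hc : ∀ n, ‖∑ k ∈ Ioc 0 n, c k‖ ≤ (R : ℝ) ^ 10) :
    ‖∑ m ∈ Ioc 0 (R ^ 600), ∑ k ∈ Ioc 0 (R ^ 22), FF R c m k‖ ≤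
      (R : ℝ) ^ 22 * ((R : ℝ) ^ 45 * (3 * (6 * (R : ℝ) ^ 10 * (200 * Real.log R) / ((R ^ 178 : ℕ) : ℝ)))) := by
  have hL := log_ge_one R hR
  rw [Finset.sum_comm]
  have key : ∀ k ∈ Ioc 0 (R ^ 22), ‖∑ m ∈ Ioc 0 (R ^ 600), FF R c m k‖ ≤
      (R : ℝ) ^ 45 * (3 * (6 * (R : ℝ) ^ 10 * (200 * Real.log R) / ((R ^ 178 : ℕ) : ℝ))) := by
    intro k hk
    rw [Finset.mem_Ioc] at hk
    have hk0 : (0:ℝ) < k := by exact_mod_cast hk.1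
    have e : ∑ m ∈ Ioc 0 (R ^ 600), FF R c m k = ((Λ k / k : ℝ) : ℂ) * c k *
        ∑ d ∈ Ioc 0 (R ^ 44), ∑ e ∈ Ioc 0 R, ((pc R d * ec R e : ℝ) : ℂ) *
        ∑ m ∈ (Ioc (R ^ 178) (R ^ 600)).filter (Nat.lcm d e ∣ ·),
          c m * (((fun m : ℕ => hat R (m * k)) m / m : ℝ) : ℂ) := by
      have h1 : ∑ m ∈ Ioc 0 (R ^ 600), FF R c m k = ∑ m ∈ Ioc (R ^ 178) (R ^ 600), FF R c m k := by
        symm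
        refine Finset.sum_subset (Finset.Ioc_subset_Ioc (Nat.zero_le _) le_rfl) ?_
        intro m hm hm2
        have : m ≤ R ^ 178 := by
          rw [Finset.mem_Ioc] at hm hm2; omega
        unfold FF
        rw [hat_lo R (m * k)]
        · simp
        · calc m * k ≤ R ^ 178 * R ^ 22 := Nat.mul_le_mul this hk.2
            _ = R ^ 200 := by rw [← pow_add]
      rw [h1]
      have h2 : ∀ m ∈ Ioc (R ^ 178) (R ^ 600), FF R c m k = ∑ d ∈ Ioc 0 (R ^ 44), ∑ e ∈ Ioc 0 R,
          if Nat.lcm d e ∣ m then ((Λ k / k : ℝ) : ℂ) * c k * (((pc R d * ec R e : ℝ) : ℂ) * (c m * ((hat R (m * k) / m : ℝ) : ℂ))) else 0 := by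
        intro m hm
        have hm0 : (m:ℝ) ≠ 0 := by
          have := (Finset.mem_Ioc.1 hm).1
          exact_mod_cast (by omega : m ≠ 0)
        have : FF R c m k = (amp R m : ℂ) * (((Λ k / k : ℝ) : ℂ) * c k * (c m * ((hat R (m * k) / m : ℝ) : ℂ))) := by
          unfold FF
          rw [hmul]
          have hk1 : (k : ℂ) ≠ 0 := by exact_mod_cast hk.1.ne'
          have hm1 : (m : ℂ) ≠ 0 := by exact_mod_cast hm0
          push_cast
          field_simp
        rw [this, amp_expand R m hR]
        push_cast
        rw [Finset.sum_mul]
        refine Finset.sum_congr rfl fun d _ => ?_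
        rw [Finset.sum_mul]
        refine Finset.sum_congr rfl fun e _ => ?_
        split_ifs
        · push_cast; ring
        · simp
      rw [Finset.sum_congr rfl h2, Finset.sum_comm, Finset.mul_sum]
      refine Finset.sum_congr rfl fun d _ => ?_
      rw [Finset.sum_comm, Finset.mul_sum]
      refine Finset.sum_congr rfl fun e _ => ?_
      rw [← Finset.sum_filter, Finset.mul_sum, Finset.mul_sum]
    rw [e, norm_mul, norm_mul]
    have hΛ : ‖((Λ k / k : ℝ) : ℂ)‖ ≤ 1 := by
      rw [Complex.norm_real, Real.norm_of_nonneg (div_nonneg vonMangoldt_nonneg hk0.le), div_le_one hk0]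
      refine vonMangoldt_le_log.trans ?_
      have := Real.log_le_sub_one_of_pos hk0
      linarith
    have h3 : ‖((Λ k / k : ℝ) : ℂ)‖ * ‖c k‖ ≤ 1 := mul_le_one₀ hΛ (norm_nonneg _) (hnorm k)
    refine (mul_le_mul h3 (double_bound R hR _ _ (by positivity) fun d e hd he => ?_) (norm_nonneg _) zero_le_one).trans (le_of_eq (one_mul _))
    set D := Nat.lcm d e
    have hD : 1 ≤ D := Nat.lcm_pos (Finset.mem_Ioc.1 hd).1 (Finset.mem_Ioc.1 he).1
    refine tail_mult c hmul hnorm _ _ (by positivity) hc D _ _ hD (Nat.one_le_pow _ _ (by omega)) _ ?_ ?_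
    · intro n hn
      exact hat_abs R _
    · intro n hn
      have := hat_step R (D * k) n (Nat.mul_pos hD hk.1) (Nat.one_le_of_lt hn)
      rw [mul_right_comm D n k, mul_right_comm D (n + 1) k]
      refine this.trans ?_
      gcongr
      linarith
  refine (norm_sum_le _ _).trans ?_
  refine (Finset.sum_le_sum key).trans (le_of_eq ?_)
  rw [Finset.sum_const, Nat.card_Ioc, nsmul_eq_mul]
  push_cast
  rw [Nat.sub_zero]; push_cast; ring

end TotRun
end

section
set_option exponentiation.threshold 2000
open ArithmeticFunction Finset
open scoped ArithmeticFunction.Moebius ArithmeticFunction.zeta ComplexConjugate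

namespace TotRun

lemma sum_Ioc_split {M : Type*} [AddCommMonoid M] (f : ℕ → M) (a b c : ℕ) (h1 : a ≤ b) (h2 : b ≤ c) :
    ∑ n ∈ Ioc a c, f n = ∑ n ∈ Ioc a b, f n + ∑ n ∈ Ioc b c, f n := by
  rw [← Finset.sum_union (Finset.disjoint_left.2 fun x hx hy => by
    rw [Finset.mem_Ioc] at hx hy; omega), Finset.Ioc_union_Ioc_eq_Ioc h1 h2]

lemma vaughan (R : ℕ) (hR : 3 ≤ R) (c : ℕ → ℂ) :
    ∑ k ∈ Ioc 0 (R ^ 600), FF R c 1 k = ∑ m ∈ Ioc 0 (R ^ 600), ∑ k ∈ Ioc 0 (R ^ 600), FF R c m k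
      - ∑ m ∈ Ioc 0 (R ^ 600), ∑ k ∈ Ioc 0 (R ^ 22), FF R c m k
      - ∑ m ∈ Ioc (R ^ 22) (R ^ 600), ∑ k ∈ Ioc (R ^ 22) (R ^ 600), FF R c m k := by
  have hU : R ^ 22 ≤ R ^ 600 := Nat.pow_le_pow_right (by omega) (by norm_num)
  have h1U : 1 ≤ R ^ 22 := Nat.one_le_pow _ _ (by omega)
  have h2 : R ^ 22 ≤ R ^ 200 := Nat.pow_le_pow_right (by omega) (by norm_num)
  have e1 : ∀ m, ∑ k ∈ Ioc 0 (R ^ 600), FF R c m k = ∑ k ∈ Ioc 0 (R ^ 22), FF R c m k + ∑ k ∈ Ioc (R ^ 22) (R ^ 600), FF R c m k :=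
    fun m => sum_Ioc_split _ 0 _ _ (Nat.zero_le _) hU
  rw [Finset.sum_congr rfl fun m _ => e1 m, Finset.sum_add_distrib, add_sub_cancel_left,
    sum_Ioc_split (fun m => ∑ k ∈ Ioc (R ^ 22) (R ^ 600), FF R c m k) 0 _ _ (Nat.zero_le _) hU, add_sub_cancel_right,
    sum_Ioc_split (fun m => ∑ k ∈ Ioc (R ^ 22) (R ^ 600), FF R c m k) 0 1 _ (Nat.zero_le _) h1U, e1 1]
  have z1 : ∑ k ∈ Ioc 0 (R ^ 22), FF R c 1 k = 0 := by
    refine Finset.sum_eq_zero fun k hk => ?_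
    unfold FF
    rw [hat_lo R (1 * k) (by rw [one_mul]; exact (Finset.mem_Ioc.1 hk).2.trans h2)]
    simp
  have z2 : ∑ m ∈ Ioc 1 (R ^ 22), ∑ k ∈ Ioc (R ^ 22) (R ^ 600), FF R c m k = 0 := by
    refine Finset.sum_eq_zero fun m hm => Finset.sum_eq_zero fun k hk => ?_
    unfold FF
    rw [Finset.mem_Ioc] at hm
    rw [amp_zero R m hR hm.1 hm.2]
    simp
  rw [z1, z2]
  simp

lemma II_bd : ∃ C : ℝ, 0 < C ∧ ∃ R0, 3 ≤ R0 ∧ ∀ R : ℕ, R0 ≤ R → ∀ (ι : Type) [Fintype ι] (χ : ι → ℕ → ℂ), Fam R χ →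
    ∑ i, ‖∑ m ∈ Ioc (R ^ 22) (R ^ 600), ∑ k ∈ Ioc (R ^ 22) (R ^ 600), FF R (χ i) m k‖ ≤ C * Real.log R ^ 2 := by
  obtain ⟨C1, hC1, R1, hR1, H1⟩ := Bmom
  obtain ⟨C2, hC2, R2, hR2, H2⟩ := Pmom
  refine ⟨1600 * (√C1 * √C2), by positivity, max R1 R2, le_max_of_le_left hR1, ?_⟩
  intro R hR ι _ χ hχ
  have hR3 : 3 ≤ R := hR1.trans ((le_max_left _ _).trans hR)
  have hL := log_ge_one R hR3
  set L := Real.log R with hLd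
  have hN : R ^ 600 ≤ R ^ 1000 := Nat.pow_le_pow_right (by omega) (by norm_num)
  have h1U : 1 ≤ R ^ 22 := Nat.one_le_pow _ _ (by omega)
  set S := Ioc (R ^ 22) (R ^ 600) with hS
  have hS1 : ∀ m ∈ S, 1 ≤ m := fun m hm => by
    have := (Finset.mem_Ioc.1 hm).1
    exact Nat.one_le_of_lt this
  have hsep : ∀ T : ℝ, 0 ≤ T → ∑ i, ‖∑ m ∈ S, ∑ k ∈ S, (((amp R m / m : ℝ) : ℂ) * χ i m) * (((Λ k / k : ℝ) : ℂ) * χ i k) * ((lpf T (m * k) : ℝ) : ℂ)‖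
      ≤ T * (√C1 * (√C2 * L)) := by
    intro T hT
    refine sep S S hS1 hS1 (fun i m => ((amp R m / m : ℝ) : ℂ) * χ i m) (fun i k => ((Λ k / k : ℝ) : ℂ) * χ i k) T _ _ hT (by positivity) (by positivity) ?_ ?_
    · intro t
      rw [hS, filter_log, Real.sq_sqrt hC1.le]
      exact H1 R ((le_max_left _ _).trans hR) ι χ hχ _ ((min_le_left _ _).trans hN)
    · intro t
      rw [hS, filter_log, mul_pow, Real.sq_sqrt hC2.le]
      exact H2 R ((le_max_right _ _).trans hR) ι χ hχ _ ((min_le_left _ _).trans hN)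
  set Q : ℝ → ι → ℂ := fun T i => ∑ m ∈ S, ∑ k ∈ S, (((amp R m / m : ℝ) : ℂ) * χ i m) * (((Λ k / k : ℝ) : ℂ) * χ i k) * ((lpf T (m * k) : ℝ) : ℂ) with hQ
  have e : ∀ i, ∑ m ∈ S, ∑ k ∈ S, FF R (χ i) m k = Q (600 * L) i - 2 * Q (400 * L) i + Q (200 * L) i := by
    intro i
    simp only [hQ, Finset.mul_sum, ← Finset.sum_sub_distrib, ← Finset.sum_add_distrib]
    refine Finset.sum_congr rfl fun m hm => Finset.sum_congr rfl fun k hk => ?_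
    unfold FF hat
    rw [hχ.mul, ← hLd]
    generalize lpf (600 * L) (m * k) = a1
    generalize lpf (400 * L) (m * k) = a2
    generalize lpf (200 * L) (m * k) = a3
    have hk1 : (k : ℂ) ≠ 0 := by exact_mod_cast (Nat.pos_iff_ne_zero.1 (hS1 k hk))
    have hm1 : (m : ℂ) ≠ 0 := by exact_mod_cast (Nat.pos_iff_ne_zero.1 (hS1 m hm))
    push_cast
    field_simp
    try ring
  calc _ ≤ ∑ i, (‖Q (600 * L) i‖ + 2 * ‖Q (400 * L) i‖ + ‖Q (200 * L) i‖) := by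
        refine Finset.sum_le_sum fun i _ => ?_
        rw [e i]
        refine (norm_add_le _ _).trans ?_
        refine add_le_add (le_trans (norm_sub_le _ _) ?_) le_rfl
        rw [norm_mul]; simp
    _ = ∑ i, ‖Q (600 * L) i‖ + 2 * ∑ i, ‖Q (400 * L) i‖ + ∑ i, ‖Q (200 * L) i‖ := by
        rw [Finset.sum_add_distrib, Finset.sum_add_distrib, Finset.mul_sum]
    _ ≤ 600 * L * (√C1 * (√C2 * L)) + 2 * (400 * L * (√C1 * (√C2 * L))) + 200 * L * (√C1 * (√C2 * L)) := by
        have a := hsep (600 * L) (by positivity)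
        have b := hsep (400 * L) (by positivity)
        have c := hsep (200 * L) (by positivity)
        linarith
    _ = _ := by ring

lemma tinyT (R : ℕ) (hR : 3 ≤ R) : (R:ℝ) ^ 10 * ((R : ℝ) ^ 45 * (3 * (6 * (R : ℝ) ^ 10 * (1000000 * Real.log R ^ 2) / ((R ^ 200 : ℕ) : ℝ)))) ≤ 1 := by
  have h3 : (3:ℝ) ≤ R := by exact_mod_cast hR
  have hL := log_ge_one R hR
  have hl : Real.log R ≤ R := (Real.log_le_sub_one_of_pos (by linarith)).trans (by linarith)
  have hl2 : Real.log R ^ 2 ≤ (R:ℝ) ^ 2 := by gcongr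
  push_cast
  have h4 : (18000000:ℝ) ≤ (R:ℝ) ^ 133 := by
    calc (18000000:ℝ) ≤ 3 ^ 133 := by norm_num
      _ ≤ _ := by gcongr
  have hR0 : (0:ℝ) < R := by linarith
  have : (R:ℝ) ^ 10 * ((R : ℝ) ^ 45 * (3 * (6 * (R : ℝ) ^ 10 * (1000000 * Real.log R ^ 2) / (R:ℝ) ^ 200))) =
    18000000 * (R:ℝ) ^ 65 * Real.log R ^ 2 / (R:ℝ) ^ 200 := by ring
  rw [this, div_le_one (by positivity)]
  calc _ ≤ (R:ℝ) ^ 133 * (R:ℝ) ^ 65 * (R:ℝ) ^ 2 := by gcongr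
    _ = _ := by ring

lemma tinyTV (R : ℕ) (hR : 3 ≤ R) : (R:ℝ) ^ 10 * ((R : ℝ) ^ 22 * ((R : ℝ) ^ 45 * (3 * (6 * (R : ℝ) ^ 10 * (200 * Real.log R) / ((R ^ 178 : ℕ) : ℝ))))) ≤ 1 := by
  have h3 : (3:ℝ) ≤ R := by exact_mod_cast hR
  have hL := log_ge_one R hR
  have hl : Real.log R ≤ R := (Real.log_le_sub_one_of_pos (by linarith)).trans (by linarith)
  push_cast
  have h4 : (3600:ℝ) ≤ (R:ℝ) ^ 90 := by
    calc (3600:ℝ) ≤ 3 ^ 90 := by norm_num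
      _ ≤ _ := by gcongr
  have hR0 : (0:ℝ) < R := by linarith
  have : (R:ℝ) ^ 10 * ((R : ℝ) ^ 22 * ((R : ℝ) ^ 45 * (3 * (6 * (R : ℝ) ^ 10 * (200 * Real.log R) / (R:ℝ) ^ 178)))) =
    3600 * (R:ℝ) ^ 87 * Real.log R / (R:ℝ) ^ 178 := by ring
  rw [this, div_le_one (by positivity)]
  calc _ ≤ (R:ℝ) ^ 90 * (R:ℝ) ^ 87 * (R:ℝ) := by gcongr
    _ = _ := by ring

/-- The prime sum against a completely multiplicative function, weighted by the hat function. -/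
noncomputable def PS (R : ℕ) (c : ℕ → ℂ) : ℂ :=
  ∑ p ∈ Ioc 0 (R ^ 600), (((if p.Prime then Real.log p else 0) * (hat R p / p) : ℝ) : ℂ) * c p

lemma claimA : ∃ C : ℝ, 0 < C ∧ ∃ R0, 3 ≤ R0 ∧ ∀ R : ℕ, R0 ≤ R → ∀ (ι : Type) [Fintype ι] (χ : ι → ℕ → ℂ), Fam R χ →
    ∑ i, ‖PS R (χ i)‖ ≤ C * Real.log R ^ 2 := by
  obtain ⟨C1, hC1, R1, hR1, H1⟩ := II_bd
  obtain ⟨C2, hC2, H2⟩ := pp_exists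
  refine ⟨C1 + 2 + 200 * C2, by positivity, R1, hR1, ?_⟩
  intro R hR ι _ χ hχ
  have hR3 : 3 ≤ R := hR1.trans hR
  have h3 : (3:ℝ) ≤ R := by exact_mod_cast hR3
  have hL := log_ge_one R hR3
  have hl : Real.log R ≤ R := (Real.log_le_sub_one_of_pos (by linarith)).trans (by linarith)
  have hII := H1 R hR ι χ hχ
  have hcard := hχ.card
  have hPP : ∀ i, ‖PS R (χ i) - ∑ k ∈ Ioc 0 (R ^ 600), FF R (χ i) 1 k‖ ≤ 200 * Real.log R * (C2 / (R:ℝ) ^ 100) := by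
    intro i
    unfold PS
    rw [← Finset.sum_sub_distrib, sum_Ioc_split _ 0 (R ^ 200) _ (Nat.zero_le _) (Nat.pow_le_pow_right (by omega) (by norm_num))]
    have z : ∑ n ∈ Ioc 0 (R ^ 200), ((((if n.Prime then Real.log n else 0) * (hat R n / n) : ℝ) : ℂ) * χ i n - FF R (χ i) 1 n) = 0 := by
      refine Finset.sum_eq_zero fun n hn => ?_
      have := hat_lo R n (Finset.mem_Ioc.1 hn).2
      unfold FF
      rw [one_mul, this]; simp
    rw [z, zero_add]
    refine (norm_sum_le _ _).trans ?_
    have hp := H2 (R ^ 200) (R ^ 600) (Nat.one_le_pow _ _ (by omega))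
    have hs : √((R ^ 200 : ℕ) : ℝ) = (R:ℝ) ^ 100 := by
      push_cast
      rw [show (R:ℝ) ^ 200 = ((R:ℝ) ^ 100) ^ 2 by ring, Real.sqrt_sq (by positivity)]
    rw [hs] at hp
    refine le_trans ?_ (mul_le_mul_of_nonneg_left hp (by positivity))
    rw [Finset.mul_sum]
    refine Finset.sum_le_sum fun n hn => ?_
    have hn0 : (0:ℝ) < n := by exact_mod_cast Nat.lt_of_le_of_lt (Nat.zero_le _) (Finset.mem_Ioc.1 hn).1
    unfold FF
    rw [one_mul, amp_one R hR3, one_mul, ← sub_mul, ← Complex.ofReal_sub, norm_mul, Complex.norm_real, ← sub_mul, norm_mul]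
    have hΛ : ‖(if n.Prime then Real.log n else 0) - Λ n‖ = (if n.Prime then 0 else Λ n) := by
      split_ifs with h
      · rw [vonMangoldt_apply_prime h]; simp
      · rw [zero_sub, norm_neg, Real.norm_of_nonneg vonMangoldt_nonneg]
    rw [hΛ, Real.norm_of_nonneg (div_nonneg (hat_nonneg _ _) hn0.le)]
    have hx : 0 ≤ (if n.Prime then 0 else Λ n) := by
      split_ifs
      · exact le_rfl
      · exact vonMangoldt_nonneg
    calc _ ≤ (if n.Prime then 0 else Λ n) * (200 * Real.log R / n) * 1 := by
          gcongr
          · exact hat_le R n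
          · exact hχ.norm i n
      _ = _ := by ring
  have hone : ∀ i, ‖PS R (χ i)‖ ≤ 
      ((R : ℝ) ^ 45 * (3 * (6 * (R : ℝ) ^ 10 * (1000000 * Real.log R ^ 2) / ((R ^ 200 : ℕ) : ℝ))) +
       (R : ℝ) ^ 22 * ((R : ℝ) ^ 45 * (3 * (6 * (R : ℝ) ^ 10 * (200 * Real.log R) / ((R ^ 178 : ℕ) : ℝ)))) +
       200 * Real.log R * (C2 / (R:ℝ) ^ 100))
       + ‖∑ m ∈ Ioc (R ^ 22) (R ^ 600), ∑ k ∈ Ioc (R ^ 22) (R ^ 600), FF R (χ i) m k‖ := by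
    intro i
    have a := T_bd R hR3 (χ i) (hχ.mul i) (hχ.norm i) (hχ.ps i)
    have b := TV_bd R hR3 (χ i) (hχ.mul i) (hχ.norm i) (hχ.ps i)
    have c := hPP i
    have v := vaughan R hR3 (χ i)
    rw [v] at c
    set x := PS R (χ i)
    set t := ∑ m ∈ Ioc 0 (R ^ 600), ∑ k ∈ Ioc 0 (R ^ 600), FF R (χ i) m k
    set tv := ∑ m ∈ Ioc 0 (R ^ 600), ∑ k ∈ Ioc 0 (R ^ 22), FF R (χ i) m k
    set ii := ∑ m ∈ Ioc (R ^ 22) (R ^ 600), ∑ k ∈ Ioc (R ^ 22) (R ^ 600), FF R (χ i) m k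
    have e : x = (x - (t - tv - ii)) + t - tv - ii := by ring
    have : ‖x‖ ≤ ‖x - (t - tv - ii)‖ + ‖t‖ + ‖tv‖ + ‖ii‖ := by
      conv_lhs => rw [e]
      refine (norm_sub_le _ _).trans (add_le_add ((norm_sub_le _ _).trans (add_le_add (norm_add_le _ _) le_rfl)) le_rfl)
    linarith
  refine (Finset.sum_le_sum fun i _ => hone i).trans ?_
  rw [Finset.sum_add_distrib, Finset.sum_const, Finset.card_univ, nsmul_eq_mul]
  have tt := tinyT R hR3
  have ttv := tinyTV R hR3
  have tp : (R:ℝ) ^ 10 * (200 * Real.log R * (C2 / (R:ℝ) ^ 100)) ≤ 200 * C2 := by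
    have hR0 : (0:ℝ) < R := by linarith
    calc (R:ℝ) ^ 10 * (200 * Real.log R * (C2 / (R:ℝ) ^ 100)) ≤ (R:ℝ) ^ 10 * (200 * R * (C2 / (R:ℝ) ^ 100)) := by gcongr
      _ = 200 * C2 * ((R:ℝ) ^ 11 / (R:ℝ) ^ 100) := by ring
      _ ≤ 200 * C2 * 1 := by
        gcongr
        rw [div_le_one (by positivity)]
        exact pow_le_pow_right₀ (by linarith) (by norm_num)
      _ = _ := mul_one _
  have hLL : 1 ≤ Real.log R ^ 2 := by nlinarith
  have h0 : 0 ≤ ((R : ℝ) ^ 45 * (3 * (6 * (R : ℝ) ^ 10 * (1000000 * Real.log R ^ 2) / ((R ^ 200 : ℕ) : ℝ))) +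
       (R : ℝ) ^ 22 * ((R : ℝ) ^ 45 * (3 * (6 * (R : ℝ) ^ 10 * (200 * Real.log R) / ((R ^ 178 : ℕ) : ℝ)))) +
       200 * Real.log R * (C2 / (R:ℝ) ^ 100)) := by positivity
  have h5 := mul_le_mul_of_nonneg_right hcard h0
  rw [mul_add, mul_add ((R:ℝ) ^ 10)] at h5
  have h6 : 0 ≤ (2 + 200 * C2) * (Real.log R ^ 2 - 1) := mul_nonneg (by positivity) (by linarith)
  nlinarith

end TotRun
end

section
open ArithmeticFunction Finset
open scoped ArithmeticFunction.Moebius ArithmeticFunction.zeta ComplexConjugate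

namespace TotRun

section tensor
variable {P O : Type} [Fintype P] [DecidableEq P] [Fintype O] [DecidableEq O]

lemma sum_split_coord (p : P) (F : (P → O) → ℝ) (o0 : O) :
    ∑ ρ, F ρ = ∑ g : {j // j ≠ p} → O, ∑ o, F (Function.update ((Equiv.funSplitAt p O).symm (o0, g)) p o) := by
  rw [← (Equiv.funSplitAt p O).symm.sum_comp F, Fintype.sum_prod_type, Finset.sum_comm]
  refine Finset.sum_congr rfl fun g _ => Finset.sum_congr rfl fun o _ => ?_
  congr 1
  ext x
  by_cases h : x = p
  · subst h; simp [Equiv.funSplitAt, Equiv.piSplitAt]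
  · simp [Equiv.funSplitAt, Equiv.piSplitAt, h]

lemma tensor_step (o0 : O) (Φ : (P → O) → ℝ) (hΦ0 : ∀ ρ, 0 ≤ Φ ρ)
    (hΦ : ∀ ρ p o, Φ (Function.update ρ p o) ≤ Φ (Function.update ρ p o0))
    (p : P) (U V : O → ℝ) (b : ℝ)
    (h : ∀ x : O → ℝ, (∀ o, 0 ≤ x o ∧ x o ≤ x o0) → ∑ o, U o * x o ≤ b * ∑ o, V o * x o)
    (T : P → O → ℝ) (hT : ∀ p o, 0 ≤ T p o) :
    ∑ ρ, Φ ρ * (U (ρ p) * ∏ p' ∈ univ.erase p, T p' (ρ p')) ≤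
      b * ∑ ρ, Φ ρ * (V (ρ p) * ∏ p' ∈ univ.erase p, T p' (ρ p')) := by
  rw [sum_split_coord p _ o0, sum_split_coord p (fun ρ => Φ ρ * (V (ρ p) * ∏ p' ∈ univ.erase p, T p' (ρ p'))) o0, Finset.mul_sum]
  refine Finset.sum_le_sum fun g _ => ?_
  set ρ := (Equiv.funSplitAt p O).symm (o0, g)
  have e : ∀ o, ∏ p' ∈ univ.erase p, T p' (Function.update ρ p o p') = ∏ p' ∈ univ.erase p, T p' (ρ p') := by
    intro o
    refine Finset.prod_congr rfl fun p' hp' => ?_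
    rw [Function.update_of_ne (Finset.ne_of_mem_erase hp')]
  simp only [e, Function.update_self]
  set c := ∏ p' ∈ univ.erase p, T p' (ρ p')
  have hc : 0 ≤ c := Finset.prod_nonneg fun p' _ => hT _ _
  have := h (fun o => Φ (Function.update ρ p o) * c) (fun o => ⟨mul_nonneg (hΦ0 _) hc, mul_le_mul_of_nonneg_right (hΦ ρ p o) hc⟩)
  calc _ = ∑ o, U o * (Φ (Function.update ρ p o) * c) := Finset.sum_congr rfl fun o _ => by ring
    _ ≤ _ := this
    _ = _ := by congr 1; exact Finset.sum_congr rfl fun o _ => by ring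

lemma tensor (o0 : O) (Φ : (P → O) → ℝ) (hΦ0 : ∀ ρ, 0 ≤ Φ ρ)
    (hΦ : ∀ ρ p o, Φ (Function.update ρ p o) ≤ Φ (Function.update ρ p o0))
    (U V : P → O → ℝ) (hU : ∀ p o, 0 ≤ U p o) (hV : ∀ p o, 0 ≤ V p o) (b : P → ℝ) (hb : ∀ p, 0 ≤ b p)
    (h : ∀ p, ∀ x : O → ℝ, (∀ o, 0 ≤ x o ∧ x o ≤ x o0) → ∑ o, U p o * x o ≤ b p * ∑ o, V p o * x o) :
    ∑ ρ, Φ ρ * ∏ p, U p (ρ p) ≤ (∏ p, b p) * ∑ ρ, Φ ρ * ∏ p, V p (ρ p) := by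
  have key : ∀ S : Finset P, ∑ ρ, Φ ρ * ∏ p, (if p ∈ S then U p (ρ p) else V p (ρ p)) ≤
      (∏ p ∈ S, b p) * ∑ ρ, Φ ρ * ∏ p, V p (ρ p) := by
    intro S
    induction S using Finset.induction_on with
    | empty => simp
    | insert a S ha ih =>
      rw [Finset.prod_insert ha, mul_assoc]
      refine le_trans ?_ (mul_le_mul_of_nonneg_left ih (hb a))
      have := tensor_step o0 Φ hΦ0 hΦ a (U a) (V a) (b a) (h a) (fun p o => if p ∈ S then U p o else V p o)
        (fun p o => by split_ifs; exacts [hU p o, hV p o])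
      have e1 : ∀ ρ : P → O, ∏ p, (if p ∈ insert a S then U p (ρ p) else V p (ρ p)) =
          U a (ρ a) * ∏ p' ∈ univ.erase a, (if p' ∈ S then U p' (ρ p') else V p' (ρ p')) := by
        intro ρ
        rw [← Finset.mul_prod_erase univ _ (Finset.mem_univ a), if_pos (Finset.mem_insert_self a S)]
        congr 1
        refine Finset.prod_congr rfl fun p hp => ?_
        have hne := Finset.ne_of_mem_erase hp
        simp [Finset.mem_insert, hne]
      have e2 : ∀ ρ : P → O, ∏ p, (if p ∈ S then U p (ρ p) else V p (ρ p)) =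
          V a (ρ a) * ∏ p' ∈ univ.erase a, (if p' ∈ S then U p' (ρ p') else V p' (ρ p')) := by
        intro ρ
        rw [← Finset.mul_prod_erase univ _ (Finset.mem_univ a), if_neg ha]
      simp only [e1, e2]
      exact this
  have := key univ
  simpa using this

lemma sum_prod_pi (f : P → O → ℝ) : ∑ ρ : P → O, ∏ p, f p (ρ p) = ∏ p, ∑ o, f p o := by
  rw [Finset.prod_univ_sum]; simp

lemma sum_prod_pi' {R : Type} [CommSemiring R] {O : P → Type} [∀ p, Fintype (O p)] (f : ∀ p, O p → R) : ∑ ρ : ∀ p, O p, ∏ p, f p (ρ p) = ∏ p, ∑ o, f p o := by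
  rw [Finset.prod_univ_sum]; simp

lemma schur (c : (P → O) → ℝ) (A : P → O → O → ℂ) (a : P → O → O → ℝ) (hA : ∀ p o o', ‖A p o o'‖ ≤ a p o o')
    (hs : ∀ p o o', a p o o' = a p o' o) :
    ‖∑ ρ, ∑ ρ', (c ρ : ℂ) * c ρ' * ∏ p, A p (ρ p) (ρ' p)‖ ≤ ∑ ρ, c ρ ^ 2 * ∏ p, ∑ o, a p (ρ p) o := by
  have ha : ∀ p o o', 0 ≤ a p o o' := fun p o o' => (norm_nonneg _).trans (hA p o o')
  have hp : ∀ ρ ρ' : P → O, 0 ≤ ∏ p, a p (ρ p) (ρ' p) := fun ρ ρ' => Finset.prod_nonneg fun p _ => ha _ _ _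
  have h1 : ‖∑ ρ, ∑ ρ', (c ρ : ℂ) * c ρ' * ∏ p, A p (ρ p) (ρ' p)‖ ≤
      ∑ ρ, ∑ ρ', (1/2 * (c ρ ^ 2 * ∏ p, a p (ρ p) (ρ' p)) + 1/2 * (c ρ' ^ 2 * ∏ p, a p (ρ p) (ρ' p))) := by
    refine (norm_sum_le _ _).trans (Finset.sum_le_sum fun ρ _ => (norm_sum_le _ _).trans (Finset.sum_le_sum fun ρ' _ => ?_))
    rw [norm_mul, norm_mul, norm_prod, Complex.norm_real, Complex.norm_real, Real.norm_eq_abs, Real.norm_eq_abs]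
    have h2 : ∏ p, ‖A p (ρ p) (ρ' p)‖ ≤ ∏ p, a p (ρ p) (ρ' p) :=
      Finset.prod_le_prod (fun _ _ => norm_nonneg _) fun p _ => hA _ _ _
    have h3 : |c ρ| * |c ρ'| ≤ 1/2 * c ρ ^ 2 + 1/2 * c ρ' ^ 2 := by
      have := sq_nonneg (|c ρ| - |c ρ'|)
      have h4 := sq_abs (c ρ)
      have h5 := sq_abs (c ρ')
      nlinarith
    calc _ ≤ (1/2 * c ρ ^ 2 + 1/2 * c ρ' ^ 2) * ∏ p, a p (ρ p) (ρ' p) :=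
          mul_le_mul h3 h2 (Finset.prod_nonneg fun _ _ => norm_nonneg _) (by positivity)
      _ = _ := by ring
  refine h1.trans (le_of_eq ?_)
  have e1 : ∑ ρ, ∑ ρ' : P → O, 1/2 * (c ρ ^ 2 * ∏ p, a p (ρ p) (ρ' p)) = 1/2 * ∑ ρ, c ρ ^ 2 * ∏ p, ∑ o, a p (ρ p) o := by
    rw [Finset.mul_sum]
    refine Finset.sum_congr rfl fun ρ _ => ?_
    rw [← Finset.mul_sum, ← Finset.mul_sum, sum_prod_pi (fun p o => a p (ρ p) o)]
  have e2 : ∑ ρ : P → O, ∑ ρ' : P → O, 1/2 * (c ρ' ^ 2 * ∏ p, a p (ρ p) (ρ' p)) = 1/2 * ∑ ρ, c ρ ^ 2 * ∏ p, ∑ o, a p (ρ p) o := by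
    rw [Finset.sum_comm, Finset.mul_sum]
    refine Finset.sum_congr rfl fun ρ _ => ?_
    rw [← Finset.mul_sum, ← Finset.mul_sum, ← sum_prod_pi (fun p o => a p (ρ p) o)]
    simp_rw [hs _ (ρ _) _]
  simp_rw [Finset.sum_add_distrib]
  rw [e1, e2]; ring

lemma schur_diag (c : (P → O) → ℝ) (A : P → O → O → ℂ) (d : P → O → ℝ) (hd : ∀ p o, A p o o = d p o) (hd0 : ∀ p o, 0 ≤ d p o)
    (a : P → O → O → ℝ) (hA : ∀ p o o', ‖A p o o'‖ ≤ a p o o') (had : ∀ p o, a p o o = d p o)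
    (hs : ∀ p o o', a p o o' = a p o' o) :
    ‖∑ ρ, ∑ ρ', (c ρ : ℂ) * c ρ' * ∏ p, A p (ρ p) (ρ' p) - ((∑ ρ, c ρ ^ 2 * ∏ p, d p (ρ p) : ℝ) : ℂ)‖
      ≤ ∑ ρ, c ρ ^ 2 * ∏ p, ∑ o, a p (ρ p) o - ∑ ρ, c ρ ^ 2 * ∏ p, d p (ρ p) := by
  have ha : ∀ p o o', 0 ≤ a p o o' := fun p o o' => (norm_nonneg _).trans (hA p o o')
  have e0 : ∑ ρ, ∑ ρ', (c ρ : ℂ) * c ρ' * ∏ p, A p (ρ p) (ρ' p) - ((∑ ρ, c ρ ^ 2 * ∏ p, d p (ρ p) : ℝ) : ℂ) =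
      ∑ ρ, ∑ ρ' ∈ univ.erase ρ, (c ρ : ℂ) * c ρ' * ∏ p, A p (ρ p) (ρ' p) := by
    push_cast
    rw [← Finset.sum_sub_distrib]
    refine Finset.sum_congr rfl fun ρ _ => ?_
    rw [← Finset.add_sum_erase univ _ (Finset.mem_univ ρ)]
    simp_rw [hd]
    ring
  have e3 : ∀ F : (P → O) → (P → O) → ℝ, ∑ ρ, ∑ ρ' ∈ univ.erase ρ, F ρ ρ' = ∑ ρ, ∑ ρ', F ρ ρ' - ∑ ρ, F ρ ρ := by
    intro F
    rw [← Finset.sum_sub_distrib]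
    refine Finset.sum_congr rfl fun ρ _ => ?_
    rw [← Finset.add_sum_erase univ _ (Finset.mem_univ ρ)]; ring
  rw [e0]
  have h1 : ‖∑ ρ, ∑ ρ' ∈ univ.erase ρ, (c ρ : ℂ) * c ρ' * ∏ p, A p (ρ p) (ρ' p)‖ ≤
      ∑ ρ, ∑ ρ' ∈ univ.erase ρ, (1/2 * (c ρ ^ 2 * ∏ p, a p (ρ p) (ρ' p)) + 1/2 * (c ρ' ^ 2 * ∏ p, a p (ρ p) (ρ' p))) := by
    refine (norm_sum_le _ _).trans (Finset.sum_le_sum fun ρ _ => (norm_sum_le _ _).trans (Finset.sum_le_sum fun ρ' _ => ?_))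
    rw [norm_mul, norm_mul, norm_prod, Complex.norm_real, Complex.norm_real, Real.norm_eq_abs, Real.norm_eq_abs]
    have h2 : ∏ p, ‖A p (ρ p) (ρ' p)‖ ≤ ∏ p, a p (ρ p) (ρ' p) :=
      Finset.prod_le_prod (fun _ _ => norm_nonneg _) fun p _ => hA _ _ _
    have h3 : |c ρ| * |c ρ'| ≤ 1/2 * c ρ ^ 2 + 1/2 * c ρ' ^ 2 := by
      have := sq_nonneg (|c ρ| - |c ρ'|)
      have h4 := sq_abs (c ρ)
      have h5 := sq_abs (c ρ')
      nlinarith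
    calc _ ≤ (1/2 * c ρ ^ 2 + 1/2 * c ρ' ^ 2) * ∏ p, a p (ρ p) (ρ' p) :=
          mul_le_mul h3 h2 (Finset.prod_nonneg fun _ _ => norm_nonneg _) (by positivity)
      _ = _ := by ring
  refine h1.trans (le_of_eq ?_)
  rw [e3]
  have e1 : ∑ ρ, ∑ ρ' : P → O, 1/2 * (c ρ ^ 2 * ∏ p, a p (ρ p) (ρ' p)) = 1/2 * ∑ ρ, c ρ ^ 2 * ∏ p, ∑ o, a p (ρ p) o := by
    rw [Finset.mul_sum]
    refine Finset.sum_congr rfl fun ρ _ => ?_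
    rw [← Finset.mul_sum, ← Finset.mul_sum, sum_prod_pi (fun p o => a p (ρ p) o)]
  have e2 : ∑ ρ : P → O, ∑ ρ' : P → O, 1/2 * (c ρ' ^ 2 * ∏ p, a p (ρ p) (ρ' p)) = 1/2 * ∑ ρ, c ρ ^ 2 * ∏ p, ∑ o, a p (ρ p) o := by
    rw [Finset.sum_comm, Finset.mul_sum]
    refine Finset.sum_congr rfl fun ρ _ => ?_
    rw [← Finset.mul_sum, ← Finset.mul_sum, ← sum_prod_pi (fun p o => a p (ρ p) o)]
    simp_rw [hs _ (ρ _) _]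
  simp_rw [Finset.sum_add_distrib]
  rw [e1, e2]
  simp_rw [had]
  rw [← Finset.mul_sum]
  ring

end tensor
end TotRun
end

section
open ArithmeticFunction Finset
open scoped ArithmeticFunction.Moebius ArithmeticFunction.zeta ComplexConjugate

namespace TotRun

/-- Squarefree integers up to `u` coprime to `W`. -/
def sqc (W u : ℕ) : Finset ℕ := (Ioc 0 u).filter fun n => Squarefree n ∧ n.Coprime W

/-- sum of reciprocals -/
noncomputable def Fs (W u : ℕ) : ℝ := ∑ n ∈ sqc W u, 1 / (n:ℝ)

lemma sum_le_inj {α β : Type} [DecidableEq β] (s : Finset α) (t : Finset β) (f : α → ℝ) (g : β → ℝ) (e : α → β)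
    (he : ∀ a ∈ s, e a ∈ t) (hi : ∀ a ∈ s, ∀ b ∈ s, e a = e b → a = b) (hfg : ∀ a ∈ s, f a ≤ g (e a)) (hg : ∀ b ∈ t, 0 ≤ g b) :
    ∑ a ∈ s, f a ≤ ∑ b ∈ t, g b := by
  calc _ ≤ ∑ a ∈ s, g (e a) := Finset.sum_le_sum hfg
    _ = ∑ b ∈ s.image e, g b := (Finset.sum_image (fun a ha b hb => hi a ha b hb)).symm
    _ ≤ _ := Finset.sum_le_sum_of_subset_of_nonneg (Finset.image_subset_iff.2 he) fun b hb _ => hg b hb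

lemma divsum_eq (W : ℕ) (hW : Squarefree W) : ∑ d ∈ W.divisors, 1 / (d:ℝ) = ∏ p ∈ W.primeFactors, (1 + 1 / (p:ℝ)) := by
  rw [← sum_div_sqfree W hW]
  refine Finset.sum_congr rfl fun d hd => ?_
  rw [Nat.mem_divisors] at hd
  have : Squarefree d := hW.squarefree_of_dvd hd.1
  rw [Finset.prod_div_distrib, Finset.prod_const_one]
  congr 1
  conv_lhs => rw [← Nat.prod_primeFactors_of_squarefree this]
  push_cast; rfl

lemma prod_one_sub_sq (S : Finset ℕ) (hS : ∀ p ∈ S, 2 ≤ p) : 1 / 2 ≤ ∏ p ∈ S, (1 - 1 / (p:ℝ) ^ 2) := by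
  have tel : ∀ N : ℕ, ∏ n ∈ Ioc 1 (N + 1), (1 - 1 / (n:ℝ) ^ 2) = ((N:ℝ) + 2) / (2 * (N + 1)) := by
    intro N
    induction N with
    | zero => simp
    | succ N ih =>
      rw [← Finset.insert_Ioc_right_eq_Ioc_add_one (by omega), Finset.prod_insert (by simp), ih]
      push_cast
      field_simp
      ring
  obtain ⟨N, hN⟩ : ∃ N, S ⊆ Ioc 1 (N + 1) := by
    refine ⟨S.sup id, fun p hp => ?_⟩
    rw [Finset.mem_Ioc]
    have := Finset.le_sup (f := id) hp
    simp only [id] at this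
    have h2 := hS p hp
    omega
  have h01 : ∀ n ∈ Ioc 1 (N + 1), 0 ≤ 1 - 1 / (n:ℝ) ^ 2 ∧ 1 - 1 / (n:ℝ) ^ 2 ≤ 1 := by
    intro n hn
    have : (1:ℝ) ≤ n := by exact_mod_cast (Finset.mem_Ioc.1 hn).1.le
    refine ⟨?_, by have : 0 ≤ 1 / (n:ℝ)^2 := by positivity
                   linarith⟩
    rw [sub_nonneg, div_le_one (by positivity)]
    nlinarith
  calc (1:ℝ) / 2 ≤ ((N:ℝ) + 2) / (2 * (N + 1)) := by
        rw [div_le_div_iff₀ (by norm_num) (by positivity)]; linarith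
    _ = ∏ n ∈ Ioc 1 (N + 1), (1 - 1 / (n:ℝ) ^ 2) := (tel N).symm
    _ ≤ _ := by
        rw [← Finset.prod_sdiff hN]
        refine mul_le_of_le_one_left (Finset.prod_nonneg fun p hp => (h01 p (hN hp)).1) ?_
        exact Finset.prod_le_one (fun p hp => (h01 p (Finset.sdiff_subset hp)).1) fun p hp => (h01 p (Finset.sdiff_subset hp)).2

lemma divsum_bounds (W : ℕ) (hW : Squarefree W) :
    (W:ℝ) / W.totient / 2 ≤ ∑ d ∈ W.divisors, 1 / (d:ℝ) ∧ ∑ d ∈ W.divisors, 1 / (d:ℝ) ≤ (W:ℝ) / W.totient := by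
  rw [divsum_eq W hW, ← totient_ratio W hW.ne_zero]
  have hp : ∀ p ∈ W.primeFactors, (2:ℝ) ≤ p := fun p hp => by exact_mod_cast (Nat.prime_of_mem_primeFactors hp).two_le
  have hinv : ∀ p ∈ W.primeFactors, 0 < 1 - (p:ℝ)⁻¹ := fun p h => by
    have := hp p h
    rw [sub_pos, inv_lt_one₀ (by linarith)]; linarith
  constructor
  · have h1 : ∏ p ∈ W.primeFactors, (1 + 1 / (p:ℝ)) = (∏ p ∈ W.primeFactors, (1 - 1 / (p:ℝ) ^ 2)) * ∏ p ∈ W.primeFactors, (1 - (p:ℝ)⁻¹)⁻¹ := by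
      rw [← Finset.prod_mul_distrib]
      refine Finset.prod_congr rfl fun p h => ?_
      rw [eq_mul_inv_iff_mul_eq₀ (hinv p h).ne']
      have := hp p h
      field_simp
      ring
    rw [h1]
    have := prod_one_sub_sq W.primeFactors fun p hp => (Nat.prime_of_mem_primeFactors hp).two_le
    have h0 : 0 ≤ ∏ p ∈ W.primeFactors, (1 - (p:ℝ)⁻¹)⁻¹ := Finset.prod_nonneg fun p h => inv_nonneg.2 (hinv p h).le
    nlinarith
  · refine Finset.prod_le_prod (fun p _ => by positivity) fun p h => ?_
    rw [← one_div, le_div_iff₀ (hinv p h)]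
    have := hp p h
    have h3 : 0 ≤ (p:ℝ)⁻¹ ^ 2 := by positivity
    rw [one_div]
    nlinarith

lemma sum_inv_sq_le (N : ℕ) : ∑ e ∈ Ioc 0 N, 1 / (e:ℝ) ^ 2 ≤ 2 := by
  have : ∀ N : ℕ, ∑ e ∈ Ioc 0 (N + 1), 1 / (e:ℝ) ^ 2 ≤ 2 - 1 / ((N:ℝ) + 1) := by
    intro N
    induction N with
    | zero => simp; norm_num
    | succ N ih =>
      rw [← Finset.insert_Ioc_right_eq_Ioc_add_one (by omega), Finset.sum_insert (by simp)]
      have : 1 / ((N + 1 + 1 : ℕ) : ℝ) ^ 2 ≤ 1 / ((N:ℝ) + 1) - 1 / (((N + 1 : ℕ) : ℝ) + 1) := by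
        push_cast
        rw [div_sub_div _ _ (by positivity) (by positivity), div_le_div_iff₀ (by positivity) (by positivity)]
        ring_nf
        nlinarith
      linarith
  rcases Nat.eq_zero_or_pos N with rfl | h
  · simp
  · obtain ⟨M, rfl⟩ : ∃ M, N = M + 1 := ⟨N - 1, by omega⟩
    have h := this M
    have : 0 ≤ 1 / ((M:ℝ) + 1) := by positivity
    linarith

lemma Fs_nonneg (W u : ℕ) : 0 ≤ Fs W u := Finset.sum_nonneg fun n _ => by positivity

lemma Fs_lower (W : ℕ) (hW : Squarefree W) (u : ℕ) : (W.totient : ℝ) / W * Real.log u / 2 ≤ Fs W u := by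
  classical
  have hWpos : 0 < W := Nat.pos_of_ne_zero hW.ne_zero
  have hφ : (0:ℝ) < W.totient := by exact_mod_cast Nat.totient_pos.2 hWpos
  have hW0 : (0:ℝ) < W := by exact_mod_cast hWpos
  rcases Nat.eq_zero_or_pos u with rfl | hu
  · simp; exact Fs_nonneg _ _
  have h1 : Real.log u ≤ ∑ n ∈ Ioc 0 u, 1 / (n:ℝ) :=
    (Real.log_le_log (by exact_mod_cast hu) (by linarith)).trans (harm_ge u)
  choose! s t hst using fun n : ℕ => Nat.sq_mul_squarefree n
  have h2 : ∑ n ∈ Ioc 0 u, 1 / (n:ℝ) ≤ ∑ x ∈ (Ioc 0 u) ×ˢ (W.divisors ×ˢ sqc W u), 1 / (x.1:ℝ) ^ 2 * (1 / (x.2.1:ℝ) * (1 / (x.2.2:ℝ))) := by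
    have hdec : ∀ n, t n ^ 2 * (Nat.gcd (s n) W * (s n / Nat.gcd (s n) W)) = n := fun n => by
      rw [Nat.mul_div_cancel' (Nat.gcd_dvd_left _ _)]; exact (hst n).1
    refine sum_le_inj _ _ _ _ (fun n => (t n, Nat.gcd (s n) W, s n / Nat.gcd (s n) W)) ?_ ?_ ?_ ?_
    · intro n hn
      rw [Finset.mem_Ioc] at hn
      have hn0 : n ≠ 0 := by omega
      have hsn : s n ≠ 0 := (hst n).2.ne_zero
      have htn : t n ≠ 0 := fun h => hn0 (by rw [← (hst n).1, h]; simp)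
      have hs_le : s n ≤ n := by
        conv_rhs => rw [← (hst n).1]
        exact Nat.le_mul_of_pos_left _ (by positivity)
      have ht_le : t n ≤ n := by
        conv_rhs => rw [← (hst n).1]
        calc t n ≤ t n ^ 2 := Nat.le_self_pow (by norm_num) _
          _ ≤ _ := Nat.le_mul_of_pos_right _ (by positivity)
      have hd := Nat.div_dvd_of_dvd (Nat.gcd_dvd_left (s n) W)
      simp only [Finset.mem_product, Finset.mem_Ioc, Nat.mem_divisors, sqc, Finset.mem_filter]
      refine ⟨⟨by omega, by omega⟩, ⟨Nat.gcd_dvd_right _ _, hW.ne_zero⟩, ⟨?_, ?_⟩, (hst n).2.squarefree_of_dvd hd, ?_⟩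
      · exact Nat.pos_of_dvd_of_pos hd (by omega)
      · exact (Nat.le_of_dvd (by omega) hd).trans (by omega)
      · have h3 : Squarefree (Nat.gcd (s n) W * (s n / Nat.gcd (s n) W)) := by
          rw [Nat.mul_div_cancel' (Nat.gcd_dvd_left _ _)]; exact (hst n).2
        have h4 := Nat.coprime_of_squarefree_mul h3
        set g := Nat.gcd (s n) W with hg
        set b := s n / g with hb
        have h5 : Nat.gcd b W ∣ g := Nat.dvd_gcd ((Nat.gcd_dvd_left b W).trans hd) (Nat.gcd_dvd_right b W)
        exact Nat.eq_one_of_dvd_coprimes h4 h5 (Nat.gcd_dvd_left b W)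
    · intro a _ b _ hab
      simp only [Prod.mk.injEq] at hab
      rw [← hdec a, ← hdec b, hab.2.2, hab.1, hab.2.1]
    · intro n hn
      refine le_of_eq ?_
      conv_lhs => rw [← hdec n]
      push_cast
      rw [← one_div_mul_one_div, ← one_div_mul_one_div]
    · intro x _
      positivity
  rw [Finset.sum_product] at h2
  simp_rw [Finset.sum_product, ← Finset.mul_sum, ← Finset.sum_mul] at h2
  have h3 := sum_inv_sq_le u
  have h4 := (divsum_bounds W hW).2
  have hF := Fs_nonneg W u
  have h5 : Real.log u ≤ 2 * ((W:ℝ) / W.totient * Fs W u) := by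
    refine h1.trans (h2.trans ?_)
    refine mul_le_mul h3 (mul_le_mul h4 le_rfl hF (by positivity)) ?_ (by norm_num)
    exact mul_nonneg (Finset.sum_nonneg fun _ _ => by positivity) hF
  calc (W.totient : ℝ) / W * Real.log u / 2 ≤ (W.totient : ℝ) / W * (2 * ((W:ℝ) / W.totient * Fs W u)) / 2 := by gcongr
    _ = Fs W u := by field_simp

lemma Fs_upper (W : ℕ) (hW : Squarefree W) (u : ℕ) (hu : 3 * W ≤ u) : Fs W u ≤ 4 * ((W.totient : ℝ) / W) * Real.log u := by
  classical
  have hWpos : 0 < W := Nat.pos_of_ne_zero hW.ne_zero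
  have hφ : (0:ℝ) < W.totient := by exact_mod_cast Nat.totient_pos.2 hWpos
  have hW0 : (0:ℝ) < W := by exact_mod_cast hWpos
  have hu0 : 0 < u := by omega
  have h1 : ∑ x ∈ W.divisors ×ˢ sqc W u, 1 / (x.1:ℝ) * (1 / (x.2:ℝ)) ≤ ∑ n ∈ Ioc 0 (W * u), 1 / (n:ℝ) := by
    refine sum_le_inj _ _ _ _ (fun x => x.1 * x.2) ?_ ?_ ?_ ?_
    · rintro ⟨a, b⟩ hx
      simp only [Finset.mem_product, Finset.mem_Ioc, Nat.mem_divisors, sqc, Finset.mem_filter] at hx ⊢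
      refine ⟨Nat.mul_pos (Nat.pos_of_dvd_of_pos hx.1.1 hWpos) hx.2.1.1, Nat.mul_le_mul (Nat.le_of_dvd hWpos hx.1.1) hx.2.1.2⟩
    · rintro ⟨a, b⟩ hx ⟨a', b'⟩ hx' h
      simp only [Finset.mem_product, Finset.mem_Ioc, Nat.mem_divisors, sqc, Finset.mem_filter] at hx hx' h
      have e1 : Nat.gcd (a * b) W = a := by
        rw [Nat.Coprime.gcd_mul_right_cancel a hx.2.2.2]; exact Nat.gcd_eq_left hx.1.1
      have e2 : Nat.gcd (a' * b') W = a' := by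
        rw [Nat.Coprime.gcd_mul_right_cancel a' hx'.2.2.2]; exact Nat.gcd_eq_left hx'.1.1
      have : a = a' := by rw [← e1, ← e2, h]
      subst this
      rw [Nat.eq_of_mul_eq_mul_left (Nat.pos_of_dvd_of_pos hx.1.1 hWpos) h]
    · rintro ⟨a, b⟩ _
      push_cast
      rw [one_div_mul_one_div]
    · intro n _; positivity
  simp_rw [Finset.sum_product, ← Finset.mul_sum, ← Finset.sum_mul] at h1
  have h4 := (divsum_bounds W hW).1
  have hF := Fs_nonneg W u
  have h2 := harm_le (W * u)
  push_cast at h2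
  have hu1 : (0:ℝ) < u := by exact_mod_cast hu0
  have h3 : 1 + Real.log (W * u) ≤ 2 * Real.log u := by
    rw [Real.log_mul hW0.ne' hu1.ne']
    have h5 : Real.log (3 * W) ≤ Real.log u := Real.log_le_log (by positivity) (by exact_mod_cast hu)
    rw [Real.log_mul (by norm_num) hW0.ne'] at h5
    have h6 : 1 ≤ Real.log 3 := by
      have := log_ge_one 3 le_rfl
      exact_mod_cast this
    linarith
  have h5 : (W:ℝ) / W.totient / 2 * Fs W u ≤ 2 * Real.log u :=
    (mul_le_mul_of_nonneg_right h4 hF).trans (h1.trans (h2.trans h3))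
  calc Fs W u = 2 * ((W.totient : ℝ) / W) * ((W:ℝ) / W.totient / 2 * Fs W u) := by field_simp
    _ ≤ 2 * ((W.totient : ℝ) / W) * (2 * Real.log u) := by gcongr
    _ = _ := by ring

end TotRun
end

section
open ArithmeticFunction Finset
open scoped ArithmeticFunction.Moebius ArithmeticFunction.zeta ComplexConjugate

namespace TotRun

/-- The type of sieving primes. -/
abbrev PT (D R : ℕ) : Type := {p : ℕ // p ∈ (Ioc D R).filter Nat.Prime}

lemma PT.prime {D R : ℕ} (p : PT D R) : p.1.Prime := (Finset.mem_filter.1 p.2).2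
lemma PT.gt {D R : ℕ} (p : PT D R) : D < p.1 := (Finset.mem_Ioc.1 (Finset.mem_filter.1 p.2).1).1
lemma PT.le {D R : ℕ} (p : PT D R) : p.1 ≤ R := (Finset.mem_Ioc.1 (Finset.mem_filter.1 p.2).1).2
lemma PT.pos {D R : ℕ} (p : PT D R) : (0:ℝ) < p.1 := by exact_mod_cast p.prime.pos

variable {D R : ℕ}

def rA (A : Finset (PT D R)) : ℕ := ∏ p ∈ A, p.1

lemma rA_pos (A : Finset (PT D R)) : 0 < rA A := Finset.prod_pos fun p _ => p.prime.pos

lemma rA_image (A : Finset (PT D R)) : rA A = ∏ p ∈ A.image Subtype.val, p := by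
  rw [Finset.prod_image (fun a _ b _ h => Subtype.ext h)]; rfl

lemma rA_primeFactors (A : Finset (PT D R)) : (rA A).primeFactors = A.image Subtype.val := by
  rw [rA_image]
  refine primeFactors_prod_primes _ fun p hp => ?_
  obtain ⟨a, _, rfl⟩ := Finset.mem_image.1 hp
  exact PT.prime a

lemma rA_inj (A B : Finset (PT D R)) (h : rA A = rA B) : A = B := by
  have h2 := rA_primeFactors A
  rw [h, rA_primeFactors B] at h2
  exact (Finset.image_injective Subtype.val_injective h2).symm

lemma rA_mono {A B : Finset (PT D R)} (h : A ⊆ B) : rA A ≤ rA B :=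
  Finset.prod_le_prod_of_subset_of_one_le' h fun p _ _ => p.prime.one_le

lemma rA_coprime (A : Finset (PT D R)) : (rA A).Coprime (primorial D) := by
  refine Nat.Coprime.prod_left fun p _ => ?_
  unfold primorial
  rw [Nat.Prime.coprime_iff_not_dvd p.prime, p.prime.prime.dvd_finset_prod_iff]
  rintro ⟨a, ha, hd⟩
  have := p.gt
  simp only [Finset.mem_filter, Finset.mem_range] at ha
  have := (Nat.prime_dvd_prime_iff_eq p.prime ha.2).1 hd
  omega

lemma rA_squarefree (A : Finset (PT D R)) : Squarefree (rA A) := by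
  rw [rA_image]
  refine Finset.squarefree_prod_of_pairwise_isCoprime ?_ ?_
  · intro a ha b hb hab
    simp only [Finset.coe_image, Set.mem_image] at ha hb
    obtain ⟨a, _, rfl⟩ := ha
    obtain ⟨b, _, rfl⟩ := hb
    rw [Function.onFun]
    exact Nat.coprime_iff_isRelPrime.1 ((Nat.coprime_primes (PT.prime a) (PT.prime b)).2 hab)
  · intro a ha
    obtain ⟨a, _, rfl⟩ := Finset.mem_image.1 ha
    exact (PT.prime a).prime.squarefree

lemma primorial_sqfree (D : ℕ) : Squarefree (primorial D) := by
  unfold primorial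
  refine Finset.squarefree_prod_of_pairwise_isCoprime ?_ ?_
  · intro a ha b hb hab
    simp only [Finset.coe_filter, Set.mem_setOf_eq] at ha hb
    rw [Function.onFun]
    exact Nat.coprime_iff_isRelPrime.1 ((Nat.coprime_primes ha.2 hb.2).2 hab)
  · intro a ha
    exact (Finset.mem_filter.1 ha).2.prime.squarefree

lemma prime_dvd_primorial {p D : ℕ} (hp : p.Prime) (h : p ≤ D) : p ∣ primorial D :=
  Finset.dvd_prod_of_mem _ (Finset.mem_filter.2 ⟨Finset.mem_range.2 (by omega), hp⟩)

lemma sum_rA (u : ℕ) (hu : u ≤ R) :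
    ∑ A : Finset (PT D R), (if rA A ≤ u then 1 / (rA A : ℝ) else 0) = Fs (primorial D) u := by
  unfold Fs
  rw [← Finset.sum_filter]
  refine Finset.sum_bij (fun A _ => rA A) ?_ ?_ ?_ ?_
  · intro A hA
    rw [Finset.mem_filter] at hA
    exact Finset.mem_filter.2 ⟨Finset.mem_Ioc.2 ⟨rA_pos A, hA.2⟩, rA_squarefree A, rA_coprime A⟩
  · intro A _ B _ h; exact rA_inj A B h
  · intro n hn
    simp only [sqc, Finset.mem_filter, Finset.mem_Ioc] at hn
    have e : rA (univ.filter fun p : PT D R => p.1 ∣ n) = n := by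
      rw [rA_image]
      conv_rhs => rw [← Nat.prod_primeFactors_of_squarefree hn.2.1]
      congr 1
      ext p
      simp only [Finset.mem_image, Finset.mem_filter, Finset.mem_univ, true_and, Nat.mem_primeFactors]
      constructor
      · rintro ⟨a, h, rfl⟩
        exact ⟨PT.prime a, h, by omega⟩
      · rintro ⟨hp, hd, _⟩
        have h1 : p ≤ R := (Nat.le_of_dvd hn.1.1 hd).trans (hn.1.2.trans hu)
        have h2 : D < p := by
          by_contra h
          have := Nat.eq_one_of_dvd_coprimes hn.2.2 hd (prime_dvd_primorial hp (by omega))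
          exact hp.one_lt.ne' this
        exact ⟨⟨p, Finset.mem_filter.2 ⟨Finset.mem_Ioc.2 ⟨h2, h1⟩, hp⟩⟩, hd, rfl⟩
    exact ⟨_, Finset.mem_filter.2 ⟨Finset.mem_univ _, by rw [e]; exact hn.1.2⟩, e⟩
  · intro A _; rfl

lemma geom_half (J : ℕ) : ∑ j ∈ range J, (1/2:ℝ) ^ j ≤ 2 := by
  have h : ∑ j ∈ range J, (1/2:ℝ) ^ j = 2 - 2 * (1/2:ℝ) ^ J := by
    induction J with
    | zero => simp
    | succ n ih => rw [Finset.sum_range_succ, ih, pow_succ]; ring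
  rw [h]
  have : (0:ℝ) ≤ (1/2) ^ J := by positivity
  linarith

/-- The one-variable sieve weight. -/
noncomputable def G (X J r : ℕ) : ℝ := ∑ j ∈ range J, (1/2:ℝ) ^ j * (if r ≤ X ^ 2 ^ j then 1 else 0)

lemma G_nonneg (X J r : ℕ) : 0 ≤ G X J r := Finset.sum_nonneg fun j _ => by split_ifs <;> positivity

lemma G_anti (X J : ℕ) {r s : ℕ} (h : r ≤ s) : G X J s ≤ G X J r := by
  refine Finset.sum_le_sum fun j _ => mul_le_mul_of_nonneg_left ?_ (by positivity)
  split_ifs with h1 h2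
  · exact le_rfl
  · omega
  · norm_num
  · exact le_rfl

lemma G_le (X J r : ℕ) : G X J r ≤ 2 := by
  calc G X J r ≤ ∑ j ∈ range J, (1/2:ℝ) ^ j := Finset.sum_le_sum fun j _ => by
        split_ifs
        · simp
        · simp
    _ ≤ 2 := by
        exact geom_half J

lemma G_one_le (X J r : ℕ) (hJ : 1 ≤ J) (hr : r ≤ X) : 1 ≤ G X J r := by
  unfold G
  have := Finset.single_le_sum (f := fun j => (1/2:ℝ) ^ j * (if r ≤ X ^ 2 ^ j then 1 else 0)) (fun j _ => by split_ifs <;> positivity) (Finset.mem_range.2 hJ)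
  simpa [hr] using this

lemma G_zero (X J r : ℕ) (hX : 1 ≤ X) (hr : X ^ 2 ^ J < r) : G X J r = 0 := by
  refine Finset.sum_eq_zero fun j hj => ?_
  rw [if_neg, mul_zero]
  have : X ^ 2 ^ j ≤ X ^ 2 ^ J := Nat.pow_le_pow_right hX (Nat.pow_le_pow_right (by norm_num) (Finset.mem_range.1 hj).le)
  omega

lemma G_sq_le (X J r : ℕ) (hX : 1 ≤ X) : G X J r ^ 2 ≤ 4 * ∑ j ∈ range J, (1/4:ℝ) ^ j * (if r ≤ X ^ 2 ^ j then 1 else 0) := by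
  have key : G X J r = 0 ∨ (G X J r + 2 * (1/2) ^ J) ^ 2 ≤ 4 * ∑ j ∈ range J, (1/4:ℝ) ^ j * (if r ≤ X ^ 2 ^ j then 1 else 0) := by
    induction J with
    | zero => left; simp [G]
    | succ J ih =>
      have e : G X (J + 1) r = G X J r + (1/2:ℝ) ^ J * (if r ≤ X ^ 2 ^ J then 1 else 0) := by
        unfold G; rw [Finset.sum_range_succ]
      rw [e, Finset.sum_range_succ]
      have e4 : (1/4:ℝ) ^ J = ((1/2:ℝ) ^ J) ^ 2 := by rw [← pow_mul, mul_comm, pow_mul]; norm_num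
      by_cases h : r ≤ X ^ 2 ^ J
      · right
        simp only [h, if_true, mul_one, pow_succ (1/2:ℝ)]
        rcases ih with ih | ih
        · have : 0 ≤ ∑ j ∈ range J, (1/4:ℝ) ^ j * (if r ≤ X ^ 2 ^ j then 1 else 0) :=
            Finset.sum_nonneg fun j _ => by split_ifs <;> positivity
          rw [ih, e4]
          nlinarith
        · have : 0 ≤ (1/4:ℝ) ^ J := by positivity
          nlinarith
      · left
        rw [G_zero X J r hX (by omega)]
        simp [h]
  rcases key with h | h
  · rw [h]
    have : 0 ≤ ∑ j ∈ range J, (1/4:ℝ) ^ j * (if r ≤ X ^ 2 ^ j then 1 else 0) :=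
            Finset.sum_nonneg fun j _ => by split_ifs <;> positivity
    linarith
  · refine le_trans ?_ h
    have h1 := G_nonneg X J r
    have : 0 ≤ (1/2:ℝ) ^ J := by positivity
    nlinarith

section sums
variable (D R)

noncomputable def bet (X J : ℕ) : ℝ := ∑ A : Finset (PT D R), G X J (rA A) / rA A
noncomputable def gam (X J : ℕ) : ℝ := ∑ A : Finset (PT D R), G X J (rA A) ^ 2 / rA A
noncomputable def lmb (X J : ℕ) : ℝ := ∑ A : Finset (PT D R), G X J (rA A) ^ 2 / rA A * Real.log (rA A)

variable (X J : ℕ)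

lemma XJ_le (hR : X ^ 2 ^ J ≤ R) (hX : 3 * primorial D ≤ X) {j : ℕ} (hj : j < J) : X ^ 2 ^ j ≤ R ∧ 3 * primorial D ≤ X ^ 2 ^ j := by
  have hX1 : 1 ≤ X := by have := primorial_pos D; omega
  refine ⟨(Nat.pow_le_pow_right hX1 (Nat.pow_le_pow_right (by norm_num) hj.le)).trans hR, hX.trans (Nat.le_self_pow (by positivity) X)⟩

lemma bet_lower (hR : X ^ 2 ^ J ≤ R) (hX : 3 * primorial D ≤ X) : J * (((primorial D).totient : ℝ) / primorial D) * Real.log X / 2 ≤ bet D R X J := by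
  have e : bet D R X J = ∑ j ∈ range J, (1/2:ℝ) ^ j * Fs (primorial D) (X ^ 2 ^ j) := by
    unfold bet G
    simp_rw [Finset.sum_div]
    rw [Finset.sum_comm]
    refine Finset.sum_congr rfl fun j hj => ?_
    rw [← sum_rA _ (XJ_le D R X J hR hX (Finset.mem_range.1 hj)).1, Finset.mul_sum]
    refine Finset.sum_congr rfl fun A _ => ?_
    split_ifs <;> ring
  rw [e]
  calc _ = ∑ j ∈ range J, (((primorial D).totient : ℝ) / primorial D) * Real.log X / 2 := by
        rw [Finset.sum_const, Finset.card_range, nsmul_eq_mul]; ring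
    _ ≤ _ := by
        refine Finset.sum_le_sum fun j hj => ?_
        have := Fs_lower (primorial D) (primorial_sqfree D) (X ^ 2 ^ j)
        rw [log_natpow] at this
        push_cast at this
        calc _ = (1/2:ℝ) ^ j * ((((primorial D).totient : ℝ) / primorial D) * (2 ^ j * Real.log X) / 2) := by
              rw [one_div, inv_pow]; field_simp
          _ ≤ _ := mul_le_mul_of_nonneg_left this (by positivity)

lemma gam_lower (hR : X ^ 2 ^ J ≤ R) (hX : 3 * primorial D ≤ X) (hJ : 1 ≤ J) : (((primorial D).totient : ℝ) / primorial D) * Real.log X / 2 ≤ gam D R X J := by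
  refine (Fs_lower (primorial D) (primorial_sqfree D) X).trans ?_
  have h0 := (XJ_le D R X J hR hX (j := 0) hJ).1
  rw [pow_zero, pow_one] at h0
  rw [← sum_rA X h0]
  refine Finset.sum_le_sum fun A _ => ?_
  have hpos : (0:ℝ) < rA A := by exact_mod_cast rA_pos A
  split_ifs with h
  · gcongr
    have := G_one_le X J _ hJ h
    nlinarith
  · positivity

lemma gam_upper (hR : X ^ 2 ^ J ≤ R) (hX : 3 * primorial D ≤ X) : gam D R X J ≤ 32 * (((primorial D).totient : ℝ) / primorial D) * Real.log X := by
  have hX1 : 1 ≤ X := by have := primorial_pos D; omega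
  set κ := (((primorial D).totient : ℝ) / primorial D)
  have hκ : 0 ≤ κ := by positivity
  have hl : 0 ≤ Real.log X := Real.log_natCast_nonneg X
  have h1 : gam D R X J ≤ ∑ A : Finset (PT D R), ∑ j ∈ range J, 4 * (1/4:ℝ) ^ j * (if rA A ≤ X ^ 2 ^ j then 1 / (rA A : ℝ) else 0) := by
    refine Finset.sum_le_sum fun A _ => ?_
    have hpos : (0:ℝ) < rA A := by exact_mod_cast rA_pos A
    calc _ ≤ (4 * ∑ j ∈ range J, (1/4:ℝ) ^ j * (if rA A ≤ X ^ 2 ^ j then 1 else 0)) / rA A := by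
          gcongr; exact G_sq_le X J _ hX1
      _ = _ := by
          rw [Finset.mul_sum, Finset.sum_div]
          refine Finset.sum_congr rfl fun j _ => ?_
          split_ifs <;> ring
  refine h1.trans ?_
  rw [Finset.sum_comm]
  calc _ ≤ ∑ j ∈ range J, 16 * κ * Real.log X * (1/2:ℝ) ^ j := by
        refine Finset.sum_le_sum fun j hj => ?_
        have hj' := XJ_le D R X J hR hX (Finset.mem_range.1 hj)
        rw [← Finset.mul_sum, sum_rA _ hj'.1]
        have := Fs_upper (primorial D) (primorial_sqfree D) _ hj'.2
        rw [log_natpow] at this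
        push_cast at this
        calc _ ≤ 4 * (1/4:ℝ) ^ j * (4 * κ * (2 ^ j * Real.log X)) := mul_le_mul_of_nonneg_left this (by positivity)
          _ = 16 * κ * Real.log X * ((1/4) ^ j * 2 ^ j) := by ring
          _ = _ := by rw [← mul_pow]; norm_num
    _ = 16 * κ * Real.log X * ∑ j ∈ range J, (1/2:ℝ) ^ j := by rw [Finset.mul_sum]
    _ ≤ 16 * κ * Real.log X * 2 := by
        gcongr
        exact geom_half J
    _ = _ := by ring

lemma lmb_upper (hR : X ^ 2 ^ J ≤ R) (hX : 3 * primorial D ≤ X) : lmb D R X J ≤ 16 * J * (((primorial D).totient : ℝ) / primorial D) * Real.log X ^ 2 := by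
  have hX1 : 1 ≤ X := by have := primorial_pos D; omega
  set κ := (((primorial D).totient : ℝ) / primorial D)
  have hκ : 0 ≤ κ := by positivity
  have hl : 0 ≤ Real.log X := Real.log_natCast_nonneg X
  have h1 : lmb D R X J ≤ ∑ A : Finset (PT D R), ∑ j ∈ range J, 4 * (1/4:ℝ) ^ j * (2 ^ j * Real.log X) * (if rA A ≤ X ^ 2 ^ j then 1 / (rA A : ℝ) else 0) := by
    refine Finset.sum_le_sum fun A _ => ?_
    have hpos : (0:ℝ) < rA A := by exact_mod_cast rA_pos A
    have hlog : 0 ≤ Real.log (rA A) := Real.log_natCast_nonneg _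
    calc _ ≤ (4 * ∑ j ∈ range J, (1/4:ℝ) ^ j * (if rA A ≤ X ^ 2 ^ j then 1 else 0)) / rA A * Real.log (rA A) := by
          gcongr; exact G_sq_le X J _ hX1
      _ = ∑ j ∈ range J, 4 * (1/4:ℝ) ^ j * (if rA A ≤ X ^ 2 ^ j then 1 / (rA A : ℝ) * Real.log (rA A) else 0) := by
          rw [Finset.mul_sum, Finset.sum_div, Finset.sum_mul]
          refine Finset.sum_congr rfl fun j _ => ?_
          split_ifs <;> ring
      _ ≤ _ := by
          refine Finset.sum_le_sum fun j _ => ?_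
          rw [mul_assoc (4 * (1/4:ℝ) ^ j)]
          refine mul_le_mul_of_nonneg_left ?_ (by positivity)
          split_ifs with h
          · rw [mul_comm]
            gcongr
            have := Real.log_le_log hpos (by exact_mod_cast h : (rA A : ℝ) ≤ ((X ^ 2 ^ j : ℕ) : ℝ))
            rw [log_natpow] at this
            exact_mod_cast this
          · simp
  refine h1.trans ?_
  rw [Finset.sum_comm]
  calc _ ≤ ∑ j ∈ range J, 16 * κ * Real.log X ^ 2 := by
        refine Finset.sum_le_sum fun j hj => ?_
        have hj' := XJ_le D R X J hR hX (Finset.mem_range.1 hj)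
        rw [← Finset.mul_sum, sum_rA _ hj'.1]
        have := Fs_upper (primorial D) (primorial_sqfree D) _ hj'.2
        rw [log_natpow] at this
        push_cast at this
        calc _ ≤ 4 * (1/4:ℝ) ^ j * (2 ^ j * Real.log X) * (4 * κ * (2 ^ j * Real.log X)) := mul_le_mul_of_nonneg_left this (by positivity)
          _ = 16 * κ * Real.log X ^ 2 * ((1/4) ^ j * 2 ^ j * 2 ^ j) := by ring
          _ = _ := by rw [← mul_pow, ← mul_pow]; norm_num
    _ = _ := by rw [Finset.sum_const, Finset.card_range, nsmul_eq_mul]; ring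

end sums
end TotRun
end

section
open ArithmeticFunction Finset
open scoped ArithmeticFunction.Moebius ArithmeticFunction.zeta ComplexConjugate

namespace TotRun

variable {D R k : ℕ}

/-- Primes assigned to coordinate `j`. -/
def As (ρ : PT D R → Option (Fin k)) (j : Fin k) : Finset (PT D R) := univ.filter fun p => ρ p = some j

def rr (ρ : PT D R → Option (Fin k)) : ℕ := ∏ p, if ρ p = none then 1 else p.1

noncomputable def yy (X J : ℕ) (ρ : PT D R → Option (Fin k)) : ℝ :=
  if rr ρ ≤ R then ∏ j, G X J (rA (As ρ j)) else 0

/-- Erase the value `some i`. -/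
def er (i : Fin k) (ρ : PT D R → Option (Fin k)) : PT D R → Option (Fin k) :=
  fun p => if ρ p = some i then none else ρ p

noncomputable def cp (X J : ℕ) (i : Fin k) (σ : PT D R → Option (Fin k)) : ℝ :=
  ∑ ρ ∈ univ.filter (fun ρ => er i ρ = σ), yy X J ρ / rA (As ρ i)

noncomputable def M1s (D R k X J : ℕ) : ℝ := ∑ ρ : PT D R → Option (Fin k), yy X J ρ ^ 2 / rr ρ
noncomputable def M2s (D R X J : ℕ) (i : Fin k) : ℝ := ∑ σ : PT D R → Option (Fin k), cp X J i σ ^ 2 / rr σ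

lemma rr_pos (ρ : PT D R → Option (Fin k)) : 0 < rr ρ :=
  Finset.prod_pos fun p _ => by split_ifs; exacts [one_pos, p.prime.pos]

lemma yy_nonneg (X J : ℕ) (ρ : PT D R → Option (Fin k)) : 0 ≤ yy X J ρ := by
  unfold yy; split_ifs
  · exact Finset.prod_nonneg fun j _ => G_nonneg _ _ _
  · exact le_rfl

lemma cp_nonneg (X J : ℕ) (i : Fin k) (ρ : PT D R → Option (Fin k)) : 0 ≤ cp X J i ρ :=
  Finset.sum_nonneg fun ρ _ => div_nonneg (yy_nonneg _ _ _) (Nat.cast_nonneg _)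

lemma rr_eq (ρ : PT D R → Option (Fin k)) : rr ρ = ∏ j, rA (As ρ j) := by
  unfold rr rA As
  simp_rw [Finset.prod_filter]
  rw [Finset.prod_comm]
  refine Finset.prod_congr rfl fun p _ => ?_
  rcases h : ρ p with _ | j
  · simp
  · simp

lemma As_inj (ρ ρ' : PT D R → Option (Fin k)) (h : As ρ = As ρ') : ρ = ρ' := by
  funext p
  have h1 : ∀ j, ρ p = some j ↔ ρ' p = some j := by
    intro j
    have := congrFun h j
    have h2 := Finset.ext_iff.1 this p
    simpa [As] using h2
  exact Option.ext fun j => h1 j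

lemma As_update (ρ : PT D R → Option (Fin k)) (p : PT D R) (o : Option (Fin k)) (j : Fin k) :
    As (Function.update ρ p none) j ⊆ As (Function.update ρ p o) j := by
  intro q hq
  simp only [As, Finset.mem_filter, Finset.mem_univ, true_and] at hq ⊢
  by_cases h : q = p
  · subst h; simp at hq
  · simpa [Function.update_of_ne h] using hq

lemma rr_update (ρ : PT D R → Option (Fin k)) (p : PT D R) (o : Option (Fin k)) :
    rr (Function.update ρ p none) ≤ rr (Function.update ρ p o) := by
  rw [rr_eq, rr_eq]
  exact Finset.prod_le_prod' fun j _ => rA_mono (As_update ρ p o j)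

lemma yy_anti (X J : ℕ) (ρ : PT D R → Option (Fin k)) (p : PT D R) (o : Option (Fin k)) :
    yy X J (Function.update ρ p o) ≤ yy X J (Function.update ρ p none) := by
  have h := rr_update ρ p o
  by_cases h1 : rr (Function.update ρ p o) ≤ R
  · unfold yy
    rw [if_pos h1, if_pos (h.trans h1)]
    exact Finset.prod_le_prod (fun j _ => G_nonneg _ _ _) fun j _ => G_anti _ _ (rA_mono (As_update ρ p o j))
  · refine le_trans (le_of_eq ?_) (yy_nonneg _ _ _)
    unfold yy; rw [if_neg h1]

lemma er_ne (i : Fin k) (ρ : PT D R → Option (Fin k)) (p : PT D R) : er i ρ p ≠ some i := by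
  unfold er; split_ifs with h
  · simp
  · exact h

lemma cp_zero (X J : ℕ) (i : Fin k) (σ : PT D R → Option (Fin k)) (p : PT D R) (h : σ p = some i) : cp X J i σ = 0 := by
  unfold cp
  rw [Finset.filter_false_of_mem, Finset.sum_empty]
  rintro ρ _ rfl
  exact er_ne _ _ _ h

lemma cp_anti (X J : ℕ) (i : Fin k) (σ : PT D R → Option (Fin k)) (p : PT D R) (o : Option (Fin k)) :
    cp X J i (Function.update σ p o) ≤ cp X J i (Function.update σ p none) := by
  by_cases hi : o = some i
  · rw [cp_zero X J i _ p (by simp [hi])]; exact cp_nonneg _ _ _ _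
  by_cases hn : o = none
  · rw [hn]
  have hval : ∀ ρ, er i ρ = Function.update σ p o → ρ p = o := by
    intro ρ h
    have := congrFun h p
    simp only [Function.update_self] at this
    unfold er at this
    split_ifs at this with h2
    · exact absurd this.symm hn
    · exact this
  unfold cp
  refine sum_le_inj _ _ _ _ (fun ρ => Function.update ρ p none) ?_ ?_ ?_ ?_
  · intro ρ hρ
    simp only [Finset.mem_filter, Finset.mem_univ, true_and] at hρ ⊢
    funext q
    by_cases hq : q = p
    · subst hq; simp [er]
    · have := congrFun hρ q
      simpa [er, Function.update_of_ne hq] using this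
  · intro ρ hρ ρ' hρ' h
    simp only [Finset.mem_filter, Finset.mem_univ, true_and] at hρ hρ'
    funext q
    by_cases hq : q = p
    · subst hq; rw [hval _ hρ, hval _ hρ']
    · have := congrFun h q
      simpa [Function.update_of_ne hq] using this
  · intro ρ hρ
    simp only [Finset.mem_filter, Finset.mem_univ, true_and] at hρ
    have hp := hval _ hρ
    have e : ρ = Function.update ρ p o := by rw [← hp]; simp
    have e2 : As (Function.update ρ p none) i = As ρ i := by
      ext q
      simp only [As, Finset.mem_filter, Finset.mem_univ, true_and]
      by_cases hq : q = p
      · subst hq; rw [hp]; simp; exact fun h => hi h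
      · simp [Function.update_of_ne hq]
    rw [e2]
    gcongr
    conv_lhs => rw [e]
    exact yy_anti _ _ _ _ _
  · intro ρ _; exact div_nonneg (yy_nonneg _ _ _) (Nat.cast_nonneg _)

lemma As_er (i : Fin k) (ρ : PT D R → Option (Fin k)) (j : Fin k) (hj : j ≠ i) : As (er i ρ) j = As ρ j := by
  ext q
  simp only [As, Finset.mem_filter, Finset.mem_univ, true_and]
  unfold er
  split_ifs with h
  · rw [h]; simp; exact fun h => hj h.symm
  · rfl

lemma As_er_self (i : Fin k) (ρ : PT D R → Option (Fin k)) : As (er i ρ) i = ∅ := by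
  ext q
  simp only [As, Finset.mem_filter, Finset.mem_univ, true_and, Finset.notMem_empty, iff_false]
  exact er_ne _ _ _

lemma rr_er (i : Fin k) (ρ : PT D R → Option (Fin k)) : rr ρ = rr (er i ρ) * rA (As ρ i) := by
  rw [rr_eq, rr_eq, ← Finset.mul_prod_erase _ _ (Finset.mem_univ i), ← Finset.mul_prod_erase (s := univ) (fun j => rA (As (er i ρ) j)) (Finset.mem_univ i), As_er_self]
  have e : ∏ j ∈ univ.erase i, rA (As (er i ρ) j) = ∏ j ∈ univ.erase i, rA (As ρ j) :=
    Finset.prod_congr rfl (fun j hj => by rw [As_er i ρ j (Finset.ne_of_mem_erase hj)])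
  rw [e]
  simp [rA]; ring

end TotRun
end

section
open ArithmeticFunction Finset
open scoped ArithmeticFunction.Moebius ArithmeticFunction.zeta ComplexConjugate

namespace TotRun

variable {D R k : ℕ}

lemma M1_le (X J : ℕ) : M1s D R k X J ≤ gam D R X J ^ k := by
  have e : gam D R X J ^ k = ∑ τ : Fin k → Finset (PT D R), ∏ j, (G X J (rA (τ j)) ^ 2 / rA (τ j)) := by
    rw [sum_prod_pi (fun (_ : Fin k) (A : Finset (PT D R)) => G X J (rA A) ^ 2 / rA A)]
    simp [gam]
  rw [e]
  refine sum_le_inj _ _ _ _ As (fun _ _ => Finset.mem_univ _) (fun ρ _ ρ' _ h => As_inj ρ ρ' h) ?_ ?_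
  · intro ρ _
    rw [Finset.prod_div_distrib, Finset.prod_pow, ← Nat.cast_prod, ← rr_eq]
    gcongr
    · exact yy_nonneg _ _ _
    · unfold yy; split_ifs
      · exact le_rfl
      · exact Finset.prod_nonneg fun j _ => G_nonneg _ _ _
  · intro τ _; exact Finset.prod_nonneg fun j _ => by positivity

lemma M1_ge_one (X J : ℕ) (hX : 1 ≤ X) (hJ : 1 ≤ J) (hR : 1 ≤ R) : 1 ≤ M1s D R k X J := by
  have h0 : rr (fun _ => none : PT D R → Option (Fin k)) = 1 := by simp [rr]
  have h1 : 1 ≤ yy X J (fun _ => none : PT D R → Option (Fin k)) := by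
    unfold yy; rw [h0, if_pos hR]
    have : ∏ j : Fin k, (1:ℝ) ≤ ∏ j : Fin k, G X J (rA (As (fun _ => none : PT D R → Option (Fin k)) j)) := by
      refine Finset.prod_le_prod (fun j _ => zero_le_one) fun j _ => ?_
      apply G_one_le _ _ _ hJ
      simpa [As, rA] using hX
    simpa using this
  have h2 := Finset.single_le_sum (f := fun ρ : PT D R → Option (Fin k) => yy X J ρ ^ 2 / rr ρ)
    (fun ρ _ => div_nonneg (sq_nonneg _) (Nat.cast_nonneg _)) (Finset.mem_univ (fun _ => none))
  simp only [h0] at h2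
  unfold M1s
  refine le_trans ?_ h2
  simp only [Nat.cast_one, div_one]; nlinarith

/-- The tuple weights. -/
noncomputable def fT (X J : ℕ) (i j : Fin k) (A : Finset (PT D R)) : ℝ :=
  if j = i then G X J (rA A) / rA A else G X J (rA A) ^ 2 / rA A

lemma fT_nonneg (X J : ℕ) (i j : Fin k) (A : Finset (PT D R)) : 0 ≤ fT X J i j A := by
  unfold fT; have := G_nonneg X J (rA A); split_ifs <;> positivity

lemma sum_fT (X J : ℕ) (i : Fin k) : ∏ j, ∑ A : Finset (PT D R), fT X J i j A = bet D R X J * gam D R X J ^ (k-1) := by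
  rw [← Finset.mul_prod_erase _ _ (Finset.mem_univ i)]
  congr 1
  · simp [fT, bet]
  · rw [Finset.prod_congr rfl (g := fun _ => gam D R X J)]
    · simp
    · intro j hj; simp [fT, Finset.ne_of_mem_erase hj, gam]

lemma fT_mem (X J : ℕ) (i j : Fin k) (p : PT D R) :
    ∑ A : Finset (PT D R), (if p ∈ A then fT X J i j A else 0) ≤ (1 / p.1 : ℝ) * ∑ A : Finset (PT D R), fT X J i j A := by
  rw [← Finset.sum_filter, Finset.mul_sum]
  refine sum_le_inj _ _ _ _ (fun A => A.erase p) (fun _ _ => Finset.mem_univ _) ?_ ?_ ?_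
  · intro A hA B hB h
    rw [Finset.mem_filter] at hA hB
    rw [← Finset.insert_erase hA.2, ← Finset.insert_erase hB.2]; rw [h]
  · intro A hA
    rw [Finset.mem_filter] at hA
    have e : rA A = p.1 * rA (A.erase p) := (Finset.mul_prod_erase _ _ hA.2).symm
    have hg : G X J (rA A) ≤ G X J (rA (A.erase p)) := G_anti _ _ (rA_mono (Finset.erase_subset _ _))
    have h0 := G_nonneg X J (rA A)
    have hp := p.pos
    have hr : (0:ℝ) < rA (A.erase p) := by exact_mod_cast rA_pos _
    have e' : (rA A : ℝ) = p.1 * rA (A.erase p) := by exact_mod_cast e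
    unfold fT
    split_ifs
    · calc G X J (rA A) / rA A ≤ G X J (rA (A.erase p)) / rA A := by gcongr
        _ = _ := by rw [e']; field_simp
    · calc G X J (rA A) ^ 2 / rA A ≤ G X J (rA (A.erase p)) ^ 2 / rA A := by gcongr
        _ = _ := by rw [e']; field_simp
  · intro A _; have := fT_nonneg X J i j A; positivity

lemma sum_inv_sq_PT : ∑ p : PT D R, (1 / (p.1:ℝ) ^ 2) ≤ 1 / (D:ℝ) ∨ D = 0 := by
  rcases Nat.eq_zero_or_pos D with h | h
  · exact Or.inr h
  left
  have h1 : ∑ p : PT D R, (1 / (p.1:ℝ) ^ 2) ≤ ∑ p ∈ Ioc D (max D R), ((p:ℝ) ^ 2)⁻¹ := by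
    refine sum_le_inj _ _ _ _ (fun p => p.1) ?_ ?_ ?_ ?_
    · intro p _; exact Finset.mem_Ioc.2 ⟨p.gt, p.le.trans (le_max_right _ _)⟩
    · intro p _ q _ h; exact Subtype.ext h
    · intro p _; rw [one_div]
    · intro p _; positivity
  have h2 := sum_Ioc_inv_sq_le_sub (α := ℝ) (k := D) (n := max D R) (by omega) (le_max_left _ _)
  have h3 : (0:ℝ) ≤ (↑(max D R))⁻¹ := by positivity
  rw [one_div]; linarith

/-- general product bound for tuples -/
lemma tup_le (X J : ℕ) (i : Fin k) (f' : Fin k → Finset (PT D R) → ℝ) (hf : ∀ j A, 0 ≤ f' j A) (t : Fin k → ℝ)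
    (h : ∀ j, ∑ A, f' j A ≤ t j * ∑ A : Finset (PT D R), fT X J i j A) :
    ∑ τ : Fin k → Finset (PT D R), ∏ j, f' j (τ j) ≤ (∏ j, t j) * (bet D R X J * gam D R X J ^ (k-1)) := by
  rw [sum_prod_pi, ← sum_fT, ← Finset.prod_mul_distrib]
  exact Finset.prod_le_prod (fun j _ => Finset.sum_nonneg fun A _ => hf j A) fun j _ => h j

lemma nondisj (X J : ℕ) (i a b : Fin k) (hab : a ≠ b) (p : PT D R) :
    ∑ τ : Fin k → Finset (PT D R), (if p ∈ τ a ∧ p ∈ τ b then ∏ j, fT X J i j (τ j) else 0) ≤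
      1 / (p.1:ℝ) ^ 2 * (bet D R X J * gam D R X J ^ (k-1)) := by
  have h := tup_le X J i (fun j A => if (j = a ∨ j = b) then (if p ∈ A then fT X J i j A else 0) else fT X J i j A)
    (fun j A => by have := fT_nonneg X J i j A; split_ifs <;> simp [this])
    (fun j => if (j = a ∨ j = b) then 1 / (p.1:ℝ) else 1) (by
      intro j
      by_cases hj : j = a ∨ j = b
      · simp only [hj, if_true]; exact fT_mem X J i j p
      · simp only [hj, if_false]; simp)
  have e1 : ∏ j : Fin k, (if (j = a ∨ j = b) then 1 / (p.1:ℝ) else 1) = 1 / (p.1:ℝ) ^ 2 := by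
    rw [← Finset.prod_filter]
    have : univ.filter (fun j : Fin k => j = a ∨ j = b) = {a, b} := by ext; simp
    rw [this, Finset.prod_pair hab]; field_simp
  rw [e1] at h
  refine le_trans (Finset.sum_le_sum fun τ _ => ?_) h
  split_ifs with h1
  · refine Finset.prod_le_prod (fun j _ => fT_nonneg X J i j _) fun j _ => ?_
    split_ifs with h2 h3
    · exact le_rfl
    · exfalso; rcases h2 with h2 | h2 <;> subst h2 <;> tauto
    · exact le_rfl
  · exact Finset.prod_nonneg fun j _ => by have := fT_nonneg X J i j (τ j); split_ifs <;> simp [this]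


lemma fT_log (X J : ℕ) (hJ : 1 ≤ J) (hR : X ^ 2 ^ J ≤ R) (hX : 3 * primorial D ≤ X) (i j : Fin k) (hj : j ≠ i) :
    ∑ A : Finset (PT D R), fT X J i j A * Real.log (rA A) ≤ 32 * J * Real.log X * ∑ A : Finset (PT D R), fT X J i j A := by
  have h1 := lmb_upper D R X J hR hX
  have h2 := gam_lower D R X J hR hX hJ
  have e1 : ∑ A : Finset (PT D R), fT X J i j A * Real.log (rA A) = lmb D R X J := by simp [fT, hj, lmb]
  have e2 : ∑ A : Finset (PT D R), fT X J i j A = gam D R X J := by simp [fT, hj, gam]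
  rw [e1, e2]
  have hl : 0 ≤ Real.log X := Real.log_natCast_nonneg X
  refine h1.trans ?_
  have := mul_le_mul_of_nonneg_left h2 (by positivity : (0:ℝ) ≤ 32 * J * Real.log X)
  refine le_trans (le_of_eq ?_) this
  ring

lemma markov (X J M : ℕ) (hJ : 1 ≤ J) (hRM : R = X ^ M) (hM : 2 * 2 ^ J ≤ M) (hM2 : 256 * k * J ≤ M) (hX : 3 * primorial D ≤ X) (i : Fin k) :
    ∑ τ : Fin k → Finset (PT D R), (if R < ∏ j, rA (τ j) then ∏ j, fT X J i j (τ j) else 0) ≤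
      1 / 4 * (bet D R X J * gam D R X J ^ (k-1)) := by
  have hX3 : 3 ≤ X := by have := primorial_pos D; omega
  have hR : X ^ 2 ^ J ≤ R := by rw [hRM]; exact Nat.pow_le_pow_right (by omega) (by omega)
  have hu : 1 ≤ Real.log X := log_ge_one X hX3
  have hL : Real.log R = M * Real.log X := by rw [hRM, log_natpow]
  have hk : 0 < k := i.pos
  have hM0 : (0:ℝ) < M := by
    have : 0 < 256 * k * J := by positivity
    exact_mod_cast (by omega : 0 < M)
  have hL0 : 0 < Real.log R := by rw [hL]; positivity
  set B := bet D R X J * gam D R X J ^ (k-1) with hB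
  have hB0 : 0 ≤ B := by
    rw [hB, ← sum_fT X J i]; exact Finset.prod_nonneg fun j _ => Finset.sum_nonneg fun A _ => fT_nonneg _ _ _ _ _
  have h1 : ∀ τ : Fin k → Finset (PT D R), (if R < ∏ j, rA (τ j) then ∏ j, fT X J i j (τ j) else 0) ≤
      2 / Real.log R * ∑ a ∈ univ.erase i, (∏ j, fT X J i j (τ j)) * Real.log (rA (τ a)) := by
    intro τ
    have hF : 0 ≤ ∏ j, fT X J i j (τ j) := Finset.prod_nonneg fun j _ => fT_nonneg _ _ _ _ _
    have hlog : ∀ a, 0 ≤ Real.log (rA (τ a)) := fun a => Real.log_natCast_nonneg _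
    have hpos : 0 ≤ 2 / Real.log R * ∑ a ∈ univ.erase i, (∏ j, fT X J i j (τ j)) * Real.log (rA (τ a)) :=
      mul_nonneg (by positivity) (Finset.sum_nonneg fun a _ => mul_nonneg hF (hlog a))
    split_ifs with h
    · by_cases hi : rA (τ i) ≤ X ^ 2 ^ J
      · have h2 : Real.log R ≤ ∑ j, Real.log (rA (τ j)) := by
          rw [← Real.log_prod (fun j _ => by exact_mod_cast (rA_pos _).ne')]
          apply Real.log_le_log
          · exact_mod_cast (by rw [hRM]; positivity : 0 < R)
          · exact_mod_cast h.le
        rw [← Finset.add_sum_erase _ _ (Finset.mem_univ i)] at h2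
        have h3 : Real.log (rA (τ i)) ≤ Real.log R / 2 := by
          calc Real.log (rA (τ i)) ≤ Real.log ((X ^ 2 ^ J : ℕ) : ℝ) := by
                apply Real.log_le_log
                · exact_mod_cast rA_pos _
                · exact_mod_cast hi
            _ = ((2 ^ J : ℕ) : ℝ) * Real.log X := log_natpow _ _
            _ ≤ _ := by
                rw [hL]
                have : ((2 * 2 ^ J : ℕ) : ℝ) ≤ M := by exact_mod_cast hM
                push_cast at this ⊢
                nlinarith
        rw [← Finset.mul_sum]
        have h4 : 1 ≤ 2 / Real.log R * ∑ a ∈ univ.erase i, Real.log (rA (τ a)) := by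
          rw [div_mul_eq_mul_div, le_div_iff₀ hL0]; linarith
        nlinarith
      · have h0 : fT X J i i (τ i) = 0 := by
          unfold fT; rw [if_pos rfl, G_zero _ _ _ (by omega) (by omega)]; simp
        rw [Finset.prod_eq_zero (Finset.mem_univ i) h0]; simp
    · exact hpos
  calc _ ≤ ∑ τ : Fin k → Finset (PT D R), 2 / Real.log R * ∑ a ∈ univ.erase i, (∏ j, fT X J i j (τ j)) * Real.log (rA (τ a)) :=
        Finset.sum_le_sum fun τ _ => h1 τ
    _ = 2 / Real.log R * ∑ a ∈ univ.erase i, ∑ τ : Fin k → Finset (PT D R), (∏ j, fT X J i j (τ j)) * Real.log (rA (τ a)) := by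
        rw [← Finset.mul_sum, Finset.sum_comm]
    _ ≤ 2 / Real.log R * ∑ a ∈ univ.erase i, 32 * J * Real.log X * B := by
        refine mul_le_mul_of_nonneg_left (Finset.sum_le_sum fun a ha => ?_) (by positivity)
        have hai := Finset.ne_of_mem_erase ha
        have h := tup_le X J i (fun j A => if j = a then fT X J i j A * Real.log (rA A) else fT X J i j A)
          (fun j A => by
            have := fT_nonneg X J i j A
            have h2 : 0 ≤ Real.log (rA A) := Real.log_natCast_nonneg _
            split_ifs <;> positivity)
          (fun j => if j = a then 32 * J * Real.log X else 1) (by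
            intro j
            by_cases hj : j = a
            · simp only [hj, if_true]; exact fT_log X J hJ hR hX i a hai
            · simp only [hj, if_false]; simp)
        rw [Finset.prod_ite_eq' univ a (fun _ => 32 * (J:ℝ) * Real.log X), if_pos (Finset.mem_univ _)] at h
        refine le_trans (le_of_eq ?_) h
        refine Finset.sum_congr rfl fun τ _ => ?_
        rw [← Finset.mul_prod_erase _ _ (Finset.mem_univ a), ← Finset.mul_prod_erase (s := univ) (fun j => if j = a then fT X J i j (τ j) * Real.log (rA (τ j)) else fT X J i j (τ j)) (Finset.mem_univ a), if_pos rfl]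
        have : ∏ j ∈ univ.erase a, (if j = a then fT X J i j (τ j) * Real.log (rA (τ j)) else fT X J i j (τ j)) = ∏ j ∈ univ.erase a, fT X J i j (τ j) :=
          Finset.prod_congr rfl fun j hj => if_neg (Finset.ne_of_mem_erase hj)
        rw [this]; ring
    _ ≤ 2 / Real.log R * (k * (32 * J * Real.log X * B)) := by
        refine mul_le_mul_of_nonneg_left ?_ (by positivity)
        rw [Finset.sum_const, nsmul_eq_mul]
        refine mul_le_mul_of_nonneg_right ?_ (by positivity)
        have : (univ.erase i).card ≤ k := by
          refine (Finset.card_le_card (Finset.erase_subset _ _)).trans ?_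
          simp
        exact_mod_cast this
    _ = (64 * k * J / M) * B := by rw [hL]; field_simp; ring
    _ ≤ _ := by
        refine mul_le_mul_of_nonneg_right ?_ hB0
        rw [div_le_iff₀ hM0]
        have : ((256 * k * J : ℕ) : ℝ) ≤ M := by exact_mod_cast hM2
        push_cast at this
        linarith

end TotRun
end

section
open ArithmeticFunction Finset
open scoped ArithmeticFunction.Moebius ArithmeticFunction.zeta ComplexConjugate

namespace TotRun

variable {D R k : ℕ}

lemma As_surj (τ : Fin k → Finset (PT D R)) (h : ∀ a b, a ≠ b → ∀ p, ¬ (p ∈ τ a ∧ p ∈ τ b)) : ∃ ρ : PT D R → Option (Fin k), As ρ = τ := by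
  classical
  refine ⟨fun p => if h : ∃ j, p ∈ τ j then some h.choose else none, ?_⟩
  funext j
  ext p
  simp only [As, Finset.mem_filter, Finset.mem_univ, true_and]
  constructor
  · intro hp
    split_ifs at hp with h1
    · have := h1.choose_spec
      rw [Option.some.inj hp] at this
      exact this
  · intro hp
    have h1 : ∃ j, p ∈ τ j := ⟨j, hp⟩
    rw [dif_pos h1]
    congr 1
    by_contra hne
    exact h _ _ hne p ⟨h1.choose_spec, hp⟩

noncomputable def Tsum (D R X J : ℕ) (i : Fin k) : ℝ :=
  ∑ ρ : PT D R → Option (Fin k), if rr ρ ≤ R then ∏ j, fT X J i j (As ρ j) else 0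

lemma T_lower (X J M : ℕ) (hJ : 1 ≤ J) (hRM : R = X ^ M) (hM : 2 * 2 ^ J ≤ M) (hM2 : 256 * k * J ≤ M) (hX : 3 * primorial D ≤ X)
    (hD : 4 * k ^ 2 ≤ D) (i : Fin k) :
    1 / 2 * (bet D R X J * gam D R X J ^ (k-1)) ≤ Tsum D R X J i := by
  classical
  have hm := markov X J M hJ hRM hM hM2 hX i
  set B := bet D R X J * gam D R X J ^ (k-1) with hB
  have hB0 : 0 ≤ B := by
    rw [hB, ← sum_fT X J i]; exact Finset.prod_nonneg fun j _ => Finset.sum_nonneg fun A _ => fT_nonneg _ _ _ _ _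
  have hBs : B = ∑ τ : Fin k → Finset (PT D R), ∏ j, fT X J i j (τ j) := by
    rw [sum_prod_pi, sum_fT]
  have hk : 0 < k := i.pos
  have hD0 : 0 < D := by have : 0 < 4 * k ^ 2 := by positivity
                         omega
  have hF : ∀ τ : Fin k → Finset (PT D R), 0 ≤ ∏ j, fT X J i j (τ j) := fun τ => Finset.prod_nonneg fun j _ => fT_nonneg _ _ _ _ _
  set N : (Fin k → Finset (PT D R)) → ℝ := fun τ => ∑ a : Fin k, ∑ b ∈ univ.erase a, ∑ p : PT D R, (if p ∈ τ a ∧ p ∈ τ b then ∏ j, fT X J i j (τ j) else 0)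
  have hN0 : ∀ τ, 0 ≤ N τ := fun τ => Finset.sum_nonneg fun a _ => Finset.sum_nonneg fun b _ => Finset.sum_nonneg fun p _ => by
    split_ifs; exacts [hF τ, le_rfl]
  have hN : ∑ τ, N τ ≤ 1 / 4 * B := by
    calc ∑ τ, N τ = ∑ a : Fin k, ∑ b ∈ univ.erase a, ∑ p : PT D R, ∑ τ : Fin k → Finset (PT D R), (if p ∈ τ a ∧ p ∈ τ b then ∏ j, fT X J i j (τ j) else 0) := by
          rw [Finset.sum_comm]; refine Finset.sum_congr rfl fun a _ => ?_
          rw [Finset.sum_comm]; refine Finset.sum_congr rfl fun b _ => ?_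
          rw [Finset.sum_comm]
      _ ≤ ∑ a : Fin k, ∑ b ∈ univ.erase a, 1 / (D:ℝ) * B := by
          refine Finset.sum_le_sum fun a _ => Finset.sum_le_sum fun b hb => ?_
          calc _ ≤ ∑ p : PT D R, 1 / (p.1:ℝ) ^ 2 * B := Finset.sum_le_sum fun p _ => nondisj X J i a b (Finset.ne_of_mem_erase hb).symm p
            _ = (∑ p : PT D R, 1 / (p.1:ℝ) ^ 2) * B := by rw [Finset.sum_mul]
            _ ≤ _ := mul_le_mul_of_nonneg_right ((sum_inv_sq_PT).resolve_right (by omega)) hB0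
      _ ≤ ∑ a : Fin k, ∑ b : Fin k, 1 / (D:ℝ) * B :=
          Finset.sum_le_sum fun a _ => Finset.sum_le_sum_of_subset_of_nonneg (Finset.erase_subset _ _) fun _ _ _ => by positivity
      _ = (k ^ 2 / D) * B := by simp; ring
      _ ≤ _ := by
          refine mul_le_mul_of_nonneg_right ?_ hB0
          have : ((4 * k ^ 2 : ℕ) : ℝ) ≤ D := by exact_mod_cast hD
          push_cast at this
          rw [div_le_iff₀ (by positivity)]; linarith
  set good : (Fin k → Finset (PT D R)) → Prop := fun τ => (∀ a b, a ≠ b → ∀ p, ¬ (p ∈ τ a ∧ p ∈ τ b)) ∧ ∏ j, rA (τ j) ≤ R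
  have hT : ∑ τ ∈ univ.filter good, ∏ j, fT X J i j (τ j) ≤ Tsum D R X J i := by
    unfold Tsum
    rw [← Finset.sum_filter]
    rw [← Finset.sum_image (g := As) (s := univ.filter fun ρ : PT D R → Option (Fin k) => rr ρ ≤ R) (f := fun τ => ∏ j, fT X J i j (τ j)) (fun ρ _ ρ' _ h => As_inj ρ ρ' h)]
    refine Finset.sum_le_sum_of_subset_of_nonneg ?_ fun τ _ _ => hF τ
    intro τ hτ
    obtain ⟨h1, h2⟩ := (Finset.mem_filter.1 hτ).2
    obtain ⟨ρ, hρ⟩ := As_surj τ h1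
    refine Finset.mem_image.2 ⟨ρ, Finset.mem_filter.2 ⟨Finset.mem_univ _, ?_⟩, hρ⟩
    rw [rr_eq, hρ]; exact h2
  have hpt : ∀ τ : Fin k → Finset (PT D R), ∏ j, fT X J i j (τ j) ≤ (if good τ then ∏ j, fT X J i j (τ j) else 0) + N τ +
      (if R < ∏ j, rA (τ j) then ∏ j, fT X J i j (τ j) else 0) := by
    intro τ
    by_cases h2 : R < ∏ j, rA (τ j)
    · rw [if_pos h2]
      have : 0 ≤ (if good τ then ∏ j, fT X J i j (τ j) else 0) := by split_ifs; exacts [hF τ, le_rfl]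
      have := hN0 τ; linarith
    · rw [if_neg h2]
      by_cases h1 : ∀ a b, a ≠ b → ∀ p, ¬ (p ∈ τ a ∧ p ∈ τ b)
      · have : good τ := ⟨h1, by omega⟩
        rw [if_pos this]
        have := hN0 τ; linarith
      · push Not at h1
        obtain ⟨a, b, hab, p, hp1, hp2⟩ := h1
        have h3 : ∏ j, fT X J i j (τ j) ≤ N τ := by
          have t0 : ∀ a b p, 0 ≤ (if p ∈ τ a ∧ p ∈ τ b then ∏ j, fT X J i j (τ j) else 0) := fun a b p => by
            split_ifs; exacts [hF τ, le_rfl]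
          calc ∏ j, fT X J i j (τ j) = (if p ∈ τ a ∧ p ∈ τ b then ∏ j, fT X J i j (τ j) else 0) := (if_pos ⟨hp1, hp2⟩).symm
            _ ≤ ∑ p : PT D R, (if p ∈ τ a ∧ p ∈ τ b then ∏ j, fT X J i j (τ j) else 0) :=
                Finset.single_le_sum (f := fun p => (if p ∈ τ a ∧ p ∈ τ b then ∏ j, fT X J i j (τ j) else 0)) (fun p _ => t0 a b p) (Finset.mem_univ p)
            _ ≤ ∑ b ∈ univ.erase a, ∑ p : PT D R, (if p ∈ τ a ∧ p ∈ τ b then ∏ j, fT X J i j (τ j) else 0) :=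
                Finset.single_le_sum (f := fun b => ∑ p : PT D R, (if p ∈ τ a ∧ p ∈ τ b then ∏ j, fT X J i j (τ j) else 0)) (fun b _ => Finset.sum_nonneg fun p _ => t0 a b p) (Finset.mem_erase.2 ⟨hab.symm, Finset.mem_univ b⟩)
            _ ≤ N τ := Finset.single_le_sum (f := fun a => ∑ b ∈ univ.erase a, ∑ p : PT D R, (if p ∈ τ a ∧ p ∈ τ b then ∏ j, fT X J i j (τ j) else 0)) (fun a _ => Finset.sum_nonneg fun b _ => Finset.sum_nonneg fun p _ => t0 a b p) (Finset.mem_univ a)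
        have : 0 ≤ (if good τ then ∏ j, fT X J i j (τ j) else 0) := by split_ifs; exacts [hF τ, le_rfl]
        linarith
  have h := Finset.sum_le_sum fun τ (_ : τ ∈ univ) => hpt τ
  rw [Finset.sum_add_distrib, Finset.sum_add_distrib, ← hBs, ← Finset.sum_filter] at h
  linarith

lemma Tsum_eq (X J : ℕ) (i : Fin k) : Tsum D R X J i = ∑ σ : PT D R → Option (Fin k),
    (∏ j ∈ univ.erase i, G X J (rA (As σ j))) / rr σ * cp X J i σ := by
  unfold Tsum cp
  rw [← Finset.sum_fiberwise (s := univ) (g := er i)]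
  refine Finset.sum_congr rfl fun σ _ => ?_
  rw [Finset.mul_sum]
  refine Finset.sum_congr rfl fun ρ hρ => ?_
  rw [Finset.mem_filter] at hρ
  obtain ⟨_, rfl⟩ := hρ
  unfold yy
  split_ifs
  · have e1 : ∏ j ∈ univ.erase i, G X J (rA (As (er i ρ) j)) = ∏ j ∈ univ.erase i, G X J (rA (As ρ j)) :=
      Finset.prod_congr rfl fun j hj => by rw [As_er i ρ j (Finset.ne_of_mem_erase hj)]
    have e2 : ∏ j, fT X J i j (As ρ j) = (G X J (rA (As ρ i)) * ∏ j ∈ univ.erase i, G X J (rA (As ρ j)) ^ 2) / rr ρ := by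
      rw [rr_eq, Nat.cast_prod, ← Finset.mul_prod_erase _ _ (Finset.mem_univ i), ← Finset.mul_prod_erase (s := univ) (fun j => (rA (As ρ j) : ℝ)) (Finset.mem_univ i),
        mul_div_mul_comm, ← Finset.prod_div_distrib]
      congr 1
      · simp [fT]
      · exact Finset.prod_congr rfl fun j hj => by simp [fT, Finset.ne_of_mem_erase hj]
    have h3 : (rr (er i ρ) : ℝ) ≠ 0 := by exact_mod_cast (rr_pos _).ne'
    have h4 : (rA (As ρ i) : ℝ) ≠ 0 := by exact_mod_cast (rA_pos _).ne'
    rw [e1, e2, ← Finset.mul_prod_erase (s := univ) (fun j => G X J (rA (As ρ j))) (Finset.mem_univ i), rr_er i ρ, Finset.prod_pow, Nat.cast_mul]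
    field_simp
  · simp

lemma T_sq (X J : ℕ) (i : Fin k) : Tsum D R X J i ^ 2 ≤ gam D R X J ^ (k-1) * M2s D R X J i := by
  classical
  set s : Finset (PT D R → Option (Fin k)) := univ.filter fun σ => As σ i = ∅
  have e : Tsum D R X J i = ∑ σ ∈ s, (∏ j ∈ univ.erase i, G X J (rA (As σ j))) / rr σ * cp X J i σ := by
    rw [Tsum_eq, Finset.sum_filter_of_ne]
    intro σ _ h
    by_contra hne
    obtain ⟨p, hp⟩ := Finset.nonempty_iff_ne_empty.2 hne
    exact h (by rw [cp_zero X J i σ p (Finset.mem_filter.1 hp).2, mul_zero])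
  have h1 : Tsum D R X J i ^ 2 ≤ (∑ σ ∈ s, (∏ j ∈ univ.erase i, G X J (rA (As σ j))) ^ 2 / rr σ) * ∑ σ ∈ s, cp X J i σ ^ 2 / rr σ := by
    rw [e]
    refine Finset.sum_sq_le_sum_mul_sum_of_sq_eq_mul _ (fun σ _ => by positivity) (fun σ _ => by positivity) fun σ _ => ?_
    have h3 : (rr σ : ℝ) ≠ 0 := by exact_mod_cast (rr_pos _).ne'
    field_simp
  refine h1.trans (mul_le_mul ?_ ?_ (Finset.sum_nonneg fun σ _ => by positivity) ?_)
  · have e2 : gam D R X J ^ (k-1) = ∑ τ : Fin k → Finset (PT D R), ∏ j, (if j = i then (if τ j = ∅ then 1 else 0) else G X J (rA (τ j)) ^ 2 / rA (τ j)) := by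
      rw [sum_prod_pi (fun (j : Fin k) (A : Finset (PT D R)) => if j = i then (if A = ∅ then (1:ℝ) else 0) else G X J (rA A) ^ 2 / rA A),
        ← Finset.mul_prod_erase _ _ (Finset.mem_univ i), Finset.prod_congr (s₂ := univ.erase i) rfl (g := fun _ => gam D R X J)]
      · simp
      · intro j hj; simp [Finset.ne_of_mem_erase hj, gam]
    rw [e2]
    refine sum_le_inj _ _ _ _ As (fun _ _ => Finset.mem_univ _) (fun ρ _ ρ' _ h => As_inj ρ ρ' h) ?_ ?_
    · intro σ hσ
      have hσ' : As σ i = ∅ := (Finset.mem_filter.1 hσ).2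
      rw [rr_eq, Nat.cast_prod, ← Finset.mul_prod_erase _ _ (Finset.mem_univ i), ← Finset.mul_prod_erase (s := univ) _ (Finset.mem_univ i), hσ']
      rw [if_pos rfl, if_pos rfl]
      have : ∏ j ∈ univ.erase i, (if j = i then (if As σ j = ∅ then (1:ℝ) else 0) else G X J (rA (As σ j)) ^ 2 / rA (As σ j)) =
        ∏ j ∈ univ.erase i, (G X J (rA (As σ j)) ^ 2 / rA (As σ j)) := Finset.prod_congr rfl fun j hj => if_neg (Finset.ne_of_mem_erase hj)
      rw [this, Finset.prod_div_distrib, Finset.prod_pow]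
      simp [rA]
    · intro τ _
      refine Finset.prod_nonneg fun j _ => ?_
      split_ifs <;> positivity
  · exact Finset.sum_le_sum_of_subset_of_nonneg (Finset.filter_subset _ _) fun σ _ _ => by positivity
  · exact pow_nonneg (Finset.sum_nonneg fun A _ => by positivity) _

lemma M2_lower (X J M : ℕ) (hJ : 1 ≤ J) (hRM : R = X ^ M) (hM : 2 * 2 ^ J ≤ M) (hM2 : 256 * k * J ≤ M) (hX : 3 * primorial D ≤ X)
    (hD : 4 * k ^ 2 ≤ D) (i : Fin k) :
    (J:ℝ) ^ 2 * (((primorial D).totient : ℝ) / primorial D) * Real.log X / 512 * M1s D R k X J ≤ M2s D R X J i := by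
  have hX3 : 3 ≤ X := by have := primorial_pos D; omega
  have hR : X ^ 2 ^ J ≤ R := by rw [hRM]; exact Nat.pow_le_pow_right (by omega) (by omega)
  have hu : 1 ≤ Real.log X := log_ge_one X hX3
  have hT := T_lower X J M hJ hRM hM hM2 hX hD i
  have hT2 := T_sq (D := D) (R := R) X J i
  have hb := bet_lower D R X J hR hX
  have hg := gam_lower D R X J hR hX hJ
  have hg2 := gam_upper D R X J hR hX
  have hm := M1_le (D := D) (R := R) (k := k) X J
  set κ := (((primorial D).totient : ℝ) / primorial D)
  have hκ : 0 < κ := div_pos (by exact_mod_cast Nat.totient_pos.2 (primorial_pos D)) (by exact_mod_cast primorial_pos D)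
  set β := bet D R X J
  set γ := gam D R X J
  set u := Real.log X
  have hγ : 0 < γ := lt_of_lt_of_le (by positivity) hg
  have hβ : 0 ≤ β := le_trans (by positivity) hb
  have hk : γ ^ k = γ ^ (k-1) * γ := by rw [← pow_succ]; congr 1; have := i.pos; omega
  have h1 : (1/2 * (β * γ ^ (k-1))) ^ 2 ≤ γ ^ (k-1) * M2s D R X J i := (pow_le_pow_left₀ (by positivity) hT 2).trans hT2
  have h2 : β ^ 2 / 4 * γ ^ (k-1) ≤ M2s D R X J i := by
    have hp : 0 < γ ^ (k-1) := by positivity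
    refine le_of_mul_le_mul_left ?_ hp
    refine le_trans (le_of_eq ?_) h1
    ring
  have h3 : J ^ 2 * κ * u / 512 * γ ≤ β ^ 2 / 4 := by
    calc J ^ 2 * κ * u / 512 * γ ≤ J ^ 2 * κ * u / 512 * (32 * κ * u) := by gcongr
      _ = (J * κ * u / 2) ^ 2 / 4 := by ring
      _ ≤ _ := by gcongr
  calc _ ≤ J ^ 2 * κ * u / 512 * γ ^ k := by gcongr
    _ = (J ^ 2 * κ * u / 512 * γ) * γ ^ (k-1) := by rw [hk]; ring
    _ ≤ β ^ 2 / 4 * γ ^ (k-1) := by gcongr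
    _ ≤ _ := h2

end TotRun
end

section
set_option exponentiation.threshold 2000
open ArithmeticFunction Finset
open scoped ArithmeticFunction.Moebius ArithmeticFunction.zeta ComplexConjugate

namespace TotRun

lemma per_two (Q1 Q2 : ℕ) (h1 : 0 < Q1) (h2 : 0 < Q2) (hc : Nat.Coprime Q1 Q2) (f g : ℕ → ℂ)
    (hf : ∀ n, f (n % Q1) = f n) (hg : ∀ n, g (n % Q2) = g n) :
    ∑ n ∈ range (Q1 * Q2), f n * g n = (∑ n ∈ range Q1, f n) * ∑ n ∈ range Q2, g n := by
  rw [Finset.sum_mul_sum, ← Finset.sum_product']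
  refine Finset.sum_nbij (fun n => (n % Q1, n % Q2)) ?_ ?_ ?_ ?_
  · intro n _
    exact Finset.mem_product.2 ⟨Finset.mem_range.2 (Nat.mod_lt _ h1), Finset.mem_range.2 (Nat.mod_lt _ h2)⟩
  · intro a ha b hb h
    simp only [Finset.coe_range, Set.mem_Iio] at ha hb
    simp only [Prod.mk.injEq] at h
    have := (Nat.modEq_and_modEq_iff_modEq_mul hc).1 ⟨h.1, h.2⟩
    unfold Nat.ModEq at this
    rwa [Nat.mod_eq_of_lt ha, Nat.mod_eq_of_lt hb] at this
  · rintro ⟨a, b⟩ hab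
    simp only [Finset.coe_product, Finset.coe_range, Set.mem_prod, Set.mem_Iio] at hab
    refine ⟨(Nat.chineseRemainder hc a b).1, ?_, ?_⟩
    · simp only [Finset.coe_range, Set.mem_Iio]
      exact Nat.chineseRemainder_lt_mul hc a b h1.ne' h2.ne'
    · have h3 : (Nat.chineseRemainder hc a b).1 % Q1 = a % Q1 := (Nat.chineseRemainder hc a b).2.1
      have h4 : (Nat.chineseRemainder hc a b).1 % Q2 = b % Q2 := (Nat.chineseRemainder hc a b).2.2
      simp only [h3, h4, Nat.mod_eq_of_lt hab.1, Nat.mod_eq_of_lt hab.2]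
  · intro n _
    simp only
    rw [hf, hg]

lemma mod_dvd (Q q : ℕ) (h : q ∣ Q) (f : ℕ → ℂ) (hf : ∀ n, f (n % q) = f n) (n : ℕ) : f (n % Q) = f n := by
  rw [← hf (n % Q), Nat.mod_mod_of_dvd _ h, hf]

lemma per_prod {ι : Type} [DecidableEq ι] (S : Finset ι) (q : ι → ℕ) (hq : ∀ i ∈ S, 0 < q i) (hc : ∀ i ∈ S, ∀ j ∈ S, i ≠ j → Nat.Coprime (q i) (q j))
    (f : ι → ℕ → ℂ) (hf : ∀ i ∈ S, ∀ n, f i (n % q i) = f i n) :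
    (∀ n, ∏ i ∈ S, f i (n % ∏ i ∈ S, q i) = ∏ i ∈ S, f i n) ∧
    ∑ n ∈ range (∏ i ∈ S, q i), ∏ i ∈ S, f i n = ∏ i ∈ S, ∑ n ∈ range (q i), f i n := by
  constructor
  · intro n
    exact Finset.prod_congr rfl fun i hi => mod_dvd _ _ (Finset.dvd_prod_of_mem q hi) _ (hf i hi) n
  induction S using Finset.induction_on with
  | empty => simp
  | insert a s ha ih =>
    have ih' := ih (fun i hi => hq i (Finset.mem_insert_of_mem hi)) (fun i hi j hj => hc i (Finset.mem_insert_of_mem hi) j (Finset.mem_insert_of_mem hj))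
      (fun i hi => hf i (Finset.mem_insert_of_mem hi))
    rw [Finset.prod_insert ha, Finset.prod_insert ha, ← ih']
    simp_rw [Finset.prod_insert ha]
    refine per_two _ _ (hq a (Finset.mem_insert_self _ _)) (Finset.prod_pos fun i hi => hq i (Finset.mem_insert_of_mem hi)) ?_ _ _ (hf a (Finset.mem_insert_self _ _)) ?_
    · refine Nat.Coprime.prod_right fun i hi => hc _ (Finset.mem_insert_self _ _) _ (Finset.mem_insert_of_mem hi) ?_
      rintro rfl; exact ha hi
    · intro n
      exact Finset.prod_congr rfl fun i hi => mod_dvd _ _ (Finset.dvd_prod_of_mem q hi) _ (hf i (Finset.mem_insert_of_mem hi)) n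

lemma per_partial (Q : ℕ) (hQ : 0 < Q) (f : ℕ → ℂ) (hf : ∀ n, f (n % Q) = f n) (h1 : ∀ n, ‖f n‖ ≤ 1) (N : ℕ) :
    ‖∑ n ∈ Ioc 0 N, (f n - (∑ n ∈ range Q, f n) / Q)‖ ≤ 2 * Q := by
  set mu := (∑ n ∈ range Q, f n) / Q with hmu
  have hQ' : (Q:ℂ) ≠ 0 := by exact_mod_cast hQ.ne'
  have hmu1 : ‖mu‖ ≤ 1 := by
    rw [hmu, norm_div, Complex.norm_natCast, div_le_one (by exact_mod_cast hQ)]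
    refine (norm_sum_le _ _).trans ((Finset.sum_le_sum fun n _ => h1 n).trans ?_)
    simp
  set g : ℕ → ℂ := fun n => f n - mu with hg
  have hgp : ∀ q n, g (Q * q + n) = g n := by
    intro q n; simp only [hg]; rw [← hf, Nat.mul_add_mod, hf]
  have hg0 : ∑ n ∈ range Q, g n = 0 := by
    simp only [hg]; rw [Finset.sum_sub_distrib]; simp; rw [hmu]; field_simp; simp
  have hg2 : ∀ n, ‖g n‖ ≤ 2 := fun n => (norm_sub_le _ _).trans (by linarith [h1 n])
  have hz : ∀ q, ∑ n ∈ range (Q * q), g n = 0 := by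
    intro q
    induction q with
    | zero => simp
    | succ q ih => rw [Nat.mul_succ, Finset.sum_range_add, ih]; simp_rw [hgp]; rw [hg0]; simp
  have hb : ‖∑ n ∈ range (N+1), g n‖ ≤ 2 * (Q - 1) := by
    rw [← Nat.div_add_mod (N+1) Q, Finset.sum_range_add, hz, zero_add]; simp_rw [hgp]
    refine (norm_sum_le _ _).trans ((Finset.sum_le_sum fun n _ => hg2 n).trans ?_)
    simp only [Finset.sum_const, Finset.card_range, nsmul_eq_mul]
    have : (N+1) % Q + 1 ≤ Q := Nat.mod_lt _ hQ
    have : (((N+1) % Q : ℕ):ℝ) + 1 ≤ Q := by exact_mod_cast this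
    linarith
  have e : ∑ n ∈ range (N+1), g n = g 0 + ∑ n ∈ Ioc 0 N, g n := by
    rw [Finset.range_eq_Ico, Finset.sum_eq_sum_Ico_succ_bot (by omega)]
    congr 1
  have e2 : ∑ n ∈ Ioc 0 N, g n = ∑ n ∈ range (N+1), g n - g 0 := by rw [e]; ring
  rw [e2]
  refine (norm_sub_le _ _).trans ?_
  linarith [hg2 0]

noncomputable def Gh (R : ℕ) : ℝ := ∑ n ∈ Ioc 0 (R ^ 600), hat R n / n

lemma hat_sum_split (R : ℕ) (hR : 1 ≤ R) (f : ℕ → ℂ) : ∑ n ∈ Ioc 0 (R ^ 600), f n * ((hat R n / n : ℝ) : ℂ) = ∑ n ∈ Ioc (R^200) (R ^ 600), f n * ((hat R n / n : ℝ) : ℂ) := by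
  have h : R ^ 200 ≤ R ^ 600 := Nat.pow_le_pow_right hR (by norm_num)
  symm
  refine Finset.sum_subset (Finset.Ioc_subset_Ioc_left (Nat.zero_le _)) fun n hn hn' => ?_
  rw [Finset.mem_Ioc] at hn hn'
  rw [hat_lo R n (by omega)]; simp

lemma smooth_mean (R : ℕ) (hR : 3 ≤ R) (Q : ℕ) (hQ : 0 < Q) (f : ℕ → ℂ) (hf : ∀ n, f (n % Q) = f n) (h1 : ∀ n, ‖f n‖ ≤ 1) :
    ‖∑ n ∈ Ioc 0 (R ^ 600), f n * ((hat R n / n : ℝ) : ℂ) - (∑ n ∈ range Q, f n) / Q * (Gh R : ℝ)‖ ≤ 2400 * Q * Real.log R / R ^ 200 := by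
  have hL := log_ge_one R hR
  set mu := (∑ n ∈ range Q, f n) / Q with hmu
  have e : ∑ n ∈ Ioc 0 (R ^ 600), f n * ((hat R n / n : ℝ) : ℂ) - mu * (Gh R : ℝ) = ∑ n ∈ Ioc (R^200) (R ^ 600), (f n - mu) * ((hat R n / n : ℝ) : ℂ) := by
    rw [← hat_sum_split R (by omega)]
    simp_rw [sub_mul]; rw [Finset.sum_sub_distrib, ← Finset.mul_sum, Gh, Complex.ofReal_sum]
  rw [e]
  refine (abel_u (fun n => f n - mu) (hat R) (2 * Q) (200 * Real.log R) (by positivity) (per_partial Q hQ f hf h1) _ _ (fun n _ => hat_abs R n) ?_).trans ?_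
  · intro n hn
    have := hat_step R 1 n le_rfl (by omega)
    simp only [one_mul] at this
    refine this.trans ?_
    gcongr
    linarith
  · have hR' : (0:ℝ) < (R:ℝ) ^ 200 := by positivity
    push_cast
    rw [show 6 * (2 * (Q:ℝ)) * (200 * Real.log R) = 2400 * Q * Real.log R by ring]
    gcongr
    linarith

lemma Gh_le (R : ℕ) (hR : 3 ≤ R) : Gh R ≤ 120200 * Real.log R ^ 2 := by
  have hL := log_ge_one R hR
  have h := harm_le (R ^ 600)
  rw [log_natpow] at h
  calc Gh R ≤ ∑ n ∈ Ioc 0 (R ^ 600), 200 * Real.log R * (1 / (n:ℝ)) := by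
        refine Finset.sum_le_sum fun n hn => ?_
        rw [mul_one_div]
        gcongr
        exact hat_le R n
    _ = 200 * Real.log R * ∑ n ∈ Ioc 0 (R ^ 600), (1 / (n:ℝ)) := by rw [Finset.mul_sum]
    _ ≤ 200 * Real.log R * (1 + 600 * Real.log R) := by gcongr; exact_mod_cast h
    _ ≤ _ := by nlinarith

lemma Gh_nonneg (R : ℕ) : 0 ≤ Gh R := Finset.sum_nonneg fun n _ => div_nonneg (hat_nonneg _ _) (Nat.cast_nonneg _)

end TotRun
end

section
set_option exponentiation.threshold 2000
open ArithmeticFunction Finset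
open scoped ArithmeticFunction.Moebius ArithmeticFunction.zeta ComplexConjugate

namespace TotRun
variable {D R k : ℕ}

def supp (ρ : PT D R → Option (Fin k)) : Finset (PT D R) := univ.filter fun p => ρ p ≠ none

lemma rr_supp (ρ : PT D R → Option (Fin k)) : rr ρ = rA (supp ρ) := by
  unfold rr rA supp
  rw [Finset.prod_filter]
  exact Finset.prod_congr rfl fun p _ => by by_cases h : ρ p = none <;> simp [h]

lemma rA_union (A B : Finset (PT D R)) : rA (A ∪ B) ≤ rA A * rA B := by
  have : rA (A ∪ B) * rA (A ∩ B) = rA A * rA B := Finset.prod_union_inter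
  rw [← this]; exact Nat.le_mul_of_pos_right _ (rA_pos _)

lemma coprime_PT (p q : PT D R) (h : p ≠ q) : Nat.Coprime p.1 q.1 :=
  (Nat.coprime_primes p.prime q.prime).2 fun h2 => h (Subtype.ext h2)

/-- mean of a `p`-periodic function -/
noncomputable def mn (q : ℕ) (f : ℕ → ℂ) : ℂ := (∑ n ∈ range q, f n) / q

lemma prod_mean (S : Finset (PT D R)) (f : PT D R → ℕ → ℂ) (hf : ∀ p n, f p (n % p.1) = f p n)
    (W : ℕ) (hW : 0 < W) (hWc : ∀ p : PT D R, Nat.Coprime W p.1) (e : ℕ → ℂ) (he : ∀ n, e (n % W) = e n) :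
    (∑ n ∈ range (W * rA S), e n * ∏ p ∈ S, f p n) / ((W * rA S : ℕ) : ℂ) = mn W e * ∏ p ∈ S, mn p.1 (f p) := by
  have h := per_prod S (fun p => p.1) (fun p _ => p.prime.pos) (fun p _ q _ h => coprime_PT p q h) f (fun p _ => hf p)
  have h2 := per_two W (rA S) hW (rA_pos S) (Nat.Coprime.prod_right fun p _ => hWc p) e (fun n => ∏ p ∈ S, f p n) he h.1
  rw [h2]
  unfold mn
  rw [show ∑ n ∈ range (rA S), ∏ p ∈ S, f p n = _ from h.2, Finset.prod_div_distrib, Nat.cast_mul, mul_div_mul_comm]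
  congr 2
  unfold rA; push_cast; rfl

lemma form_mean (E : Finset (PT D R)) (hR : 3 ≤ R) (W : ℕ) (hW : 0 < W) (hWc : ∀ p : PT D R, Nat.Coprime W p.1) (e : ℕ → ℂ)
    (he : ∀ n, e (n % W) = e n) (he1 : ∀ n, ‖e n‖ ≤ 1)
    (g : PT D R → Option (Fin k) → Option (Fin k) → ℕ → ℂ) (hg1 : ∀ p o o' n, ‖g p o o' n‖ ≤ 1)
    (hgp : ∀ p o o' n, g p o o' (n % p.1) = g p o o' n) (hg0 : ∀ p ∉ E, ∀ n, g p none none n = 1)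
    (c : (PT D R → Option (Fin k)) → ℝ) (hc : ∀ ρ, c ρ ≠ 0 → rr ρ ≤ R) :
    ‖∑ n ∈ Ioc 0 (R ^ 600), (e n * ∑ ρ, ∑ ρ', (c ρ : ℂ) * c ρ' * ∏ p, g p (ρ p) (ρ' p) n) * ((hat R n / n : ℝ) : ℂ)
      - mn W e * (∑ ρ, ∑ ρ', (c ρ : ℂ) * c ρ' * ∏ p, mn p.1 (g p (ρ p) (ρ' p))) * (Gh R : ℝ)‖
      ≤ (∑ ρ, |c ρ|) ^ 2 * (2400 * (W * rA E * R ^ 2) * Real.log R / R ^ 200) := by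
  have hL := log_ge_one R hR
  set err : ℝ := 2400 * (W * rA E * R ^ 2) * Real.log R / R ^ 200
  have herr : 0 ≤ err := by positivity
  have e1 : ∑ n ∈ Ioc 0 (R ^ 600), (e n * ∑ ρ, ∑ ρ', (c ρ : ℂ) * c ρ' * ∏ p, g p (ρ p) (ρ' p) n) * ((hat R n / n : ℝ) : ℂ)
      - mn W e * (∑ ρ, ∑ ρ', (c ρ : ℂ) * c ρ' * ∏ p, mn p.1 (g p (ρ p) (ρ' p))) * (Gh R : ℝ) =
      ∑ ρ, ∑ ρ', (c ρ : ℂ) * c ρ' * (∑ n ∈ Ioc 0 (R ^ 600), (e n * ∏ p, g p (ρ p) (ρ' p) n) * ((hat R n / n : ℝ) : ℂ)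
        - mn W e * (∏ p, mn p.1 (g p (ρ p) (ρ' p))) * (Gh R : ℝ)) := by
    simp_rw [mul_sub, Finset.sum_sub_distrib]
    congr 1
    · simp_rw [Finset.mul_sum, Finset.sum_mul]
      rw [Finset.sum_comm]
      refine Finset.sum_congr rfl fun ρ _ => ?_
      rw [Finset.sum_comm]
      refine Finset.sum_congr rfl fun ρ' _ => Finset.sum_congr rfl fun n _ => by ring
    · simp_rw [Finset.mul_sum, Finset.sum_mul]
      refine Finset.sum_congr rfl fun ρ _ => Finset.sum_congr rfl fun ρ' _ => by ring
  rw [e1]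
  have key : ∀ ρ ρ', ‖(c ρ : ℂ) * c ρ' * (∑ n ∈ Ioc 0 (R ^ 600), (e n * ∏ p, g p (ρ p) (ρ' p) n) * ((hat R n / n : ℝ) : ℂ)
        - mn W e * (∏ p, mn p.1 (g p (ρ p) (ρ' p))) * (Gh R : ℝ))‖ ≤ |c ρ| * |c ρ'| * err := by
    intro ρ ρ'
    by_cases h1 : c ρ = 0
    · simp [h1]
    by_cases h2 : c ρ' = 0
    · simp [h2]
    have h1' := hc ρ h1
    have h2' := hc ρ' h2
    rw [norm_mul, norm_mul, Complex.norm_real, Complex.norm_real, Real.norm_eq_abs, Real.norm_eq_abs]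
    refine mul_le_mul_of_nonneg_left ?_ (by positivity)
    set S := E ∪ supp ρ ∪ supp ρ' with hS
    have hout : ∀ p ∉ S, ρ p = none ∧ ρ' p = none ∧ p ∉ E := by
      intro p hp
      simp only [hS, Finset.mem_union, supp, Finset.mem_filter, Finset.mem_univ, true_and] at hp
      tauto
    have p1 : ∀ n, ∏ p, g p (ρ p) (ρ' p) n = ∏ p ∈ S, g p (ρ p) (ρ' p) n := by
      intro n; symm
      refine Finset.prod_subset (Finset.subset_univ _) fun p _ hp => ?_
      obtain ⟨a, b, c⟩ := hout p hp
      rw [a, b, hg0 p c]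
    have p2 : ∏ p, mn p.1 (g p (ρ p) (ρ' p)) = ∏ p ∈ S, mn p.1 (g p (ρ p) (ρ' p)) := by
      symm
      refine Finset.prod_subset (Finset.subset_univ _) fun p _ hp => ?_
      obtain ⟨a, b, c⟩ := hout p hp
      rw [a, b]
      unfold mn
      simp_rw [hg0 p c]
      have := p.prime.ne_zero
      simp [this]
    simp_rw [p1]
    rw [p2, ← prod_mean S (fun p => g p (ρ p) (ρ' p)) (fun p n => hgp p _ _ n) W hW hWc e he]
    have hQ : 0 < W * rA S := Nat.mul_pos hW (rA_pos S)
    have hper := per_prod S (fun p => p.1) (fun p _ => p.prime.pos) (fun p _ q _ h => coprime_PT p q h) (fun p => g p (ρ p) (ρ' p)) (fun p _ n => hgp p _ _ n)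
    refine (smooth_mean R hR (W * rA S) hQ (fun n => e n * ∏ p ∈ S, g p (ρ p) (ρ' p) n) ?_ ?_).trans ?_
    · intro n
      rw [mod_dvd (W * rA S) W (Dvd.intro _ rfl) e he, mod_dvd (W * rA S) (rA S) (Dvd.intro_left _ rfl) (fun n => ∏ p ∈ S, g p (ρ p) (ρ' p) n) hper.1]
    · intro n
      rw [norm_mul, norm_prod]
      exact mul_le_one₀ (he1 n) (Finset.prod_nonneg fun _ _ => norm_nonneg _) (Finset.prod_le_one (fun _ _ => norm_nonneg _) fun p _ => hg1 _ _ _ _)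
    · have hS2 : rA S ≤ rA E * R ^ 2 := by
        calc rA S ≤ rA E * rA (supp ρ) * rA (supp ρ') := (rA_union _ _).trans (Nat.mul_le_mul_right _ (rA_union _ _))
          _ ≤ rA E * R * R := by
            rw [← rr_supp, ← rr_supp]; gcongr
          _ = _ := by ring
      have hS3 : ((W * rA S : ℕ) : ℝ) ≤ W * rA E * R ^ 2 := by
        have : W * rA S ≤ W * rA E * R ^ 2 := by rw [mul_assoc]; gcongr
        exact_mod_cast this
      simp only [err]
      gcongr
  refine (norm_sum_le _ _).trans ((Finset.sum_le_sum fun ρ _ => (norm_sum_le _ _).trans (Finset.sum_le_sum fun ρ' _ => key ρ ρ')).trans (le_of_eq ?_))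
  rw [sq, Finset.sum_mul_sum, Finset.sum_mul]
  refine Finset.sum_congr rfl fun ρ _ => ?_
  rw [Finset.sum_mul]

end TotRun
end

section
set_option exponentiation.threshold 2000
open ArithmeticFunction Finset
open scoped ArithmeticFunction.Moebius ArithmeticFunction.zeta ComplexConjugate

namespace TotRun
variable {D R k : ℕ}

noncomputable def ff (h : Fin k → ℕ) (p : ℕ) (o : Option (Fin k)) (n : ℕ) : ℝ :=
  o.elim 1 fun j => 1 / (p:ℝ) - (if p ∣ n + h j then 1 else 0)

@[simp] lemma ff_none (h : Fin k → ℕ) (p n : ℕ) : ff h p none n = 1 := rfl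
lemma ff_some (h : Fin k → ℕ) (p n : ℕ) (j : Fin k) : ff h p (some j) n = 1 / (p:ℝ) - (if p ∣ n + h j then 1 else 0) := rfl

noncomputable def Zs (D R X J : ℕ) (h : Fin k → ℕ) (n : ℕ) : ℝ :=
  ∑ ρ : PT D R → Option (Fin k), yy X J ρ * ∏ p, ff h p.1 (ρ p) n

lemma ff_abs (h : Fin k → ℕ) (p : ℕ) (hp : 1 ≤ p) (o : Option (Fin k)) (n : ℕ) : |ff h p o n| ≤ 1 := by
  rcases o with _ | j
  · simp
  · rw [ff_some]
    have h1 : (1:ℝ) / p ≤ 1 := by rw [div_le_one (by exact_mod_cast hp)]; exact_mod_cast hp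
    have h2 : (0:ℝ) ≤ 1 / p := by positivity
    rw [abs_le]; split_ifs <;> constructor <;> linarith

lemma ff_mod (h : Fin k → ℕ) (p : ℕ) (o : Option (Fin k)) (n : ℕ) : ff h p o (n % p) = ff h p o n := by
  rcases o with _ | j
  · rfl
  · rw [ff_some, ff_some]
    have : p ∣ n % p + h j ↔ p ∣ n + h j := by
      rw [Nat.dvd_iff_mod_eq_zero, Nat.dvd_iff_mod_eq_zero, Nat.mod_add_mod]
    simp [this]

lemma ind_mod (p s n : ℕ) : (p ∣ n % p + s) ↔ p ∣ n + s := by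
  rw [Nat.dvd_iff_mod_eq_zero, Nat.dvd_iff_mod_eq_zero, Nat.mod_add_mod]

lemma cnt (p s : ℕ) (hp : 0 < p) : ∑ n ∈ range p, (if p ∣ n + s then (1:ℝ) else 0) = 1 := by
  rw [Finset.sum_eq_single ((p - s % p) % p)]
  · rw [if_pos]
    rw [Nat.dvd_iff_mod_eq_zero, Nat.mod_add_mod, Nat.add_mod, ]
    have h1 := Nat.mod_lt s hp
    rcases Nat.eq_zero_or_pos (s % p) with h | h
    · simp [h]
    · rw [Nat.mod_eq_of_lt (by omega : p - s % p < p), Nat.sub_add_cancel h1.le, Nat.mod_self]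
  · intro n hn hne
    rw [if_neg]
    intro hd
    apply hne
    have hn' := Finset.mem_range.1 hn
    have h1 := Nat.mod_lt s hp
    rw [Nat.dvd_iff_mod_eq_zero, Nat.add_mod, Nat.mod_eq_of_lt hn'] at hd
    obtain ⟨c, hc⟩ := Nat.dvd_of_mod_eq_zero hd
    have hc2 : c < 2 := by
      by_contra h
      have : p * 2 ≤ p * c := Nat.mul_le_mul_left _ (by omega)
      omega
    interval_cases c
    · have : s % p = 0 := by omega
      have : n = 0 := by omega
      simp [*]
    · rw [Nat.mod_eq_of_lt (by omega)]; omega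
  · intro h; exact absurd (Finset.mem_range.2 (Nat.mod_lt _ hp)) h

noncomputable def aB (p : ℕ) (o o' : Option (Fin k)) : ℝ :=
  match o, o' with
  | none, none => 1
  | none, some _ => 0
  | some _, none => 0
  | some i, some j => if i = j then 1 / (p:ℝ) else 1 / (p:ℝ) ^ 2

lemma aB_symm (p : ℕ) (o o' : Option (Fin k)) : aB p o o' = aB p o' o := by
  rcases o with _ | i <;> rcases o' with _ | j <;> simp [aB, eq_comm]

lemma ff_zero (h : Fin k → ℕ) (p : ℕ) (hp : 0 < p) (i : Fin k) : ∑ n ∈ range p, ff h p (some i) n = 0 := by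
  simp_rw [ff_some]
  rw [Finset.sum_sub_distrib, cnt p _ hp]
  have : (p:ℝ) ≠ 0 := by exact_mod_cast hp.ne'
  simp [this]

lemma ff_mean (h : Fin k → ℕ) (p : ℕ) (hp : 0 < p) (hh : ∀ i j, i ≠ j → ∀ n, ¬ (p ∣ n + h i ∧ p ∣ n + h j)) (o o' : Option (Fin k)) :
    |(∑ n ∈ range p, ff h p o n * ff h p o' n) / p| ≤ aB p o o' := by
  have hp' : (0:ℝ) < p := by exact_mod_cast hp
  have hp1 : (1:ℝ) ≤ p := by exact_mod_cast hp
  rcases o with _ | i <;> rcases o' with _ | j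
  · simp [aB, hp'.ne']
  · simp only [ff_none, one_mul, ff_zero h p hp j]; simp [aB]
  · simp only [ff_none, mul_one, ff_zero h p hp i]; simp [aB]
  · have e : ∀ n, ff h p (some i) n * ff h p (some j) n = 1 / (p:ℝ)^2 - (1/p) * (if p ∣ n + h i then 1 else 0) - (1/p) * (if p ∣ n + h j then 1 else 0)
        + (if i = j then (if p ∣ n + h i then 1 else 0) else 0) := by
      intro n
      rw [ff_some, ff_some]
      by_cases hij : i = j
      · subst hij
        by_cases h1 : p ∣ n + h i <;> simp [h1] <;> field_simp <;> ring
      · have := hh i j hij n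
        by_cases h1 : p ∣ n + h i <;> by_cases h2 : p ∣ n + h j
        · exact absurd ⟨h1, h2⟩ this
        all_goals simp [h1, h2, hij] <;> field_simp <;> ring
    simp_rw [e]
    rw [Finset.sum_add_distrib, Finset.sum_sub_distrib, Finset.sum_sub_distrib, ← Finset.mul_sum, ← Finset.mul_sum, cnt p _ hp, cnt p _ hp]
    by_cases hij : i = j
    · subst hij
      simp only [if_true, aB]
      rw [cnt p _ hp]
      simp only [Finset.sum_const, Finset.card_range, nsmul_eq_mul]
      have e2 : ((p:ℝ) * (1 / (p:ℝ)^2) - 1/p * 1 - 1/p*1 + 1) / p = (1 - 1/p) * (1/p) := by field_simp; ring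
      rw [e2]
      have h1 : (1:ℝ) / p ≤ 1 := by rw [div_le_one hp']; exact hp1
      have h2 : (0:ℝ) < 1 / p := by positivity
      rw [abs_of_nonneg (mul_nonneg (by linarith) h2.le)]
      nlinarith
    · simp only [hij, if_false, aB]
      simp only [Finset.sum_const, Finset.card_range, nsmul_eq_mul]
      have e2 : ((p:ℝ) * (1 / (p:ℝ)^2) - 1/p * 1 - 1/p*1 + (p:ℝ) * 0) / p = - (1/(p:ℝ)^2) := by field_simp; ring
      rw [e2, abs_neg, abs_of_nonneg (by positivity)]

lemma prod_exp_bound (a : ℝ) (ha : 0 ≤ a) (hD : 0 < D) (haD : 2 * a ≤ D) : ∏ p : PT D R, (1 + a / (p.1:ℝ) ^ 2) ≤ 2 := by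
  calc ∏ p : PT D R, (1 + a / (p.1:ℝ) ^ 2) ≤ ∏ p : PT D R, Real.exp (a / (p.1:ℝ) ^ 2) :=
        Finset.prod_le_prod (fun p _ => by positivity) fun p _ => by rw [add_comm]; exact Real.add_one_le_exp _
    _ = Real.exp (a * ∑ p : PT D R, 1 / (p.1:ℝ)^2) := by rw [← Real.exp_sum, Finset.mul_sum]; simp_rw [mul_one_div]
    _ ≤ Real.exp (1/2) := by
        apply Real.exp_le_exp.2
        have h := (sum_inv_sq_PT (D := D) (R := R)).resolve_right (by omega)
        have hD' : (0:ℝ) < D := by exact_mod_cast hD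
        calc a * ∑ p : PT D R, 1 / (p.1:ℝ)^2 ≤ a * (1 / D) := by gcongr
          _ ≤ 1/2 := by rw [mul_one_div, div_le_iff₀ hD']; linarith
    _ ≤ 2 := by
        have h1 : Real.exp (1/2) ^ 2 = Real.exp 1 := by rw [← Real.exp_nat_mul]; norm_num
        have h2 := Real.exp_one_lt_d9
        have h3 := Real.exp_pos (1/2)
        nlinarith

lemma yy_sum (X J : ℕ) (hD : 0 < D) (hk : 2 * k ≤ D) : ∑ ρ : PT D R → Option (Fin k), |yy X J ρ| ≤ 2 ^ (k+1) * (R:ℝ) ^ 2 := by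
  have h1 : ∀ ρ : PT D R → Option (Fin k), |yy X J ρ| ≤ 2 ^ k * R ^ 2 * ∏ p, (ρ p).elim 1 (fun _ => 1 / (p.1:ℝ) ^ 2) := by
    intro ρ
    rw [abs_of_nonneg (yy_nonneg _ _ _)]
    have e : ∏ p, (ρ p).elim (1:ℝ) (fun _ => 1 / (p.1:ℝ) ^ 2) = 1 / (rr ρ : ℝ) ^ 2 := by
      unfold rr
      push_cast
      rw [← Finset.prod_pow, one_div, ← Finset.prod_inv_distrib]
      refine Finset.prod_congr rfl fun p _ => ?_
      rcases ρ p with _ | j <;> simp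
    rw [e]
    have hr : (0:ℝ) < rr ρ := by exact_mod_cast rr_pos ρ
    unfold yy
    split_ifs with h
    · have h2 : ∏ j, G X J (rA (As ρ j)) ≤ 2 ^ k := by
        calc _ ≤ ∏ j : Fin k, (2:ℝ) := Finset.prod_le_prod (fun j _ => G_nonneg _ _ _) fun j _ => G_le _ _ _
          _ = _ := by simp
      have h3 : (1:ℝ) ≤ R ^ 2 * (1 / (rr ρ : ℝ) ^ 2) := by
        rw [mul_one_div, one_le_div (by positivity)]
        have : (rr ρ : ℝ) ≤ R := by exact_mod_cast h
        gcongr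
      calc _ ≤ (2:ℝ) ^ k * 1 := by linarith
        _ ≤ (2:ℝ) ^ k * (R ^ 2 * (1 / (rr ρ : ℝ) ^ 2)) := by gcongr
        _ = _ := by ring
    · positivity
  refine (Finset.sum_le_sum fun ρ _ => h1 ρ).trans ?_
  rw [← Finset.mul_sum, sum_prod_pi (fun (p : PT D R) (o : Option (Fin k)) => o.elim (1:ℝ) (fun _ => 1 / (p.1:ℝ) ^ 2))]
  have := prod_exp_bound (D := D) (R := R) k (by positivity) hD (by exact_mod_cast hk)
  simp only [Fintype.sum_option, Option.elim, Finset.sum_const, Finset.card_univ, Fintype.card_fin, nsmul_eq_mul, mul_one_div]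
  calc _ ≤ (2:ℝ) ^ k * R ^ 2 * 2 := by gcongr
    _ = _ := by ring

end TotRun
end

section
set_option exponentiation.threshold 2000
open ArithmeticFunction Finset
open scoped ArithmeticFunction.Moebius ArithmeticFunction.zeta ComplexConjugate

namespace TotRun
variable {D R k : ℕ}

lemma hh_of (h : Fin k → ℕ) (hinj : Function.Injective h) (hD : ∀ j, h j ≤ D) (p : PT D R) :
    ∀ i j, i ≠ j → ∀ n, ¬ (p.1 ∣ n + h i ∧ p.1 ∣ n + h j) := by
  intro i j hij n hn
  have hp := p.gt
  have hi := hD i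
  have hj := hD j
  have hne : h i ≠ h j := fun e => hij (hinj e)
  rcases lt_or_gt_of_ne hne with hl | hl
  · have := Nat.dvd_sub hn.2 hn.1
    have := Nat.le_of_dvd (by omega) this
    omega
  · have := Nat.dvd_sub hn.1 hn.2
    have := Nat.le_of_dvd (by omega) this
    omega

lemma V_prod (ρ : PT D R → Option (Fin k)) : ∏ p, (ρ p).elim (1:ℝ) (fun _ => 1 / (p.1:ℝ)) = 1 / (rr ρ : ℝ) := by
  unfold rr
  push_cast
  rw [one_div, ← Finset.prod_inv_distrib]
  refine Finset.prod_congr rfl fun p _ => ?_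
  rcases ρ p with _ | j <;> simp

lemma S1_form (h : Fin k → ℕ) (hinj : Function.Injective h) (hD : ∀ j, h j ≤ D) (hk : 1 ≤ k) (hkD : 4 * k ^ 2 ≤ D) (X J : ℕ)
    (E : Finset (PT D R)) (s : PT D R → ℕ) :
    ‖∑ ρ : PT D R → Option (Fin k), ∑ ρ', (yy X J ρ : ℂ) * yy X J ρ' * ∏ p : PT D R, mn p.1 (fun n => ((ff h p.1 (ρ p) n * ff h p.1 (ρ' p) n *
      (if p ∈ E then (if p.1 ∣ n + s p then 1 else 0) else 1) : ℝ) : ℂ))‖ ≤ 2 * ((k+1:ℝ)^2) ^ E.card / rA E * M1s D R k X J := by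
  have hD0 : 0 < D := by have : 0 < 4 * k ^ 2 := by positivity
                         omega
  set a : PT D R → Option (Fin k) → Option (Fin k) → ℝ := fun p o o' => if p ∈ E then 1 / (p.1:ℝ) else aB p.1 o o' with ha
  refine (schur (yy X J) (fun p o o' => mn p.1 (fun n => ((ff h p.1 o n * ff h p.1 o' n *
      (if p ∈ E then (if p.1 ∣ n + s p then 1 else 0) else 1) : ℝ) : ℂ))) a ?_ ?_).trans ?_
  · intro p o o'
    have hp := p.pos
    simp only [ha, mn]
    rw [← Complex.ofReal_sum, ← Complex.ofReal_natCast, ← Complex.ofReal_div, Complex.norm_real, Real.norm_eq_abs]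
    by_cases hE : p ∈ E
    · simp only [hE, if_true]
      rw [abs_div, abs_of_pos hp]
      gcongr
      calc _ ≤ ∑ n ∈ range p.1, |ff h p.1 o n * ff h p.1 o' n * (if p.1 ∣ n + s p then 1 else 0)| := Finset.abs_sum_le_sum_abs _ _
        _ ≤ ∑ n ∈ range p.1, (if p.1 ∣ n + s p then (1:ℝ) else 0) := by
            refine Finset.sum_le_sum fun n _ => ?_
            have h1 := ff_abs h p.1 p.prime.one_le o n
            have h2 := ff_abs h p.1 p.prime.one_le o' n
            split_ifs
            · rw [mul_one, abs_mul]; exact mul_le_one₀ h1 (abs_nonneg _) h2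
            · simp
        _ = 1 := cnt _ _ p.prime.pos
    · simp only [hE, if_false, mul_one]
      exact ff_mean h p.1 p.prime.pos (hh_of h hinj hD p) o o'
  · intro p o o'
    simp only [ha]; split_ifs; exacts [rfl, aB_symm _ _ _]
  · set b : PT D R → ℝ := fun p => if p ∈ E then (k+1:ℝ)^2 / p.1 else 1 + (k:ℝ)^2 / (p.1:ℝ)^2 with hb
    have hb0 : ∀ p, 0 ≤ b p := fun p => by simp only [hb]; split_ifs <;> positivity
    have ht := tensor (P := PT D R) (O := Option (Fin k)) none (fun ρ => yy X J ρ ^ 2) (fun ρ => sq_nonneg _)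
      (fun ρ p o => pow_le_pow_left₀ (yy_nonneg _ _ _) (yy_anti X J ρ p o) 2)
      (fun p o => ∑ o', a p o o') (fun p o => o.elim (1:ℝ) (fun _ => 1 / (p.1:ℝ)))
      (fun p o => Finset.sum_nonneg fun o' _ => by
        simp only [ha]; split_ifs
        · positivity
        · rcases o with _ | i <;> rcases o' with _ | j <;> simp [aB]
          split_ifs <;> positivity)
      (fun p o => by rcases o with _ | i <;> simp) b hb0 (by
        intro p x hx
        have hp := p.pos
        have hp1 : (1:ℝ) ≤ p.1 := by exact_mod_cast p.prime.one_le
        have hx0 : 0 ≤ x none := (hx none).1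
        have hxs : ∑ j : Fin k, x (some j) ≤ k * x none := by
          calc _ ≤ ∑ j : Fin k, x none := Finset.sum_le_sum fun j _ => (hx _).2
            _ = _ := by simp
        have hxs0 : 0 ≤ ∑ j : Fin k, x (some j) := Finset.sum_nonneg fun j _ => (hx _).1
        have eV : ∑ o : Option (Fin k), o.elim (1:ℝ) (fun _ => 1 / (p.1:ℝ)) * x o = 1 * x none + 1 / p.1 * ∑ i, x (some i) := by
          rw [Fintype.sum_option, Finset.mul_sum]; rfl
        rw [eV, Fintype.sum_option]
        by_cases hE : p ∈ E
        · simp only [ha, hb, hE, if_true]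
          simp only [Finset.sum_const, Finset.card_univ, Fintype.card_option, Fintype.card_fin, nsmul_eq_mul]
          rw [← Finset.mul_sum]
          push_cast
          calc ((k:ℝ) + 1) * (1 / p.1) * x none + ((k:ℝ) + 1) * (1 / p.1) * ∑ i, x (some i)
              ≤ ((k:ℝ) + 1) * (1 / p.1) * x none + ((k:ℝ) + 1) * (1 / p.1) * (k * x none) := by gcongr
            _ = ((k:ℝ)+1)^2 / p.1 * (1 * x none) := by ring
            _ ≤ _ := by
                gcongr
                have : 0 ≤ 1 / (p.1:ℝ) * ∑ i, x (some i) := by positivity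
                linarith
        · simp only [ha, hb, hE, if_false]
          have r0 : ∑ o' : Option (Fin k), aB p.1 none o' = 1 := by rw [Fintype.sum_option]; simp [aB]
          have r1 : ∀ j : Fin k, ∑ o' : Option (Fin k), aB p.1 (some j) o' ≤ 1 / p.1 + k / (p.1:ℝ)^2 := by
            intro j
            rw [Fintype.sum_option]
            simp only [aB, zero_add]
            calc _ ≤ ∑ i : Fin k, ((if j = i then 1 / (p.1:ℝ) else 0) + 1 / (p.1:ℝ)^2) := by
                  refine Finset.sum_le_sum fun i _ => ?_
                  split_ifs
                  · have : 0 ≤ 1 / (p.1:ℝ)^2 := by positivity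
                    linarith
                  · simp
              _ = _ := by rw [Finset.sum_add_distrib]; simp; ring
          rw [r0]
          have r2 : ∑ i : Fin k, (∑ o' : Option (Fin k), aB p.1 (some i) o') * x (some i) ≤ (1 / p.1 + k / (p.1:ℝ)^2) * ∑ i, x (some i) := by
            rw [Finset.mul_sum]
            exact Finset.sum_le_sum fun i _ => mul_le_mul_of_nonneg_right (r1 i) (hx _).1
          have r3 : (k / (p.1:ℝ)^2) * ∑ i, x (some i) ≤ (k / (p.1:ℝ)^2) * (k * x none) := by gcongr
          have r4 : 0 ≤ (k:ℝ)^2 / (p.1:ℝ)^2 * (1 / p.1 * ∑ i, x (some i)) := by positivity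
          calc _ ≤ 1 * x none + (1 / p.1 + k / (p.1:ℝ)^2) * ∑ i, x (some i) := by linarith
            _ ≤ 1 * x none + 1 / p.1 * ∑ i, x (some i) + (k / (p.1:ℝ)^2) * (k * x none) := by linarith
            _ ≤ (1 + (k:ℝ)^2 / (p.1:ℝ)^2) * (1 * x none + 1 / p.1 * ∑ i, x (some i)) := by
              have : (k / (p.1:ℝ)^2) * (k * x none) = (k:ℝ)^2 / (p.1:ℝ)^2 * x none := by ring
              rw [this]; linarith)
    refine ht.trans ?_
    have eM : ∑ ρ : PT D R → Option (Fin k), yy X J ρ ^ 2 * ∏ p, (ρ p).elim (1:ℝ) (fun _ => 1 / (p.1:ℝ)) = M1s D R k X J := by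
      unfold M1s
      refine Finset.sum_congr rfl fun ρ _ => ?_
      rw [V_prod, mul_one_div]
    rw [eM]
    have hM0 : 0 ≤ M1s D R k X J := Finset.sum_nonneg fun ρ _ => by positivity
    refine mul_le_mul_of_nonneg_right ?_ hM0
    have hpe := prod_exp_bound (D := D) (R := R) ((k:ℝ)^2) (by positivity) hD0 (by
      have : ((4 * k ^ 2 : ℕ):ℝ) ≤ D := by exact_mod_cast hkD
      push_cast at this
      nlinarith [sq_nonneg (k:ℝ)])
    calc ∏ p, b p ≤ ∏ p, ((if p ∈ E then (k+1:ℝ)^2 / p.1 else 1) * (1 + (k:ℝ)^2 / (p.1:ℝ)^2)) := by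
          refine Finset.prod_le_prod (fun p _ => hb0 p) fun p _ => ?_
          simp only [hb]
          have : 0 ≤ (k:ℝ)^2 / (p.1:ℝ)^2 := by positivity
          have h2 : 0 ≤ (k+1:ℝ)^2 / p.1 := by positivity
          split_ifs
          · nlinarith
          · linarith
      _ = (∏ p ∈ E, (k+1:ℝ)^2 / p.1) * ∏ p : PT D R, (1 + (k:ℝ)^2 / (p.1:ℝ)^2) := by
          rw [Finset.prod_mul_distrib, Finset.prod_ite_mem, Finset.univ_inter]
      _ ≤ (∏ p ∈ E, (k+1:ℝ)^2 / p.1) * 2 := by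
          refine mul_le_mul_of_nonneg_left hpe (Finset.prod_nonneg fun p _ => by positivity)
      _ = _ := by
          rw [Finset.prod_div_distrib, Finset.prod_const]
          unfold rA; push_cast; ring

lemma Zs_sq (X J : ℕ) (h : Fin k → ℕ) (n : ℕ) (t : PT D R → ℝ) : ((Zs D R X J h n ^ 2 * ∏ p, t p : ℝ) : ℂ) =
    ∑ ρ : PT D R → Option (Fin k), ∑ ρ', (yy X J ρ : ℂ) * yy X J ρ' * ∏ p : PT D R, ((ff h p.1 (ρ p) n * ff h p.1 (ρ' p) n * t p : ℝ) : ℂ) := by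
  have : Zs D R X J h n ^ 2 * ∏ p, t p = ∑ ρ : PT D R → Option (Fin k), ∑ ρ', yy X J ρ * yy X J ρ' * ∏ p : PT D R, (ff h p.1 (ρ p) n * ff h p.1 (ρ' p) n * t p) := by
    rw [sq, Zs, Finset.sum_mul_sum, Finset.sum_mul]
    refine Finset.sum_congr rfl fun ρ _ => ?_
    rw [Finset.sum_mul]
    refine Finset.sum_congr rfl fun ρ' _ => ?_
    rw [Finset.prod_mul_distrib, Finset.prod_mul_distrib]; ring
  rw [this]; push_cast; rfl

/-- The first sum (with extra divisibility conditions at the primes in `E`). -/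
lemma S1_bound (h : Fin k → ℕ) (hinj : Function.Injective h) (hD : ∀ j, h j ≤ D) (hk : 1 ≤ k) (hkD : 4 * k ^ 2 ≤ D) (hR : 3 ≤ R) (X J v : ℕ)
    (E : Finset (PT D R)) (s : PT D R → ℕ) :
    ∑ n ∈ Ioc 0 (R ^ 600), (if n % primorial D = v % primorial D then 1 else 0) * (Zs D R X J h n ^ 2 * ∏ p ∈ E, (if p.1 ∣ n + s p then 1 else 0)) * (hat R n / n) ≤
      2 * ((k+1:ℝ)^2) ^ E.card / rA E * M1s D R k X J * Gh R / primorial D +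
      (2 ^ (k+1) * (R:ℝ) ^ 2) ^ 2 * (2400 * (primorial D * rA E * R ^ 2) * Real.log R / R ^ 200) := by
  have hD0 : 0 < D := by have : 0 < 4 * k ^ 2 := by positivity
                         omega
  have hW := primorial_pos D
  set W := primorial D with hWd
  have hL := log_ge_one R hR
  set e : ℕ → ℂ := fun n => if n % W = v % W then 1 else 0 with he
  have hmn : mn W e = 1 / W := by
    unfold mn
    congr 1
    rw [Finset.sum_eq_single (v % W)]
    · simp [he]
    · intro n hn hne
      simp only [he]
      rw [Nat.mod_eq_of_lt (Finset.mem_range.1 hn), if_neg hne]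
    · intro h; exact absurd (Finset.mem_range.2 (Nat.mod_lt _ hW)) h
  set t : PT D R → ℕ → ℝ := fun p n => if p ∈ E then (if p.1 ∣ n + s p then 1 else 0) else 1 with ht
  have hm := form_mean (D := D) (R := R) (k := k) E hR W hW (fun p => by
      have := rA_coprime ({p} : Finset (PT D R)); simp [rA] at this; exact this.symm) e (by intro n; simp [he]) (by intro n; simp only [he]; split_ifs <;> simp)
      (fun p o o' n => ((ff h p.1 o n * ff h p.1 o' n * t p n : ℝ) : ℂ)) (by
        intro p o o' n
        rw [Complex.norm_real, Real.norm_eq_abs, abs_mul, abs_mul]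
        refine mul_le_one₀ (mul_le_one₀ (ff_abs _ _ p.prime.one_le _ _) (abs_nonneg _) (ff_abs _ _ p.prime.one_le _ _)) (abs_nonneg _) ?_
        simp only [ht]; split_ifs <;> simp) (by
        intro p o o' n
        simp only [ff_mod, ht, ind_mod]) (by
        intro p hp n; simp [ht, hp]) (yy X J) (by
        intro ρ hρ
        unfold yy at hρ
        by_contra h
        rw [if_neg h] at hρ; exact hρ rfl)
  simp_rw [← Zs_sq] at hm
  rw [hmn] at hm
  set F := ∑ ρ : PT D R → Option (Fin k), ∑ ρ', (yy X J ρ : ℂ) * yy X J ρ' * ∏ p : PT D R, mn p.1 (fun n => ((ff h p.1 (ρ p) n * ff h p.1 (ρ' p) n * t p n : ℝ) : ℂ)) with hF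
  have hFb : ‖F‖ ≤ _ := S1_form h hinj hD hk hkD X J E s
  set T := ∑ n ∈ Ioc 0 (R ^ 600), (if n % W = v % W then 1 else 0) * (Zs D R X J h n ^ 2 * ∏ p ∈ E, (if p.1 ∣ n + s p then 1 else 0)) * (hat R n / n) with hT
  have hTc : (T:ℂ) = ∑ n ∈ Ioc 0 (R ^ 600), (e n * ((Zs D R X J h n ^ 2 * ∏ p, t p n : ℝ) : ℂ)) * ((hat R n / n : ℝ) : ℂ) := by
    rw [hT, Complex.ofReal_sum]
    refine Finset.sum_congr rfl fun n _ => ?_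
    have e1 : ∏ p, t p n = ∏ p ∈ E, (if p.1 ∣ n + s p then (1:ℝ) else 0) := by
      simp only [ht]; rw [Finset.prod_ite_mem, Finset.univ_inter]
    rw [e1, Complex.ofReal_mul, Complex.ofReal_mul]
    congr 2
    simp only [he]; split_ifs <;> simp
  rw [← hTc] at hm
  have h1 : T ≤ ‖(T:ℂ)‖ := by rw [Complex.norm_real]; exact le_abs_self T
  have h2 : ‖(T:ℂ)‖ ≤ ‖1 / (W:ℂ) * F * (Gh R : ℝ)‖ + ‖(T:ℂ) - 1 / (W:ℂ) * F * (Gh R : ℝ)‖ := by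
    have := norm_add_le (1 / (W:ℂ) * F * (Gh R : ℝ)) ((T:ℂ) - 1 / (W:ℂ) * F * (Gh R : ℝ))
    simpa using this
  have hG := Gh_nonneg R
  have h3 : ‖1 / (W:ℂ) * F * (Gh R : ℝ)‖ ≤ 2 * ((k+1:ℝ)^2) ^ E.card / rA E * M1s D R k X J * Gh R / W := by
    rw [norm_mul, norm_mul, norm_div, norm_one, Complex.norm_natCast, Complex.norm_real, Real.norm_eq_abs, abs_of_nonneg hG]
    calc 1 / (W:ℝ) * ‖F‖ * Gh R ≤ 1 / (W:ℝ) * (2 * ((k+1:ℝ)^2) ^ E.card / rA E * M1s D R k X J) * Gh R := by gcongr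
      _ = _ := by ring
  have hys := yy_sum (D := D) (R := R) (k := k) X J hD0 (by nlinarith)
  have h4 : (∑ ρ : PT D R → Option (Fin k), |yy X J ρ|) ^ 2 ≤ (2 ^ (k+1) * (R:ℝ) ^ 2) ^ 2 :=
    pow_le_pow_left₀ (Finset.sum_nonneg fun _ _ => abs_nonneg _) hys 2
  have h5 : (∑ ρ : PT D R → Option (Fin k), |yy X J ρ|) ^ 2 * (2400 * (W * rA E * R ^ 2) * Real.log R / R ^ 200) ≤ (2 ^ (k+1) * (R:ℝ) ^ 2) ^ 2 * (2400 * (W * rA E * R ^ 2) * Real.log R / R ^ 200) :=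
    mul_le_mul_of_nonneg_right h4 (by positivity)
  linarith

end TotRun
end

section
set_option exponentiation.threshold 2000
open ArithmeticFunction Finset
open scoped ArithmeticFunction.Moebius ArithmeticFunction.zeta ComplexConjugate

namespace TotRun
variable {D R k : ℕ}

noncomputable def FT (q : ℕ) [NeZero q] (F : ZMod q → ℂ) (χ : DirichletCharacter ℂ q) : ℂ :=
  (∑ a : ZMod q, F a * conj (χ a)) / Nat.totient q

lemma char_conj {q : ℕ} [NeZero q] (χ : DirichletCharacter ℂ q) (a : ZMod q) (ha : IsUnit a) : conj (χ a) = χ a⁻¹ := by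
  have h1 : ‖χ a‖ = 1 := by
    obtain ⟨u, rfl⟩ := ha
    exact χ.unit_norm_eq_one u
  have h2 : χ a⁻¹ * χ a = 1 := by
    rw [← map_mul, (ZMod.inv_mul_eq_one_of_isUnit ha a).2 rfl, map_one]
  rw [← Complex.inv_eq_conj h1]
  exact (eq_inv_of_mul_eq_one_left h2).symm

lemma FT_inv {q : ℕ} [NeZero q] (F : ZMod q → ℂ) (b : ZMod q) (hb : IsUnit b) : ∑ χ, FT q F χ * χ b = F b := by
  have hq : (Nat.totient q : ℂ) ≠ 0 := by
    have := Nat.totient_pos.2 (Nat.pos_of_ne_zero (NeZero.ne q))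
    exact_mod_cast this.ne'
  unfold FT
  have e : ∀ a : ZMod q, ∑ χ : DirichletCharacter ℂ q, conj (χ a) * χ b = if a = b then (Nat.totient q : ℂ) else 0 := by
    intro a
    by_cases ha : IsUnit a
    · rw [← DirichletCharacter.sum_char_inv_mul_char_eq ℂ ha b]
      exact Finset.sum_congr rfl fun χ _ => by rw [char_conj χ a ha]
    · rw [if_neg (by rintro rfl; exact ha hb)]
      exact Finset.sum_eq_zero fun χ _ => by rw [MulChar.map_nonunit _ ha]; simp
  simp_rw [div_mul_eq_mul_div, ← Finset.sum_div, Finset.sum_mul]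
  rw [Finset.sum_comm]
  simp_rw [mul_assoc, ← Finset.mul_sum, e]
  simp [hq]

lemma char_sum {q : ℕ} [NeZero q] (χ ψ : DirichletCharacter ℂ q) (h : χ ≠ ψ) : ∑ a : ZMod q, χ a * conj (ψ a) = 0 := by
  have h1 : χ * ψ⁻¹ ≠ 1 := fun h2 => h (mul_inv_eq_one.1 h2)
  rw [← MulChar.sum_eq_zero_of_ne_one h1]
  refine Finset.sum_congr rfl fun a _ => ?_
  rw [MulChar.mul_apply]
  by_cases ha : IsUnit a
  · rw [char_conj ψ a ha, MulChar.inv_apply]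
    congr 2
    obtain ⟨u, rfl⟩ := ha
    rw [Ring.inverse_unit, ZMod.inv_coe_unit]
  · rw [MulChar.map_nonunit _ ha]; simp

lemma FT_one (q : ℕ) [NeZero q] (χ : DirichletCharacter ℂ q) : FT q (fun _ => 1) χ = if χ = 1 then 1 else 0 := by
  have hq : (Nat.totient q : ℂ) ≠ 0 := by
    have := Nat.totient_pos.2 (Nat.pos_of_ne_zero (NeZero.ne q))
    exact_mod_cast this.ne'
  split_ifs with h
  · subst h
    unfold FT
    rw [div_eq_one_iff_eq hq]
    have h2 := MulChar.sum_one_eq_card_units (R := ZMod q) (R' := ℂ)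
    rw [ZMod.card_units_eq_totient] at h2
    rw [← h2]
    refine Finset.sum_congr rfl fun a _ => ?_
    rw [one_mul]
    by_cases ha : IsUnit a
    · rw [MulChar.one_apply ha]; simp
    · rw [MulChar.map_nonunit _ ha]; simp
  · unfold FT
    have h1 := MulChar.sum_eq_zero_of_ne_one h
    simp_rw [one_mul]
    rw [← map_sum, h1]; simp

lemma FT_norm (p : ℕ) (hp : p.Prime) [NeZero p] (F : ZMod p → ℂ) (χ : DirichletCharacter ℂ p) :
    ‖FT p F χ‖ ≤ (∑ a ∈ univ.erase (0 : ZMod p), ‖F a‖) / (p - 1) := by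
  unfold FT
  haveI := Fact.mk hp
  rw [Nat.totient_prime hp, norm_div, Complex.norm_natCast, Nat.cast_sub hp.one_le, Nat.cast_one]
  have h1 : (1:ℝ) < p := by exact_mod_cast hp.one_lt
  refine div_le_div_of_nonneg_right ?_ (by linarith)
  refine (norm_sum_le _ _).trans ?_
  rw [← Finset.add_sum_erase _ _ (Finset.mem_univ (0 : ZMod p)), MulChar.map_zero]
  simp only [_root_.map_zero, mul_zero, norm_zero, zero_add]
  refine Finset.sum_le_sum fun a _ => ?_
  rw [norm_mul, RCLike.norm_conj]
  exact mul_le_of_le_one_right (norm_nonneg _) (DirichletCharacter.norm_le_one χ a)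

lemma FT_triv (p : ℕ) (hp : p.Prime) [NeZero p] (F : ZMod p → ℂ) :
    FT p F 1 = (∑ a ∈ univ.erase (0 : ZMod p), F a) / ((p:ℂ) - 1) := by
  unfold FT
  haveI := Fact.mk hp
  rw [Nat.totient_prime hp, Nat.cast_sub hp.one_le, Nat.cast_one, ← Finset.add_sum_erase _ _ (Finset.mem_univ (0 : ZMod p)), MulChar.map_zero]
  simp only [_root_.map_zero, mul_zero, zero_add]
  congr 1
  refine Finset.sum_congr rfl fun a ha => ?_
  rw [MulChar.one_apply (IsUnit.mk0 _ (Finset.ne_of_mem_erase ha))]; simp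

/-- the local functions after removing coordinate `i` -/
noncomputable def gi (h : Fin k → ℕ) (i : Fin k) (p : ℕ) (o : Option (Fin k)) (a : ZMod p) : ℝ :=
  o.elim 1 fun j => if j = i then 0 else 1 / (p:ℝ) - if a = (h i : ZMod p) - h j then 1 else 0

lemma sum_ind (p : ℕ) (hp : p.Prime) [NeZero p] (s : ZMod p) (hs : s ≠ 0) (c : ℝ) :
    ∑ a ∈ univ.erase (0 : ZMod p), (if a = s then c else 0) = c := by
  rw [Finset.sum_ite_eq', if_pos (by simp [hs])]

lemma card_er (p : ℕ) (hp : p.Prime) [NeZero p] : ((univ.erase (0 : ZMod p)).card : ℝ) = p - 1 := by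
  rw [Finset.card_erase_of_mem (Finset.mem_univ _), Finset.card_univ, ZMod.card, Nat.cast_sub hp.one_le, Nat.cast_one]

lemma s1 (p : ℕ) (hp : p.Prime) [NeZero p] (s : ZMod p) (hs : s ≠ 0) :
    ∑ a ∈ univ.erase (0 : ZMod p), (1 / (p:ℝ) - if a = s then 1 else 0) = - (1 / p) := by
  rw [Finset.sum_sub_distrib, sum_ind p hp s hs, Finset.sum_const, nsmul_eq_mul, card_er p hp]
  have : (p:ℝ) ≠ 0 := by exact_mod_cast hp.ne_zero
  field_simp; ring

lemma s2 (p : ℕ) (hp : p.Prime) [NeZero p] (s t : ZMod p) (hs : s ≠ 0) (ht : t ≠ 0) :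
    ∑ a ∈ univ.erase (0 : ZMod p), (1 / (p:ℝ) - if a = s then 1 else 0) * (1 / (p:ℝ) - if a = t then 1 else 0) =
      (p - 1) / p ^ 2 - 2 / p + if s = t then 1 else 0 := by
  have e : ∀ a : ZMod p, (1 / (p:ℝ) - if a = s then 1 else 0) * (1 / (p:ℝ) - if a = t then 1 else 0) =
      1 / p ^ 2 - (if a = s then 1 / (p:ℝ) else 0) - (if a = t then 1 / (p:ℝ) else 0) + (if a = s then (if s = t then 1 else 0) else 0) := by
    intro a
    by_cases h1 : a = s
    · subst h1; simp only [if_true]; split_ifs <;> ring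
    · simp only [h1, if_false]; split_ifs <;> ring
  simp_rw [e]
  rw [Finset.sum_add_distrib, Finset.sum_sub_distrib, Finset.sum_sub_distrib, sum_ind p hp s hs, sum_ind p hp t ht, sum_ind p hp s hs,
    Finset.sum_const, nsmul_eq_mul, card_er p hp]
  ring

lemma s3 (p : ℕ) (hp : p.Prime) [NeZero p] (s : ZMod p) (hs : s ≠ 0) :
    ∑ a ∈ univ.erase (0 : ZMod p), |1 / (p:ℝ) - if a = s then 1 else 0| ≤ 2 := by
  have hp1 : (1:ℝ) ≤ p := by exact_mod_cast hp.one_le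
  calc _ ≤ ∑ a ∈ univ.erase (0 : ZMod p), (1 / (p:ℝ) + if a = s then 1 else 0) := by
        refine Finset.sum_le_sum fun a _ => (abs_sub _ _).trans ?_
        rw [abs_of_nonneg (by positivity), abs_of_nonneg (by split_ifs <;> norm_num)]
    _ = (p - 1) / p + 1 := by
        rw [Finset.sum_add_distrib, sum_ind p hp s hs, Finset.sum_const, nsmul_eq_mul, card_er p hp]; ring
    _ ≤ 2 := by
        have : ((p:ℝ) - 1) / p ≤ 1 := by rw [div_le_one (by linarith)]; linarith
        linarith

/-- Fourier coefficient of a product of two local functions. -/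
noncomputable def gF (h : Fin k → ℕ) (i : Fin k) (p : ℕ) [NeZero p] (χ : DirichletCharacter ℂ p) (o o' : Option (Fin k)) : ℂ :=
  FT p (fun a => ((gi h i p o a * gi h i p o' a : ℝ) : ℂ)) χ

noncomputable def dT (i : Fin k) (p : ℕ) (o : Option (Fin k)) : ℝ :=
  o.elim 1 fun j => if j = i then 0 else 1 / (p:ℝ) - 1 / (p ^ 2 * (p - 1))

noncomputable def aT (i : Fin k) (p : ℕ) (o o' : Option (Fin k)) : ℝ :=
  if o = o' then dT i p o else 3 / p ^ 2

lemma aT_symm (i : Fin k) (p : ℕ) (o o' : Option (Fin k)) : aT i p o o' = aT i p o' o := by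
  unfold aT; by_cases h : o = o'
  · rw [h]
  · rw [if_neg h, if_neg (Ne.symm h)]

noncomputable def aN (p : ℕ) (o o' : Option (Fin k)) : ℝ := if o = none ∧ o' = none then 0 else 4 / p

lemma aN_symm (p : ℕ) (o o' : Option (Fin k)) : aN p o o' = aN p o' o := by
  unfold aN; simp only [and_comm]

lemma dT_nonneg (i : Fin k) (p : ℕ) (hp : p.Prime) (o : Option (Fin k)) : 0 ≤ dT i p o := by
  unfold dT
  have h2 : (2:ℝ) ≤ p := by exact_mod_cast hp.two_le
  rcases o with _ | j
  · simp
  · simp only [Option.elim]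
    split_ifs
    · exact le_rfl
    · rw [sub_nonneg]
      exact one_div_le_one_div_of_le (by linarith) (by nlinarith)

section
variable (h : Fin k → ℕ) (i : Fin k) (p : ℕ) [NeZero p]

lemma gi_symm (χ : DirichletCharacter ℂ p) (o o' : Option (Fin k)) : gF h i p χ o o' = gF h i p χ o' o := by
  unfold gF; simp_rw [mul_comm]

lemma gF_triv_diag (hp : p.Prime) (hs : ∀ j l, j ≠ l → (h j : ZMod p) ≠ h l) (o : Option (Fin k)) : gF h i p 1 o o = dT i p o := by
  have h2 : (2:ℝ) ≤ p := by exact_mod_cast hp.two_le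
  rcases o with _ | j
  · have := FT_one p 1
    simp only [gF, gi, dT, Option.elim, mul_one, Complex.ofReal_one]
    rw [this, if_pos rfl]
  · by_cases hj : j = i
    · simp [gF, gi, dT, hj, FT]
    · unfold gF
      rw [FT_triv p hp, ← Complex.ofReal_sum]
      simp only [gi, dT, Option.elim, if_neg hj]
      rw [s2 p hp _ _ (sub_ne_zero.2 (hs i j (Ne.symm hj))) (sub_ne_zero.2 (hs i j (Ne.symm hj))), if_pos rfl,
        ← Complex.ofReal_natCast, ← Complex.ofReal_one, ← Complex.ofReal_sub, ← Complex.ofReal_div]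
      congr 1
      have : (p:ℝ) - 1 ≠ 0 := by linarith
      have : (p:ℝ) ≠ 0 := by linarith
      field_simp; ring

lemma gF_triv (hp : p.Prime) (hs : ∀ j l, j ≠ l → (h j : ZMod p) ≠ h l) (o o' : Option (Fin k)) : ‖gF h i p 1 o o'‖ ≤ aT i p o o' := by
  have h2 : (2:ℝ) ≤ p := by exact_mod_cast hp.two_le
  unfold aT
  split_ifs with hoo
  · subst hoo
    rw [gF_triv_diag h i p hp hs, Complex.norm_real, Real.norm_eq_abs, abs_of_nonneg (dT_nonneg i p hp o)]
  · have hz : ∀ o, gF h i p 1 (some i) o = 0 := fun o => by simp [gF, gi, FT]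
    have key0 : ∀ j, ‖gF h i p 1 none (some j)‖ ≤ 3 / (p:ℝ) ^ 2 := by
      intro j
      by_cases hj : j = i
      · rw [gi_symm, hj, hz]; simp; positivity
      unfold gF
      rw [FT_triv p hp, ← Complex.ofReal_sum]
      simp only [gi, Option.elim, if_neg hj, one_mul]
      rw [s1 p hp _ (sub_ne_zero.2 (hs i j (Ne.symm hj))),
        ← Complex.ofReal_natCast, ← Complex.ofReal_one, ← Complex.ofReal_sub, ← Complex.ofReal_div, Complex.norm_real, Real.norm_eq_abs, abs_div, abs_neg,
        abs_of_nonneg (by positivity : (0:ℝ) ≤ 1 / p), abs_of_nonneg (by linarith : (0:ℝ) ≤ p - 1), div_div, div_le_div_iff₀ (by nlinarith) (by positivity)]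
      nlinarith
    rcases o with _ | j <;> rcases o' with _ | l
    · exact absurd rfl hoo
    · exact key0 l
    · rw [gi_symm]; exact key0 j
    · by_cases hj : j = i
      · rw [hj, hz]; simp; positivity
      by_cases hl : l = i
      · rw [gi_symm, hl, hz]; simp; positivity
      have hjl : l ≠ j := fun h => hoo (by rw [h])
      unfold gF
      rw [FT_triv p hp, ← Complex.ofReal_sum]
      simp only [gi, Option.elim, if_neg hj, if_neg hl]
      rw [s2 p hp _ _ (sub_ne_zero.2 (hs i j (Ne.symm hj))) (sub_ne_zero.2 (hs i l (Ne.symm hl))),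
        if_neg (fun h => hs l j hjl (by linear_combination h)),
        ← Complex.ofReal_natCast, ← Complex.ofReal_one, ← Complex.ofReal_sub, ← Complex.ofReal_div, Complex.norm_real, Real.norm_eq_abs]
      have e : (((p:ℝ) - 1) / p ^ 2 - 2 / p + 0) / (p - 1) = - ((p + 1) / (p ^ 2 * (p - 1))) := by
        have : (p:ℝ) - 1 ≠ 0 := by linarith
        have : (p:ℝ) ≠ 0 := by linarith
        field_simp; ring
      rw [e, abs_neg, abs_of_nonneg (by have : (0:ℝ) ≤ p - 1 := by linarith
                                        positivity), ← div_div, div_right_comm]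
      gcongr
      rw [div_le_iff₀ (by linarith)]; linarith

lemma gF_nontriv (hp : p.Prime) (hs : ∀ j l, j ≠ l → (h j : ZMod p) ≠ h l) (χ : DirichletCharacter ℂ p) (hχ : χ ≠ 1) (o o' : Option (Fin k)) : ‖gF h i p χ o o'‖ ≤ aN p o o' := by
  have h2 : (2:ℝ) ≤ p := by exact_mod_cast hp.two_le
  unfold aN
  have gle : ∀ o a, |gi h i p o a| ≤ 1 := by
    intro o a
    have h1 : 1 / (p:ℝ) ≤ 1 := by rw [div_le_one (by linarith)]; linarith
    have h0 : 0 ≤ 1 / (p:ℝ) := by positivity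
    unfold gi
    rcases o with _ | j
    · simp
    · simp only [Option.elim]
      split_ifs <;> rw [abs_le] <;> constructor <;> linarith
  have key : ∀ j o, ‖gF h i p χ (some j) o‖ ≤ 4 / (p:ℝ) := by
    intro j o
    by_cases hj : j = i
    · have : gF h i p χ (some j) o = 0 := by simp [gF, gi, FT, hj]
      rw [this]; simp; positivity
    unfold gF
    refine (FT_norm p hp _ χ).trans ?_
    calc _ ≤ (2:ℝ) / (p - 1) := by
          refine div_le_div_of_nonneg_right (le_trans ?_ (s3 p hp _ (sub_ne_zero.2 (hs i j (Ne.symm hj))))) (by linarith)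
          refine Finset.sum_le_sum fun a _ => ?_
          rw [Complex.norm_real, Real.norm_eq_abs, abs_mul]
          refine (mul_le_of_le_one_right (abs_nonneg _) (gle o a)).trans (le_of_eq ?_)
          simp only [gi, Option.elim, if_neg hj]
      _ ≤ _ := by rw [div_le_div_iff₀ (by linarith) (by linarith)]; linarith
  rcases o with _ | j
  · rcases o' with _ | l
    · simp only [and_self, if_true]
      have := FT_one p χ
      simp only [gF, gi, Option.elim, mul_one, Complex.ofReal_one]
      rw [this, if_neg hχ]; simp
    · rw [gi_symm]; simpa using key l none
  · simpa using key j o'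
end
end TotRun
end

section
set_option exponentiation.threshold 2000
open ArithmeticFunction Finset
open scoped ArithmeticFunction.Moebius ArithmeticFunction.zeta ComplexConjugate

namespace TotRun
variable {D R k : ℕ}

instance (p : PT D R) : NeZero p.1 := ⟨p.prime.ne_zero⟩

abbrev Ch (D R : ℕ) := ∀ p : PT D R, DirichletCharacter ℂ p.1

open Classical in
noncomputable def Qs (χ : Ch D R) : Finset (PT D R) := univ.filter fun p => χ p ≠ 1

lemma mem_Qs (χ : Ch D R) (p : PT D R) : p ∈ Qs χ ↔ χ p ≠ 1 := by simp [Qs]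

noncomputable def wh (X J : ℕ) (h : Fin k → ℕ) (i : Fin k) (χ : Ch D R) : ℂ :=
  ∑ ρ : PT D R → Option (Fin k), ∑ ρ', (cp X J i ρ : ℂ) * cp X J i ρ' * ∏ p : PT D R, gF h i p.1 (χ p) (ρ p) (ρ' p)

lemma cp_supp (X J : ℕ) (i : Fin k) (σ : PT D R → Option (Fin k)) (h : cp X J i σ ≠ 0) : rr σ ≤ R := by
  unfold cp at h
  obtain ⟨ρ, hρ, hne⟩ := Finset.exists_ne_zero_of_sum_ne_zero h
  have h1 : er i ρ = σ := (Finset.mem_filter.1 hρ).2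
  have h2 : rr ρ ≤ R := by
    by_contra h3
    unfold yy at hne
    rw [if_neg h3] at hne
    simp at hne
  rw [rr_er i ρ, h1] at h2
  exact (Nat.le_mul_of_pos_right _ (rA_pos _)).trans h2

lemma hs_of (h : Fin k → ℕ) (hinj : Function.Injective h) (hD : ∀ j, h j ≤ D) (p : PT D R) (j l : Fin k) (hjl : j ≠ l) :
    (h j : ZMod p.1) ≠ h l := by
  intro e
  rw [ZMod.natCast_eq_natCast_iff'] at e
  rw [Nat.mod_eq_of_lt (lt_of_le_of_lt (hD j) p.gt), Nat.mod_eq_of_lt (lt_of_le_of_lt (hD l) p.gt)] at e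
  exact hjl (hinj e)

lemma wh_zero (X J : ℕ) (h : Fin k → ℕ) (hinj : Function.Injective h) (hD : ∀ j, h j ≤ D) (i : Fin k) (χ : Ch D R)
    (hQ : R ^ 2 < rA (Qs χ)) : wh X J h i χ = 0 := by
  refine Finset.sum_eq_zero fun ρ _ => Finset.sum_eq_zero fun ρ' _ => ?_
  by_contra hne
  have hne' := mul_ne_zero_iff.1 hne
  have hc := mul_ne_zero_iff.1 hne'.1
  have h1 := cp_supp X J i ρ (by exact_mod_cast hc.1)
  have h2 := cp_supp X J i ρ' (by exact_mod_cast hc.2)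
  have hsub : Qs χ ⊆ supp ρ ∪ supp ρ' := by
    intro p hp
    by_contra hn
    simp only [supp, Finset.mem_union, Finset.mem_filter, Finset.mem_univ, true_and, not_or, not_not] at hn
    refine hne'.2 (Finset.prod_eq_zero (Finset.mem_univ p) ?_)
    have := gF_nontriv h i p.1 p.prime (hs_of h hinj hD p) (χ p) ((mem_Qs χ p).1 hp) (ρ p) (ρ' p)
    rw [hn.1, hn.2] at this ⊢
    simpa [aN] using this
  have h3 : rA (Qs χ) ≤ rA (supp ρ ∪ supp ρ') := Nat.le_of_dvd (rA_pos _) (Finset.prod_dvd_prod_of_subset _ _ _ hsub)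
  have h4 := rA_union (supp ρ) (supp ρ')
  rw [← rr_supp, ← rr_supp] at h4
  have : rr ρ * rr ρ' ≤ R * R := Nat.mul_le_mul h1 h2
  nlinarith

lemma prod_exp_bound2 (a : ℝ) (ha : 0 ≤ a) (hD : 0 < D) (haD : a ≤ D) : ∏ p : PT D R, (1 + a / (p.1:ℝ) ^ 2) ≤ 1 + 2 * (a / D) := by
  have hD' : (0:ℝ) < D := by exact_mod_cast hD
  calc ∏ p : PT D R, (1 + a / (p.1:ℝ) ^ 2) ≤ ∏ p : PT D R, Real.exp (a / (p.1:ℝ) ^ 2) :=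
        Finset.prod_le_prod (fun p _ => by positivity) fun p _ => by rw [add_comm]; exact Real.add_one_le_exp _
    _ = Real.exp (a * ∑ p : PT D R, 1 / (p.1:ℝ)^2) := by rw [← Real.exp_sum, Finset.mul_sum]; simp_rw [mul_one_div]
    _ ≤ Real.exp (a / D) := by
        apply Real.exp_le_exp.2
        have h := (sum_inv_sq_PT (D := D) (R := R)).resolve_right (by omega)
        calc a * ∑ p : PT D R, 1 / (p.1:ℝ)^2 ≤ a * (1 / D) := by gcongr
          _ = _ := by ring
    _ ≤ 1 + 2 * (a / D) := by
        have h0 : 0 ≤ a / D := by positivity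
        have h1 := Real.abs_exp_sub_one_le (x := a / D) (by rw [abs_of_nonneg h0, div_le_one hD']; exact haD)
        rw [abs_of_nonneg h0] at h1
        have := le_abs_self (Real.exp (a / D) - 1)
        linarith

lemma cp_sq_anti (X J : ℕ) (i : Fin k) (σ : PT D R → Option (Fin k)) (p : PT D R) (o : Option (Fin k)) :
    cp X J i (Function.update σ p o) ^ 2 ≤ cp X J i (Function.update σ p none) ^ 2 :=
  pow_le_pow_left₀ (cp_nonneg _ _ _ _) (cp_anti X J i σ p o) 2

lemma M2_eq (X J : ℕ) (i : Fin k) : M2s D R X J i = ∑ σ : PT D R → Option (Fin k), cp X J i σ ^ 2 * ∏ p, (σ p).elim (1:ℝ) (fun _ => 1 / (p.1:ℝ)) := by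
  unfold M2s
  simp_rw [V_prod, mul_one_div]

lemma aT_nonneg (i : Fin k) (p : ℕ) (hp : p.Prime) (o o' : Option (Fin k)) : 0 ≤ aT i p o o' := by
  unfold aT; split_ifs
  · exact dT_nonneg i p hp o
  · positivity

lemma aN_le (p : ℕ) (o o' : Option (Fin k)) : aN p o o' ≤ 4 / p := by
  unfold aN; split_ifs
  · positivity
  · exact le_rfl

lemma aN_nonneg (p : ℕ) (o o' : Option (Fin k)) : 0 ≤ aN p o o' := by
  unfold aN; split_ifs
  · exact le_rfl
  · positivity

lemma dT_le (i : Fin k) (p : ℕ) (hp : p.Prime) (o : Option (Fin k)) : dT i p o ≤ o.elim (1:ℝ) (fun _ => 1 / (p:ℝ)) := by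
  have h2 : (2:ℝ) ≤ p := by exact_mod_cast hp.two_le
  unfold dT
  rcases o with _ | j
  · simp
  · simp only [Option.elim]
    split_ifs
    · positivity
    · have : 0 ≤ 1 / ((p:ℝ) ^ 2 * (p - 1)) := by
        have : (0:ℝ) ≤ p - 1 := by linarith
        positivity
      linarith

lemma row_T (hk : 1 ≤ k) (i : Fin k) (p : ℕ) (hp : p.Prime) (x : Option (Fin k) → ℝ) (hx : ∀ o, 0 ≤ x o ∧ x o ≤ x none) :
    ∑ o, (∑ o', aT i p o o') * x o ≤ (1 + 6 * (k:ℝ) ^ 2 / p ^ 2) * ∑ o, o.elim (1:ℝ) (fun _ => 1 / (p:ℝ)) * x o := by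
  have hk' : (1:ℝ) ≤ k := by exact_mod_cast hk
  have h1 : ∀ o : Option (Fin k), ∑ o', aT i p o o' ≤ o.elim (1:ℝ) (fun _ => 1 / (p:ℝ)) + k * (3 / p ^ 2) := by
    intro o
    rw [← Finset.add_sum_erase _ _ (Finset.mem_univ o)]
    have e1 : aT i p o o = dT i p o := by simp [aT]
    have e2 : ∑ o' ∈ univ.erase o, aT i p o o' = k * (3 / (p:ℝ) ^ 2) := by
      rw [Finset.sum_congr rfl (fun o' ho' => (by unfold aT; rw [if_neg (Finset.ne_of_mem_erase ho').symm] : aT i p o o' = 3 / (p:ℝ) ^ 2)), Finset.sum_const, Finset.card_erase_of_mem (Finset.mem_univ _)]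
      simp
    rw [e1, e2]
    linarith [dT_le i p hp o]
  have h0 : x none ≤ ∑ o, o.elim (1:ℝ) (fun _ => 1 / (p:ℝ)) * x o := by
    rw [Fintype.sum_option]
    simp only [Option.elim, one_mul]
    have : 0 ≤ ∑ j : Fin k, 1 / (p:ℝ) * x (some j) := Finset.sum_nonneg fun j _ => mul_nonneg (by positivity) (hx _).1
    linarith
  calc ∑ o, (∑ o', aT i p o o') * x o ≤ ∑ o : Option (Fin k), (o.elim (1:ℝ) (fun _ => 1 / (p:ℝ)) * x o + k * (3 / p ^ 2) * x none) := by
        refine Finset.sum_le_sum fun o _ => ?_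
        have := mul_le_mul_of_nonneg_right (h1 o) (hx o).1
        have h3 : (k:ℝ) * (3 / p ^ 2) * x o ≤ k * (3 / p ^ 2) * x none := mul_le_mul_of_nonneg_left (hx o).2 (by positivity)
        linarith
    _ = ∑ o : Option (Fin k), o.elim (1:ℝ) (fun _ => 1 / (p:ℝ)) * x o + (k + 1) * (k * (3 / p ^ 2)) * x none := by
        rw [Finset.sum_add_distrib, Finset.sum_const, Finset.card_univ, Fintype.card_option, Fintype.card_fin, nsmul_eq_mul]
        push_cast; ring
    _ ≤ _ := by
        have h4 : ((k:ℝ) + 1) * (k * (3 / p ^ 2)) ≤ 6 * (k:ℝ) ^ 2 / p ^ 2 := by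
          rw [show ((k:ℝ) + 1) * (k * (3 / p ^ 2)) = ((k:ℝ) + 1) * (k * 3) / p ^ 2 by ring]
          exact div_le_div_of_nonneg_right (by nlinarith) (by positivity)
        have h5 : ((k:ℝ) + 1) * (k * (3 / p ^ 2)) * x none ≤ 6 * (k:ℝ) ^ 2 / p ^ 2 * ∑ o, o.elim (1:ℝ) (fun _ => 1 / (p:ℝ)) * x o :=
          mul_le_mul h4 h0 (hx none).1 (by positivity)
        linarith

lemma row_N (hk : 1 ≤ k) (p : ℕ) (x : Option (Fin k) → ℝ) (hx : ∀ o, 0 ≤ x o ∧ x o ≤ x none) :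
    ∑ o, (∑ o', aN p o o') * x o ≤ (16 * (k:ℝ) ^ 2 / p) * ∑ o, o.elim (1:ℝ) (fun _ => 1 / (p:ℝ)) * x o := by
  have hk' : (1:ℝ) ≤ k := by exact_mod_cast hk
  have h0 : x none ≤ ∑ o, o.elim (1:ℝ) (fun _ => 1 / (p:ℝ)) * x o := by
    rw [Fintype.sum_option]
    simp only [Option.elim, one_mul]
    have : 0 ≤ ∑ j : Fin k, 1 / (p:ℝ) * x (some j) := Finset.sum_nonneg fun j _ => mul_nonneg (by positivity) (hx _).1
    linarith
  calc ∑ o, (∑ o', aN p o o') * x o ≤ ∑ o : Option (Fin k), (∑ o' : Option (Fin k), 4 / (p:ℝ)) * x none := by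
        refine Finset.sum_le_sum fun o _ => mul_le_mul (Finset.sum_le_sum fun o' _ => aN_le p o o') (hx o).2 (hx o).1 (by positivity)
    _ = (k + 1) ^ 2 * (4 / (p:ℝ)) * x none := by simp; ring
    _ ≤ _ := by
        refine mul_le_mul ?_ h0 (hx none).1 (by positivity)
        rw [show ((k:ℝ) + 1) ^ 2 * (4 / (p:ℝ)) = ((k:ℝ) + 1) ^ 2 * 4 / p by ring]
        exact div_le_div_of_nonneg_right (by nlinarith) (by positivity)

lemma wh_small (X J : ℕ) (h : Fin k → ℕ) (hinj : Function.Injective h) (hD : ∀ j, h j ≤ D) (hk : 1 ≤ k) (hkD : 120 * k ^ 2 ≤ D) (i : Fin k) (χ : Ch D R)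
    (hQ : (Qs χ).Nonempty) : ‖wh X J h i χ‖ ≤ 32 * (k:ℝ) ^ 2 / D * M2s D R X J i := by
  classical
  have hk' : (1:ℝ) ≤ k := by exact_mod_cast hk
  have hkD' : 120 * (k:ℝ) ^ 2 ≤ D := by exact_mod_cast hkD
  have hD0 : (0:ℝ) < D := by nlinarith
  have h1 := schur (cp X J i) (fun p : PT D R => gF h i p.1 (χ p)) (fun p => if p ∈ Qs χ then aN p.1 else aT i p.1)
    (fun p o o' => by
      split_ifs with hp
      · exact gF_nontriv h i p.1 p.prime (hs_of h hinj hD p) (χ p) ((mem_Qs χ p).1 hp) o o'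
      · have : χ p = 1 := by simpa [mem_Qs] using hp
        rw [this]
        exact gF_triv h i p.1 p.prime (hs_of h hinj hD p) o o')
    (fun p o o' => by split_ifs; exacts [aN_symm _ _ _, aT_symm _ _ _ _])
  refine h1.trans ?_
  have h2 := tensor none (fun ρ => cp X J i ρ ^ 2) (fun ρ => sq_nonneg _) (fun ρ p o => cp_sq_anti X J i ρ p o)
    (fun p o => ∑ o', (if p ∈ Qs χ then aN p.1 else aT i p.1) o o') (fun p o => o.elim (1:ℝ) (fun _ => 1 / (p.1:ℝ)))
    (fun p o => Finset.sum_nonneg fun o' _ => by split_ifs; exacts [aN_nonneg _ _ _, aT_nonneg _ _ p.prime _ _])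
    (fun p o => by rcases o with _ | j <;> simp)
    (fun p => if p ∈ Qs χ then 16 * (k:ℝ) ^ 2 / p.1 else 1 + 6 * (k:ℝ) ^ 2 / p.1 ^ 2)
    (fun p => by split_ifs <;> positivity)
    (fun p x hx => by
      split_ifs
      · exact row_N hk p.1 x hx
      · exact row_T hk i p.1 p.prime x hx)
  rw [← M2_eq] at h2
  refine h2.trans ?_
  have hM : 0 ≤ M2s D R X J i := Finset.sum_nonneg fun σ _ => by positivity
  refine mul_le_mul_of_nonneg_right ?_ hM
  have hle : ∀ p : PT D R, 16 * (k:ℝ) ^ 2 / p.1 ≤ 16 * (k:ℝ) ^ 2 / D := fun p => by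
    have : (D:ℝ) ≤ p.1 := by exact_mod_cast p.gt.le
    gcongr
  have hle1 : 16 * (k:ℝ) ^ 2 / D ≤ 1 := by rw [div_le_one hD0]; nlinarith
  obtain ⟨q, hq⟩ := hQ
  calc ∏ p : PT D R, (if p ∈ Qs χ then 16 * (k:ℝ) ^ 2 / p.1 else 1 + 6 * (k:ℝ) ^ 2 / p.1 ^ 2)
      ≤ ∏ p : PT D R, ((1 + 6 * (k:ℝ) ^ 2 / p.1 ^ 2) * if p = q then 16 * (k:ℝ) ^ 2 / D else 1) := by
        refine Finset.prod_le_prod (fun p _ => by split_ifs <;> positivity) fun p _ => ?_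
        have h3 : (1:ℝ) ≤ 1 + 6 * (k:ℝ) ^ 2 / p.1 ^ 2 := by
          have : 0 ≤ 6 * (k:ℝ) ^ 2 / p.1 ^ 2 := by positivity
          linarith
        by_cases hpq : p = q
        · subst hpq
          rw [if_pos hq, if_pos rfl]
          exact (hle p).trans (le_mul_of_one_le_left (by positivity) h3)
        · rw [if_neg hpq, mul_one]
          split_ifs
          · exact (hle p).trans (hle1.trans h3)
          · exact le_rfl
    _ = (∏ p : PT D R, (1 + 6 * (k:ℝ) ^ 2 / p.1 ^ 2)) * (16 * (k:ℝ) ^ 2 / D) := by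
        rw [Finset.prod_mul_distrib, Finset.prod_ite_eq' univ q, if_pos (Finset.mem_univ q)]
    _ ≤ 2 * (16 * (k:ℝ) ^ 2 / D) := by
        gcongr
        exact prod_exp_bound _ (by positivity) (by exact_mod_cast hD0) (by nlinarith)
    _ = _ := by ring

lemma wh_main (X J : ℕ) (h : Fin k → ℕ) (hinj : Function.Injective h) (hD : ∀ j, h j ≤ D) (hk : 1 ≤ k) (hkD : 120 * k ^ 2 ≤ D) (i : Fin k) :
    1 / 2 * M2s D R X J i ≤ (wh X J h i (1 : Ch D R)).re := by
  have hk' : (1:ℝ) ≤ k := by exact_mod_cast hk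
  have hkD' : 120 * (k:ℝ) ^ 2 ≤ D := by exact_mod_cast hkD
  have hD0 : (0:ℝ) < D := by nlinarith
  have hM : 0 ≤ M2s D R X J i := Finset.sum_nonneg fun σ _ => by positivity
  have h1 := schur_diag (cp X J i) (fun p : PT D R => gF h i p.1 1) (fun p => dT i p.1)
    (fun p o => gF_triv_diag h i p.1 p.prime (hs_of h hinj hD p) o) (fun p o => dT_nonneg i p.1 p.prime o)
    (fun p => aT i p.1) (fun p o o' => gF_triv h i p.1 p.prime (hs_of h hinj hD p) o o') (fun p o => by simp [aT])
    (fun p o o' => aT_symm _ _ _ _)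
  have h2 := tensor none (fun ρ => cp X J i ρ ^ 2) (fun ρ => sq_nonneg _) (fun ρ p o => cp_sq_anti X J i ρ p o)
    (fun (p : PT D R) o => ∑ o', aT i p.1 o o') (fun p o => o.elim (1:ℝ) (fun _ => 1 / (p.1:ℝ)))
    (fun p o => Finset.sum_nonneg fun o' _ => aT_nonneg _ _ p.prime _ _)
    (fun p o => by rcases o with _ | j <;> simp)
    (fun p => 1 + 6 * (k:ℝ) ^ 2 / p.1 ^ 2) (fun p => by positivity) (fun p x hx => row_T hk i p.1 p.prime x hx)
  rw [← M2_eq] at h2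
  have h3 := tensor none (fun ρ => cp X J i ρ ^ 2) (fun ρ => sq_nonneg _) (fun ρ p o => cp_sq_anti X J i ρ p o)
    (fun (p : PT D R) o => o.elim (1:ℝ) (fun j => if j = i then 0 else 1 / (p.1:ℝ))) (fun p o => dT i p.1 o)
    (fun p o => by rcases o with _ | j <;> simp; split_ifs <;> positivity)
    (fun p o => dT_nonneg i p.1 p.prime o)
    (fun p => 1 + 2 / (p.1:ℝ) ^ 2) (fun p => by positivity)
    (fun p x hx => by
      rw [Finset.mul_sum]
      refine Finset.sum_le_sum fun o _ => ?_
      rw [← mul_assoc]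
      refine mul_le_mul_of_nonneg_right ?_ (hx o).1
      have hp : (120:ℝ) ≤ p.1 := by
        have : (D:ℝ) ≤ p.1 := by exact_mod_cast p.gt.le
        nlinarith
      rcases o with _ | j
      · simp only [dT, Option.elim, mul_one]
        have : 0 ≤ 2 / (p.1:ℝ) ^ 2 := by positivity
        linarith
      · simp only [dT, Option.elim]
        split_ifs
        · simp
        · set q : ℝ := (p.1 : ℝ)
          have e : (1 + 2 / q ^ 2) * (1 / q - 1 / (q ^ 2 * (q - 1))) - 1 / q = (q ^ 2 - 2 * q - 2) / (q ^ 4 * (q - 1)) := by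
            have : q - 1 ≠ 0 := by linarith
            have : q ≠ 0 := by linarith
            field_simp; ring
          have : 0 ≤ (q ^ 2 - 2 * q - 2) / (q ^ 4 * (q - 1)) := div_nonneg (by nlinarith) (mul_nonneg (by positivity) (by linarith))
          linarith)
  have e3 : ∑ σ : PT D R → Option (Fin k), cp X J i σ ^ 2 * ∏ p, (σ p).elim (1:ℝ) (fun j => if j = i then 0 else 1 / (p.1:ℝ)) = M2s D R X J i := by
    rw [M2_eq]
    refine Finset.sum_congr rfl fun σ _ => ?_
    by_cases hc : cp X J i σ = 0
    · simp [hc]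
    congr 1
    refine Finset.prod_congr rfl fun p _ => ?_
    rcases hj : σ p with _ | j
    · rfl
    · simp only [Option.elim]
      rw [if_neg]
      rintro rfl
      exact hc (cp_zero X J j σ p hj)
  rw [e3] at h3
  set Sd := ∑ ρ : PT D R → Option (Fin k), cp X J i ρ ^ 2 * ∏ p, dT i p.1 (ρ p)
  set Sa := ∑ ρ : PT D R → Option (Fin k), cp X J i ρ ^ 2 * ∏ p, ∑ o, aT i p.1 (ρ p) o
  have hSd : 0 ≤ Sd := Finset.sum_nonneg fun σ _ => mul_nonneg (by positivity) (Finset.prod_nonneg fun p _ => dT_nonneg i p.1 p.prime _)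
  have b2 : ∏ p : PT D R, (1 + 6 * (k:ℝ) ^ 2 / (p.1:ℝ) ^ 2) ≤ 11/10 := by
    refine (prod_exp_bound2 _ (by positivity) (by exact_mod_cast hD0) (by nlinarith)).trans ?_
    have : 6 * (k:ℝ) ^ 2 / D ≤ 1/20 := by rw [div_le_iff₀ hD0]; linarith
    linarith
  have b3 : ∏ p : PT D R, (1 + 2 / (p.1:ℝ) ^ 2) ≤ 11/10 := by
    refine (prod_exp_bound2 _ (by positivity) (by exact_mod_cast hD0) (by nlinarith)).trans ?_
    have : (2:ℝ) / D ≤ 1/20 := by rw [div_le_iff₀ hD0]; nlinarith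
    linarith
  have h2' : Sa ≤ 11/10 * M2s D R X J i := h2.trans (mul_le_mul_of_nonneg_right b2 hM)
  have h3' : M2s D R X J i ≤ 11/10 * Sd := h3.trans (mul_le_mul_of_nonneg_right b3 hSd)
  have h4 := (Complex.abs_re_le_norm _).trans h1
  rw [Complex.sub_re, Complex.ofReal_re] at h4
  have h5 := (abs_le.1 h4).1
  have h6 : (wh X J h i (1 : Ch D R)).re = (∑ ρ : PT D R → Option (Fin k), ∑ ρ', (cp X J i ρ : ℂ) * cp X J i ρ' * ∏ p : PT D R, gF h i p.1 1 (ρ p) (ρ' p)).re := rfl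
  rw [h6]
  linarith
end TotRun
end

section
set_option exponentiation.threshold 2000
open ArithmeticFunction Finset
open scoped ArithmeticFunction.Moebius ArithmeticFunction.zeta ComplexConjugate

namespace TotRun
variable {D R k : ℕ}

lemma sum_range_zmod (q : ℕ) [NeZero q] (F : ZMod q → ℂ) : ∑ n ∈ range q, F (n : ZMod q) = ∑ a : ZMod q, F a := by
  refine Finset.sum_nbij' (fun n => (n : ZMod q)) (fun a => a.val) (fun _ _ => Finset.mem_univ _)
    (fun a _ => Finset.mem_range.2 (ZMod.val_lt a)) (fun n hn => ZMod.val_cast_of_lt (Finset.mem_range.1 hn))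
    (fun a _ => ZMod.natCast_zmod_val a) (fun _ _ => rfl)

lemma per_zero (S : Finset (PT D R)) (f : PT D R → ℕ → ℂ) (hf : ∀ p n, f p (n % p.1) = f p n) (hf1 : ∀ p n, ‖f p n‖ ≤ 1)
    (W : ℕ) (hW : 0 < W) (hWc : ∀ p : PT D R, Nat.Coprime W p.1) (e : ℕ → ℂ) (he : ∀ n, e (n % W) = e n) (he1 : ∀ n, ‖e n‖ ≤ 1)
    (h0 : mn W e = 0 ∨ ∃ p ∈ S, mn p.1 (f p) = 0) (N : ℕ) : ‖∑ n ∈ Ioc 0 N, e n * ∏ p ∈ S, f p n‖ ≤ 2 * (W * rA S : ℕ) := by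
  have hQ : 0 < W * rA S := Nat.mul_pos hW (rA_pos S)
  have hper := per_prod S (fun p => p.1) (fun p _ => p.prime.pos) (fun p _ q _ h => coprime_PT p q h) f (fun p _ n => hf p n)
  have hm := prod_mean S f hf W hW hWc e he
  have hz : mn W e * ∏ p ∈ S, mn p.1 (f p) = 0 := by
    rcases h0 with h0 | ⟨p, hp, h0⟩
    · rw [h0, zero_mul]
    · rw [Finset.prod_eq_zero hp h0, mul_zero]
  have := per_partial (W * rA S) hQ (fun n => e n * ∏ p ∈ S, f p n) (fun n => by
      rw [mod_dvd (W * rA S) W (Dvd.intro _ rfl) e he, mod_dvd (W * rA S) (rA S) (Dvd.intro_left _ rfl) (fun n => ∏ p ∈ S, f p n) hper.1])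
    (fun n => by
      rw [norm_mul, norm_prod]
      exact mul_le_one₀ (he1 n) (Finset.prod_nonneg fun _ _ => norm_nonneg _) (Finset.prod_le_one (fun _ _ => norm_nonneg _) fun p _ => hf1 _ _)) N
  rw [hm, hz] at this
  simpa using this

open Classical in
noncomputable def lc (q : ℕ) (χ : DirichletCharacter ℂ q) (n : ℕ) : ℂ := if χ = 1 then 1 else χ n

lemma lc_mod (q : ℕ) (χ : DirichletCharacter ℂ q) (n : ℕ) : lc q χ (n % q) = lc q χ n := by
  unfold lc; rw [ZMod.natCast_mod]

lemma lc_norm (q : ℕ) (χ : DirichletCharacter ℂ q) (n : ℕ) : ‖lc q χ n‖ ≤ 1 := by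
  unfold lc; split_ifs
  · simp
  · exact DirichletCharacter.norm_le_one χ _

lemma lc_mul (q : ℕ) (χ : DirichletCharacter ℂ q) (m n : ℕ) : lc q χ (m * n) = lc q χ m * lc q χ n := by
  unfold lc; split_ifs
  · simp
  · push_cast; rw [map_mul]

lemma lc_mean (q : ℕ) [NeZero q] (χ : DirichletCharacter ℂ q) (h : χ ≠ 1) : mn q (lc q χ) = 0 := by
  unfold mn lc
  simp only [if_neg h]
  rw [sum_range_zmod q (fun a => χ a), MulChar.sum_eq_zero_of_ne_one h, zero_div]

lemma ch_mean (q : ℕ) [NeZero q] (χ ψ : DirichletCharacter ℂ q) (h : χ ≠ ψ) : mn q (fun n => χ n * conj (ψ n)) = 0 := by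
  unfold mn
  rw [sum_range_zmod q (fun a => χ a * conj (ψ a)), char_sum χ ψ h, zero_div]

lemma lc_mean2 (q : ℕ) [NeZero q] (χ ψ : DirichletCharacter ℂ q) (h : χ ≠ ψ) : mn q (fun n => lc q χ n * conj (lc q ψ n)) = 0 := by
  by_cases h1 : χ = 1
  · subst h1
    have := lc_mean q ψ (Ne.symm h)
    unfold mn at this ⊢
    rw [div_eq_zero_iff] at this ⊢
    refine this.imp_left fun h2 => ?_
    have h3 := congrArg conj h2
    rw [map_sum] at h3
    simpa [lc] using h3
  · by_cases h2 : ψ = 1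
    · subst h2
      have := lc_mean q χ h
      unfold mn lc at *
      simpa using this
    · have := ch_mean q χ ψ h
      simpa [lc, h1, h2] using this

/-- the combined character -/
noncomputable def cv (W : ℕ) (x : DirichletCharacter ℂ W × Ch D R) (n : ℕ) : ℂ := x.1 n * ∏ p, lc p.1 (x.2 p) n

lemma cv_Q (W : ℕ) (x : DirichletCharacter ℂ W × Ch D R) (S : Finset (PT D R)) (hS : Qs x.2 ⊆ S) (n : ℕ) :
    ∏ p, lc p.1 (x.2 p) n = ∏ p ∈ S, lc p.1 (x.2 p) n := by
  symm
  refine Finset.prod_subset (Finset.subset_univ _) fun p _ hp => ?_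
  have : x.2 p = 1 := by
    by_contra h
    exact hp (hS ((mem_Qs _ _).2 h))
  simp [lc, this]

abbrev Ix (D R W : ℕ) := {x : DirichletCharacter ℂ W × Ch D R // (Qs x.2).Nonempty ∧ rA (Qs x.2) ≤ R ^ 2}

open Classical in
noncomputable instance (W : ℕ) : Fintype (Ix D R W) := Subtype.fintype _

lemma card_Ix (W : ℕ) [NeZero W] (hD : 2 ≤ D) : (Fintype.card (Ix D R W) : ℝ) ≤ W * (2 * R ^ 6) := by
  classical
  have h1 : (Fintype.card (Ix D R W) : ℝ) = ∑ x : DirichletCharacter ℂ W × Ch D R, if (Qs x.2).Nonempty ∧ rA (Qs x.2) ≤ R ^ 2 then (1:ℝ) else 0 := by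
    rw [Finset.sum_boole, Fintype.card_subtype]
  rw [h1]
  have hcard : ∀ q : ℕ, [NeZero q] → (Fintype.card (DirichletCharacter ℂ q) : ℝ) ≤ q := by
    intro q _
    rw [← Nat.card_eq_fintype_card, DirichletCharacter.card_eq_totient_of_hasEnoughRootsOfUnity]
    exact_mod_cast Nat.totient_le q
  calc _ ≤ ∑ x : DirichletCharacter ℂ W × Ch D R, (R:ℝ) ^ 6 * ∏ p : PT D R, (if x.2 p = 1 then (1:ℝ) else 1 / (p.1:ℝ) ^ 3) := by
        refine Finset.sum_le_sum fun x _ => ?_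
        have e : ∏ p : PT D R, (if x.2 p = 1 then (1:ℝ) else 1 / (p.1:ℝ) ^ 3) = 1 / (rA (Qs x.2) : ℝ) ^ 3 := by
          unfold rA Qs
          push_cast
          rw [Finset.prod_filter, ← Finset.prod_pow, ← Finset.prod_const_one, ← Finset.prod_div_distrib]
          refine Finset.prod_congr rfl fun p _ => ?_
          by_cases h : x.2 p = 1 <;> simp [h]
        rw [e]
        split_ifs with h
        · have hpos : (0:ℝ) < rA (Qs x.2) := by exact_mod_cast rA_pos _
          have hle : (rA (Qs x.2) : ℝ) ≤ R ^ 2 := by exact_mod_cast h.2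
          rw [mul_one_div, one_le_div (by positivity)]
          calc (rA (Qs x.2) : ℝ) ^ 3 ≤ (R ^ 2) ^ 3 := by gcongr
            _ = _ := by ring
        · positivity
    _ = (Fintype.card (DirichletCharacter ℂ W) : ℝ) * ((R:ℝ) ^ 6 * ∏ p : PT D R, ∑ χ : DirichletCharacter ℂ p.1, (if χ = 1 then (1:ℝ) else 1 / (p.1:ℝ) ^ 3)) := by
        rw [Fintype.sum_prod_type]
        rw [← sum_prod_pi' (fun (p : PT D R) (χ : DirichletCharacter ℂ p.1) => if χ = 1 then (1:ℝ) else 1 / (p.1:ℝ) ^ 3)]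
        refine (Finset.sum_const (∑ ρ : Ch D R, (R:ℝ) ^ 6 * ∏ p : PT D R, if ρ p = 1 then (1:ℝ) else 1 / (p.1:ℝ) ^ 3)).trans ?_
        rw [Finset.card_univ, nsmul_eq_mul, ← Finset.mul_sum]
    _ ≤ (W:ℝ) * ((R:ℝ) ^ 6 * ∏ p : PT D R, (1 + 1 / (p.1:ℝ) ^ 2)) := by
        have hpr : ∏ p : PT D R, ∑ χ : DirichletCharacter ℂ p.1, (if χ = 1 then (1:ℝ) else 1 / (p.1:ℝ) ^ 3) ≤ ∏ p : PT D R, (1 + 1 / (p.1:ℝ) ^ 2) := by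
          refine Finset.prod_le_prod (fun p _ => Finset.sum_nonneg fun χ _ => by split_ifs <;> positivity) fun p _ => ?_
          have hp : (0:ℝ) < p.1 := by exact_mod_cast p.prime.pos
          calc ∑ χ : DirichletCharacter ℂ p.1, (if χ = 1 then (1:ℝ) else 1 / (p.1:ℝ) ^ 3) ≤ ∑ χ : DirichletCharacter ℂ p.1, ((if χ = 1 then 1 else 0) + 1 / (p.1:ℝ) ^ 3) := by
                refine Finset.sum_le_sum fun χ _ => ?_
                split_ifs
                · have : 0 ≤ 1 / (p.1:ℝ) ^ 3 := by positivity
                  linarith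
                · linarith
            _ = 1 + (Fintype.card (DirichletCharacter ℂ p.1) : ℝ) * (1 / (p.1:ℝ) ^ 3) := by
                rw [Finset.sum_add_distrib]; simp
            _ ≤ 1 + p.1 * (1 / (p.1:ℝ) ^ 3) := by
              have := hcard p.1
              gcongr
            _ = _ := by field_simp
        have := hcard W
        gcongr
    _ ≤ W * (R ^ 6 * 2) := by
        have := prod_exp_bound (D := D) (R := R) 1 (by norm_num) (by omega) (by exact_mod_cast (by omega : 2 * 1 ≤ D))
        gcongr
    _ = _ := by ring

lemma fam_Ix (W : ℕ) [NeZero W] (hD : 2 ≤ D) (hR : 3 ≤ R) (hWR : W ≤ R) (hWc : ∀ p : PT D R, Nat.Coprime W p.1) :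
    Fam R (fun x : Ix D R W => cv W x.1) := by
  have hW : 0 < W := Nat.pos_of_ne_zero (NeZero.ne W)
  have hWR' : (W:ℝ) ≤ R := by exact_mod_cast hWR
  have hR' : (3:ℝ) ≤ R := by exact_mod_cast hR
  have bd : ∀ a : ℕ, a ≤ R ^ 4 → (2:ℝ) * ((W * a : ℕ) : ℝ) ≤ R ^ 10 := by
    intro a ha
    have ha' : (a:ℝ) ≤ R ^ 4 := by exact_mod_cast ha
    push_cast
    calc (2:ℝ) * (W * a) ≤ R * (R * R ^ 4) := by gcongr; linarith
      _ = R ^ 6 := by ring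
      _ ≤ R ^ 10 := pow_le_pow_right₀ (by linarith) (by norm_num)
  have hmod : ∀ (χ : DirichletCharacter ℂ W) (n : ℕ), χ ((n % W : ℕ) : ZMod W) = χ n := fun χ n => by rw [ZMod.natCast_mod]
  constructor
  · intro x m n
    simp only [cv, lc_mul, Finset.prod_mul_distrib]
    push_cast
    rw [map_mul]; ring
  · intro x n
    simp only [cv]
    rw [norm_mul, norm_prod]
    exact mul_le_one₀ (DirichletCharacter.norm_le_one _ _) (Finset.prod_nonneg fun _ _ => norm_nonneg _) (Finset.prod_le_one (fun _ _ => norm_nonneg _) fun p _ => lc_norm _ _ _)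
  · intro x N
    simp only [cv]
    simp_rw [cv_Q W x.1 (Qs x.1.2) (Finset.Subset.refl _)]
    obtain ⟨p, hp⟩ := x.2.1
    refine (per_zero (Qs x.1.2) (fun p => lc p.1 (x.1.2 p)) (fun p n => lc_mod _ _ _) (fun p n => lc_norm _ _ _) W hW hWc (fun n => x.1.1 n) (hmod _)
      (fun n => DirichletCharacter.norm_le_one _ _) (Or.inr ⟨p, hp, lc_mean _ _ ((mem_Qs _ _).1 hp)⟩) N).trans (bd _ ?_)
    exact x.2.2.trans (Nat.pow_le_pow_right (by omega) (by norm_num))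
  · intro x y hxy N
    simp only [cv]
    have e : ∀ n : ℕ, (x.1.1 n * ∏ p, lc p.1 (x.1.2 p) n) * conj (y.1.1 n * ∏ p, lc p.1 (y.1.2 p) n) =
        (x.1.1 n * conj (y.1.1 n)) * ∏ p ∈ Qs x.1.2 ∪ Qs y.1.2, (lc p.1 (x.1.2 p) n * conj (lc p.1 (y.1.2 p) n)) := by
      intro n
      rw [cv_Q W x.1 (Qs x.1.2 ∪ Qs y.1.2) Finset.subset_union_left, cv_Q W y.1 (Qs x.1.2 ∪ Qs y.1.2) Finset.subset_union_right, Finset.prod_mul_distrib, map_mul, map_prod]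
      ring
    simp_rw [e]
    refine (per_zero (Qs x.1.2 ∪ Qs y.1.2) (fun p n => lc p.1 (x.1.2 p) n * conj (lc p.1 (y.1.2 p) n)) (fun p n => by simp only [lc_mod])
      (fun p n => by rw [norm_mul, RCLike.norm_conj]; exact mul_le_one₀ (lc_norm _ _ _) (norm_nonneg _) (lc_norm _ _ _)) W hW hWc
      (fun n => x.1.1 n * conj (y.1.1 n)) (fun n => by simp only [hmod])
      (fun n => by rw [norm_mul, RCLike.norm_conj]; exact mul_le_one₀ (DirichletCharacter.norm_le_one _ _) (norm_nonneg _) (DirichletCharacter.norm_le_one _ _)) ?_ N).trans (bd _ ?_)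
    · by_cases h1 : x.1.1 = y.1.1
      · right
        have h2 : x.1.2 ≠ y.1.2 := fun h2 => hxy (Subtype.ext (Prod.ext h1 h2))
        obtain ⟨p, hp⟩ := Function.ne_iff.1 h2
        refine ⟨p, ?_, lc_mean2 _ _ _ hp⟩
        rw [Finset.mem_union, mem_Qs, mem_Qs]
        by_contra h3
        push Not at h3
        exact hp (h3.1.trans h3.2.symm)
      · left; exact ch_mean W _ _ h1
    · calc _ ≤ rA (Qs x.1.2) * rA (Qs y.1.2) := rA_union _ _
        _ ≤ R ^ 2 * R ^ 2 := Nat.mul_le_mul x.2.2 y.2.2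
        _ = R ^ 4 := by ring
  · refine (card_Ix W hD).trans ?_
    calc (W:ℝ) * (2 * (R:ℝ) ^ 6) ≤ R * (R * (R:ℝ) ^ 6) := by gcongr; linarith
      _ = (R:ℝ) ^ 8 := by ring
      _ ≤ R ^ 10 := pow_le_pow_right₀ (by linarith) (by norm_num)
end TotRun
end

section
set_option exponentiation.threshold 2000
open ArithmeticFunction Finset
open scoped ArithmeticFunction.Moebius ArithmeticFunction.zeta ComplexConjugate

namespace TotRun
variable {D R k : ℕ}

/-- the prime weight -/
noncomputable def pw (R m : ℕ) : ℝ := (if m.Prime then Real.log m else 0) * (hat R m / m)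

lemma pw_supp (R m : ℕ) (h : pw R m ≠ 0) : m.Prime ∧ R ^ 200 < m := by
  unfold pw at h
  constructor
  · by_contra h1; simp [h1] at h
  · by_contra h1
    rw [hat_lo R m (by omega)] at h
    simp at h

lemma Zs_prime (h : Fin k → ℕ) (i : Fin k) (X J m : ℕ) (hm : m.Prime) (hmR : R < m) (hi : h i ≤ m) :
    Zs D R X J h (m - h i) = ∑ σ : PT D R → Option (Fin k), cp X J i σ * ∏ p : PT D R, gi h i p.1 (σ p) (m : ZMod p.1) := by
  have e1 : ∀ ρ : PT D R → Option (Fin k), ∏ p, ff h p.1 (ρ p) (m - h i) = 1 / (rA (As ρ i) : ℝ) * ∏ p : PT D R, gi h i p.1 (er i ρ p) (m : ZMod p.1) := by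
    intro ρ
    have : 1 / (rA (As ρ i) : ℝ) = ∏ p : PT D R, if ρ p = some i then 1 / (p.1:ℝ) else 1 := by
      unfold rA As
      push_cast
      rw [Finset.prod_filter, ← Finset.prod_const_one, ← Finset.prod_div_distrib]
      exact Finset.prod_congr rfl fun p _ => by split_ifs <;> simp
    rw [this, ← Finset.prod_mul_distrib]
    refine Finset.prod_congr rfl fun p _ => ?_
    by_cases h1 : ρ p = some i
    · rw [if_pos h1, h1, ff_some, Nat.sub_add_cancel hi, if_neg]
      · simp [er, h1, gi]
      · intro h2
        have := (Nat.prime_dvd_prime_iff_eq p.prime hm).1 h2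
        have := p.le
        omega
    · rw [if_neg h1, one_mul]
      have : er i ρ p = ρ p := by simp [er, h1]
      rw [this]
      rcases hj : ρ p with _ | j
      · simp [gi]
      · have hji : j ≠ i := by rintro rfl; exact h1 hj
        rw [ff_some]
        simp only [gi, Option.elim, if_neg hji]
        congr 2
        rw [← ZMod.natCast_eq_zero_iff]
        push_cast [Nat.cast_sub hi]
        rw [eq_iff_iff]
        constructor
        · intro h; linear_combination h
        · intro h; rw [h]; ring
  unfold Zs
  simp_rw [e1]
  rw [← Finset.sum_fiberwise (s := univ) (g := er i)]
  refine Finset.sum_congr rfl fun σ _ => ?_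
  unfold cp
  rw [Finset.sum_mul]
  refine Finset.sum_congr rfl fun ρ hρ => ?_
  rw [(Finset.mem_filter.1 hρ).2]; ring

lemma Zs_sq_prime (h : Fin k → ℕ) (i : Fin k) (X J m : ℕ) (hm : m.Prime) (hmR : R < m) (hi : h i ≤ m) :
    ((Zs D R X J h (m - h i) ^ 2 : ℝ) : ℂ) = ∑ χ : Ch D R, wh X J h i χ * ∏ p, lc p.1 (χ p) m := by
  have hu : ∀ p : PT D R, IsUnit (m : ZMod p.1) := fun p => by
    rw [ZMod.isUnit_iff_coprime]
    refine (Nat.coprime_primes hm p.prime).2 ?_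
    have := p.le
    omega
  have e1 : ∀ ρ ρ' : PT D R → Option (Fin k), ((∏ p : PT D R, (gi h i p.1 (ρ p) (m : ZMod p.1) * gi h i p.1 (ρ' p) (m : ZMod p.1)) : ℝ) : ℂ) =
      ∑ χ : Ch D R, ∏ p : PT D R, (gF h i p.1 (χ p) (ρ p) (ρ' p) * lc p.1 (χ p) m) := by
    intro ρ ρ'
    rw [sum_prod_pi' (fun (p : PT D R) (χ : DirichletCharacter ℂ p.1) => gF h i p.1 χ (ρ p) (ρ' p) * lc p.1 χ m), Complex.ofReal_prod]
    refine Finset.prod_congr rfl fun p _ => ?_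
    rw [← FT_inv (fun a => ((gi h i p.1 (ρ p) a * gi h i p.1 (ρ' p) a : ℝ) : ℂ)) _ (hu p)]
    refine Finset.sum_congr rfl fun χ _ => ?_
    unfold gF lc
    congr 1
    split_ifs with h1
    · rw [h1, MulChar.one_apply (hu p)]
    · rfl
  rw [Zs_prime h i X J m hm hmR hi, sq, Finset.sum_mul_sum]
  push_cast
  unfold wh
  simp_rw [Finset.sum_mul]
  rw [Finset.sum_comm (s := univ (α := Ch D R))]
  refine Finset.sum_congr rfl fun ρ _ => ?_
  rw [Finset.sum_comm (s := univ (α := Ch D R))]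
  refine Finset.sum_congr rfl fun ρ' _ => ?_
  have := e1 ρ ρ'
  simp only [Complex.ofReal_prod, Complex.ofReal_mul, Finset.prod_mul_distrib] at this
  rw [mul_mul_mul_comm, this, Finset.mul_sum]
  exact Finset.sum_congr rfl fun χ _ => by ring

lemma S2_lower (C : ℝ) (W : ℕ) [NeZero W] (hR : 3 ≤ R) (hDR : D ≤ R) (hWR : W ≤ R) (hWc : ∀ p : PT D R, Nat.Coprime W p.1)
    (hA : ∀ (ι : Type) [Fintype ι] (χ : ι → ℕ → ℂ), Fam R χ → ∑ i, ‖PS R (χ i)‖ ≤ C * Real.log R ^ 2)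
    (X J : ℕ) (h : Fin k → ℕ) (hinj : Function.Injective h) (hD : ∀ j, h j ≤ D) (hk : 1 ≤ k) (hkD : 120 * k ^ 2 ≤ D) (i : Fin k) (v : ℕ) (hv : Nat.Coprime v W) :
    1 / 2 * M2s D R X J i * ∑ m ∈ Ioc 0 (R ^ 600), pw R m * (if m % W = v % W then 1 else 0) - 32 * (k:ℝ) ^ 2 / D * M2s D R X J i * (C * Real.log R ^ 2) / Nat.totient W
      ≤ ∑ m ∈ Ioc 0 (R ^ 600), pw R m * (if m % W = v % W then 1 else 0) * Zs D R X J h (m - h i) ^ 2 := by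
  classical
  have hM : 0 ≤ M2s D R X J i := Finset.sum_nonneg fun σ _ => by positivity
  have hk' : (1:ℝ) ≤ k := by exact_mod_cast hk
  have hD2 : 2 ≤ D := by nlinarith
  have hRR : R ≤ R ^ 200 := Nat.le_self_pow (by norm_num) R
  have hW0 : 0 < W := Nat.pos_of_ne_zero (NeZero.ne W)
  have hφ : (0:ℝ) < Nat.totient W := by exact_mod_cast Nat.totient_pos.2 hW0
  set T0 := ∑ m ∈ Ioc 0 (R ^ 600), pw R m * (if m % W = v % W then 1 else 0) with hT0
  set S2 := ∑ m ∈ Ioc 0 (R ^ 600), pw R m * (if m % W = v % W then 1 else 0) * Zs D R X J h (m - h i) ^ 2 with hS2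
  set δ : ZMod W → ℂ := fun a => if a = (v : ZMod W) then 1 else 0 with hδ
  have hδm : ∀ m : ℕ, δ m = ((if m % W = v % W then 1 else 0 : ℝ) : ℂ) := by
    intro m
    simp only [hδ, ZMod.natCast_eq_natCast_iff']
    split_ifs <;> simp
  have hFT : ∀ χ, ‖FT W δ χ‖ ≤ 1 / Nat.totient W := by
    intro χ
    unfold FT
    rw [norm_div, Complex.norm_natCast]
    refine div_le_div_of_nonneg_right ?_ hφ.le
    simp only [hδ, ite_mul, one_mul, zero_mul, Finset.sum_ite_eq', Finset.mem_univ, if_true]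
    rw [RCLike.norm_conj]
    exact DirichletCharacter.norm_le_one _ _
  set B : Ch D R → ℂ := fun χ => ∑ ψ, FT W δ ψ * PS R (cv W (ψ, χ)) with hB
  have hB' : ∀ χ, B χ = ∑ m ∈ Ioc 0 (R ^ 600), ((pw R m : ℝ) : ℂ) * (δ m * ∏ p, lc p.1 (χ p) m) := by
    intro χ
    simp only [hB, PS, Finset.mul_sum]
    rw [Finset.sum_comm]
    refine Finset.sum_congr rfl fun m hm => ?_
    by_cases h0 : pw R m = 0
    · unfold pw at h0
      simp [pw, h0]
    obtain ⟨hmp, hmR⟩ := pw_supp R m h0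
    have hu : IsUnit (m : ZMod W) := by
      rw [ZMod.isUnit_iff_coprime, Nat.coprime_comm, Nat.coprime_comm]
      exact (Nat.coprime_of_lt_prime hW0.ne' (by omega) hmp)
    rw [← FT_inv δ _ hu, Finset.sum_mul, Finset.mul_sum]
    refine Finset.sum_congr rfl fun ψ _ => ?_
    unfold cv pw; ring
  have hS2c : (S2 : ℂ) = ∑ χ : Ch D R, wh X J h i χ * B χ := by
    simp only [hB', Finset.mul_sum]
    rw [Finset.sum_comm, hS2, Complex.ofReal_sum]
    refine Finset.sum_congr rfl fun m hm => ?_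
    by_cases h0 : pw R m = 0
    · simp [h0]
    obtain ⟨hmp, hmR⟩ := pw_supp R m h0
    have := hD i
    rw [Complex.ofReal_mul, Complex.ofReal_mul, Zs_sq_prime h i X J m hmp (by omega) (by omega), ← hδm, Finset.mul_sum]
    exact Finset.sum_congr rfl fun χ _ => by ring
  have hB1 : B 1 = (T0 : ℂ) := by
    rw [hB', hT0, Complex.ofReal_sum]
    refine Finset.sum_congr rfl fun m hm => ?_
    have h1 : ∀ p : PT D R, lc p.1 ((1 : Ch D R) p) m = 1 := fun p => if_pos rfl
    rw [hδm, Finset.prod_congr rfl fun p _ => h1 p, Finset.prod_const_one, mul_one, Complex.ofReal_mul]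
  rw [← Finset.add_sum_erase _ _ (Finset.mem_univ (1 : Ch D R)), hB1] at hS2c
  set E := ∑ χ ∈ univ.erase (1 : Ch D R), wh X J h i χ * B χ with hE
  have hEb : ‖E‖ ≤ 32 * (k:ℝ) ^ 2 / D * M2s D R X J i * (C * Real.log R ^ 2) / Nat.totient W := by
    have hstep : ∀ χ ∈ univ.erase (1 : Ch D R), ‖wh X J h i χ * B χ‖ ≤ ∑ ψ : DirichletCharacter ℂ W,
        if (Qs χ).Nonempty ∧ rA (Qs χ) ≤ R ^ 2 then 32 * (k:ℝ) ^ 2 / D * M2s D R X J i * (1 / Nat.totient W) * ‖PS R (cv W (ψ, χ))‖ else 0 := by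
      intro χ hχ
      have hne : (Qs χ).Nonempty := by
        obtain ⟨p, hp⟩ := Function.ne_iff.1 (Finset.ne_of_mem_erase hχ)
        exact ⟨p, (mem_Qs χ p).2 hp⟩
      by_cases hc : rA (Qs χ) ≤ R ^ 2
      · simp only [hne, hc, and_self, if_true]
        rw [norm_mul, ← Finset.mul_sum, mul_assoc]
        refine mul_le_mul (wh_small X J h hinj hD hk hkD i χ hne) ?_ (norm_nonneg _) (by positivity)
        rw [Finset.mul_sum]
        refine (norm_sum_le _ _).trans (Finset.sum_le_sum fun ψ _ => ?_)
        rw [norm_mul]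
        exact mul_le_mul_of_nonneg_right (hFT ψ) (norm_nonneg _)
      · rw [wh_zero X J h hinj hD i χ (by omega)]
        simp [hc]
    have hsum : ∑ x : DirichletCharacter ℂ W × Ch D R, (if (Qs x.2).Nonempty ∧ rA (Qs x.2) ≤ R ^ 2 then 32 * (k:ℝ) ^ 2 / D * M2s D R X J i * (1 / Nat.totient W) * ‖PS R (cv W x)‖ else 0)
        = 32 * (k:ℝ) ^ 2 / D * M2s D R X J i * (1 / Nat.totient W) * ∑ x : Ix D R W, ‖PS R (cv W x.1)‖ := by
      rw [← Finset.sum_filter, ← Finset.mul_sum]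
      congr 1
      exact Finset.sum_subtype _ (fun x => by simp) _
    calc ‖E‖ ≤ ∑ χ ∈ univ.erase (1 : Ch D R), ∑ ψ : DirichletCharacter ℂ W,
        (if (Qs χ).Nonempty ∧ rA (Qs χ) ≤ R ^ 2 then 32 * (k:ℝ) ^ 2 / D * M2s D R X J i * (1 / Nat.totient W) * ‖PS R (cv W (ψ, χ))‖ else 0) :=
          (norm_sum_le _ _).trans (Finset.sum_le_sum hstep)
      _ ≤ ∑ χ : Ch D R, ∑ ψ : DirichletCharacter ℂ W,
        (if (Qs χ).Nonempty ∧ rA (Qs χ) ≤ R ^ 2 then 32 * (k:ℝ) ^ 2 / D * M2s D R X J i * (1 / Nat.totient W) * ‖PS R (cv W (ψ, χ))‖ else 0) :=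
          Finset.sum_le_sum_of_subset_of_nonneg (Finset.erase_subset _ _) fun χ _ _ => Finset.sum_nonneg fun ψ _ => by split_ifs <;> positivity
      _ = 32 * (k:ℝ) ^ 2 / D * M2s D R X J i * (1 / Nat.totient W) * ∑ x : Ix D R W, ‖PS R (cv W x.1)‖ := by
          rw [← hsum, Fintype.sum_prod_type, Finset.sum_comm]
      _ ≤ 32 * (k:ℝ) ^ 2 / D * M2s D R X J i * (1 / Nat.totient W) * (C * Real.log R ^ 2) := by
          refine mul_le_mul_of_nonneg_left ?_ (by positivity)
          exact hA (Ix D R W) (fun x => cv W x.1) (fam_Ix W hD2 hR hWR hWc)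
      _ = _ := by ring
  have hre := congrArg Complex.re hS2c
  rw [Complex.ofReal_re, Complex.add_re, Complex.re_mul_ofReal] at hre
  have hT0n : 0 ≤ T0 := Finset.sum_nonneg fun m _ => mul_nonneg (mul_nonneg (by split_ifs with hp; exacts [Real.log_natCast_nonneg m, le_rfl]) (div_nonneg (hat_nonneg R m) (Nat.cast_nonneg _))) (by split_ifs <;> norm_num)
  have h1 := mul_le_mul_of_nonneg_right (wh_main X J h hinj hD hk hkD i (R := R)) hT0n
  have h2 := (abs_le.1 ((Complex.abs_re_le_norm E).trans hEb)).1
  rw [hre]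
  linarith
end TotRun
end

section
set_option exponentiation.threshold 2000
open ArithmeticFunction Finset
open scoped ArithmeticFunction.Moebius ArithmeticFunction.zeta ComplexConjugate
namespace TotRun

lemma chi_partial (W : ℕ) [NeZero W] (χ : DirichletCharacter ℂ W) (hχ : χ ≠ 1) (N : ℕ) :
    ‖∑ n ∈ Ioc 0 N, χ (n : ZMod W)‖ ≤ 2 * W := by
  have h := per_partial W (Nat.pos_of_ne_zero (NeZero.ne W)) (fun n => χ (n : ZMod W)) (fun n => by simp only [ZMod.natCast_mod])
    (fun n => DirichletCharacter.norm_le_one _ _) N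
  have h0 : ∑ n ∈ range W, χ (n : ZMod W) = 0 := by
    rw [sum_range_zmod W (fun a => χ a)]
    exact MulChar.sum_eq_zero_of_ne_one hχ
  simpa [h0] using h

open Filter Topology in
lemma chi_L (W : ℕ) [NeZero W] (χ : DirichletCharacter ℂ W) (hχ : χ ≠ 1) :
    ∃ L : ℂ, L ≠ 0 ∧ ∀ N : ℕ, ‖L - ∑ n ∈ Ioc 0 N, χ (n : ZMod W) * ((1 / n : ℝ) : ℂ)‖ ≤ 12 * W / (N + 1) := by
  refine ⟨DirichletCharacter.LFunction χ 1, DirichletCharacter.LFunction_apply_one_ne_zero hχ, fun N => ?_⟩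
  have key : ∀ x : ℝ, 1 < x → x ≤ 2 → ‖DirichletCharacter.LFunction χ x - ∑ n ∈ Ioc 0 N, χ (n : ZMod W) * ((((n:ℝ) ^ (1 - x) / n : ℝ)) : ℂ)‖ ≤ 12 * W / (N + 1) := by
    intro x hx hx2
    have hre : 1 < (x : ℂ).re := by simpa using hx
    have hs := (DirichletCharacter.LSeriesSummable_of_one_lt_re χ hre).hasSum.tendsto_sum_nat
    have hL : DirichletCharacter.LFunction χ x = ∑' n, LSeries.term (fun n => χ n) x n := DirichletCharacter.LFunction_eq_LSeries χ hre
    rw [← hL] at hs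
    have hterm : ∀ M, ∑ n ∈ range (M + 1), LSeries.term (fun n => χ n) x n = ∑ n ∈ Ioc 0 M, χ (n : ZMod W) * ((((n:ℝ) ^ (1 - x) / n : ℝ)) : ℂ) := by
      intro M
      rw [Finset.sum_range_succ', LSeries.term_zero, add_zero, Finset.range_eq_Ico, Finset.sum_Ico_add' (fun n => LSeries.term (fun n => χ n) x n) 0 M 1]
      refine Finset.sum_congr (by ext; simp; omega) fun n hn => ?_
      have hn0 : n ≠ 0 := by have := mem_Ioc.1 hn; omega
      have hn' : (0:ℝ) < n := by positivity
      rw [LSeries.term_of_ne_zero hn0, div_eq_mul_inv]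
      congr 1
      have : (n:ℝ) ^ (1 - x) / n = ((n:ℝ) ^ x)⁻¹ := by
        rw [Real.rpow_sub hn', Real.rpow_one]; field_simp
      rw [this, Complex.ofReal_inv, Complex.ofReal_cpow hn'.le]; simp
    have hs' := (hs.comp (tendsto_add_atTop_nat 1)).sub_const (∑ n ∈ Ioc 0 N, χ (n : ZMod W) * ((((n:ℝ) ^ (1 - x) / n : ℝ)) : ℂ))
    refine le_of_tendsto hs'.norm ?_
    filter_upwards [eventually_ge_atTop N] with M hM
    simp only [Function.comp]
    rw [hterm, ← Finset.sum_Ioc_consecutive _ (Nat.zero_le N) hM, add_sub_cancel_left]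
    refine (abel_u (fun n => χ (n : ZMod W)) (fun n => (n:ℝ) ^ (1 - x)) (2 * W) 1 zero_le_one (chi_partial W χ hχ) N M ?_ ?_).trans (le_of_eq (by ring))
    · intro n hn
      rw [abs_of_nonneg (by positivity)]
      exact Real.rpow_le_one_of_one_le_of_nonpos (by exact_mod_cast (by omega : 1 ≤ n)) (by linarith)
    · intro n hn
      have hn' : (1:ℝ) ≤ n := by exact_mod_cast (by omega : 1 ≤ n)
      have hn0 : (0:ℝ) < n := by linarith
      have h1 : ((n + 1 : ℕ) : ℝ) ^ (1 - x) = (n:ℝ) ^ (1 - x) * ((n:ℝ) / (n + 1)) ^ (x - 1) := by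
        rw [Real.div_rpow hn0.le (by positivity), mul_div_assoc', ← Real.rpow_add hn0]
        push_cast
        rw [show 1 - x + (x - 1) = 0 by ring, Real.rpow_zero, one_div, ← Real.rpow_neg (by positivity), neg_sub]
      have hb : (n:ℝ) / (n + 1) ≤ 1 := by rw [div_le_one (by positivity)]; linarith
      have hb0 : 0 < (n:ℝ) / (n + 1) := by positivity
      have h2 : (n:ℝ) / (n + 1) ≤ ((n:ℝ) / (n + 1)) ^ (x - 1) := by
        conv_lhs => rw [← Real.rpow_one ((n:ℝ) / (n + 1))]
        exact Real.rpow_le_rpow_of_exponent_ge hb0 hb (by linarith)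
      have h3 : ((n:ℝ) / (n + 1)) ^ (x - 1) ≤ 1 := Real.rpow_le_one hb0.le hb (by linarith)
      have h4 : (n:ℝ) ^ (1 - x) ≤ 1 := Real.rpow_le_one_of_one_le_of_nonpos hn' (by linarith)
      have h5 : 0 ≤ (n:ℝ) ^ (1 - x) := by positivity
      rw [h1, show (n:ℝ) ^ (1 - x) - (n:ℝ) ^ (1 - x) * ((n:ℝ) / (n + 1)) ^ (x - 1) = (n:ℝ) ^ (1 - x) * (1 - ((n:ℝ) / (n + 1)) ^ (x - 1)) by ring,
        abs_of_nonneg (mul_nonneg h5 (by linarith))]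
      calc _ ≤ 1 * (1 - (n:ℝ) / (n + 1)) := by gcongr <;> linarith
        _ = 1 / (n + 1) := by field_simp; ring
        _ ≤ 1 / n := by gcongr; linarith
  have hc : Tendsto (fun x : ℝ => ‖DirichletCharacter.LFunction χ x - ∑ n ∈ Ioc 0 N, χ (n : ZMod W) * ((((n:ℝ) ^ (1 - x) / n : ℝ)) : ℂ)‖) (𝓝[>] 1)
      (𝓝 ‖DirichletCharacter.LFunction χ ((1:ℝ):ℂ) - ∑ n ∈ Ioc 0 N, χ (n : ZMod W) * ((((n:ℝ) ^ (1 - (1:ℝ)) / n : ℝ)) : ℂ)‖) := by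
    refine Tendsto.mono_left (ContinuousAt.tendsto ?_) nhdsWithin_le_nhds
    refine ContinuousAt.norm (ContinuousAt.sub ?_ ?_)
    · exact ((DirichletCharacter.differentiable_LFunction hχ).continuous.comp Complex.continuous_ofReal).continuousAt
    · refine tendsto_finsetSum _ fun n hn => ?_
      have hn0 : (n:ℝ) ≠ 0 := by have := mem_Ioc.1 hn; exact_mod_cast (by omega : n ≠ 0)
      refine Tendsto.mul tendsto_const_nhds (ContinuousAt.tendsto (f := fun x : ℝ => ((((n:ℝ) ^ (1 - x) / n : ℝ)) : ℂ)) ?_)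
      refine Complex.continuous_ofReal.continuousAt.comp (ContinuousAt.div_const ?_ _)
      exact ((Real.continuousAt_const_rpow hn0).comp (by fun_prop : ContinuousAt (fun x : ℝ => 1 - x) 1))
  have := le_of_tendsto hc (by
    have : Set.Ioc (1:ℝ) 2 ∈ 𝓝[>] (1:ℝ) := Ioc_mem_nhdsGT (by norm_num)
    filter_upwards [this] with x hx using key x hx.1 hx.2)
  simpa using this

lemma psi_le6 (N : ℕ) : ∑ d ∈ Ioc 0 N, Λ d ≤ 6 * N := by
  have := Chebyshev.psi_le_const_mul_self (x := N) (by positivity)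
  simp only [Chebyshev.psi, Nat.floor_natCast] at this
  have h4 : Real.log 4 ≤ 2 := by
    have : Real.log 4 = 2 * Real.log 2 := by
      rw [show (4 : ℝ) = 2 ^ 2 by norm_num, Real.log_pow]; norm_num
    have := Real.log_two_lt_d9
    linarith
  have : (0:ℝ) ≤ N := by positivity
  nlinarith

lemma chi_log (W : ℕ) [NeZero W] (χ : DirichletCharacter ℂ W) (hχ : χ ≠ 1) (N : ℕ) :
    ‖∑ n ∈ Ioc 0 N, χ (n : ZMod W) * ((Real.log n / n : ℝ) : ℂ)‖ ≤ 2 + 8 * W := by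
  have hv : ∀ n : ℕ, |Real.log n / n| ≤ 1 := by
    intro n
    rcases Nat.eq_zero_or_pos n with h | h
    · simp [h]
    have hn' : (0:ℝ) < n := by exact_mod_cast h
    rw [abs_of_nonneg (div_nonneg (Real.log_natCast_nonneg n) hn'.le), div_le_one hn']
    linarith [Real.log_le_sub_one_of_pos hn']
  by_cases hN : 2 ≤ N
  · rw [← Finset.sum_Ioc_consecutive _ (Nat.zero_le 2) hN]
    refine (norm_add_le _ _).trans (add_le_add ?_ ?_)
    · refine (norm_sum_le _ _).trans ?_
      calc _ ≤ ∑ n ∈ Ioc 0 2, (1:ℝ) := Finset.sum_le_sum fun n _ => by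
            rw [norm_mul, Complex.norm_real]
            exact mul_le_one₀ (DirichletCharacter.norm_le_one _ _) (norm_nonneg _) (hv n)
        _ = 2 := by simp
    · refine (abel_bound (fun n => χ (n : ZMod W)) (fun n => Real.log n / n) (2 * W) (chi_partial W χ hχ) 2 N hN).trans ?_
      have hanti : ∀ n : ℕ, 2 < n → Real.log ((n + 1 : ℕ) : ℝ) / ((n + 1 : ℕ) : ℝ) ≤ Real.log n / n := by
        intro n hn
        have h3 : (3:ℝ) ≤ n := by exact_mod_cast hn
        have he := Real.exp_one_lt_d9
        exact Real.log_div_self_antitoneOn (by show Real.exp 1 ≤ (n:ℝ); linarith) (by show Real.exp 1 ≤ ((n + 1 : ℕ):ℝ); push_cast; linarith) (by push_cast; linarith)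
      have htel : ∀ M : ℕ, 2 ≤ M → ∑ n ∈ Ioc 2 M, |Real.log n / n - Real.log ((n + 1 : ℕ) : ℝ) / ((n + 1 : ℕ) : ℝ)| = Real.log (3:ℕ) / (3:ℕ) - Real.log ((M + 1 : ℕ) : ℝ) / ((M + 1 : ℕ) : ℝ) := by
        intro M hM
        induction M, hM using Nat.le_induction with
        | base => simp
        | succ n hn ih =>
          rw [Finset.sum_Ioc_succ_top (by omega), ih, abs_of_nonneg (by linarith [hanti (n + 1) (by omega)])]
          ring
      rw [htel N hN]
      have h1 := hv 3
      have h2 := hv (N + 1)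
      have h3 : 0 ≤ Real.log ((N + 1 : ℕ) : ℝ) / ((N + 1 : ℕ) : ℝ) := div_nonneg (Real.log_natCast_nonneg _) (by positivity)
      rw [abs_of_nonneg h3] at *
      rw [abs_le] at h1
      have : (0:ℝ) ≤ W := by positivity
      nlinarith
  · refine (norm_sum_le _ _).trans ?_
    calc _ ≤ ∑ n ∈ Ioc 0 N, (1:ℝ) := Finset.sum_le_sum fun n _ => by
          rw [norm_mul, Complex.norm_real]
          exact mul_le_one₀ (DirichletCharacter.norm_le_one _ _) (norm_nonneg _) (hv n)
      _ = N := by simp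
      _ ≤ 2 + 8 * W := by
        have : (N:ℝ) ≤ 2 := by exact_mod_cast (by omega : N ≤ 2)
        have : (0:ℝ) ≤ W := by positivity
        linarith

lemma chi_vM (W : ℕ) [NeZero W] (χ : DirichletCharacter ℂ W) (hχ : χ ≠ 1) :
    ∃ C : ℝ, ∀ N : ℕ, ‖∑ n ∈ Ioc 0 N, χ (n : ZMod W) * ((Λ n / n : ℝ) : ℂ)‖ ≤ C := by
  obtain ⟨L, hL, hLN⟩ := chi_L W χ hχ
  refine ⟨(2 + 8 * W + 72 * W) / ‖L‖, fun N => ?_⟩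
  rw [le_div_iff₀ (norm_pos_iff.2 hL), ← norm_mul, Finset.sum_mul]
  have hd := dbl N (fun d m => χ (d : ZMod W) * ((Λ d / d : ℝ) : ℂ) * (χ (m : ZMod W) * ((1 / m : ℝ) : ℂ)))
  have hl : ∑ n ∈ Ioc 0 N, ∑ d ∈ n.divisors, χ (d : ZMod W) * ((Λ d / d : ℝ) : ℂ) * (χ ((n / d : ℕ) : ZMod W) * ((1 / (n / d : ℕ) : ℝ) : ℂ))
      = ∑ n ∈ Ioc 0 N, χ (n : ZMod W) * ((Real.log n / n : ℝ) : ℂ) := by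
    refine Finset.sum_congr rfl fun n hn => ?_
    have hn0 : n ≠ 0 := by have := mem_Ioc.1 hn; omega
    rw [← vonMangoldt_sum, Finset.sum_div, Complex.ofReal_sum, Finset.mul_sum]
    refine Finset.sum_congr rfl fun d hd => ?_
    obtain ⟨e, he⟩ := Nat.dvd_of_mem_divisors hd
    have hd0 : d ≠ 0 := by rintro rfl; simp at he; exact hn0 he
    subst he
    have he0 : e ≠ 0 := by rintro rfl; simp at hn0
    rw [Nat.mul_div_cancel_left e (Nat.pos_of_ne_zero hd0)]
    push_cast
    rw [map_mul]
    field_simp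
  rw [hl] at hd
  have hsplit : ∑ d ∈ Ioc 0 N, χ (d : ZMod W) * ((Λ d / d : ℝ) : ℂ) * L = ∑ n ∈ Ioc 0 N, χ (n : ZMod W) * ((Real.log n / n : ℝ) : ℂ)
      + ∑ d ∈ Ioc 0 N, χ (d : ZMod W) * ((Λ d / d : ℝ) : ℂ) * (L - ∑ m ∈ Ioc 0 (N / d), χ (m : ZMod W) * ((1 / m : ℝ) : ℂ)) := by
    rw [hd, ← Finset.sum_add_distrib]
    refine Finset.sum_congr rfl fun d _ => ?_
    rw [← Finset.mul_sum]; ring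
  rw [hsplit]
  refine (norm_add_le _ _).trans (add_le_add (chi_log W χ hχ N) ?_)
  refine (norm_sum_le _ _).trans ?_
  rcases Nat.eq_zero_or_pos N with h | h
  · simp [h]
  have hN' : (0:ℝ) < N := by exact_mod_cast h
  calc _ ≤ ∑ d ∈ Ioc 0 N, Λ d * (12 * W / N) := Finset.sum_le_sum fun d hd => by
        have hd0 : 0 < d := (mem_Ioc.1 hd).1
        have hd' : (0:ℝ) < d := by exact_mod_cast hd0
        rw [norm_mul, norm_mul, Complex.norm_real, Real.norm_of_nonneg (div_nonneg vonMangoldt_nonneg hd'.le)]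
        have h1 := hLN (N / d)
        have h2 : (N / d : ℝ) ≤ ((N / d : ℕ) : ℝ) + 1 := by
          rw [div_le_iff₀ hd']
          have := Nat.lt_div_mul_add (a := N) hd0
          have h2 : N ≤ (N / d + 1) * d := by nlinarith
          exact_mod_cast h2
        calc _ ≤ 1 * (Λ d / d) * (12 * W / (N / d)) := by
              refine mul_le_mul (mul_le_mul_of_nonneg_right (DirichletCharacter.norm_le_one _ _) (div_nonneg vonMangoldt_nonneg hd'.le)) (h1.trans ?_) (norm_nonneg _) (by have := vonMangoldt_nonneg (n := d); positivity)
              exact div_le_div_of_nonneg_left (by positivity) (by positivity) h2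
          _ = _ := by field_simp
    _ = (∑ d ∈ Ioc 0 N, Λ d) * (12 * W / N) := by rw [Finset.sum_mul]
    _ ≤ 6 * N * (12 * W / N) := mul_le_mul_of_nonneg_right (psi_le6 N) (by positivity)
    _ = 72 * W := by field_simp; ring

/-- Mertens for primes twisted by a nontrivial character. -/
lemma chi_pr (W : ℕ) [NeZero W] (χ : DirichletCharacter ℂ W) (hχ : χ ≠ 1) :
    ∃ C : ℝ, ∀ N : ℕ, ‖∑ n ∈ Ioc 0 N, χ (n : ZMod W) * (((if n.Prime then Real.log n else 0) / n : ℝ) : ℂ)‖ ≤ C := by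
  obtain ⟨C1, h1⟩ := chi_vM W χ hχ
  obtain ⟨C2, hC2, h2⟩ := pp_exists
  refine ⟨C1 + C2, fun N => ?_⟩
  have hsplit : ∑ n ∈ Ioc 0 N, χ (n : ZMod W) * (((if n.Prime then Real.log n else 0) / n : ℝ) : ℂ) = ∑ n ∈ Ioc 0 N, χ (n : ZMod W) * ((Λ n / n : ℝ) : ℂ)
     - ∑ n ∈ Ioc 0 N, χ (n : ZMod W) * (((if n.Prime then 0 else Λ n) / n : ℝ) : ℂ) := by
    rw [← Finset.sum_sub_distrib]
    refine Finset.sum_congr rfl fun n _ => ?_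
    by_cases hp : n.Prime
    · simp [hp, vonMangoldt_apply_prime hp]
    · simp [hp]
  rw [hsplit]
  refine (norm_sub_le _ _).trans (add_le_add (h1 N) ((norm_sum_le _ _).trans ?_))
  calc _ ≤ ∑ n ∈ Ioc 0 N, (if n.Prime then 0 else Λ n) / (n:ℝ) := Finset.sum_le_sum fun n _ => by
        have h0 : 0 ≤ (if n.Prime then 0 else Λ n) / (n:ℝ) := by
          refine div_nonneg ?_ (by positivity)
          split_ifs
          · exact le_rfl
          · exact vonMangoldt_nonneg
        rw [norm_mul, Complex.norm_real, Real.norm_of_nonneg h0]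
        exact mul_le_of_le_one_left h0 (DirichletCharacter.norm_le_one _ _)
    _ ≤ C2 := by
      rcases Nat.eq_zero_or_pos N with h | h
      · simp [h, hC2.le]
      rw [← Finset.sum_Ioc_consecutive _ (Nat.zero_le 1) h]
      simpa using h2 1 N le_rfl

lemma mertens_ap (W v : ℕ) [NeZero W] (hv : Nat.Coprime v W) : ∃ C : ℝ, ∀ A N : ℕ, W ≤ A → A ≤ N →
    (Real.log N - Real.log A) / Nat.totient W - C ≤ ∑ n ∈ Ioc A N, (if n.Prime then Real.log n else 0) / n * (if n % W = v % W then (1:ℝ) else 0) := by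
  classical
  have hW0 : 0 < W := Nat.pos_of_ne_zero (NeZero.ne W)
  have hφ : (0:ℝ) < Nat.totient W := by exact_mod_cast Nat.totient_pos.2 hW0
  have hch : ∀ χ : DirichletCharacter ℂ W, ∃ C : ℝ, χ ≠ 1 → ∀ N : ℕ, ‖∑ n ∈ Ioc 0 N, χ (n : ZMod W) * (((if n.Prime then Real.log n else 0) / n : ℝ) : ℂ)‖ ≤ C := by
    intro χ
    by_cases hχ : χ = 1
    · exact ⟨0, fun h => absurd hχ h⟩
    · obtain ⟨C, h⟩ := chi_pr W χ hχ
      exact ⟨C, fun _ => h⟩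
  choose Cf hCf using hch
  obtain ⟨C0, hC0, hm⟩ := mertens_prime
  refine ⟨2 * C0 / Nat.totient W + ∑ χ ∈ univ.erase (1 : DirichletCharacter ℂ W), ‖FT W (fun a => if a = (v : ZMod W) then 1 else 0) χ‖ * (2 * Cf χ), fun A N hA hAN => ?_⟩
  set δ : ZMod W → ℂ := fun a => if a = (v : ZMod W) then 1 else 0 with hδ
  set w : ℕ → ℝ := fun n => (if n.Prime then Real.log n else 0) / n with hw
  have hvu : IsUnit (v : ZMod W) := (ZMod.isUnit_iff_coprime _ _).2 hv
  have h1 : FT W δ 1 = 1 / Nat.totient W := by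
    unfold FT
    simp only [hδ, ite_mul, one_mul, zero_mul, Finset.sum_ite_eq', Finset.mem_univ, if_true]
    rw [MulChar.one_apply hvu]; simp
  have hS : ((∑ n ∈ Ioc A N, w n * (if n % W = v % W then (1:ℝ) else 0) : ℝ) : ℂ) = ∑ χ, FT W δ χ * ∑ n ∈ Ioc A N, χ (n : ZMod W) * ((w n : ℝ) : ℂ) := by
    simp only [Finset.mul_sum]
    rw [Finset.sum_comm, Complex.ofReal_sum]
    refine Finset.sum_congr rfl fun n hn => ?_
    by_cases hp : n.Prime
    · have hu : IsUnit (n : ZMod W) := by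
        rw [ZMod.isUnit_iff_coprime]
        exact Nat.coprime_of_lt_prime hW0.ne' (by have := mem_Ioc.1 hn; omega) hp
      have h2 := FT_inv δ _ hu
      simp only [hδ, ZMod.natCast_eq_natCast_iff'] at h2
      rw [Complex.ofReal_mul, show (((if n % W = v % W then (1:ℝ) else 0 : ℝ)) : ℂ) = if n % W = v % W then 1 else 0 by split_ifs <;> simp, ← h2, Finset.mul_sum]
      exact Finset.sum_congr rfl fun χ _ => by ring
    · simp [hw, hp]
  have hone : ∑ n ∈ Ioc A N, (1 : DirichletCharacter ℂ W) (n : ZMod W) * ((w n : ℝ) : ℂ) = ((∑ n ∈ Ioc A N, w n : ℝ) : ℂ) := by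
    rw [Complex.ofReal_sum]
    refine Finset.sum_congr rfl fun n hn => ?_
    by_cases hp : n.Prime
    · have hu : IsUnit (n : ZMod W) := by
        rw [ZMod.isUnit_iff_coprime]
        exact Nat.coprime_of_lt_prime hW0.ne' (by have := mem_Ioc.1 hn; omega) hp
      rw [MulChar.one_apply hu, one_mul]
    · simp [hw, hp]
  rw [← Finset.add_sum_erase _ _ (Finset.mem_univ (1 : DirichletCharacter ℂ W)), hone, h1] at hS
  set E := ∑ χ ∈ univ.erase (1 : DirichletCharacter ℂ W), FT W δ χ * ∑ n ∈ Ioc A N, χ (n : ZMod W) * ((w n : ℝ) : ℂ) with hE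
  have hEb : ‖E‖ ≤ ∑ χ ∈ univ.erase (1 : DirichletCharacter ℂ W), ‖FT W δ χ‖ * (2 * Cf χ) := by
    refine (norm_sum_le _ _).trans (Finset.sum_le_sum fun χ hχ => ?_)
    rw [norm_mul]
    refine mul_le_mul_of_nonneg_left ?_ (norm_nonneg _)
    have e := hCf χ (Finset.ne_of_mem_erase hχ)
    have : ∑ n ∈ Ioc A N, χ (n : ZMod W) * ((w n : ℝ) : ℂ) = ∑ n ∈ Ioc 0 N, χ (n : ZMod W) * ((w n : ℝ) : ℂ) - ∑ n ∈ Ioc 0 A, χ (n : ZMod W) * ((w n : ℝ) : ℂ) := by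
      rw [← Finset.sum_Ioc_consecutive _ (Nat.zero_le A) hAN]; ring
    rw [this]
    refine (norm_sub_le _ _).trans ?_
    linarith [e N, e A]
  have hre := congrArg Complex.re hS
  rw [Complex.ofReal_re, Complex.add_re, show (1 / (Nat.totient W : ℂ) * ((∑ n ∈ Ioc A N, w n : ℝ) : ℂ)) = ((1 / (Nat.totient W : ℝ) * ∑ n ∈ Ioc A N, w n : ℝ) : ℂ) by push_cast; ring, Complex.ofReal_re] at hre
  have hEr : -‖E‖ ≤ E.re := by have := Complex.abs_re_le_norm E; rw [abs_le] at this; exact this.1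
  have hmm : Real.log N - Real.log A - 2 * C0 ≤ ∑ n ∈ Ioc A N, w n := by
    have a1 := hm N (by omega)
    have a2 := hm A (by omega)
    rw [← Finset.sum_Ioc_consecutive _ (Nat.zero_le A) hAN] at a1
    rw [abs_le] at a1 a2
    linarith [a1.1, a2.2]
  have := mul_le_mul_of_nonneg_left hmm (by positivity : 0 ≤ 1 / (Nat.totient W : ℝ))
  rw [hre]
  calc _ = 1 / (Nat.totient W : ℝ) * (Real.log N - Real.log A - 2 * C0) - ∑ χ ∈ univ.erase (1 : DirichletCharacter ℂ W), ‖FT W δ χ‖ * (2 * Cf χ) := by ring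
    _ ≤ _ := by linarith

lemma hat_mid (R n : ℕ) (hR : 1 ≤ R) (h1 : R ^ 300 ≤ n) (h2 : n ≤ R ^ 500) : 100 * Real.log R ≤ hat R n := by
  have hR' : (0:ℝ) < R := by exact_mod_cast hR
  have hn : (0:ℝ) < n := by exact_mod_cast (Nat.pow_pos hR).trans_le h1
  have a1 := Real.log_le_log (by positivity) (by exact_mod_cast h1 : (R:ℝ) ^ 300 ≤ n)
  have a2 := Real.log_le_log hn (by exact_mod_cast h2 : (n:ℝ) ≤ (R:ℝ) ^ 500)
  rw [Real.log_pow] at a1 a2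
  push_cast at a1 a2
  have hL : 0 ≤ Real.log R := Real.log_natCast_nonneg R
  unfold hat lpf
  rw [max_eq_right (by linarith : 0 ≤ 600 * Real.log R - Real.log n), max_eq_left (by linarith : 200 * Real.log R - Real.log n ≤ 0)]
  rcases max_cases 0 (400 * Real.log R - Real.log n) with h | h <;> rw [h.1] <;> linarith

lemma pw_lower (W v : ℕ) [NeZero W] (hv : Nat.Coprime v W) : ∃ R1 : ℕ, ∀ R ≥ R1,
    10000 * Real.log R ^ 2 / Nat.totient W ≤ ∑ m ∈ Ioc 0 (R ^ 600), pw R m * (if m % W = v % W then (1:ℝ) else 0) := by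
  obtain ⟨C, hC⟩ := mertens_ap W v hv
  have hW0 : 0 < W := Nat.pos_of_ne_zero (NeZero.ne W)
  have hφ : (0:ℝ) < Nat.totient W := by exact_mod_cast Nat.totient_pos.2 hW0
  obtain ⟨R2, hR2⟩ := Filter.eventually_atTop.1 ((Real.tendsto_log_atTop.comp tendsto_natCast_atTop_atTop).eventually_ge_atTop (C * Nat.totient W / 100))
  refine ⟨max (max R2 W) 3, fun R hR => ?_⟩
  have hRW : W ≤ R := (le_max_right R2 W).trans ((le_max_left _ _).trans hR)
  have hR3 : 3 ≤ R := (le_max_right _ _).trans hR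
  have hL := hR2 R ((le_max_left R2 W).trans ((le_max_left _ _).trans hR))
  simp only [Function.comp] at hL
  have hL1 := log_ge_one R hR3
  have hp1 : R ^ 300 ≤ R ^ 500 := Nat.pow_le_pow_right (by omega) (by norm_num)
  have hp2 : R ^ 500 ≤ R ^ 600 := Nat.pow_le_pow_right (by omega) (by norm_num)
  have h := hC (R ^ 300) (R ^ 500) (hRW.trans (Nat.le_self_pow (by norm_num) R)) hp1
  rw [log_natpow, log_natpow] at h
  push_cast at h
  calc _ ≤ 100 * Real.log R * ((500 * Real.log R - 300 * Real.log R) / Nat.totient W - C) := by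
        rw [div_le_iff₀ (by positivity)] at hL
        have e : 100 * Real.log R * ((500 * Real.log R - 300 * Real.log R) / Nat.totient W - C) - 10000 * Real.log R ^ 2 / Nat.totient W
          = 100 * Real.log R / Nat.totient W * (Real.log R * 100 - C * Nat.totient W) := by field_simp; ring
        have : 0 ≤ 100 * Real.log R / Nat.totient W * (Real.log R * 100 - C * Nat.totient W) := mul_nonneg (by positivity) (by linarith)
        linarith
    _ ≤ 100 * Real.log R * ∑ n ∈ Ioc (R ^ 300) (R ^ 500), (if n.Prime then Real.log n else 0) / n * (if n % W = v % W then (1:ℝ) else 0) :=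
        mul_le_mul_of_nonneg_left h (by positivity)
    _ ≤ ∑ m ∈ Ioc (R ^ 300) (R ^ 500), pw R m * (if m % W = v % W then (1:ℝ) else 0) := by
        rw [Finset.mul_sum]
        refine Finset.sum_le_sum fun m hm => ?_
        rw [mem_Ioc] at hm
        have := hat_mid R m (by omega) hm.1.le hm.2
        rw [← mul_assoc]
        refine mul_le_mul_of_nonneg_right ?_ (by split_ifs <;> norm_num)
        unfold pw
        rw [mul_div_assoc', mul_div_assoc']
        refine div_le_div_of_nonneg_right ?_ (by positivity)
        rw [mul_comm]
        refine mul_le_mul_of_nonneg_left this ?_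
        split_ifs
        · exact Real.log_natCast_nonneg _
        · exact le_rfl
    _ ≤ _ := by
        refine Finset.sum_le_sum_of_subset_of_nonneg (Finset.Ioc_subset_Ioc (Nat.zero_le _) hp2) fun m _ _ => ?_
        refine mul_nonneg (mul_nonneg ?_ (div_nonneg (hat_nonneg R m) (by positivity))) (by split_ifs <;> norm_num)
        split_ifs
        · exact Real.log_natCast_nonneg _
        · exact le_rfl

end TotRun
end

section
set_option exponentiation.threshold 2000
open ArithmeticFunction Finset
open scoped ArithmeticFunction.Moebius ArithmeticFunction.zeta ComplexConjugate
namespace TotRun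
variable {D R k : ℕ}

lemma Zs_bd (h : Fin k → ℕ) (X J n : ℕ) (hD : 0 < D) (hk : 2 * k ≤ D) (hR : 2 ^ (k+1) ≤ R) : Zs D R X J h n ^ 2 ≤ (R:ℝ) ^ 6 := by
  have h1 : |Zs D R X J h n| ≤ 2 ^ (k+1) * (R:ℝ) ^ 2 := by
    refine (Finset.abs_sum_le_sum_abs _ _).trans (le_trans (Finset.sum_le_sum fun ρ _ => ?_) (yy_sum (R := R) X J hD hk))
    rw [abs_mul, Finset.abs_prod]
    exact mul_le_of_le_one_right (abs_nonneg _) (Finset.prod_le_one (fun _ _ => abs_nonneg _) fun p _ => ff_abs h p.1 p.prime.one_le _ _)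
  have h2 : (2:ℝ) ^ (k+1) ≤ R := by exact_mod_cast hR
  rw [← sq_abs]
  calc _ ≤ ((R:ℝ) * (R:ℝ) ^ 2) ^ 2 := by gcongr; exact h1.trans (by gcongr)
    _ = _ := by ring

lemma err_le (W a : ℕ) (hR : 2400 ≤ R) (h2 : 2 ^ (k+1) ≤ R) (hW : W ≤ R) (ha : a ≤ R) :
    (2 ^ (k+1) * (R:ℝ) ^ 2) ^ 2 * (2400 * (W * a * (R:ℝ) ^ 2) * Real.log R / R ^ 200) ≤ 1 / (R:ℝ) ^ 185 := by
  have h2' : (2:ℝ) ^ (k+1) ≤ R := by exact_mod_cast h2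
  have hR' : (2400:ℝ) ≤ R := by exact_mod_cast hR
  have hW' : (W:ℝ) ≤ R := by exact_mod_cast hW
  have ha' : (a:ℝ) ≤ R := by exact_mod_cast ha
  have hL : Real.log R ≤ R := by linarith [Real.log_le_sub_one_of_pos (x := (R:ℝ)) (by linarith)]
  have hL0 : 0 ≤ Real.log R := Real.log_natCast_nonneg R
  have hR0 : (0:ℝ) < R := by linarith
  calc _ ≤ ((R:ℝ) * (R:ℝ) ^ 2) ^ 2 * ((R:ℝ) * (R * R * (R:ℝ) ^ 2) * R / R ^ 200) := by gcongr
    _ = 1 / (R:ℝ) ^ 188 := by field_simp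
    _ ≤ _ := by
      refine one_div_le_one_div_of_le (by positivity) (pow_le_pow_right₀ (by linarith) (by norm_num))

lemma hat_shift (R n h : ℕ) (hn : 1 ≤ n) : hat R (n + h) / ((n + h : ℕ):ℝ) ≤ hat R n / n + 4 * h / (n:ℝ) ^ 2 := by
  have hn' : (0:ℝ) < n := by exact_mod_cast hn
  have h1 := (le_abs_self _).trans (hat_lip R (n + h) n)
  have h3 : (n:ℝ) ≤ ((n + h : ℕ) : ℝ) := by push_cast; linarith [(Nat.cast_nonneg h : (0:ℝ) ≤ h)]
  have h2 : |Real.log ((n + h : ℕ) : ℝ) - Real.log n| ≤ h / n := by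
    rw [abs_of_nonneg (sub_nonneg.2 (Real.log_le_log hn' h3)), ← Real.log_div (by positivity) (by positivity)]
    refine (Real.log_le_sub_one_of_pos (by positivity)).trans (le_of_eq ?_)
    push_cast; field_simp; ring
  calc _ ≤ hat R (n + h) / n := div_le_div_of_nonneg_left (hat_nonneg _ _) hn' h3
    _ ≤ (hat R n + 4 * (h / n)) / n := div_le_div_of_nonneg_right (by linarith) hn'.le
    _ = _ := by field_simp

lemma S2_upper (X J W v c : ℕ) (h : Fin k → ℕ) (hD : ∀ j, h j ≤ D) (hD0 : 0 < D) (hk : 2 * k ≤ D) (hR : 2500 ≤ R) (h2 : 2 ^ (k+1) ≤ R) (hDR : D ≤ R) (i : Fin k) :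
    ∑ m ∈ Ioc 0 (R ^ 600), pw R m * (if m % W = (v + h i) % W then 1 else 0) * Zs D R X J h (m - h i) ^ 2 ≤
     600 * Real.log R * (∑ n ∈ Ioc 0 (R ^ 600), (if (n + h i).Prime then (1:ℝ) else 0) * ((if n % W = v % W then 1 else 0) * Zs D R X J h n ^ 2 * (hat R n / n)) + 1 / (R:ℝ) ^ 185) := by
  have hR' : (2500:ℝ) ≤ R := by exact_mod_cast hR
  have hR0 : (0:ℝ) < R := by linarith
  have hL0 : 0 ≤ Real.log R := Real.log_natCast_nonneg R
  have hL : Real.log R ≤ R := by linarith [Real.log_le_sub_one_of_pos (x := (R:ℝ)) (by linarith)]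
  have hDR' : (D:ℝ) ≤ R := by exact_mod_cast hDR
  have hpow : D + R ^ 199 ≤ R ^ 200 := by
    have : R ≤ R ^ 199 := Nat.le_self_pow (by norm_num) R
    calc D + R ^ 199 ≤ R ^ 199 * 2 := by omega
      _ ≤ R ^ 199 * R := Nat.mul_le_mul_left _ (by omega)
      _ = _ := by ring
  set g : ℕ → ℝ := fun n => 600 * Real.log R * ((if (n + h i).Prime then (1:ℝ) else 0) * ((if n % W = v % W then 1 else 0) * Zs D R X J h n ^ 2 * (hat R n / n)) + 4 * (R:ℝ) ^ 7 / R ^ 199 * (1 / n)) with hg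
  have hg0 : ∀ n, 0 ≤ g n := by
    intro n
    refine mul_nonneg (by positivity) (add_nonneg (mul_nonneg (by split_ifs <;> norm_num) (mul_nonneg (mul_nonneg (by split_ifs <;> norm_num) (sq_nonneg _)) (div_nonneg (hat_nonneg _ _) (by positivity)))) (by positivity))
  have step : ∑ m ∈ Ioc 0 (R ^ 600), pw R m * (if m % W = (v + h i) % W then 1 else 0) * Zs D R X J h (m - h i) ^ 2 ≤ ∑ n ∈ Ioc 0 (R ^ 600), g n := by
    calc _ = ∑ m ∈ (Ioc 0 (R ^ 600)).filter (fun m => pw R m ≠ 0), pw R m * (if m % W = (v + h i) % W then 1 else 0) * Zs D R X J h (m - h i) ^ 2 := by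
          rw [Finset.sum_filter]
          refine Finset.sum_congr rfl fun m _ => ?_
          by_cases h0 : pw R m = 0 <;> simp [h0]
      _ ≤ ∑ m ∈ (Ioc 0 (R ^ 600)).filter (fun m => pw R m ≠ 0), g (m - h i) := by
          refine Finset.sum_le_sum fun m hm => ?_
          obtain ⟨hm1, hm2⟩ := Finset.mem_filter.1 hm
          obtain ⟨hmp, hmR⟩ := pw_supp R m hm2
          obtain ⟨n, rfl⟩ : ∃ n, m = n + h i := ⟨m - h i, by have := hD i; omega⟩
          have hDi := hD i
          have hn : R ^ 199 ≤ n := by omega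
          have hn1 : 1 ≤ n := (Nat.one_le_pow _ _ (by omega)).trans hn
          have hn' : (0:ℝ) < n := by exact_mod_cast hn1
          have hnR : (R:ℝ) ^ 199 ≤ n := by exact_mod_cast hn
          have hmod : ((n + h i) % W = (v + h i) % W) ↔ (n % W = v % W) := ⟨fun a => Nat.ModEq.add_right_cancel' (h i) a, fun a => Nat.ModEq.add_right (h i) a⟩
          simp only [hg, Nat.add_sub_cancel, hmod, pw, if_pos hmp, one_mul]
          by_cases he : n % W = v % W
          swap
          · simp only [he, if_false]; rw [mul_zero, zero_mul]
            exact mul_nonneg (by positivity) (add_nonneg (by simp) (by positivity))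
          simp only [he, if_true, mul_one, one_mul]
          have hlog : Real.log ((n + h i : ℕ) : ℝ) ≤ 600 * Real.log R := by
            have := Real.log_le_log (by exact_mod_cast hmp.pos) (by exact_mod_cast (mem_Ioc.1 hm1).2 : ((n + h i : ℕ) : ℝ) ≤ ((R ^ 600 : ℕ) : ℝ))
            rw [log_natpow] at this
            exact_mod_cast this
          have hs := hat_shift R n (h i) hn1
          have hZ := Zs_bd (D := D) (R := R) h X J n hD0 hk h2
          have hDi' : (h i : ℝ) ≤ R := by exact_mod_cast hDi.trans hDR
          have hh0 : 0 ≤ hat R (n + h i) / ((n + h i : ℕ):ℝ) := div_nonneg (hat_nonneg _ _) (by positivity)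
          calc _ ≤ 600 * Real.log R * (hat R n / n + 4 * h i / (n:ℝ) ^ 2) * Zs D R X J h n ^ 2 := by gcongr
            _ = 600 * Real.log R * (Zs D R X J h n ^ 2 * (hat R n / n) + 4 * h i / (n:ℝ) ^ 2 * Zs D R X J h n ^ 2) := by ring
            _ ≤ _ := by
              refine mul_le_mul_of_nonneg_left (add_le_add le_rfl ?_) (by positivity)
              calc 4 * (h i : ℝ) / (n:ℝ) ^ 2 * Zs D R X J h n ^ 2 ≤ 4 * R / ((R:ℝ) ^ 199 * n) * (R:ℝ) ^ 6 := by
                    rw [sq (n:ℝ)]; gcongr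
                _ = _ := by field_simp
      _ ≤ _ := by
          refine sum_le_inj _ _ _ _ (fun m => m - h i) ?_ ?_ (fun m _ => le_rfl) (fun m _ => hg0 m)
          · intro m hm
            obtain ⟨hm1, hm2⟩ := Finset.mem_filter.1 hm
            obtain ⟨hmp, hmR⟩ := pw_supp R m hm2
            have := hD i
            have := mem_Ioc.1 hm1
            rw [mem_Ioc]; omega
          · intro a ha b hb hab
            have a2 := pw_supp R a (Finset.mem_filter.1 ha).2
            have b2 := pw_supp R b (Finset.mem_filter.1 hb).2
            have := hD i
            have hab' : a - h i = b - h i := hab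
            omega
  refine step.trans ?_
  simp only [hg]
  rw [← Finset.mul_sum, Finset.sum_add_distrib, ← Finset.mul_sum]
  refine mul_le_mul_of_nonneg_left (add_le_add le_rfl ?_) (by positivity)
  have hh := harm_le (R ^ 600)
  rw [log_natpow] at hh
  calc _ ≤ 4 * (R:ℝ) ^ 7 / R ^ 199 * (601 * R) := mul_le_mul_of_nonneg_left (hh.trans (by push_cast; linarith)) (by positivity)
    _ = 2404 * (R:ℝ) ^ 8 / R ^ 199 := by ring
    _ ≤ R * (R:ℝ) ^ 8 / R ^ 199 := by gcongr; linarith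
    _ = 1 / (R:ℝ) ^ 190 := by field_simp
    _ ≤ _ := one_div_le_one_div_of_le (by positivity) (pow_le_pow_right₀ (by linarith) (by norm_num))

lemma big_primes (N : ℕ) (hN : N ≠ 0) (hR : 2500 ≤ R) (hNR : N ≤ R ^ 602) : ∑ l ∈ N.primeFactors.filter (fun l => R < l), 1 / (l:ℝ) ≤ 1 / 4 := by
  have hR' : (2500:ℝ) ≤ R := by exact_mod_cast hR
  set S := N.primeFactors.filter (fun l => R < l) with hS
  have h1 : R ^ S.card ≤ N := by
    calc R ^ S.card = ∏ l ∈ S, R := by simp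
      _ ≤ ∏ l ∈ S, l := Finset.prod_le_prod' fun l hl => (Finset.mem_filter.1 hl).2.le
      _ ≤ N := Nat.le_of_dvd (Nat.pos_of_ne_zero hN) ((Finset.prod_dvd_prod_of_subset _ _ _ (Finset.filter_subset _ _)).trans (Nat.prod_primeFactors_dvd N))
  have h2 : S.card ≤ 602 := (Nat.pow_le_pow_iff_right (by omega : 1 < R)).1 (h1.trans hNR)
  calc _ ≤ ∑ l ∈ S, 1 / (R:ℝ) := Finset.sum_le_sum fun l hl => one_div_le_one_div_of_le (by linarith) (by exact_mod_cast (Finset.mem_filter.1 hl).2.le)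
    _ = S.card * (1 / (R:ℝ)) := by simp
    _ ≤ 602 * (1 / 2500) := by gcongr; exact_mod_cast h2
    _ ≤ _ := by norm_num

/-- the pointwise pigeonhole inequality -/
lemma pigeon (h : Fin k → ℕ) (hh : ∀ j, 1 ≤ h j) (hD : ∀ j, h j ≤ R) (K n : ℕ) (hn1 : 1 ≤ n) (hR : 2500 ≤ R) (hn : n ≤ R ^ 600)
    (hfail : ¬ (K ≤ (univ.filter fun j => (n + h j).Prime).card ∧ ∀ j, ∑ l ∈ (n + h j - 1).primeFactors.filter (fun l => D < l), 1 / (l:ℝ) ≤ 1 / 2)) :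
    ∑ i, (if (n + h i).Prime then (1:ℝ) else 0) ≤ K + 4 * k * ∑ j, ∑ p : PT D R, 1 / (p.1:ℝ) * (if p.1 ∣ n + (h j - 1) then 1 else 0) := by
  have hnn : ∀ j, 0 ≤ ∑ p : PT D R, 1 / (p.1:ℝ) * (if p.1 ∣ n + (h j - 1) then (1:ℝ) else 0) := fun j =>
    Finset.sum_nonneg fun p _ => mul_nonneg (by positivity) (by split_ifs <;> norm_num)
  by_cases hc : K ≤ (univ.filter fun j => (n + h j).Prime).card
  · have : ∃ j, 1 / 2 < ∑ l ∈ (n + h j - 1).primeFactors.filter (fun l => D < l), 1 / (l:ℝ) := by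
      by_contra hcon
      push Not at hcon
      exact hfail ⟨hc, hcon⟩
    obtain ⟨j, hj⟩ := this
    have hN : n + h j - 1 ≠ 0 := by have := hh j; omega
    have hb := big_primes (R := R) (n + h j - 1) hN hR (by
      have := hD j
      calc n + h j - 1 ≤ R ^ 600 + R := by omega
        _ ≤ R ^ 600 * 2 := by have : R ≤ R ^ 600 := Nat.le_self_pow (by norm_num) R
                              omega
        _ ≤ R ^ 600 * R ^ 2 := Nat.mul_le_mul_left _ (by nlinarith)
        _ = _ := by ring)
    have hsplit : ∑ l ∈ (n + h j - 1).primeFactors.filter (fun l => D < l), 1 / (l:ℝ) ≤ ∑ l ∈ (n + h j - 1).primeFactors.filter (fun l => D < l ∧ l ≤ R), 1 / (l:ℝ)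
       + ∑ l ∈ (n + h j - 1).primeFactors.filter (fun l => R < l), 1 / (l:ℝ) := by
      rw [← Finset.sum_union]
      · refine Finset.sum_le_sum_of_subset_of_nonneg (fun l hl => ?_) (fun _ _ _ => by positivity)
        obtain ⟨a, b⟩ := Finset.mem_filter.1 hl
        rw [Finset.mem_union, Finset.mem_filter, Finset.mem_filter]
        by_cases hlR : l ≤ R
        · exact Or.inl ⟨a, b, hlR⟩
        · exact Or.inr ⟨a, by omega⟩
      · rw [Finset.disjoint_left]
        intro l h1 h2
        have := (Finset.mem_filter.1 h1).2
        have := (Finset.mem_filter.1 h2).2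
        omega
    have hpt : ∑ l ∈ (n + h j - 1).primeFactors.filter (fun l => D < l ∧ l ≤ R), 1 / (l:ℝ) ≤ ∑ p : PT D R, 1 / (p.1:ℝ) * (if p.1 ∣ n + (h j - 1) then 1 else 0) := by
      have e : n + (h j - 1) = n + h j - 1 := by have := hh j; omega
      rw [e]
      have := Finset.sum_coe_sort ((Ioc D R).filter Nat.Prime) (fun l => 1 / (l:ℝ) * (if l ∣ n + h j - 1 then (1:ℝ) else 0))
      rw [this]
      calc _ = ∑ l ∈ (n + h j - 1).primeFactors.filter (fun l => D < l ∧ l ≤ R), 1 / (l:ℝ) * (if l ∣ n + h j - 1 then (1:ℝ) else 0) :=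
            Finset.sum_congr rfl fun l hl => by rw [if_pos (Nat.dvd_of_mem_primeFactors (Finset.mem_filter.1 hl).1), mul_one]
        _ ≤ _ := by
            refine Finset.sum_le_sum_of_subset_of_nonneg (fun l hl => ?_) (fun l _ _ => mul_nonneg (by positivity) (by split_ifs <;> norm_num))
            obtain ⟨a, b⟩ := Finset.mem_filter.1 hl
            exact Finset.mem_filter.2 ⟨Finset.mem_Ioc.2 b, Nat.prime_of_mem_primeFactors a⟩
    have hone : 1 / 4 ≤ ∑ j, ∑ p : PT D R, 1 / (p.1:ℝ) * (if p.1 ∣ n + (h j - 1) then (1:ℝ) else 0) := by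
      refine le_trans ?_ (Finset.single_le_sum (fun j _ => hnn j) (Finset.mem_univ j))
      linarith
    have hle : ∑ i, (if (n + h i).Prime then (1:ℝ) else 0) ≤ k := by
      calc _ ≤ ∑ i : Fin k, (1:ℝ) := Finset.sum_le_sum fun i _ => by split_ifs <;> norm_num
        _ = k := by simp
    have := mul_le_mul_of_nonneg_left hone (by positivity : (0:ℝ) ≤ 4 * k)
    linarith [(Nat.cast_nonneg K : (0:ℝ) ≤ K)]
  · have hle : ∑ i, (if (n + h i).Prime then (1:ℝ) else 0) ≤ K := by
      rw [Finset.sum_ite, Finset.sum_const_zero, add_zero, Finset.sum_const, nsmul_eq_mul, mul_one]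
      exact_mod_cast (by omega : _ ≤ K)
    have : 0 ≤ ∑ j, ∑ p : PT D R, 1 / (p.1:ℝ) * (if p.1 ∣ n + (h j - 1) then (1:ℝ) else 0) := Finset.sum_nonneg fun j _ => hnn j
    have : 0 ≤ 4 * (k:ℝ) * ∑ j, ∑ p : PT D R, 1 / (p.1:ℝ) * (if p.1 ∣ n + (h j - 1) then (1:ℝ) else 0) := by positivity
    linarith
end TotRun
end

section
set_option exponentiation.threshold 2000
open ArithmeticFunction Finset
open scoped ArithmeticFunction.Moebius ArithmeticFunction.zeta ComplexConjugate
namespace TotRun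
variable {D R k : ℕ}

def Good (D K : ℕ) (h : Fin k → ℕ) (n : ℕ) : Prop :=
  K ≤ (univ.filter fun j => (n + h j).Prime).card ∧ ∀ j, ∑ l ∈ (n + h j - 1).primeFactors.filter (fun l => D < l), 1 / (l:ℝ) ≤ 1 / 2

lemma sum_upper (h : Fin k → ℕ) (hinj : Function.Injective h) (hh : ∀ j, 1 ≤ h j) (hD : ∀ j, h j ≤ D) (hk : 1 ≤ k) (hkD : 4 * k ^ 2 * (k + 1) ^ 2 ≤ D)
    (X J v K : ℕ) (hR : 2500 ≤ R) (h2 : 2 ^ (k+1) ≤ R) (hDR : D ≤ R) (hW : primorial D ≤ R) (hKR : K ≤ R) (hkR : k ≤ R) (hM : 0 ≤ M1s D R k X J)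
    (hfail : ∀ n, R ≤ n → n % primorial D = v % primorial D → ¬ Good D K h n) :
    ∑ i, ∑ m ∈ Ioc 0 (R ^ 600), pw R m * (if m % primorial D = (v + h i) % primorial D then 1 else 0) * Zs D R X J h (m - h i) ^ 2 ≤
      600 * Real.log R * (2 * (K + 1) * (M1s D R k X J * Gh R / primorial D) + 1 / R) := by
  have hk1 : k ^ 2 * 1 ≤ k ^ 2 * (k+1) ^ 2 := Nat.mul_le_mul_left _ (Nat.one_le_pow _ _ (by omega))
  have hkk : k ≤ k ^ 2 := Nat.le_self_pow (by norm_num) k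
  have h4 : 4 * k ^ 2 ≤ D := by nlinarith
  have h2k : 2 * k ≤ D := by omega
  have hD0 : 0 < D := by omega
  have hR' : (2500:ℝ) ≤ R := by exact_mod_cast hR
  have hR0 : (0:ℝ) < R := by linarith
  have hL0 : 0 ≤ Real.log R := Real.log_natCast_nonneg R
  set W := primorial D with hWdef
  set ε : ℝ := 1 / (R:ℝ) ^ 185 with hε
  have hε0 : 0 < ε := by positivity
  set G : ℝ := M1s D R k X J * Gh R / W with hG
  have hG0 : 0 ≤ G := div_nonneg (mul_nonneg hM (Gh_nonneg R)) (by positivity)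
  set w : ℕ → ℝ := fun n => (if n % W = v % W then (1:ℝ) else 0) * Zs D R X J h n ^ 2 * (hat R n / n) with hw
  have hw0 : ∀ n, 0 ≤ w n := fun n => mul_nonneg (mul_nonneg (by split_ifs <;> norm_num) (sq_nonneg _)) (div_nonneg (hat_nonneg _ _) (by positivity))
  have hE0 : ∑ n ∈ Ioc 0 (R ^ 600), w n ≤ 2 * G + ε := by
    have a := S1_bound h hinj hD hk h4 (by omega : 3 ≤ R) X J v ∅ (fun _ => 0)
    have b := err_le (R := R) (k := k) W 1 (by omega) h2 hW (by omega)
    simp only [Finset.prod_empty, mul_one, Finset.card_empty, pow_zero, rA, Nat.cast_one, div_one] at a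
    push_cast at b
    refine a.trans (add_le_add (le_of_eq (by rw [hG]; ring)) ?_)
    refine le_trans (le_of_eq ?_) b
    ring
  have hE1 : ∀ j, ∀ p : PT D R, ∑ n ∈ Ioc 0 (R ^ 600), (if p.1 ∣ n + (h j - 1) then (1:ℝ) else 0) * w n ≤ 2 * (k+1:ℝ) ^ 2 / p.1 * G + ε := by
    intro j p
    have a := S1_bound h hinj hD hk h4 (by omega : 3 ≤ R) X J v {p} (fun _ => h j - 1)
    have b := err_le (R := R) (k := k) W p.1 (by omega) h2 hW p.le
    simp only [Finset.prod_singleton, Finset.card_singleton, pow_one, rA] at a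
    calc _ = _ := Finset.sum_congr rfl fun n _ => by rw [hw]; ring
      _ ≤ _ := a
      _ ≤ _ := add_le_add (le_of_eq (by rw [hG]; ring)) b
  have hpt : ∀ n ∈ Ioc 0 (R ^ 600), (∑ i, (if (n + h i).Prime then (1:ℝ) else 0)) * w n ≤ (K + 4 * k * ∑ j, ∑ p : PT D R, 1 / (p.1:ℝ) * (if p.1 ∣ n + (h j - 1) then (1:ℝ) else 0)) * w n := by
    intro n hn
    by_cases hz : w n = 0
    · rw [hz, mul_zero, mul_zero]
    have hmod : n % W = v % W := by
      by_contra hc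
      exact hz (by simp [hw, hc])
    have hbig : R ≤ n := by
      by_contra hc
      have : n ≤ R ^ 200 := (by omega : n ≤ R).trans (Nat.le_self_pow (by norm_num) R)
      exact hz (by simp [hw, hat_lo R n this])
    exact mul_le_mul_of_nonneg_right (pigeon h hh (fun j => (hD j).trans hDR) K n (by omega) hR (mem_Ioc.1 hn).2 (hfail n hbig hmod)) (hw0 n)
  have hinv := (sum_inv_sq_PT (D := D) (R := R)).resolve_right (by omega)
  have hcard : (Fintype.card (PT D R) : ℝ) ≤ R := by
    have : Fintype.card (PT D R) ≤ R := by
      rw [Fintype.card_coe]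
      refine (Finset.card_filter_le _ _).trans ?_
      rw [Nat.card_Ioc]; omega
    exact_mod_cast this
  have hk' : (1:ℝ) ≤ k := by exact_mod_cast hk
  have hD' : 4 * (k:ℝ) ^ 2 * (k + 1) ^ 2 ≤ D := by exact_mod_cast hkD
  have hDp : (0:ℝ) < D := by exact_mod_cast hD0
  have hsumj : ∀ j, ∑ p : PT D R, 1 / (p.1:ℝ) * ∑ n ∈ Ioc 0 (R ^ 600), (if p.1 ∣ n + (h j - 1) then (1:ℝ) else 0) * w n ≤ 2 * (k+1:ℝ) ^ 2 * G / D + R * ε := by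
    intro j
    calc _ ≤ ∑ p : PT D R, (2 * (k+1:ℝ) ^ 2 * G * (1 / (p.1:ℝ) ^ 2) + ε) := by
          refine Finset.sum_le_sum fun p _ => ?_
          have hp := p.pos
          have hp1 : 1 / (p.1:ℝ) ≤ 1 := by
            rw [div_le_one hp]; exact_mod_cast p.prime.one_le
          calc _ ≤ 1 / (p.1:ℝ) * (2 * (k+1:ℝ) ^ 2 / p.1 * G + ε) := mul_le_mul_of_nonneg_left (hE1 j p) (by positivity)
            _ = 2 * (k+1:ℝ) ^ 2 * G * (1 / (p.1:ℝ) ^ 2) + 1 / (p.1:ℝ) * ε := by field_simp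
            _ ≤ _ := add_le_add le_rfl (mul_le_of_le_one_left hε0.le hp1)
      _ = 2 * (k+1:ℝ) ^ 2 * G * ∑ p : PT D R, (1 / (p.1:ℝ) ^ 2) + Fintype.card (PT D R) * ε := by
          rw [Finset.sum_add_distrib, Finset.mul_sum, Finset.sum_const, nsmul_eq_mul, Finset.card_univ]
      _ ≤ 2 * (k+1:ℝ) ^ 2 * G * (1 / D) + R * ε := by gcongr
      _ = _ := by ring
  have hmain : ∑ i, ∑ n ∈ Ioc 0 (R ^ 600), (if (n + h i).Prime then (1:ℝ) else 0) * w n ≤ K * (2 * G + ε) + 4 * k * (k * (2 * (k+1:ℝ) ^ 2 * G / D + R * ε)) := by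
    rw [Finset.sum_comm]
    calc _ ≤ ∑ n ∈ Ioc 0 (R ^ 600), (K * w n + 4 * k * ∑ j, ∑ p : PT D R, 1 / (p.1:ℝ) * ((if p.1 ∣ n + (h j - 1) then (1:ℝ) else 0) * w n)) := by
          refine Finset.sum_le_sum fun n hn => ?_
          have := hpt n hn
          rw [← Finset.sum_mul]
          refine this.trans (le_of_eq ?_)
          rw [add_mul, mul_assoc (4 * (k:ℝ)), Finset.sum_mul]
          congr 2
          refine Finset.sum_congr rfl fun j _ => ?_
          rw [Finset.sum_mul]
          exact Finset.sum_congr rfl fun p _ => by ring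
      _ = K * ∑ n ∈ Ioc 0 (R ^ 600), w n + 4 * k * ∑ j, ∑ p : PT D R, 1 / (p.1:ℝ) * ∑ n ∈ Ioc 0 (R ^ 600), (if p.1 ∣ n + (h j - 1) then (1:ℝ) else 0) * w n := by
          rw [Finset.sum_add_distrib, ← Finset.mul_sum, ← Finset.mul_sum]
          congr 2
          rw [Finset.sum_comm]
          refine Finset.sum_congr rfl fun j _ => ?_
          rw [Finset.sum_comm]
          refine Finset.sum_congr rfl fun p _ => ?_
          rw [Finset.mul_sum]
      _ ≤ K * (2 * G + ε) + 4 * k * ∑ j : Fin k, (2 * (k+1:ℝ) ^ 2 * G / D + R * ε) := by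
          refine add_le_add (mul_le_mul_of_nonneg_left hE0 (by positivity)) (mul_le_mul_of_nonneg_left (Finset.sum_le_sum fun j _ => hsumj j) (by positivity))
      _ = _ := by rw [Finset.sum_const, Finset.card_univ, Fintype.card_fin, nsmul_eq_mul]
  calc _ ≤ ∑ i, 600 * Real.log R * (∑ n ∈ Ioc 0 (R ^ 600), (if (n + h i).Prime then (1:ℝ) else 0) * w n + ε) :=
        Finset.sum_le_sum fun i _ => S2_upper X J W v 0 h hD hD0 h2k hR h2 hDR i
    _ = 600 * Real.log R * (∑ i, ∑ n ∈ Ioc 0 (R ^ 600), (if (n + h i).Prime then (1:ℝ) else 0) * w n + k * ε) := by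
        rw [← Finset.mul_sum, Finset.sum_add_distrib]; simp
    _ ≤ _ := by
        refine mul_le_mul_of_nonneg_left ?_ (by positivity)
        have hq : 4 * (k:ℝ) * (k * (2 * (k+1:ℝ) ^ 2 * G / D)) ≤ 2 * G := by
          rw [show 4 * (k:ℝ) * (k * (2 * (k+1:ℝ) ^ 2 * G / D)) = (4 * (k:ℝ) ^ 2 * (k+1) ^ 2) * (2 * G) / D by ring, div_le_iff₀ hDp, mul_comm (2 * G)]
          exact mul_le_mul_of_nonneg_right hD' (by linarith)
        have hKR' : (K:ℝ) ≤ R := by exact_mod_cast hKR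
        have hkR' : (k:ℝ) ≤ R := by exact_mod_cast hkR
        have ht : (K + 4 * k * k * R + k) * ε ≤ 1 / R := by
          have h3 : K + 4 * k * k * R + k ≤ (R:ℝ) ^ 4 := by
            calc K + 4 * k * k * R + k ≤ (R:ℝ) + 4 * R * R * R + R := by gcongr
              _ ≤ (R:ℝ) ^ 4 := by nlinarith [pow_pos hR0 2, pow_pos hR0 3]
          calc _ ≤ (R:ℝ) ^ 4 * ε := mul_le_mul_of_nonneg_right h3 hε0.le
            _ = 1 / (R:ℝ) ^ 181 := by rw [hε]; field_simp
            _ ≤ 1 / (R:ℝ) ^ 1 := one_div_le_one_div_of_le (by positivity) (pow_le_pow_right₀ (by linarith) (by norm_num))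
            _ = _ := by rw [pow_one]
        nlinarith
end TotRun
end

section
set_option exponentiation.threshold 2000
open ArithmeticFunction Finset
open scoped ArithmeticFunction.Moebius ArithmeticFunction.zeta ComplexConjugate
namespace TotRun

set_option maxHeartbeats 2000000 in
theorem maynard (K : ℕ) : ∃ k, 1 ≤ k ∧ ∀ h : Fin k → ℕ, Function.Injective h → (∀ j, 1 ≤ h j) → ∃ D1, ∀ D ≥ D1, ∀ v,
    (∀ j, Nat.Coprime (v + h j) (primorial D)) → ∀ N0, ∃ n ≥ N0, n % primorial D = v % primorial D ∧ Good D K h n := by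
  obtain ⟨J, hJ⟩ : ∃ J, J = 10 ^ 10 * (K + 1) := ⟨_, rfl⟩
  have hJ1 : 1 ≤ J := by omega
  obtain ⟨k, hkJ⟩ : ∃ k, k = 2 ^ J := ⟨_, rfl⟩
  have hk : 1 ≤ k := hkJ ▸ Nat.one_le_two_pow
  obtain ⟨C, hC, R0, hR0, hA⟩ := claimA
  refine ⟨k, hk, fun h hinj hh => ?_⟩
  refine ⟨120 * k ^ 2 + 4 * k ^ 2 * (k + 1) ^ 2 + ⌈(k:ℝ) ^ 2 * C⌉₊ + ∑ j, h j, fun D hD1 v hv N0 => ?_⟩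
  have hD2 : 120 * k ^ 2 ≤ D := by omega
  have hD3 : 4 * k ^ 2 * (k + 1) ^ 2 ≤ D := by omega
  have hD4 : (k:ℝ) ^ 2 * C ≤ D := (Nat.le_ceil _).trans (by exact_mod_cast (by omega : ⌈(k:ℝ) ^ 2 * C⌉₊ ≤ D))
  have hD : ∀ j, h j ≤ D := fun j => (Finset.single_le_sum (fun j _ => Nat.zero_le (h j)) (Finset.mem_univ j)).trans (by omega)
  by_contra hcon
  push Not at hcon
  have hW0 : 0 < primorial D := primorial_pos D
  haveI : NeZero (primorial D) := ⟨hW0.ne'⟩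
  choose R1 hR1 using fun j => pw_lower (primorial D) (v + h j) (hv j)
  obtain ⟨X, hX⟩ : ∃ X, X = R0 + ∑ j, R1 j + 2500 + 2 ^ (k+1) + D + 3 * primorial D + K + k + N0 := ⟨_, rfl⟩
  have h2k := Nat.one_le_two_pow (n := k)
  obtain ⟨M, hM⟩ : ∃ M, M = 256 * k * J := ⟨_, rfl⟩
  have hM1 : 1 ≤ M := by rw [hM]; nlinarith [Nat.mul_le_mul hk hJ1]
  obtain ⟨R, hR⟩ : ∃ R, R = X ^ M := ⟨_, rfl⟩
  have hXR : X ≤ R := hR ▸ Nat.le_self_pow (by omega) X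
  have hR1' : ∀ j, R1 j ≤ R := fun j => (Finset.single_le_sum (fun j _ => Nat.zero_le (R1 j)) (Finset.mem_univ j)).trans (by omega)
  have hM1s := M1_ge_one (D := D) (R := R) (k := k) X J (by omega) hJ1 (by omega)
  have hup := sum_upper (D := D) (R := R) h hinj hh hD hk hD3 X J v K (by omega) (by omega) (by omega) (by omega) (by omega) (by omega) (by linarith)
    (fun n hn hmod => hcon n (by omega) hmod)
  have hL := log_ge_one R (by omega)
  have hGh := Gh_le R (by omega)
  have hlogX : Real.log X = Real.log R / M := by
    rw [hR, log_natpow]; field_simp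
  have hWc : ∀ p : PT D R, Nat.Coprime (primorial D) p.1 := by
    intro p
    rw [Nat.coprime_comm, Nat.Prime.coprime_iff_not_dvd p.prime, p.prime.dvd_primorial_iff]
    have := p.gt; omega
  set L := Real.log R with hLd
  set m1 := M1s D R k X J with hm1
  have hφ : (0:ℝ) < (primorial D).totient := by exact_mod_cast Nat.totient_pos.2 hW0
  have hW' : (0:ℝ) < primorial D := by exact_mod_cast hW0
  have hk' : (0:ℝ) < k := by exact_mod_cast hk
  have hJ' : (0:ℝ) < J := by exact_mod_cast hJ1
  have hD' : (0:ℝ) < D := by exact_mod_cast (by nlinarith [Nat.one_le_pow 2 k hk] : 0 < D)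
  have hlow : ∀ i, 4000 / 131072 * J / k * (L ^ 3 * m1 / primorial D) ≤ ∑ m ∈ Ioc 0 (R ^ 600), pw R m * (if m % primorial D = (v + h i) % primorial D then 1 else 0) * Zs D R X J h (m - h i) ^ 2 := by
    intro i
    refine le_trans ?_ (S2_lower (D := D) (R := R) C (primorial D) (by omega) (by omega) (by omega) hWc (hA R (by omega)) X J h hinj hD hk hD2 i (v + h i) (hv i))
    have a := hR1 i R (hR1' i)
    have b := M2_lower (D := D) (R := R) X J M hJ1 hR (by rw [hM, hkJ]; nlinarith [Nat.one_le_two_pow (n := J)]) (by omega) (by omega) (by omega) i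
    rw [hlogX] at b
    have hM2 : 0 ≤ M2s D R X J i := Finset.sum_nonneg fun σ _ => by positivity
    have c : 32 * (k:ℝ) ^ 2 / D * C ≤ 32 := by
      rw [show 32 * (k:ℝ) ^ 2 / D * C = 32 * (k ^ 2 * C) / D by ring, div_le_iff₀ hD']; linarith
    calc _ = 4000 * L ^ 2 / (primorial D).totient * ((J:ℝ) ^ 2 * (((primorial D).totient : ℝ) / primorial D) * (L / M) / 512 * m1) := by
          rw [hM]; push_cast; field_simp; norm_num
      _ ≤ 4000 * L ^ 2 / (primorial D).totient * M2s D R X J i := mul_le_mul_of_nonneg_left b (by positivity)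
      _ ≤ 1 / 2 * M2s D R X J i * (10000 * L ^ 2 / (primorial D).totient) - 32 * M2s D R X J i * L ^ 2 / (primorial D).totient := by
          have : 0 ≤ M2s D R X J i * L ^ 2 / (primorial D).totient := by positivity
          have e : 1 / 2 * M2s D R X J i * (10000 * L ^ 2 / (primorial D).totient) - 32 * M2s D R X J i * L ^ 2 / (primorial D).totient
            = 4968 * (M2s D R X J i * L ^ 2 / (primorial D).totient) := by ring
          rw [e]
          calc _ = 4000 * (M2s D R X J i * L ^ 2 / (primorial D).totient) := by ring
            _ ≤ _ := by linarith
      _ ≤ _ := by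
          refine sub_le_sub (mul_le_mul_of_nonneg_left a (by positivity)) (div_le_div_of_nonneg_right ?_ hφ.le)
          calc 32 * (k:ℝ) ^ 2 / D * M2s D R X J i * (C * L ^ 2) = (32 * (k:ℝ) ^ 2 / D * C) * (M2s D R X J i * L ^ 2) := by ring
            _ ≤ 32 * (M2s D R X J i * L ^ 2) := mul_le_mul_of_nonneg_right c (by positivity)
            _ = _ := by ring
  have hlow2 := (Finset.sum_le_sum fun i (_ : i ∈ univ) => hlow i).trans hup
  rw [Finset.sum_const, Finset.card_univ, Fintype.card_fin, nsmul_eq_mul] at hlow2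
  set Q := L ^ 3 * m1 / primorial D with hQ
  have hQ0 : 0 < Q := by positivity
  have e1 : (k:ℝ) * (4000 / 131072 * J / k * Q) = 4000 / 131072 * J * Q := by field_simp
  rw [e1] at hlow2
  have hGQ : L * (m1 * Gh R / primorial D) ≤ 120200 * Q := by
    calc _ ≤ L * (m1 * (120200 * L ^ 2) / primorial D) := by gcongr
      _ = _ := by rw [hQ]; ring
  have hLR : L * (1 / R) ≤ Q := by
    have h1 : (1:ℝ) / R ≤ 1 / primorial D := one_div_le_one_div_of_le hW' (by exact_mod_cast (by omega : primorial D ≤ R))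
    calc L * (1 / R) ≤ L * (1 / primorial D) := mul_le_mul_of_nonneg_left h1 (by linarith)
      _ = L * 1 / primorial D := by ring
      _ ≤ L ^ 3 * m1 / primorial D := by
        refine div_le_div_of_nonneg_right ?_ hW'.le
        have : L ≤ L ^ 3 := le_self_pow₀ hL (by norm_num)
        exact mul_le_mul this hM1s zero_le_one (by positivity)
  have hJr : (J:ℝ) = 10 ^ 10 * (K + 1) := by rw [hJ]; push_cast; ring
  have hfin : 600 * L * (2 * (K + 1) * (m1 * Gh R / primorial D) + 1 / R) ≤ 600 * 240401 * (K + 1) * Q := by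
    have h1 := mul_le_mul_of_nonneg_left hGQ (by positivity : (0:ℝ) ≤ 2 * (K + 1))
    have h2 : (0:ℝ) ≤ K * Q := by positivity
    nlinarith
  have := hlow2.trans hfin
  rw [hJr] at this
  have h2 : (0:ℝ) < (K + 1) * Q := by positivity
  nlinarith

end TotRun
end

section
set_option exponentiation.threshold 2000
open ArithmeticFunction Finset
open scoped ArithmeticFunction.Moebius ArithmeticFunction.zeta ComplexConjugate
namespace TotRun

theorem prod_anti_sub {A B : Finset ℕ} (h : A ⊆ B) (f : ℕ → ℝ) (h0 : ∀ b ∈ B, 0 ≤ f b)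
    (h1 : ∀ b ∈ B, f b ≤ 1) : ∏ b ∈ B, f b ≤ ∏ b ∈ A, f b := by
  rw [← Finset.prod_sdiff h]
  apply mul_le_of_le_one_left
  · exact Finset.prod_nonneg fun b hb => h0 b (h hb)
  · exact Finset.prod_le_one (fun b hb => h0 b (Finset.sdiff_subset hb))
      (fun b hb => h1 b (Finset.sdiff_subset hb))

theorem one_sub_sum_le_prod (A : Finset ℕ) (f : ℕ → ℝ) (h0 : ∀ b ∈ A, 0 ≤ f b)
    (h1 : ∀ b ∈ A, f b ≤ 1) : 1 - ∑ b ∈ A, f b ≤ ∏ b ∈ A, (1 - f b) := by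
  classical
  induction A using Finset.induction_on with
  | empty => simp
  | insert a s ha ih =>
    rw [Finset.sum_insert ha, Finset.prod_insert ha]
    have i1 := ih (fun b hb => h0 b (Finset.mem_insert_of_mem hb))
      (fun b hb => h1 b (Finset.mem_insert_of_mem hb))
    have a0 := h0 a (Finset.mem_insert_self _ _)
    have a1 := h1 a (Finset.mem_insert_self _ _)
    have s0 : 0 ≤ ∑ b ∈ s, f b :=
      Finset.sum_nonneg fun b hb => h0 b (Finset.mem_insert_of_mem hb)
    nlinarith

theorem pf01 {l : ℕ} (h : l.Prime) : 0 < 1 - 1 / (l:ℝ) ∧ 1 - 1 / (l:ℝ) ≤ 1 := by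
  have : (2:ℝ) ≤ l := by exact_mod_cast h.two_le
  have h1 : 1 / (l:ℝ) ≤ 1 / 2 := one_div_le_one_div_of_le (by norm_num) this
  have h2 : 0 ≤ 1 / (l:ℝ) := by positivity
  constructor <;> linarith

noncomputable def Fsm (D m : ℕ) : ℝ := ∏ l ∈ m.primeFactors.filter (fun l => l ≤ D), (1 - 1 / (l:ℝ))

theorem Fsm_pos (D m : ℕ) : 0 < Fsm D m :=
  Finset.prod_pos fun l hl => (pf01 (Nat.prime_of_mem_primeFactors (Finset.mem_filter.1 hl).1)).1

theorem tot_eq (D m : ℕ) : (Nat.totient m : ℝ) = m * (Fsm D m *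
    ∏ l ∈ m.primeFactors.filter (fun l => D < l), (1 - 1 / (l:ℝ))) := by
  have h := Nat.totient_eq_mul_prod_factors m
  have h2 : (Nat.totient m : ℝ) = m * ∏ p ∈ m.primeFactors, (1 - 1 / (p:ℝ)) := by
    have := congrArg (fun x : ℚ => (x : ℝ)) h
    push_cast at this
    rw [this]; simp only [one_div]
  rw [h2, Fsm]
  congr 1
  rw [← Finset.prod_filter_mul_prod_filter_not m.primeFactors (fun l => l ≤ D)]
  simp only [not_le]

theorem tot_lt {D m1 m2 : ℕ} (hm : m1 ≤ m2) (h0 : 0 < m1) (hF : Fsm D m1 ≤ Fsm D m2 / 4)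
    (hs : ∑ l ∈ m2.primeFactors.filter (fun l => D < l), 1 / (l:ℝ) ≤ 1 / 2) :
    Nat.totient m1 < Nat.totient m2 := by
  have : (Nat.totient m1 : ℝ) < Nat.totient m2 := by
    rw [tot_eq D m1, tot_eq D m2]
    have pr : ∀ m : ℕ, ∀ l ∈ m.primeFactors.filter (fun l => D < l), l.Prime := fun m l hl =>
      Nat.prime_of_mem_primeFactors (Finset.mem_filter.1 hl).1
    have a1 : ∏ l ∈ m1.primeFactors.filter (fun l => D < l), (1 - 1 / (l:ℝ)) ≤ 1 :=
      Finset.prod_le_one (fun l hl => (pf01 (pr _ l hl)).1.le) (fun l hl => (pf01 (pr _ l hl)).2)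
    have a2 := one_sub_sum_le_prod (m2.primeFactors.filter (fun l => D < l)) (fun l => 1 / (l:ℝ))
      (fun l hl => by positivity) (fun l hl => by linarith [(pf01 (pr _ l hl)).1])
    have f1 := Fsm_pos D m1
    have f2 := Fsm_pos D m2
    have c1 : (0:ℝ) < m1 := by exact_mod_cast h0
    have c2 : (m1:ℝ) ≤ m2 := by exact_mod_cast hm
    calc _ ≤ (m1:ℝ) * (Fsm D m1 * 1) := by gcongr
      _ ≤ m2 * (Fsm D m2 / 4) := by rw [mul_one]; gcongr
      _ < m2 * (Fsm D m2 * (1 / 2)) := by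
        apply mul_lt_mul_of_pos_left _ (by linarith); linarith
      _ ≤ _ := by gcongr; linarith
  exact_mod_cast this

noncomputable def Vp (x : ℕ) : ℝ := ∏ l ∈ (range (x + 1)).filter Nat.Prime, (1 - 1 / (l:ℝ))

theorem Vp_pos (x : ℕ) : 0 < Vp x :=
  Finset.prod_pos fun l hl => (pf01 (Finset.mem_filter.1 hl).2).1

theorem Vp_le_exp (x : ℕ) : Vp x ≤ Real.exp (-∑ l ∈ (range (x + 1)).filter Nat.Prime, 1 / (l:ℝ)) := by
  rw [← Finset.sum_neg_distrib, Real.exp_sum]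
  apply Finset.prod_le_prod
  · intro l hl; exact (pf01 (Finset.mem_filter.1 hl).2).1.le
  · intro l hl; linarith [Real.add_one_le_exp (-(1 / (l:ℝ)))]

theorem Vp_small (e : ℝ) (he : 0 < e) (M : ℕ) : ∃ x ≥ M, Vp x ≤ e := by
  have h := not_summable_one_div_on_primes
  rw [not_summable_iff_tendsto_nat_atTop_of_nonneg
    (fun n => Set.indicator_nonneg (fun _ _ => by positivity) n)] at h
  have h2 := (h.comp (Filter.tendsto_add_atTop_nat 1)).eventually_ge_atTop (-Real.log e)
  obtain ⟨x, hx, hM⟩ := (h2.and (Filter.eventually_ge_atTop M)).exists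
  refine ⟨x, hM, (Vp_le_exp x).trans ?_⟩
  rw [← Real.le_log_iff_exp_le he]
  simp only [Function.comp, Set.indicator_apply, Set.mem_setOf_eq, ← Finset.sum_filter] at hx
  linarith

theorem exists_t (M : ℕ) : ∃ t : ℕ → ℕ, Monotone t ∧ M ≤ t 0 ∧ ∀ s, Vp (t (s+1)) ≤ Vp (t s) ^ 2 / 4 := by
  have hx : ∀ a : ℕ, ∃ x ≥ a, Vp x ≤ Vp a ^ 2 / 4 := fun a =>
    Vp_small _ (by have := Vp_pos a; positivity) a
  choose f hf hf2 using hx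
  refine ⟨fun s => f^[s] M, ?_, le_refl _, ?_⟩
  · apply monotone_nat_of_le_succ
    intro n; simp only [Function.iterate_succ_apply']; exact hf _
  · intro n; simp only [Function.iterate_succ_apply']; exact hf2 _

/-- Comparison of the small-prime parts. -/
theorem Fsm_cmp {D m1 m2 a b : ℕ} {t : ℕ → ℕ} (ht : Monotone t)
    (hV : ∀ s, Vp (t (s+1)) ≤ Vp (t s) ^ 2 / 4) (h0 : 0 < m1) (hba : b ≤ a) (hD : t (a+1) ≤ D)
    (h1 : ∀ l, l.Prime → t a < l → l ≤ t (a+1) → l ∣ m1)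
    (h2 : ∀ l, l.Prime → l ≤ D → l ∣ m2 → l ≤ t b) : Fsm D m1 ≤ Fsm D m2 / 4 := by
  have e2 : Vp (t b) ≤ Fsm D m2 := by
    refine prod_anti_sub (f := fun l : ℕ => 1 - 1 / (l:ℝ)) ?_ ?_ ?_
    · intro l hl
      simp only [Finset.mem_filter, Finset.mem_range, Nat.mem_primeFactors] at hl ⊢
      exact ⟨Nat.lt_succ_of_le (h2 l hl.1.1 hl.2 hl.1.2.1), hl.1.1⟩
    · intro l hl; exact (pf01 (Finset.mem_filter.1 hl).2).1.le
    · intro l hl; exact (pf01 (Finset.mem_filter.1 hl).2).2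
  have e3 : Vp (t a) ≤ Vp (t b) := by
    refine prod_anti_sub (f := fun l : ℕ => 1 - 1 / (l:ℝ)) ?_ ?_ ?_
    · intro l hl
      simp only [Finset.mem_filter, Finset.mem_range] at hl ⊢
      have := ht hba
      exact ⟨by omega, hl.2⟩
    · intro l hl; exact (pf01 (Finset.mem_filter.1 hl).2).1.le
    · intro l hl; exact (pf01 (Finset.mem_filter.1 hl).2).2
  have e1 : Fsm D m1 * Vp (t a) ≤ Vp (t (a+1)) := by
    have hs : (range (t a + 1)).filter Nat.Prime ⊆ (range (t (a+1) + 1)).filter Nat.Prime := by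
      intro l hl
      simp only [Finset.mem_filter, Finset.mem_range] at hl ⊢
      have := ht (Nat.le_succ a)
      simp only [Nat.succ_eq_add_one] at this
      exact ⟨by omega, hl.2⟩
    have := Finset.prod_sdiff hs (f := fun l : ℕ => (1 - 1 / (l:ℝ)))
    rw [show Vp (t (a+1)) = _ from this.symm]
    apply mul_le_mul_of_nonneg_right _ (Vp_pos _).le
    refine prod_anti_sub (f := fun l : ℕ => 1 - 1 / (l:ℝ)) ?_ ?_ ?_
    · intro l hl
      simp only [Finset.mem_filter, Finset.mem_range, Finset.mem_sdiff, Nat.mem_primeFactors] at hl ⊢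
      have hh : t a < l := by
        by_contra hc
        exact hl.2 ⟨by omega, hl.1.2⟩
      exact ⟨⟨hl.1.2, h1 l hl.1.2 hh (by omega), h0.ne'⟩, by omega⟩
    · intro l hl; exact (pf01 (Nat.prime_of_mem_primeFactors (Finset.mem_filter.1 hl).1)).1.le
    · intro l hl; exact (pf01 (Nat.prime_of_mem_primeFactors (Finset.mem_filter.1 hl).1)).2
  have := hV a
  have p := Vp_pos (t a)
  have : Fsm D m1 ≤ Vp (t a) / 4 := by
    by_contra hc
    push Not at hc
    nlinarith
  linarith

end TotRun
end

section
set_option exponentiation.threshold 2000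
open ArithmeticFunction Finset
open scoped ArithmeticFunction.Moebius ArithmeticFunction.zeta ComplexConjugate
namespace TotRun

theorem nd {l a b : ℕ} (ha : a < l) (hb : b < l) (hab : a ≠ b) : ¬ l ∣ (l - b) + a := by
  rintro ⟨c, hc⟩
  have h1 : l * c < l * 2 := by omega
  have h2 : 0 < l * c := by omega
  have : c < 2 := Nat.lt_of_mul_lt_mul_left h1
  have : 0 < c := Nat.pos_of_mul_pos_left h2
  have : c = 1 := by omega
  subst this
  omega

theorem design (k : ℕ) : ∃ (h : Fin k → ℕ) (H : ℕ) (t c q : ℕ → ℕ), StrictMono h ∧ (∀ j, 1 ≤ h j) ∧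
    (∀ j, h j ≤ H) ∧ Monotone t ∧ (∀ s, Vp (t (s+1)) ≤ Vp (t s) ^ 2 / 4) ∧ (∀ g, (q g).Prime) ∧
    (∀ g ≤ H, q g ≤ t 0) ∧
    (∀ l, l.Prime → (∀ j, ¬ l ∣ c l + h j) ∧
      (∀ g, 1 ≤ g → g ≤ H → (∀ j, g ≠ h j) → q g = l → l ∣ c l + g) ∧
      (t 0 < l → ∀ j, (l ∣ c l + (h j - 1) ↔ t (k - 1 - j) < l ∧ l ≤ t (k - j)))) := by
  set W := (k+2).factorial with hW
  have hW2 : 2 ∣ W := Nat.dvd_factorial (by norm_num) (by omega)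
  have hW0 : 2 ≤ W := Nat.le_of_dvd (Nat.factorial_pos _) hW2
  set h : Fin k → ℕ := fun j => (j+1) * W with hh
  have hmono : StrictMono h := by
    intro i j hij
    exact Nat.mul_lt_mul_of_pos_right (by simpa using hij) (by omega)
  have h1 : ∀ j, 2 ≤ h j := fun j => hW0.trans (Nat.le_mul_of_pos_left _ (Nat.succ_pos _))
  have he : ∀ j, 2 ∣ h j := fun j => hW2.mul_left _
  set H := k * W with hH
  have hle : ∀ j, h j ≤ H := fun j => Nat.mul_le_mul_right _ j.2
  set B := H + k + 3 with hB
  set q : ℕ → ℕ := fun g => Nat.nth Nat.Prime (B + g) with hq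
  have hqp : ∀ g, (q g).Prime := fun g => Nat.prime_nth_prime _
  have hsm := Nat.nth_strictMono Nat.infinite_setOfPred_prime
  have hqm : StrictMono q := fun a b hab => hsm (by omega)
  have hqB : ∀ g, B + g ≤ q g := fun g => hsm.le_apply
  obtain ⟨t, ht, ht0, hV⟩ := exists_t (B + q H)
  have key : ∀ l, ∃ x, l.Prime → (∀ j, ¬ l ∣ x + h j) ∧
      (∀ g, 1 ≤ g → g ≤ H → (∀ j, g ≠ h j) → q g = l → l ∣ x + g) ∧
      (t 0 < l → ∀ j, (l ∣ x + (h j - 1) ↔ t (k - 1 - j) < l ∧ l ≤ t (k - j))) := by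
    intro l
    by_cases hl : l.Prime
    swap
    · exact ⟨0, fun h => absurd h hl⟩
    by_cases c1 : l ≤ k + 2
    · refine ⟨1, fun _ => ⟨?_, ?_, ?_⟩⟩
      · intro j hd
        have : l ∣ h j := (Nat.dvd_factorial hl.pos c1).mul_left _
        have := (Nat.dvd_add_left this).1 hd
        exact hl.one_lt.ne' (Nat.dvd_one.1 this)
      · intro g _ _ _ hg
        have := hqB g; omega
      · intro h; omega
    by_cases c2 : l < B
    · refine ⟨0, fun _ => ⟨?_, ?_, ?_⟩⟩
      · intro j hd
        rw [zero_add] at hd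
        rcases (Nat.Prime.dvd_mul hl).1 hd with h | h
        · have := Nat.le_of_dvd (Nat.succ_pos _) h
          have := j.2; omega
        · exact c1 ((Nat.Prime.dvd_factorial hl).1 h)
      · intro g _ _ _ hg
        have := hqB g; omega
      · intro h; omega
    by_cases c3 : ∃ g, 1 ≤ g ∧ g ≤ H ∧ (∀ j, g ≠ h j) ∧ q g = l
    · obtain ⟨g, g1, g2, g3, g4⟩ := c3
      refine ⟨l - g, fun _ => ⟨?_, ?_, ?_⟩⟩
      · intro j
        exact nd (by have := hle j; omega) (by omega) (g3 j).symm
      · intro g' _ _ _ hg'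
        have : g' = g := hqm.injective (hg'.trans g4.symm)
        rw [this, Nat.sub_add_cancel (by omega)]
      · intro h
        have := hqm.monotone g2
        omega
    have v2 : ∀ x, (∀ g, 1 ≤ g → g ≤ H → (∀ j, g ≠ h j) → q g = l → l ∣ x + g) := by
      intro x g a b c d
      exact absurd ⟨g, a, b, c, d⟩ c3
    by_cases c4 : ∃ j : Fin k, t (k - 1 - j) < l ∧ l ≤ t (k - j)
    · obtain ⟨j0, p1, p2⟩ := c4
      refine ⟨l - (h j0 - 1), fun _ => ⟨?_, v2 _, ?_⟩⟩
      · intro j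
        apply nd
        · have := hle j; omega
        · have := hle j0; omega
        · have := he j; have := he j0; have := h1 j; have := h1 j0; omega
      · intro _ j
        by_cases hj : j = j0
        · subst hj
          have := hle j
          rw [Nat.sub_add_cancel (by omega)]
          exact ⟨fun _ => ⟨p1, p2⟩, fun _ => dvd_refl _⟩
        · constructor
          · intro hd
            exfalso
            refine nd ?_ ?_ ?_ hd
            · have := hle j; omega
            · have := hle j0; omega
            · have := h1 j; have := h1 j0
              have : h j ≠ h j0 := fun e => hj (hmono.injective e)
              omega
          · rintro ⟨r1, r2⟩
            exfalso
            have hne : (j:ℕ) ≠ j0 := fun e => hj (Fin.ext e)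
            have := j.2
            have := j0.2
            rcases Nat.lt_or_ge j j0 with hlt | hge
            · have := ht (show k - j0 ≤ k - 1 - j by omega); omega
            · have := ht (show k - j ≤ k - 1 - j0 by omega); omega
    · refine ⟨2, fun _ => ⟨?_, v2 _, ?_⟩⟩
      · intro j hd
        have := Nat.le_of_dvd (by omega) hd
        have := hle j; omega
      · intro _ j
        constructor
        · intro hd
          have := Nat.le_of_dvd (by omega) hd
          have := hle j; omega
        · intro hh; exact absurd ⟨j, hh⟩ c4
  choose c hc using key
  refine ⟨h, H, t, c, q, hmono, fun j => (by norm_num : 1 ≤ 2).trans (h1 j), hle, ht, hV, hqp, ?_, fun l hl => hc l hl⟩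
  intro g hg
  have := hqm.monotone hg
  omega

end TotRun
end

section
set_option exponentiation.threshold 2000
open ArithmeticFunction Finset
open scoped ArithmeticFunction.Moebius ArithmeticFunction.zeta ComplexConjugate
namespace TotRun

theorem crt_primes (D : ℕ) (c : ℕ → ℕ) : ∃ v, ∀ l, l.Prime → l ≤ D → v ≡ c l [MOD l] := by
  obtain ⟨v, hv⟩ := Nat.chineseRemainderOfFinset c (fun l => l) ((range (D+1)).filter Nat.Prime)
    (fun l hl => (Finset.mem_filter.1 hl).2.ne_zero)
    (fun a ha b hb hab => (Nat.coprime_primes (Finset.mem_filter.1 ha).2 (Finset.mem_filter.1 hb).2).2 hab)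
  exact ⟨v, fun l hl hD => hv l (Finset.mem_filter.2 ⟨Finset.mem_range.2 (by omega), hl⟩)⟩

theorem runs (K N0 : ℕ) : ∃ n ≥ N0, ∃ (k H : ℕ) (h : Fin k → ℕ), StrictMono h ∧ (∀ j, 1 ≤ h j) ∧ (∀ j, h j ≤ H) ∧
    K ≤ (univ.filter fun j => (n + h j).Prime).card ∧
    (∀ g, 1 ≤ g → g ≤ H → (n + g).Prime → ∃ j, g = h j) ∧
    (∀ i j, i < j → Nat.totient (n + h i - 1) < Nat.totient (n + h j - 1)) := by
  obtain ⟨k, hk, hmay⟩ := maynard K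
  obtain ⟨h, H, t, c, q, hm, h1, hH, ht, hV, hq, hqt, hc⟩ := design k
  obtain ⟨D1, hD1⟩ := hmay h hm.injective h1
  set D := D1 + t k with hD
  obtain ⟨v, hv⟩ := crt_primes D c
  obtain ⟨n, hn, hmod, hcard, hsum⟩ := hD1 D (by omega) v (by
    intro j
    apply Nat.coprime_of_dvd
    intro l hl hd hd2
    have hle := (Nat.Prime.dvd_primorial_iff hl).1 hd2
    have e : v + h j ≡ c l + h j [MOD l] := (hv l hl hle).add_right _
    exact (hc l hl).1 j ((e.dvd_iff dvd_rfl).1 hd)) (N0 + D + 1)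
  have hnl : ∀ l, l.Prime → l ≤ D → n ≡ c l [MOD l] := fun l hl hle =>
    (Nat.ModEq.of_dvd (prime_dvd_primorial hl hle) hmod).trans (hv l hl hle)
  have ht0 : t 0 ≤ D := (ht (Nat.zero_le k)).trans (by omega)
  refine ⟨n, by omega, k, H, h, hm, h1, hH, hcard, ?_, ?_⟩
  · intro g g1 g2 hp
    by_contra hcon
    push Not at hcon
    have hqD : q g ≤ D := (hqt g g2).trans ht0
    have hd := (hc (q g) (hq g)).2.1 g g1 g2 hcon rfl
    have e : n + g ≡ c (q g) + g [MOD q g] := (hnl _ (hq g) hqD).add_right _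
    have hd2 := (e.dvd_iff dvd_rfl).2 hd
    have := (Nat.prime_dvd_prime_iff_eq (hq g) hp).1 hd2
    omega
  · intro i j hij
    have hij2 := hm hij
    have hij3 : (i:ℕ) < j := hij
    have hi := i.2
    have hj := j.2
    have hi1 := h1 i
    have e : ∀ a : Fin k, ∀ l, l.Prime → l ≤ D → (l ∣ n + h a - 1 ↔ l ∣ c l + (h a - 1)) := by
      intro a l hl hle
      have : n + h a - 1 = n + (h a - 1) := by have := h1 a; omega
      rw [this]
      exact ((hnl l hl hle).add_right _).dvd_iff dvd_rfl
    have hkD : ∀ s ≤ k, t s ≤ D := fun s hs => (ht hs).trans (by omega)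
    have hsi : k - 1 - (i:ℕ) + 1 = k - i := by omega
    refine tot_lt (D := D) (by omega) (by omega) ?_ (hsum j)
    refine Fsm_cmp (a := k - 1 - i) (b := k - j) ht hV (by omega) (by omega) (hkD _ (by omega)) ?_ ?_
    · intro l hl r1 r2
      have hl0 : t 0 < l := (ht (Nat.zero_le _)).trans_lt r1
      have hlD := r2.trans (hkD _ (by omega))
      rw [hsi] at r2
      exact (e i l hl hlD).2 (((hc l hl).2.2 hl0 i).2 ⟨r1, r2⟩)
    · intro l hl hlD hd
      by_cases hl0 : t 0 < l
      · exact (((hc l hl).2.2 hl0 j).1 ((e j l hl hlD).1 hd)).2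
      · exact (not_lt.1 hl0).trans (ht (Nat.zero_le _))

theorem main (K : ℕ) :
    {n : ℕ | ∀ i : ℕ, i + 1 < K →
      Nat.totient (Nat.nth Nat.Prime (n + i) - 1) <
        Nat.totient (Nat.nth Nat.Prime (n + i + 1) - 1)}.Infinite := by
  apply Set.infinite_of_forall_exists_gt
  intro a
  have hsm := Nat.nth_strictMono Nat.infinite_setOfPred_prime
  obtain ⟨n, hn, k, H, h, hm, h1, hH, hcard, hkill, htot⟩ := runs K (Nat.nth Nat.Prime (a+1))
  refine ⟨Nat.count Nat.Prime (n+1), ?_, ?_⟩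
  · set N := Nat.count Nat.Prime (n+1) with hN
    have hcount : N + K ≤ Nat.count Nat.Prime (n + H + 1) := by
      rw [hN, Nat.count_eq_card_filter_range, Nat.count_eq_card_filter_range]
      have hdisj : Disjoint ((range (n+1)).filter Nat.Prime)
          ((univ.filter fun j => (n + h j).Prime).image fun j => n + h j) := by
        rw [Finset.disjoint_left]
        intro x hx hx2
        simp only [Finset.mem_filter, Finset.mem_range, Finset.mem_image] at hx hx2
        obtain ⟨j, _, hj⟩ := hx2
        have := h1 j
        omega
      have hci : ((univ.filter fun j => (n + h j).Prime).image fun j => n + h j).card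
          = (univ.filter fun j => (n + h j).Prime).card :=
        Finset.card_image_of_injective _ (fun a b hab => hm.injective (Nat.add_left_cancel hab))
      calc _ ≤ _ := Nat.add_le_add_left (hcard.trans hci.ge) _
        _ = _ := (Finset.card_union_of_disjoint hdisj).symm
        _ ≤ _ := by
          apply Finset.card_le_card
          intro x hx
          simp only [Finset.mem_union, Finset.mem_filter, Finset.mem_range, Finset.mem_image,
            Finset.mem_univ, true_and] at hx ⊢
          rcases hx with hx | ⟨j, hj, rfl⟩
          · exact ⟨by omega, hx.2⟩
          · exact ⟨by have := hH j; omega, hj⟩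
    have hrep : ∀ i < K, ∃ j, Nat.nth Nat.Prime (N + i) = n + h j := by
      intro i hi
      have u : Nat.nth Nat.Prime (N + i) < n + H + 1 := Nat.nth_lt_of_lt_count (by omega)
      have l : n + 1 ≤ Nat.nth Nat.Prime (N + i) := by
        by_contra hc
        push Not at hc
        have := Nat.count_strict_mono (Nat.prime_nth_prime (N+i)) hc
        rw [Nat.count_nth_of_infinite Nat.infinite_setOfPred_prime] at this
        omega
      obtain ⟨j, hj⟩ := hkill (Nat.nth Nat.Prime (N + i) - n) (by omega) (by omega) (by
        rw [Nat.add_sub_cancel' (by omega)]; exact Nat.prime_nth_prime _)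
      exact ⟨j, by omega⟩
    intro i hi
    obtain ⟨x, hx⟩ := hrep i (by omega)
    obtain ⟨y, hy⟩ := hrep (i+1) hi
    rw [← add_assoc] at hy
    have hlt : Nat.nth Nat.Prime (N + i) < Nat.nth Nat.Prime (N + i + 1) := hsm (Nat.lt_succ_self _)
    rw [hx, hy] at hlt ⊢
    exact htot x y (hm.lt_iff_lt.1 (by omega))
  · have h2 : Nat.count Nat.Prime (Nat.nth Nat.Prime (a+1)) ≤ Nat.count Nat.Prime (n+1) :=
      Nat.count_monotone _ (by omega)
    rw [Nat.count_nth_of_infinite Nat.infinite_setOfPred_prime] at h2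
    omega

end TotRun
end

/-- Pollack–Thompson: for every `K ≥ 1`, there are infinitely many `n` such that
Euler's totient evaluated at `p - 1` is strictly increasing along the run of `K`
consecutive primes `p_n, p_{n+1}, …, p_{n+K-1}`. -/
theorem totient_increasing_runs (K : ℕ) (hK : 1 ≤ K) :
    {n : ℕ | ∀ i : ℕ, i + 1 < K →
      Nat.totient (Nat.nth Nat.Prime (n + i) - 1) <
        Nat.totient (Nat.nth Nat.Prime (n + i + 1) - 1)}.Infinite := by
  exact TotRun.main K
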